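/- Let G be a locally finite transitive accessible graph that is not quasi-isometric to any locally finite Cayley graph of a finitely generated group. Then there is a one-ended locally finite transitive graph that is quasi-isometric to some factor in a terminal factorisation of G and that is not quasi-isometric to any locally finite Cayley graph of a finitely generated group. -/

import Mathlib

open SimpleGraph

universe u v

/-! ### Quasi-isometries -/

/-- `f` is a `(γ, c)`-quasi-isometry from `G` to `H`. -/
def IsQIWith {V : Type u} {W : Type v} (G : SimpleGraph V) (H : SimpleGraph W)
    (γ c : ℝ) (f : V → W) : Prop :=
  (∀ u v : V, γ⁻¹ * (G.dist u v : ℝ) - c ≤ (H.dist (f u) (f v) : ℝ) ∧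
      (H.dist (f u) (f v) : ℝ) ≤ γ * (G.dist u v : ℝ) + c) ∧
  ∀ w : W, ∃ x : V, (H.dist w (f x) : ℝ) ≤ c

/-- `G` and `H` are quasi-isometric. -/
def QuasiIsometric {V : Type u} {W : Type v} (G : SimpleGraph V) (H : SimpleGraph W) : Prop :=
  ∃ (γ c : ℝ) (f : V → W), 1 ≤ γ ∧ 0 ≤ c ∧ IsQIWith G H γ c f

/-- `H` embeds quasi-isometrically into `G`. -/
def QIEmbeds {V : Type u} {W : Type v} (H : SimpleGraph V) (G : SimpleGraph W) : Prop :=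
  ∃ (γ c : ℝ) (f : V → W), 1 ≤ γ ∧ 0 ≤ c ∧
    ∀ u v : V, γ⁻¹ * (H.dist u v : ℝ) - c ≤ (G.dist (f u) (f v) : ℝ) ∧
      (G.dist (f u) (f v) : ℝ) ≤ γ * (H.dist u v : ℝ) + c

/-! ### Basic graph properties -/

/-- Every vertex has finite degree. -/
def LocallyFiniteGraph {V : Type u} (G : SimpleGraph V) : Prop :=
  ∀ v : V, (G.neighborSet v).Finite

/-- The automorphism group of `G` has finitely many orbits on the vertex set. -/
def QuasiTransitive {V : Type u} (G : SimpleGraph V) : Prop :=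
  ∃ s : Set V, s.Finite ∧ ∀ v : V, ∃ u ∈ s, ∃ g : G ≃g G, g u = v

/-- The automorphism group of `G` acts transitively on the vertex set. -/
def VertexTransitive {V : Type u} (G : SimpleGraph V) : Prop :=
  ∀ u v : V, ∃ g : G ≃g G, g u = v

/-- `G` has exactly one end. -/
def OneEnded {V : Type u} (G : SimpleGraph V) : Prop :=
  Nonempty G.end ∧ Subsingleton G.end

/-- `G` and `H` have the same number of ends (in the sense `0, 1, 2, …, ∞`). -/
def SameNumberOfEnds {V : Type u} {W : Type v} (G : SimpleGraph V) (H : SimpleGraph W) : Prop :=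
  (Infinite G.end ∧ Infinite H.end) ∨
    (Finite G.end ∧ Finite H.end ∧ Nat.card G.end = Nat.card H.end)

/-- There is `n : ℕ` such that every two distinct ends of `G` can be separated by removing
at most `n` vertices. -/
def Accessible {V : Type u} (G : SimpleGraph V) : Prop :=
  ∃ n : ℕ, ∀ e e' : G.end, e ≠ e' →
    ∃ K : Finset V, K.card ≤ n ∧ e.val (Opposite.op K) ≠ e'.val (Opposite.op K)

/-- `T` is a tree all of whose vertices have degree `3`. -/
def CubicTree {W : Type u} (T : SimpleGraph W) : Prop :=
  T.IsTree ∧ ∀ v : W, (T.neighborSet v).ncard = 3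

/-! ### Tree amalgamations -/

/-- The bipartite graph on `VT1 ⊕ VT2` given by the relation `R`. -/
def bipGraph {VT1 VT2 : Type u} (R : VT1 → VT2 → Prop) : SimpleGraph (VT1 ⊕ VT2) :=
  SimpleGraph.fromRel fun x y =>
    match x, y with
    | Sum.inl a, Sum.inr b => R a b
    | _, _ => False

/-- All the data of a tree amalgamation `G1 ∗_T G2`: a semiregular tree (given by its
bipartition classes `VT1`, `VT2` and the adjacency relation `Tadj`), a labelling of the
edges of the tree by pairs of indices from `K1 × K2` such that the labels at each vertex of
`VTi` biject with `Ki` in the `i`-th coordinate, families of adhesion sets `S1`, `S2`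
(all of the same cardinality), and the gluing bijections `glue k l : S1 k → S2 l`. -/
structure TreeAmalgData {V1 V2 : Type u} (G1 : SimpleGraph V1) (G2 : SimpleGraph V2) :
    Type (u + 1) where
  VT1 : Type u
  VT2 : Type u
  K1 : Type u
  K2 : Type u
  Tadj : VT1 → VT2 → Prop
  isTree : (bipGraph Tadj).IsTree
  lab1 : ∀ a b, Tadj a b → K1
  lab2 : ∀ a b, Tadj a b → K2
  lab1_bij : ∀ a : VT1, Function.Bijective fun b : {b : VT2 // Tadj a b} => lab1 a b.1 b.2
  lab2_bij : ∀ b : VT2, Function.Bijective fun a : {a : VT1 // Tadj a b} => lab2 a.1 b a.2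
  S1 : K1 → Set V1
  S2 : K2 → Set V2
  S1_nonempty : ∀ k, (S1 k).Nonempty
  glue : K1 → K2 → V1 → V2
  glue_bij : ∀ k l, Set.BijOn (glue k l) (S1 k) (S2 l)

namespace TreeAmalgData

variable {V1 V2 : Type u} {G1 : SimpleGraph V1} {G2 : SimpleGraph V2}

/-- The vertex set of the graph `G1 + G2`. -/
abbrev PlusV (D : TreeAmalgData G1 G2) : Type u := (D.VT1 × V1) ⊕ (D.VT2 × V2)

/-- The relation describing the edges added between the copies `G1^u` and `G2^v`. -/
def cross (D : TreeAmalgData G1 G2) (p : D.VT1 × V1) (q : D.VT2 × V2) : Prop :=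
  ∃ h : D.Tadj p.1 q.1, p.2 ∈ D.S1 (D.lab1 p.1 q.1 h) ∧
    q.2 = D.glue (D.lab1 p.1 q.1 h) (D.lab2 p.1 q.1 h) p.2

def plusRel (D : TreeAmalgData G1 G2) : D.PlusV → D.PlusV → Prop
  | Sum.inl p, Sum.inl p' => p.1 = p'.1 ∧ G1.Adj p.2 p'.2
  | Sum.inr q, Sum.inr q' => q.1 = q'.1 ∧ G2.Adj q.2 q'.2
  | Sum.inl p, Sum.inr q => D.cross p q
  | Sum.inr _, Sum.inl _ => False

/-- The graph `G1 + G2`: disjoint copies of `G1` and `G2` along the tree, together with the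
added matching edges between adhesion sets. -/
def plusGraph (D : TreeAmalgData G1 G2) : SimpleGraph D.PlusV :=
  SimpleGraph.fromRel D.plusRel

/-- The relation identifying the endpoints of the added edges (which get contracted). -/
def idRel (D : TreeAmalgData G1 G2) : D.PlusV → D.PlusV → Prop :=
  fun x y => ∃ p q, x = Sum.inl p ∧ y = Sum.inr q ∧ D.cross p q

/-- Vertex set of the tree amalgamation `G1 ∗_T G2`. -/
abbrev AmalgV (D : TreeAmalgData G1 G2) : Type u := Quot D.idRel

/-- The canonical contraction map `ψ : V(G1 + G2) → V(G1 ∗_T G2)`. -/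
def toAmalg (D : TreeAmalgData G1 G2) : D.PlusV → D.AmalgV := Quot.mk _

/-- The tree amalgamation `G1 ∗_T G2`, obtained from `G1 + G2` by contracting all the
added edges. -/
def amalgGraph (D : TreeAmalgData G1 G2) : SimpleGraph D.AmalgV :=
  SimpleGraph.fromRel fun x y =>
    ∃ a b, x = D.toAmalg a ∧ y = D.toAmalg b ∧ D.plusGraph.Adj a b

/-- The tree vertex at which a vertex of `G1 + G2` lives. -/
def site (D : TreeAmalgData G1 G2) : D.PlusV → D.VT1 ⊕ D.VT2
  | Sum.inl p => Sum.inl p.1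
  | Sum.inr q => Sum.inr q.1

/-- The set of tree vertices hosting representatives of `x`; the identification size of `x`
is the number of its elements. -/
def support (D : TreeAmalgData G1 G2) (x : D.AmalgV) : Set (D.VT1 ⊕ D.VT2) :=
  {t | ∃ p, D.toAmalg p = x ∧ D.site p = t}

/-- Every vertex of `G1 ∗_T G2` has finite identification size. -/
def FiniteIdentification (D : TreeAmalgData G1 G2) : Prop :=
  ∀ x : D.AmalgV, (D.support x).Finite

/-- All adhesion sets are finite. -/
def FiniteAdhesion (D : TreeAmalgData G1 G2) : Prop :=
  (∀ k, (D.S1 k).Finite) ∧ ∀ l, (D.S2 l).Finite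

/-- The tree amalgamation is trivial: the contraction map restricts to a bijection on some
copy of `G1` or of `G2`. -/
def IsTrivial (D : TreeAmalgData G1 G2) : Prop :=
  (∃ a : D.VT1, Function.Bijective fun x : V1 => D.toAmalg (Sum.inl (a, x))) ∨
  ∃ b : D.VT2, Function.Bijective fun y : V2 => D.toAmalg (Sum.inr (b, y))

end TreeAmalgData

/-- Some group of automorphisms of `G` acts with finitely many orbits on the vertices of `G`
and with finitely many orbits on the family `S` of adhesion sets of `G`. -/
def GoodAction {V : Type u} (G : SimpleGraph V) {K : Type u} (S : K → Set V) : Prop :=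
  ∃ Γ : Subgroup (G ≃g G),
    (∃ s : Set V, s.Finite ∧ ∀ v : V, ∃ u ∈ s, ∃ g ∈ Γ, g u = v) ∧
    ∃ I : Set K, I.Finite ∧ ∀ k : K, ∃ k' ∈ I, ∃ g ∈ Γ, ⇑g '' S k' = S k

/-- A bundled graph. -/
structure BGraph : Type (u + 1) where
  V : Type u
  G : SimpleGraph V

/-- `Z` is (isomorphic to) a tree amalgamation of `X` and `Y` of finite adhesion and finite
identification. -/
def AmalgStep (X Y Z : BGraph.{u}) : Prop :=
  ∃ D : TreeAmalgData X.G Y.G,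
    D.FiniteAdhesion ∧ D.FiniteIdentification ∧ Nonempty (Z.G ≃g D.amalgGraph)

/-- `Z` is (isomorphic to) a tree amalgamation of `X` and `Y` of finite adhesion and finite
identification such that some group of automorphisms of each factor acts with finitely many
orbits on that factor and on the set of its adhesion sets. -/
def GoodAmalgStep (X Y Z : BGraph.{u}) : Prop :=
  ∃ D : TreeAmalgData X.G Y.G,
    D.FiniteAdhesion ∧ D.FiniteIdentification ∧
    GoodAction X.G D.S1 ∧ GoodAction Y.G D.S2 ∧ Nonempty (Z.G ≃g D.amalgGraph)

/-- `Z` is obtained from the list `l` of graphs by iterated tree amalgamations of finite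
adhesion and finite identification. -/
inductive IterAmalg : BGraph.{u} → List BGraph.{u} → Prop
  | single (X : BGraph) : IterAmalg X [X]
  | step {X Y Z : BGraph} {l1 l2 : List BGraph} :
      IterAmalg X l1 → IterAmalg Y l2 → AmalgStep X Y Z → IterAmalg Z (l1 ++ l2)

/-- `Z` is obtained from the list `l` of graphs by iterated tree amalgamations of finite
adhesion and finite identification with quasi-transitive actions on the factors and their
adhesion sets. -/
inductive GoodIterAmalg : BGraph.{u} → List BGraph.{u} → Prop
  | single (X : BGraph) : GoodIterAmalg X [X]
  | step {X Y Z : BGraph} {l1 l2 : List BGraph} :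
      GoodIterAmalg X l1 → GoodIterAmalg Y l2 → GoodAmalgStep X Y Z →
        GoodIterAmalg Z (l1 ++ l2)

/-- `l` is a factorisation of the graph `Gb`. -/
def IsFactorisation (Gb : BGraph.{u}) (l : List BGraph.{u}) : Prop :=
  (∀ X ∈ l, X.G.Connected ∧ LocallyFiniteGraph X.G ∧ QuasiTransitive X.G) ∧
    GoodIterAmalg Gb l

/-- A factorisation is terminal if every factor has at most one end. -/
def IsTerminal (l : List BGraph.{u}) : Prop := ∀ X ∈ l, Subsingleton X.G.end

/-- The Cayley graph of `Γ` with respect to `S`. -/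
def cayleyGraph (Γ : Type u) [Group Γ] (S : Set Γ) : SimpleGraph Γ :=
  SimpleGraph.fromRel fun g h => g⁻¹ * h ∈ S

/-- `G` is not quasi-isometric to any locally finite Cayley graph of a finitely
generated group. -/
def NotQIToAnyCayley {V : Type u} (G : SimpleGraph V) : Prop :=
  ∀ (Γ : Type u) (_ : Group Γ) (S : Set Γ), S.Finite → Subgroup.closure S = ⊤ →
    ¬ QuasiIsometric G (cayleyGraph Γ S)

section
open scoped Pointwise
open Relation SimpleGraph

namespace TA

variable {V : Type u} {G : SimpleGraph V}

/-! ### Connectivity inside a set -/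

/-- `x` and `y` are joined by a walk all of whose edges lie in `S`. -/
def Join (G : SimpleGraph V) (S : Set V) : V → V → Prop :=
  ReflTransGen fun a b => G.Adj a b ∧ a ∈ S ∧ b ∈ S

def Conn (G : SimpleGraph V) (S : Set V) : Prop := ∀ x ∈ S, ∀ y ∈ S, Join G S x y

theorem Join.symm {S : Set V} {x y : V} (h : Join G S x y) : Join G S y x := by
  induction h with
  | refl => exact ReflTransGen.refl
  | tail _ h2 ih => exact ReflTransGen.head ⟨h2.1.symm, h2.2.2, h2.2.1⟩ ih

theorem Join.trans {S : Set V} {x y z : V} (h : Join G S x y) (h' : Join G S y z) :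
    Join G S x z := ReflTransGen.trans h h'

theorem Join.mono {S T : Set V} {x y : V} (h : Join G S x y) (hs : S ⊆ T) : Join G T x y :=
  ReflTransGen.mono (fun _ _ h => ⟨h.1, hs h.2.1, hs h.2.2⟩) x y h

theorem Join.mem {S : Set V} {x y : V} (h : Join G S x y) (hx : x ∈ S) : y ∈ S := by
  induction h with
  | refl => exact hx
  | tail _ h2 _ => exact h2.2.2

theorem Join.of_adj {S : Set V} {x y : V} (h : G.Adj x y) (hx : x ∈ S) (hy : y ∈ S) :
    Join G S x y := ReflTransGen.single ⟨h, hx, hy⟩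

theorem join_univ_of_reachable {x y : V} (h : G.Reachable x y) : Join G Set.univ x y := by
  obtain ⟨w⟩ := h
  induction w with
  | nil => exact ReflTransGen.refl
  | cons h _ ih => exact ReflTransGen.head ⟨h, trivial, trivial⟩ ih

theorem Join.reachable {S : Set V} {x y : V} (h : Join G S x y) : G.Reachable x y := by
  induction h with
  | refl => exact SimpleGraph.Reachable.refl _
  | tail _ h2 ih => exact ih.trans h2.1.reachable

theorem Join.reachable_induce {S : Set V} {x y : V} (h : Join G S x y) (hx : x ∈ S)
    (hy : y ∈ S) : (G.induce S).Reachable ⟨x, hx⟩ ⟨y, hy⟩ := by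
  induction h with
  | refl => exact SimpleGraph.Reachable.refl _
  | tail h1 h2 ih =>
    refine (ih h2.2.1).trans (SimpleGraph.Adj.reachable ?_)
    exact h2.1

theorem join_of_reachable_induce {S : Set V} {x y : S} (h : (G.induce S).Reachable x y) :
    Join G S x y := by
  obtain ⟨w⟩ := h
  induction w with
  | nil => exact ReflTransGen.refl
  | @cons a b c h _ ih => exact ReflTransGen.head ⟨h, a.2, b.2⟩ ih

/-- A walk leaving a set `C` has an edge in the boundary. -/
theorem Join.exists_exit {S C : Set V} {x y : V} (h : Join G S x y) (hx : x ∈ C) (hy : y ∉ C) :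
    ∃ a b, G.Adj a b ∧ a ∈ S ∧ b ∈ S ∧ a ∈ C ∧ b ∉ C := by
  induction h with
  | refl => exact absurd hx hy
  | @tail b c _ h2 ih =>
    by_cases hb : b ∈ C
    · exact ⟨b, c, h2.1, h2.2.1, h2.2.2, hb, hy⟩
    · exact ih hb

/-! ### Edge boundaries -/

/-- The (oriented) edge boundary of `C`. -/
def bd (G : SimpleGraph V) (C : Set V) : Set (V × V) := {p | G.Adj p.1 p.2 ∧ p.1 ∈ C ∧ p.2 ∉ C}

theorem bd_compl (C : Set V) : bd G Cᶜ = Prod.swap '' bd G C := by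
  ext ⟨a, b⟩
  simp only [bd, Set.mem_ofPred_eq, Set.mem_image, Prod.exists, Prod.swap, Set.mem_compl_iff,
    not_not, Prod.mk.injEq]
  constructor
  · rintro ⟨h1, h2, h3⟩; exact ⟨b, a, ⟨h1.symm, h3, h2⟩, rfl, rfl⟩
  · rintro ⟨c, d, ⟨h1, h2, h3⟩, rfl, rfl⟩; exact ⟨h1.symm, h3, h2⟩

noncomputable def sz (G : SimpleGraph V) (C : Set V) : ℕ := (bd G C).ncard

theorem sz_compl (C : Set V) : sz G Cᶜ = sz G C := by
  rw [sz, bd_compl, Set.ncard_image_of_injective _ Prod.swap_injective, sz]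

theorem bd_compl_fin {C : Set V} (h : (bd G C).Finite) : (bd G Cᶜ).Finite := by
  rw [bd_compl]; exact h.image _

theorem bd_inter_sub (C D : Set V) : bd G (C ∩ D) ⊆ bd G C ∪ bd G D := by
  rintro ⟨a, b⟩ h
  simp only [bd, Set.mem_ofPred_eq, Set.mem_union, Set.mem_inter_iff] at h ⊢
  tauto

theorem bd_inter_fin {C D : Set V} (h : (bd G C).Finite) (h' : (bd G D).Finite) :
    (bd G (C ∩ D)).Finite := (h.union h').subset (bd_inter_sub C D)

/-- Submodularity for opposite corners. -/
theorem sz_corner {C D : Set V} (h : (bd G C).Finite) (h' : (bd G D).Finite) :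
    sz G (C ∩ D) + sz G (Cᶜ ∩ Dᶜ) ≤ sz G C + sz G D := by
  have e : sz G (Cᶜ ∩ Dᶜ) = sz G (C ∪ D) := by rw [← Set.compl_union, sz_compl]
  rw [e]
  have hU : bd G (C ∩ D) ∪ bd G (C ∪ D) ⊆ bd G C ∪ bd G D := by
    rintro ⟨a, b⟩ h
    simp only [bd, Set.mem_ofPred_eq, Set.mem_union, Set.mem_inter_iff] at h ⊢
    tauto
  have hI : bd G (C ∩ D) ∩ bd G (C ∪ D) ⊆ bd G C ∩ bd G D := by
    rintro ⟨a, b⟩ h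
    simp only [bd, Set.mem_ofPred_eq, Set.mem_union, Set.mem_inter_iff] at h ⊢
    tauto
  have f1 := bd_inter_fin h h'
  have f2 : (bd G (C ∪ D)).Finite := (h.union h').subset (Set.subset_union_right.trans hU)
  unfold sz
  rw [← Set.ncard_union_add_ncard_inter _ _ f1 f2, ← Set.ncard_union_add_ncard_inter _ _ h h']
  exact Nat.add_le_add (Set.ncard_le_ncard hU (h.union h'))
    (Set.ncard_le_ncard hI (h.inter_of_left _))

/-- Thomassen–Woess: finitely many tight cuts of bounded size through an edge. -/
theorem tight_finite : ∀ (k : ℕ) (G : SimpleGraph V), G.Preconnected → ∀ x y : V,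
    {C : Set V | Conn G C ∧ Conn G Cᶜ ∧ (bd G C).Finite ∧ sz G C ≤ k ∧ G.Adj x y ∧ x ∈ C ∧
      y ∉ C}.Finite := by
  intro k
  induction k with
  | zero =>
    intro G _ x y
    convert Set.finite_empty
    ext C
    simp only [Set.mem_ofPred_eq, Set.mem_empty_iff_false, iff_false]
    rintro ⟨-, -, hf, h0, ha, hx, hy⟩
    have : (bd G C) = ∅ := (Set.ncard_eq_zero hf).1 (Nat.le_zero.1 h0)
    have h : (x, y) ∈ bd G C := ⟨ha, hx, hy⟩
    rw [this] at h; exact h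
  | succ k ih =>
    intro G hG x y
    set G' := G.deleteEdges {s(x, y)} with hG'
    have hadj : ∀ a b, G'.Adj a b ↔ G.Adj a b ∧ s(a, b) ≠ s(x, y) := by
      intro a b; rw [hG', SimpleGraph.deleteEdges_adj]; simp
    have conn' : ∀ C : Set V, Conn G C → (x ∈ C → y ∉ C) → Conn G' C := by
      intro C hC hxy a ha b hb
      refine ReflTransGen.mono ?_ a b (hC a ha b hb)
      rintro c d ⟨h1, h2, h3⟩
      refine ⟨(hadj _ _).2 ⟨h1, ?_⟩, h2, h3⟩
      intro h
      rcases Sym2.eq_iff.1 h with ⟨rfl, rfl⟩ | ⟨rfl, rfl⟩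
      · exact hxy h2 h3
      · exact hxy h3 h2
    by_cases hr : G'.Reachable x y
    · have hpre : G'.Preconnected := by
        intro a b
        have := join_univ_of_reachable (hG a b)
        induction this with
        | refl => exact SimpleGraph.Reachable.refl _
        | @tail c d _ h2 ih =>
          refine ih.trans ?_
          by_cases e : s(c, d) = s(x, y)
          · rcases Sym2.eq_iff.1 e with ⟨rfl, rfl⟩ | ⟨rfl, rfl⟩
            · exact hr
            · exact hr.symm
          · exact ((hadj _ _).2 ⟨h2.1, e⟩).reachable
      obtain ⟨w⟩ := hr
      refine Set.Finite.subset (Set.Finite.biUnion (List.finite_toSet w.darts)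
        (fun d _ => ih G' hpre d.fst d.snd)) ?_
      rintro C ⟨h1, h2, hf, hs, ha, hx, hy⟩
      obtain ⟨d, hd, hd1, hd2⟩ := w.exists_boundary_dart C hx hy
      simp only [Set.mem_iUnion, Set.mem_ofPred_eq]
      have hb : bd G' C = bd G C \ {(x, y)} := by
        ext ⟨a, b⟩
        simp only [bd, Set.mem_ofPred_eq, Set.mem_sdiff, Set.mem_singleton_iff, hadj, ne_eq,
          Prod.mk.injEq, Sym2.eq_iff]
        constructor
        · rintro ⟨⟨h, h'⟩, ha, hb⟩; exact ⟨⟨h, ha, hb⟩, fun h => h' (Or.inl h)⟩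
        · rintro ⟨⟨h, ha', hb⟩, h'⟩
          refine ⟨⟨h, ?_⟩, ha', hb⟩
          rintro (h | ⟨rfl, rfl⟩)
          · exact h' h
          · exact hy ha'
      have hmem : (x, y) ∈ bd G C := ⟨ha, hx, hy⟩
      refine ⟨d, hd, conn' C h1 fun _ => hy, conn' _ h2 fun h => absurd hx h, ?_, ?_, d.adj,
        hd1, hd2⟩
      · rw [hb]; exact hf.subset Set.sdiff_subset
      · have := Set.ncard_sdiff_singleton_add_one hmem hf
        unfold sz at hs ⊢
        rw [hb]; omega
    · refine Set.Finite.subset (Set.finite_singleton {z | G'.Reachable x z}) ?_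
      rintro C ⟨h1, h2, hf, hs, ha, hx, hy⟩
      rw [Set.mem_singleton_iff]
      ext z
      constructor
      · intro hz; exact (conn' C h1 (fun _ => hy) x hx z hz).reachable
      · intro hz
        by_contra hzC
        exact hr (SimpleGraph.Reachable.trans hz
          (conn' _ h2 (fun h => absurd hx h) z hzC y hy).reachable)

/-! ### Group actions -/

def Acts (G : SimpleGraph V) (Γ : Type*) [Group Γ] [MulAction Γ V] : Prop :=
  ∀ (g : Γ) (a b : V), G.Adj (g • a) (g • b) ↔ G.Adj a b

variable {Γ : Type*} [Group Γ] [MulAction Γ V]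

theorem smul_compl' (g : Γ) (C : Set V) : g • Cᶜ = (g • C)ᶜ := Set.smul_set_compl

theorem Join.smul (hA : Acts G Γ) (g : Γ) {S : Set V} {x y : V} (h : Join G S x y) :
    Join G (g • S) (g • x) (g • y) := by
  induction h with
  | refl => exact ReflTransGen.refl
  | tail _ h2 ih =>
    exact ReflTransGen.tail ih ⟨(hA g _ _).2 h2.1, Set.smul_mem_smul_set h2.2.1,
      Set.smul_mem_smul_set h2.2.2⟩

theorem Conn.smul (hA : Acts G Γ) (g : Γ) {S : Set V} (h : Conn G S) : Conn G (g • S) := by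
  rintro _ ⟨x, hx, rfl⟩ _ ⟨y, hy, rfl⟩
  exact (h x hx y hy).smul hA g

theorem bd_smul (hA : Acts G Γ) (g : Γ) (C : Set V) : bd G (g • C) = g • bd G C := by
  ext ⟨a, b⟩
  rw [Set.mem_smul_set_iff_inv_smul_mem]
  simp only [bd, Set.mem_ofPred_eq, Set.mem_smul_set_iff_inv_smul_mem, Prod.smul_mk]
  rw [hA g⁻¹ a b]

theorem sz_smul (hA : Acts G Γ) (g : Γ) (C : Set V) : sz G (g • C) = sz G C := by
  rw [sz, bd_smul hA, sz]
  exact Set.ncard_image_of_injective _ (MulAction.injective g)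

theorem bd_smul_fin (hA : Acts G Γ) (g : Γ) {C : Set V} (h : (bd G C).Finite) :
    (bd G (g • C)).Finite := by
  rw [bd_smul hA]; exact h.image _

/-! ### Nested sets -/

def Nested (A B : Set V) : Prop := A ⊆ B ∨ A ⊆ Bᶜ ∨ Aᶜ ⊆ B ∨ Aᶜ ⊆ Bᶜ

theorem Nested.symm {A B : Set V} (h : Nested A B) : Nested B A := by
  unfold Nested at *
  rcases h with h | h | h | h
  · right; right; right; exact Set.compl_subset_compl.2 h
  · right; left; exact Set.subset_compl_comm.1 h
  · right; right; left; exact Set.compl_subset_comm.1 h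
  · left; exact Set.compl_subset_compl.1 h

theorem nested_compl_left {A B : Set V} : Nested Aᶜ B ↔ Nested A B := by
  unfold Nested; rw [compl_compl]; tauto

theorem nested_compl_right {A B : Set V} : Nested A Bᶜ ↔ Nested A B := by
  unfold Nested; rw [compl_compl]; tauto

theorem nested_smul_iff (g : Γ) {A B : Set V} : Nested (g • A) (g • B) ↔ Nested A B := by
  unfold Nested; simp only [← smul_compl', Set.smul_set_subset_smul_set_iff]

end TA
end

section
open scoped Pointwise
open Relation SimpleGraph

namespace TA

variable {V : Type u} {G : SimpleGraph V}

/-- An abstract family of ends, given by the sets in which they live. -/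
structure EndFam (G : SimpleGraph V) {Ω : Type*} (L : Ω → Set V → Prop) : Prop where
  mono : ∀ e C D, C ⊆ D → L e C → L e D
  inter : ∀ e C D, L e C → L e D → L e (C ∩ D)
  inf : ∀ e C, L e C → C.Infinite
  dich : ∀ e C, (bd G C).Finite → L e C ∨ L e Cᶜ

/-- The tight cuts of size at most `k` crossing `C`. -/
def crossers (G : SimpleGraph V) (k : ℕ) (C : Set V) : Set (Set V) :=
  {F | Conn G F ∧ Conn G Fᶜ ∧ (bd G F).Finite ∧ sz G F ≤ k ∧ ¬ Nested F C}

noncomputable def mm (G : SimpleGraph V) (k : ℕ) (C : Set V) : ℕ := (crossers G k C).ncard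

theorem crossers_compl (k : ℕ) (C : Set V) : crossers G k Cᶜ = crossers G k C := by
  ext F; simp only [crossers, Set.mem_ofPred_eq, nested_compl_right]

theorem mm_compl (k : ℕ) (C : Set V) : mm G k Cᶜ = mm G k C := by rw [mm, crossers_compl, mm]

theorem crossers_finite (hG : G.Preconnected) (k : ℕ) {C : Set V} (hf : (bd G C).Finite) :
    (crossers G k C).Finite := by
  classical
  set P : Set V := Prod.fst '' bd G C ∪ Prod.snd '' bd G C with hP
  have hPf : P.Finite := (hf.image _).union (hf.image _)
  have w : ∀ a b, G.Walk a b := fun a b => (hG a b).some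
  refine Set.Finite.subset (Set.Finite.biUnion (hPf.prod hPf) fun p _ =>
    Set.Finite.biUnion (List.finite_toSet (w p.1 p.2).darts)
        (fun d _ => tight_finite k G hG d.fst d.snd)) ?_
  rintro F ⟨h1, h2, h3, h4, h5⟩
  have key : ∀ F : Set V, Conn G F → ¬ Nested F C → ∃ a ∈ P, a ∈ F := by
    intro F hF hn
    by_contra hcon
    push Not at hcon
    apply hn
    by_cases hx : ∃ x ∈ F, x ∈ C
    · obtain ⟨x, hxF, hxC⟩ := hx
      left
      intro y hy
      by_contra hyC
      obtain ⟨a, b, hab, ha, hb, haC, hbC⟩ := (hF x hxF y hy).exists_exit hxC hyC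
      exact hcon a (Or.inl ⟨(a, b), ⟨hab, haC, hbC⟩, rfl⟩) ha
    · right; left
      intro y hy hyC
      exact hx ⟨y, hy, hyC⟩
  obtain ⟨a, haP, haF⟩ := key F h1 h5
  obtain ⟨b, hbP, hbF⟩ := key Fᶜ h2 (by rwa [nested_compl_left])
  obtain ⟨d, hd, hd1, hd2⟩ := (w a b).exists_boundary_dart F haF hbF
  simp only [Set.mem_iUnion]
  exact ⟨(a, b), ⟨haP, hbP⟩, d, hd, h1, h2, h3, h4, d.adj, hd1, hd2⟩

/-- The strict inequality for opposite corners. -/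
theorem mm_corner (hG : G.Preconnected) (k : ℕ) {C D : Set V}
    (hC : Conn G C) (hC' : Conn G Cᶜ) (hCf : (bd G C).Finite) (hCk : sz G C ≤ k)
    (hDf : (bd G D).Finite) (hx : ¬ Nested C D) :
    mm G k (C ∩ D) + mm G k (Cᶜ ∩ Dᶜ) < mm G k C + mm G k D := by
  have fC := crossers_finite hG k hCf
  have fD := crossers_finite hG k hDf
  have fE := crossers_finite hG k (bd_inter_fin hCf hDf)
  have fE' := crossers_finite hG k (bd_inter_fin (bd_compl_fin hCf) (bd_compl_fin hDf))
  have n1 : ∀ F, Nested F C → Nested F D → Nested F (C ∩ D) := by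
    intro F h1 h2
    unfold Nested at h1 h2 hx ⊢
    simp only [Set.subset_def, Set.mem_compl_iff, Set.mem_inter_iff] at *
    grind
  have n2 : ∀ F, Nested F C → Nested F D → Nested F (Cᶜ ∩ Dᶜ) := by
    intro F h1 h2
    unfold Nested at h1 h2 hx ⊢
    simp only [Set.subset_def, Set.mem_compl_iff, Set.mem_inter_iff] at *
    grind
  have n3 : ∀ F C D : Set V, Nested F C → Nested F (C ∩ D) ∨ Nested F (Cᶜ ∩ Dᶜ) := by
    intro F C D h1
    unfold Nested at h1 ⊢
    simp only [Set.subset_def, Set.mem_compl_iff, Set.mem_inter_iff] at *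
    grind
  have hU : crossers G k (C ∩ D) ∪ crossers G k (Cᶜ ∩ Dᶜ) ⊆
      (crossers G k C ∪ crossers G k D) \ {C} := by
    rintro F hF
    refine ⟨?_, ?_⟩
    · by_contra hcon
      rcases hF with ⟨a, b, c, d, e⟩ | ⟨a, b, c, d, e⟩
      · have h1 : Nested F C := by
          by_contra h; exact hcon (Or.inl ⟨a, b, c, d, h⟩)
        have h2 : Nested F D := by
          by_contra h; exact hcon (Or.inr ⟨a, b, c, d, h⟩)
        exact e (n1 F h1 h2)
      · have h1 : Nested F C := by
          by_contra h; exact hcon (Or.inl ⟨a, b, c, d, h⟩)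
        have h2 : Nested F D := by
          by_contra h; exact hcon (Or.inr ⟨a, b, c, d, h⟩)
        exact e (n2 F h1 h2)
    · rintro rfl
      rcases hF with hF | hF
      · exact hF.2.2.2.2 (Nested.symm (Or.inl Set.inter_subset_left))
      · exact hF.2.2.2.2 (Nested.symm (Or.inr (Or.inl Set.inter_subset_left)))
  have hI : crossers G k (C ∩ D) ∩ crossers G k (Cᶜ ∩ Dᶜ) ⊆
      crossers G k C ∩ crossers G k D := by
    rintro F ⟨⟨a, b, c, d, e⟩, -, -, -, -, e'⟩
    refine ⟨⟨a, b, c, d, fun h => ?_⟩, ⟨a, b, c, d, fun h => ?_⟩⟩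
    · rcases n3 F C D h with h | h
      exacts [e h, e' h]
    · rcases n3 F D C h with h | h
      · rw [Set.inter_comm] at h; exact e h
      · rw [Set.inter_comm] at h; exact e' h
  have hCm : C ∈ crossers G k C ∪ crossers G k D := Or.inr ⟨hC, hC', hCf, hCk, hx⟩
  unfold mm
  rw [← Set.ncard_union_add_ncard_inter _ _ fE fE', ← Set.ncard_union_add_ncard_inter _ _ fC fD]
  have h1 := Set.ncard_le_ncard hU ((fC.union fD).subset Set.sdiff_subset)
  have h2 := Set.ncard_le_ncard hI (fC.inter_of_left _)
  have h3 := Set.ncard_sdiff_singleton_add_one hCm (fC.union fD)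
  omega

section Opt

variable {Ω : Type*} (L : Ω → Set V → Prop)

def Sep (G : SimpleGraph V) (e e' : Ω) : Set (Set V) := {C | (bd G C).Finite ∧ L e C ∧ L e' Cᶜ}

def MinSep (G : SimpleGraph V) (e e' : Ω) : Set (Set V) :=
  {C | C ∈ Sep L G e e' ∧ ∀ D ∈ Sep L G e e', sz G C ≤ sz G D}

def Opt (G : SimpleGraph V) (k : ℕ) (e e' : Ω) : Set (Set V) :=
  {C | C ∈ MinSep L G e e' ∧ ∀ D ∈ MinSep L G e e', mm G k C ≤ mm G k D}

variable {L}

theorem Sep.compl {e e' : Ω} {C : Set V} (h : C ∈ Sep L G e e') : Cᶜ ∈ Sep L G e' e :=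
  ⟨bd_compl_fin h.1, h.2.2, by rw [compl_compl]; exact h.2.1⟩

theorem MinSep.compl {e e' : Ω} {C : Set V} (h : C ∈ MinSep L G e e') :
    Cᶜ ∈ MinSep L G e' e := by
  refine ⟨Sep.compl h.1, fun D hD => ?_⟩
  have := h.2 _ (Sep.compl hD)
  rwa [sz_compl] at this ⊢

theorem Opt.compl {k : ℕ} {e e' : Ω} {C : Set V} (h : C ∈ Opt L G k e e') :
    Cᶜ ∈ Opt L G k e' e := by
  refine ⟨MinSep.compl h.1, fun D hD => ?_⟩
  have := h.2 _ (MinSep.compl hD)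
  rwa [mm_compl] at this ⊢

theorem MinSep.conn (hL : EndFam G L) (hG : G.Preconnected) {e e' : Ω} {C : Set V}
    (h : C ∈ MinSep L G e e') : Conn G C := by
  intro x hx y hy
  by_contra hn
  set A : Set V := {z | z ∈ C ∧ Join G C x z} with hA
  set B : Set V := C \ A with hB
  have hAB : ∀ a ∈ A, ∀ b ∈ B, ¬ G.Adj a b := by
    intro a ha b hb hab
    exact hb.2 ⟨hb.1, ha.2.trans (Join.of_adj hab ha.1 hb.1)⟩
  have hAC : A ⊆ C := fun z hz => hz.1
  have hBC : B ⊆ C := fun z hz => hz.1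
  have bA : bd G A ⊆ bd G C := by
    rintro ⟨a, b⟩ ⟨h1, h2, h3⟩
    exact ⟨h1, hAC h2, fun hb => hAB a h2 b ⟨hb, h3⟩ h1⟩
  have bB : bd G B ⊆ bd G C := by
    rintro ⟨a, b⟩ ⟨h1, h2, h3⟩
    refine ⟨h1, hBC h2, fun hb => ?_⟩
    by_cases hb' : b ∈ A
    · exact hAB b hb' a h2 h1.symm
    · exact h3 ⟨hb, hb'⟩
  have hxA : x ∈ A := ⟨hx, ReflTransGen.refl⟩
  have hyB : y ∈ B := ⟨hy, fun h => hn h.2⟩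
  have pos : ∀ A' : Set V, A' ⊆ C → (bd G A' ⊂ bd G C) → L e A' → False := by
    intro A' hA' hs hl
    have h1 : A' ∈ Sep L G e e' := ⟨h.1.1.subset hs.subset, hl,
      hL.mono _ _ _ (Set.compl_subset_compl.2 hA') h.1.2.2⟩
    have h2 := h.2 _ h1
    have h3 := Set.ncard_lt_ncard hs h.1.1
    unfold sz at h2; omega
  have nonem : ∀ A' B' : Set V, A' ∩ B' = ∅ → A'.Nonempty → B'.Nonempty →
      (bd G A').Nonempty := by
    rintro A' B' hd ⟨a, ha⟩ ⟨b, hb⟩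
    have hba : b ∉ A' := fun h => by
      have : b ∈ A' ∩ B' := ⟨h, hb⟩
      rw [hd] at this; exact this
    obtain ⟨c, d, hcd, -, -, h1, h2⟩ :=
      (join_univ_of_reachable (hG a b)).exists_exit ha hba
    exact ⟨(c, d), hcd, h1, h2⟩
  have dj : A ∩ B = ∅ := by ext z; simp only [hB]; simp
  have dbd : ∀ p, p ∈ bd G A → p ∈ bd G B → False := by
    rintro p ⟨-, h1, -⟩ ⟨-, h2, -⟩
    exact h2.2 h1
  rcases hL.dich e A (h.1.1.subset bA) with hl | hl
  · refine pos A hAC ⟨bA, fun hc => ?_⟩ hl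
    obtain ⟨p, hp⟩ := nonem B A (by rw [Set.inter_comm]; exact dj) ⟨y, hyB⟩ ⟨x, hxA⟩
    exact dbd p (hc (bB hp)) hp
  · refine pos B hBC ⟨bB, fun hc => ?_⟩ ?_
    · obtain ⟨p, hp⟩ := nonem A B dj ⟨x, hxA⟩ ⟨y, hyB⟩
      exact dbd p hp (hc (bA hp))
    · exact hL.mono _ _ _ (fun z hz => ⟨hz.1, hz.2⟩) (hL.inter _ _ _ h.1.2.1 hl)

theorem EndFam.not_both (hL : EndFam G L) {e : Ω} {C : Set V} (h : L e C) (h' : L e Cᶜ) :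
    False := by
  have := hL.inf _ _ (hL.inter _ _ _ h h')
  rw [Set.inter_compl_self] at this
  exact this Set.finite_empty

/-- A corner containing an end of the pair separates the pair. -/
theorem corner_bound {k : ℕ} {e e' : Ω} {C : Set V} (hC : C ∈ Opt L G k e e')
    {E : Set V} (hE : (bd G E).Finite)
    (h : (L e E ∧ L e' Eᶜ) ∨ (L e' E ∧ L e Eᶜ)) :
    sz G C ≤ sz G E ∧ (sz G E ≤ sz G C → mm G k C ≤ mm G k E) := by
  rcases h with h | h
  · have hs : E ∈ Sep L G e e' := ⟨hE, h.1, h.2⟩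
    refine ⟨hC.1.2 _ hs, fun hle => hC.2 _ ⟨hs, fun D hD => hle.trans (hC.1.2 _ hD)⟩⟩
  · have hs : Eᶜ ∈ Sep L G e e' := ⟨bd_compl_fin hE, h.2, by rw [compl_compl]; exact h.1⟩
    have h1 := hC.1.2 _ hs
    rw [sz_compl] at h1
    refine ⟨h1, fun hle => ?_⟩
    have := hC.2 _ ⟨hs, fun D hD => by rw [sz_compl]; exact hle.trans (hC.1.2 _ hD)⟩
    rwa [mm_compl] at this

theorem Opt.nested (hL : EndFam G L) (hG : G.Preconnected) {k : ℕ} {e1 e2 f1 f2 : Ω}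
    {C D : Set V} (hC : C ∈ Opt L G k e1 e2) (hD : D ∈ Opt L G k f1 f2)
    (hCk : sz G C ≤ k) : Nested C D := by
  by_contra hx
  have cC := MinSep.conn hL hG hC.1
  have cC' := MinSep.conn hL hG (MinSep.compl hC.1)
  have fC := hC.1.1.1
  have fD := hD.1.1.1
  have fC' := bd_compl_fin fC
  have fD' := bd_compl_fin fD
  -- corners
  have s1 := sz_corner fC fD
  have s2 := sz_corner fC fD'
  have m1 := mm_corner hG k cC cC' fC hCk fD hx
  have m2 := mm_corner hG k cC cC' fC hCk fD' (by rwa [nested_compl_right])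
  rw [sz_compl D] at s2
  rw [mm_compl] at m2
  rw [compl_compl] at s2 m2
  have f00 := bd_inter_fin fC fD
  have f01 := bd_inter_fin fC fD'
  have f10 := bd_inter_fin fC' fD
  have f11 := bd_inter_fin fC' fD'
  -- facts for `e`-ends and `f`-ends in corners
  have eb : ∀ E : Set V, (bd G E).Finite → (E ⊆ C ∧ L e1 E ∨ E ⊆ Cᶜ ∧ L e2 E) →
      sz G C ≤ sz G E ∧ (sz G E ≤ sz G C → mm G k C ≤ mm G k E) := by
    intro E hE h
    refine corner_bound hC hE ?_
    rcases h with ⟨h, h'⟩ | ⟨h, h'⟩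
    · exact Or.inl ⟨h', hL.mono _ _ _ (Set.compl_subset_compl.2 h) hC.1.1.2.2⟩
    · exact Or.inr ⟨h', hL.mono _ _ _ (Set.subset_compl_comm.1 h) hC.1.1.2.1⟩
  have fb : ∀ E : Set V, (bd G E).Finite → (E ⊆ D ∧ L f1 E ∨ E ⊆ Dᶜ ∧ L f2 E) →
      sz G D ≤ sz G E ∧ (sz G E ≤ sz G D → mm G k D ≤ mm G k E) := by
    intro E hE h
    refine corner_bound hD hE ?_
    rcases h with ⟨h, h'⟩ | ⟨h, h'⟩
    · exact Or.inl ⟨h', hL.mono _ _ _ (Set.compl_subset_compl.2 h) hD.1.1.2.2⟩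
    · exact Or.inr ⟨h', hL.mono _ _ _ (Set.subset_compl_comm.1 h) hD.1.1.2.1⟩
  have l1 : ∀ A B : Set V, A ∩ B ⊆ A := fun A B => Set.inter_subset_left
  have l2 : ∀ A B : Set V, A ∩ B ⊆ B := fun A B => Set.inter_subset_right
  have E1 : L e1 (C ∩ D) ∨ L e1 (C ∩ Dᶜ) := (hL.dich e1 D fD).imp
    (hL.inter _ _ _ hC.1.1.2.1) (hL.inter _ _ _ hC.1.1.2.1)
  have E2 : L e2 (Cᶜ ∩ D) ∨ L e2 (Cᶜ ∩ Dᶜ) := (hL.dich e2 D fD).imp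
    (hL.inter _ _ _ hC.1.1.2.2) (hL.inter _ _ _ hC.1.1.2.2)
  have F1 : L f1 (C ∩ D) ∨ L f1 (Cᶜ ∩ D) := (hL.dich f1 C fC).imp
    (fun h => hL.inter _ _ _ h hD.1.1.2.1) (fun h => hL.inter _ _ _ h hD.1.1.2.1)
  have F2 : L f2 (C ∩ Dᶜ) ∨ L f2 (Cᶜ ∩ Dᶜ) := (hL.dich f2 C fC).imp
    (fun h => hL.inter _ _ _ h hD.1.1.2.2) (fun h => hL.inter _ _ _ h hD.1.1.2.2)
  have E1' := E1.imp (fun h => eb _ f00 (Or.inl ⟨l1 _ _, h⟩)) (fun h => eb _ f01 (Or.inl ⟨l1 _ _, h⟩))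
  have E2' := E2.imp (fun h => eb _ f10 (Or.inr ⟨l1 _ _, h⟩)) (fun h => eb _ f11 (Or.inr ⟨l1 _ _, h⟩))
  have F1' := F1.imp (fun h => fb _ f00 (Or.inl ⟨l2 _ _, h⟩)) (fun h => fb _ f10 (Or.inl ⟨l2 _ _, h⟩))
  have F2' := F2.imp (fun h => fb _ f01 (Or.inr ⟨l2 _ _, h⟩)) (fun h => fb _ f11 (Or.inr ⟨l2 _ _, h⟩))
  clear E1 E2 F1 F2 eb fb
  rcases E1' with ⟨a1, a2⟩ | ⟨a1, a2⟩ <;> rcases E2' with ⟨b1, b2⟩ | ⟨b1, b2⟩ <;>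
  rcases F1' with ⟨c1, c2⟩ | ⟨c1, c2⟩ <;> rcases F2' with ⟨d1, d2⟩ | ⟨d1, d2⟩ <;> omega

end Opt

/-- A nested, invariant system of cuts. -/
structure CutSys (G : SimpleGraph V) (Γ : Type*) [Group Γ] [MulAction Γ V]
    (𝓔 : Set (Set V)) : Prop where
  compl : ∀ C ∈ 𝓔, Cᶜ ∈ 𝓔
  smul : ∀ (g : Γ), ∀ C ∈ 𝓔, g • C ∈ 𝓔
  nested : ∀ C ∈ 𝓔, ∀ D ∈ 𝓔, Nested C D
  conn : ∀ C ∈ 𝓔, Conn G C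
  fin : ∀ C ∈ 𝓔, (bd G C).Finite
  inf : ∀ C ∈ 𝓔, C.Infinite
  edge : ∀ x y, {C | C ∈ 𝓔 ∧ G.Adj x y ∧ x ∈ C ∧ y ∉ C}.Finite

theorem exists_cutSys (hG : G.Preconnected) {Ω : Type*} {L : Ω → Set V → Prop}
    (hL : EndFam G L) {Γ : Type*} [Group Γ] [MulAction Γ V] (hA : Acts G Γ)
    (ga : Γ → Ω → Ω) (hga : ∀ g e C, L (ga g e) (g • C) ↔ L e C) (k : ℕ)
    (hsep : ∀ e e' : Ω, e ≠ e' → ∃ C ∈ Sep L G e e', sz G C ≤ k) :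
    ∃ 𝓔, CutSys G Γ 𝓔 ∧ ∀ e e' : Ω, e ≠ e' → ∃ C ∈ 𝓔, L e C ∧ L e' Cᶜ := by
  set 𝓔 : Set (Set V) := {C | ∃ e e' : Ω, C ∈ Opt L G k e e' ∧ sz G C ≤ k} with h𝓔
  have hsub : ∀ C ∈ 𝓔, Conn G C ∧ Conn G Cᶜ ∧ (bd G C).Finite ∧ sz G C ≤ k := by
    rintro C ⟨e, e', h, hk⟩
    exact ⟨MinSep.conn hL hG h.1, MinSep.conn hL hG (MinSep.compl h.1), h.1.1.1, hk⟩
  have hcr : ∀ (g : Γ) C, crossers G k (g • C) = g • crossers G k C := by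
    intro g C
    ext F
    rw [Set.mem_smul_set_iff_inv_smul_mem]
    have e1 : ∀ F, Conn G F → Conn G (g⁻¹ • F) := fun F h => h.smul hA _
    have e2 : ∀ F : Set V, Conn G (g⁻¹ • F) → Conn G F := fun F h => by
      have := h.smul hA g; rwa [smul_inv_smul] at this
    have e3 : Nested (g⁻¹ • F) C ↔ Nested F (g • C) := by
      rw [← nested_smul_iff g, smul_inv_smul]
    simp only [crossers, Set.mem_ofPred_eq, sz_smul hA, e3, ← smul_compl']
    constructor
    · rintro ⟨a, b, c, d⟩; exact ⟨e1 _ a, e1 _ b, bd_smul_fin hA _ c, d⟩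
    · rintro ⟨a, b, c, d⟩
      refine ⟨e2 _ a, e2 _ b, ?_, d⟩
      have := bd_smul_fin hA g c; rwa [smul_inv_smul] at this
  have hmm : ∀ (g : Γ) C, mm G k (g • C) = mm G k C := by
    intro g C; rw [mm, hcr]; exact Set.ncard_image_of_injective _ (MulAction.injective g)
  have s1 : ∀ (g : Γ) e e' C, C ∈ Sep L G e e' → g • C ∈ Sep L G (ga g e) (ga g e') := by
    rintro g e e' C ⟨h1, h2, h3⟩
    exact ⟨bd_smul_fin hA g h1, (hga _ _ _).2 h2, by rw [← smul_compl']; exact (hga _ _ _).2 h3⟩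
  have s2 : ∀ (g : Γ) e e' C, C ∈ Sep L G (ga g e) (ga g e') → g⁻¹ • C ∈ Sep L G e e' := by
    rintro g e e' C ⟨h1, h2, h3⟩
    refine ⟨bd_smul_fin hA _ h1, ?_, ?_⟩
    · rw [← hga g, smul_inv_smul]; exact h2
    · rw [← hga g, ← smul_compl', smul_inv_smul]; exact h3
  have t1 : ∀ (g : Γ) e e' C, C ∈ MinSep L G e e' → g • C ∈ MinSep L G (ga g e) (ga g e') := by
    rintro g e e' C ⟨h1, h2⟩
    refine ⟨s1 g _ _ _ h1, fun D hD => ?_⟩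
    have := h2 _ (s2 g _ _ _ hD)
    rwa [sz_smul hA] at this ⊢
  have t2 : ∀ (g : Γ) e e' C, C ∈ MinSep L G (ga g e) (ga g e') → g⁻¹ • C ∈ MinSep L G e e' := by
    rintro g e e' C ⟨h1, h2⟩
    refine ⟨s2 g _ _ _ h1, fun D hD => ?_⟩
    have := h2 _ (s1 g _ _ _ hD)
    rwa [sz_smul hA] at this ⊢
  refine ⟨𝓔, ⟨?_, ?_, ?_, fun C hC => (hsub C hC).1, fun C hC => (hsub C hC).2.2.1, ?_, ?_⟩, ?_⟩
  · rintro C ⟨e, e', h, hk⟩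
    exact ⟨e', e, Opt.compl h, by rwa [sz_compl]⟩
  · rintro g C ⟨e, e', h, hk⟩
    refine ⟨ga g e, ga g e', ⟨t1 g _ _ _ h.1, fun D hD => ?_⟩, by rwa [sz_smul hA]⟩
    have := h.2 _ (t2 g _ _ _ hD)
    rwa [hmm] at this ⊢
  · rintro C ⟨e, e', h, hk⟩ D ⟨f, f', h', hk'⟩
    exact Opt.nested hL hG h h' hk
  · rintro C ⟨e, e', h, hk⟩
    exact hL.inf _ _ h.1.1.2.1
  · intro x y
    refine (tight_finite k G hG x y).subset ?_
    rintro C ⟨h, hx⟩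
    obtain ⟨h1, h2, h3, h4⟩ := hsub C h
    exact ⟨h1, h2, h3, h4, hx⟩
  · intro e e' hne
    obtain ⟨C0, hC0, hk0⟩ := hsep e e' hne
    obtain ⟨C1, hC1, hmin1⟩ : ∃ C1 ∈ Sep L G e e', ∀ D ∈ Sep L G e e', sz G C1 ≤ sz G D := by
      obtain ⟨C1, h1, h2⟩ := (measure (sz G)).wf.has_min (Sep L G e e') ⟨C0, hC0⟩
      exact ⟨C1, h1, fun D hD => not_lt.1 (h2 D hD)⟩
    obtain ⟨C2, hC2, hmin2⟩ : ∃ C2 ∈ MinSep L G e e', ∀ D ∈ MinSep L G e e',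
        mm G k C2 ≤ mm G k D := by
      obtain ⟨C1, h1, h2⟩ := (measure (mm G k)).wf.has_min (MinSep L G e e') ⟨C1, hC1, hmin1⟩
      exact ⟨C1, h1, fun D hD => not_lt.1 (h2 D hD)⟩
    exact ⟨C2, ⟨e, e', ⟨hC2, hmin2⟩, (hC2.2 _ hC0).trans hk0⟩, hC2.1.2.1, hC2.1.2.2⟩

end TA
end

section
open scoped Pointwise
open Relation SimpleGraph

namespace TA

variable {V : Type u} {G : SimpleGraph V}

/-! ### Ends -/

/-- The component of `G - K` in which the end `e` lives. -/
def eset (e : G.end) (K : Finset V) : Set V :=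
  ComponentCompl.supp (K := (K : Set V)) (e.val (Opposite.op K))

theorem componentComplMk_eq_iff {K : Set V} {x y : V} (hx : x ∉ K) (hy : y ∉ K) :
    G.componentComplMk hx = G.componentComplMk hy ↔ Join G Kᶜ x y := by
  rw [componentComplMk, componentComplMk, ConnectedComponent.eq]
  constructor
  · intro h; exact join_of_reachable_induce h
  · intro h; exact h.reachable_induce hx hy

theorem eset_spec (e : G.end) (K : Finset V) :
    ∃ x, x ∉ K ∧ eset e K = {y | y ∉ K ∧ Join G (↑K)ᶜ x y} := by
  obtain ⟨x, hx, h⟩ := ComponentCompl.exists_eq_mk (G := G) (K := (K : Set V)) (e.val (Opposite.op K))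
  refine ⟨x, hx, ?_⟩
  ext y
  unfold eset
  rw [← h]
  constructor
  · rintro ⟨hy, h'⟩
    exact ⟨hy, ((componentComplMk_eq_iff hy hx).1 h').symm⟩
  · rintro ⟨hy, h'⟩
    exact ⟨hy, (componentComplMk_eq_iff hy hx).2 h'.symm⟩

theorem eset_mono (e : G.end) {K K' : Finset V} (h : K ⊆ K') : eset e K' ⊆ eset e K := by
  have h1 := e.2 (CategoryTheory.opHomOfLE h)
  have h2 : ComponentCompl.hom (K := (K : Set V)) (L := (K' : Set V)) (by exact_mod_cast h)
    (e.val (Opposite.op K')) = e.val (Opposite.op K) := h1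
  have := ComponentCompl.subset_hom (G := G) (K := (K : Set V)) (L := (K' : Set V))
    (e.val (Opposite.op K')) (by exact_mod_cast h)
  rw [h2] at this
  exact this

theorem exists_end (Q : Finset V → Set V)
    (h1 : ∀ K, ∃ x, x ∉ K ∧ Q K = {y | y ∉ K ∧ Join G (↑K)ᶜ x y})
    (h2 : ∀ K K' : Finset V, K ⊆ K' → Q K' ⊆ Q K) : ∃ e : G.end, ∀ K, eset e K = Q K := by
  choose x hx hQ using h1
  have hx' : ∀ K : Finset V, x K ∉ (K : Set V) := fun K => by simpa using hx K
  have hs : ∀ K : Finset V, ComponentCompl.supp (G.componentComplMk (hx' K)) = Q K := by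
    intro K
    rw [hQ]
    ext y
    constructor
    · rintro ⟨hy, h'⟩
      exact ⟨hy, ((componentComplMk_eq_iff hy _).1 h').symm⟩
    · rintro ⟨hy, h'⟩
      exact ⟨hy, (componentComplMk_eq_iff hy _).2 h'.symm⟩
  refine ⟨⟨fun K => G.componentComplMk (hx' K.unop), ?_⟩, fun K => hs K⟩
  intro K' K f
  have hle : K.unop ⊆ K'.unop := CategoryTheory.leOfHom f.unop
  have hle' : (K.unop : Set V) ⊆ (K'.unop : Set V) := by exact_mod_cast hle
  change ComponentCompl.hom hle' (G.componentComplMk (hx' K'.unop)) = _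
  rw [ComponentCompl.hom_eq_iff_le]
  intro z hz
  have hz1 : z ∈ Q K'.unop := by rw [← hs]; exact hz
  have hz2 := h2 _ _ hle hz1
  rw [← hs] at hz2
  exact hz2

theorem end_ext {e e' : G.end} (h : ∀ K, eset e K = eset e' K) : e = e' := by
  apply Subtype.ext
  funext K
  exact ComponentCompl.supp_injective (h K.unop)

theorem eset_inf (e : G.end) (K : Finset V) : (eset e K).Infinite := by
  classical
  intro hf
  obtain ⟨x, hx, hE⟩ := eset_spec e (K ∪ hf.toFinset)
  have hm : x ∈ eset e (K ∪ hf.toFinset) := by rw [hE]; exact ⟨hx, ReflTransGen.refl⟩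
  have := eset_mono e Finset.subset_union_left hm
  exact hx (Finset.mem_union_right _ (hf.mem_toFinset.2 this))

/-- The end `e` lives in `C`. -/
def LL (G : SimpleGraph V) (e : G.end) (C : Set V) : Prop := ∃ K, eset e K ⊆ C

theorem endFam (G : SimpleGraph V) : EndFam G (LL G) where
  mono := fun e C D h ⟨K, hK⟩ => ⟨K, hK.trans h⟩
  inter := by
    classical
    rintro e C D ⟨K, hK⟩ ⟨K', hK'⟩
    exact ⟨K ∪ K', Set.subset_inter ((eset_mono e Finset.subset_union_left).trans hK)
      ((eset_mono e Finset.subset_union_right).trans hK')⟩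
  inf := fun e C ⟨K, hK⟩ => (eset_inf e K).mono hK
  dich := by
    intro e C hf
    have hf' := hf.image Prod.fst
    obtain ⟨x, hx, hE⟩ := eset_spec e hf'.toFinset
    by_cases hxC : x ∈ C
    · left
      refine ⟨hf'.toFinset, fun y hy => ?_⟩
      rw [hE] at hy
      by_contra hyC
      obtain ⟨a, b, hab, ha, hb, h1, h2⟩ := hy.2.exists_exit hxC hyC
      exact ha (hf'.mem_toFinset.2 ⟨(a, b), ⟨hab, h1, h2⟩, rfl⟩)
    · right
      refine ⟨hf'.toFinset, fun y hy => ?_⟩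
      rw [hE] at hy
      intro hyC
      obtain ⟨a, b, hab, ha, hb, h1, h2⟩ := hy.2.symm.exists_exit hyC hxC
      exact ha (hf'.mem_toFinset.2 ⟨(a, b), ⟨hab, h1, h2⟩, rfl⟩)

theorem compl_components_finite (hc : G.Connected) (hlf : LocallyFiniteGraph G) (K : Finset V) :
    Finite (G.ComponentCompl (K : Set V)) := by
  have : G.LocallyFinite := fun v => (hlf v).fintype
  have : Fact G.Preconnected := ⟨hc.preconnected⟩
  exact componentCompl_finite K

/-- Every infinite set accumulates at an end. -/
theorem exists_end_of_infinite (hc : G.Connected) (hlf : LocallyFiniteGraph G) {A : Set V}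
    (hA : A.Infinite) : ∃ e : G.end, ∀ K, (eset e K ∩ A).Infinite := by
  classical
  have : Infinite A := hA.to_subtype
  have : (Filter.cofinite ⊓ Filter.principal A).NeBot := by
    rw [Filter.cofinite_inf_principal_neBot_iff]; exact hA
  set U := Ultrafilter.of (Filter.cofinite ⊓ Filter.principal A) with hU
  have hUle : (U : Filter V) ≤ Filter.cofinite ⊓ Filter.principal A := Ultrafilter.of_le _
  have hUA : A ∈ U := hUle (Filter.mem_inf_of_right (Filter.mem_principal_self A))
  have hUinf : ∀ S ∈ U, S.Infinite := by
    intro S hS hf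
    have : Sᶜ ∈ U := hUle (Filter.mem_inf_of_left hf.compl_mem_cofinite)
    exact (Ultrafilter.compl_mem_iff_notMem.1 this) hS
  have key : ∀ K : Finset V, ∃ x, x ∉ K ∧ {y | y ∉ K ∧ Join G (↑K)ᶜ x y} ∈ U := by
    intro K
    have := compl_components_finite hc hlf K
    have hK : ((K : Set V)ᶜ) ∈ U :=
      hUle (Filter.mem_inf_of_left K.finite_toSet.compl_mem_cofinite)
    have : (⋃ Q ∈ (Set.univ : Set (G.ComponentCompl (K : Set V))), Q.supp) ∈ U := by
      refine Filter.mem_of_superset hK ?_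
      intro y hy
      simp only [Set.mem_iUnion]
      exact ⟨G.componentComplMk hy, trivial, hy, rfl⟩
    rw [Ultrafilter.finite_biUnion_mem_iff Set.finite_univ] at this
    obtain ⟨Q, -, hQ⟩ := this
    obtain ⟨x, hx, rfl⟩ := Q.exists_eq_mk
    refine ⟨x, hx, Filter.mem_of_superset hQ ?_⟩
    rintro y ⟨hy, h'⟩
    exact ⟨hy, ((componentComplMk_eq_iff hy hx).1 h').symm⟩
  choose x hx hxU using key
  obtain ⟨e, he⟩ := exists_end (G := G) (fun K => {y | y ∉ K ∧ Join G (↑K)ᶜ (x K) y})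
    (fun K => ⟨x K, hx K, rfl⟩) (by
      intro K K' hKK y hy
      obtain ⟨z, hz, hz'⟩ := Ultrafilter.nonempty_of_mem (Filter.inter_mem (hxU K) (hxU K'))
      have hsub : ((K' : Set V)ᶜ) ⊆ ((K : Set V)ᶜ) := by
        intro a ha ha'; exact ha (hKK ha')
      exact ⟨fun h => hy.1 (hKK h), hz.2.trans ((hz'.2.symm.trans hy.2).mono hsub)⟩)
  refine ⟨e, fun K => hUinf _ ?_⟩
  rw [he]
  exact Filter.inter_mem (hxU K) hUA

/-- Any two vertices far away are joined outside `K`. -/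
def Crit (G : SimpleGraph V) : Prop :=
  ∀ K : Finset V, ∃ K' : Finset V, ∀ x y, x ∉ K' → y ∉ K' → Join G (↑K)ᶜ x y

theorem Crit.subsingleton (h : Crit G) : Subsingleton G.end := by
  classical
  refine ⟨fun e e' => end_ext fun K => ?_⟩
  obtain ⟨K', hK'⟩ := h K
  have : ∀ e e' : G.end, eset e K ⊆ eset e' K := by
    intro e e' z hz
    have mem : ∀ e : G.end, ∃ x, x ∉ K' ∧ x ∈ eset e K := by
      intro e
      obtain ⟨x, hx, hE⟩ := (eset_inf e K).exists_notMem_finset K'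
      exact ⟨x, hE, hx⟩
    obtain ⟨x, hx, hxe⟩ := mem e
    obtain ⟨y, hy, hye⟩ := mem e'
    obtain ⟨p, hp, hpE⟩ := eset_spec e K
    obtain ⟨q, hq, hqE⟩ := eset_spec e' K
    rw [hpE] at hz hxe
    rw [hqE] at hye ⊢
    exact ⟨hz.1, hye.2.trans ((hK' x y hx hy).symm.trans (hxe.2.symm.trans hz.2))⟩
  exact (this e e').antisymm (this e' e)

/-- If no two distinct ends accumulate at `A`, then the far away points of `A` are joined. -/
theorem crit_of_ends (hc : G.Connected) (hlf : LocallyFiniteGraph G) (A : Set V)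
    (h : ∀ e e' : G.end, (∀ K, (eset e K ∩ A).Infinite) → (∀ K, (eset e' K ∩ A).Infinite) →
      e = e') (K : Finset V) :
    ∃ K' : Finset V, ∀ x y, x ∈ A → y ∈ A → x ∉ K' → y ∉ K' → Join G (↑K)ᶜ x y := by
  classical
  have := compl_components_finite hc hlf K
  set B : Set V := ⋃ Q ∈ {Q : G.ComponentCompl (K : Set V) | (Q.supp ∩ A).Finite}, Q.supp ∩ A
    with hB
  have hBf : B.Finite := Set.Finite.biUnion (Set.toFinite _) fun Q hQ => hQ
  refine ⟨K ∪ hBf.toFinset, fun x y hxA hyA hx hy => ?_⟩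
  have key : ∀ x, x ∈ A → x ∉ K ∪ hBf.toFinset → x ∉ K ∧ ∃ e : G.end, x ∈ eset e K ∧
      ∀ K, (eset e K ∩ A).Infinite := by
    intro x hxA hx
    have hxK : x ∉ K := fun h => hx (Finset.mem_union_left _ h)
    have hxB : x ∉ B := fun h => hx (Finset.mem_union_right _ (hBf.mem_toFinset.2 h))
    refine ⟨hxK, ?_⟩
    set Q := G.componentComplMk (K := (K : Set V)) (v := x) (by simpa using hxK) with hQ
    have hxQ : x ∈ Q.supp := ⟨by simpa using hxK, rfl⟩
    have hinf : (Q.supp ∩ A).Infinite := by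
      intro hf
      apply hxB
      simp only [hB, Set.mem_iUnion]
      exact ⟨Q, hf, hxQ, hxA⟩
    obtain ⟨e, he⟩ := exists_end_of_infinite hc hlf hinf
    refine ⟨e, ?_, fun K => (he K).mono (fun z hz => ⟨hz.1, hz.2.2⟩)⟩
    obtain ⟨z, hz1, hz2, -⟩ := (he K).nonempty
    obtain ⟨p, hp, hpE⟩ := eset_spec e K
    rw [hpE] at hz1 ⊢
    obtain ⟨hzK, hzQ⟩ := hz2
    exact ⟨hxK, hz1.2.trans ((componentComplMk_eq_iff _ _).1 hzQ)⟩
  obtain ⟨hxK, e, hxe, he⟩ := key x hxA hx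
  obtain ⟨hyK, e', hye, he'⟩ := key y hyA hy
  obtain rfl := h e e' he he'
  obtain ⟨p, hp, hpE⟩ := eset_spec e K
  rw [hpE] at hxe hye
  exact hxe.2.symm.trans hye.2

theorem nonempty_end (hc : G.Connected) (hlf : LocallyFiniteGraph G) [Infinite V] :
    Nonempty G.end :=
  let ⟨e, _⟩ := exists_end_of_infinite hc hlf Set.infinite_univ
  ⟨e⟩

/-! ### The action on ends and the cut system -/

variable {Γ : Type*} [Group Γ] [MulAction Γ V]

theorem exists_smul_end (hA : Acts G Γ) (g : Γ) (e : G.end) :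
    ∃ e' : G.end, ∀ C, LL G e' (g • C) ↔ LL G e C := by
  classical
  have hfin : ∀ (g : Γ) (K : Finset V), ((g • K : Finset V) : Set V) = g • (K : Set V) :=
    fun g K => Finset.coe_smul_finset g K
  obtain ⟨e', he'⟩ := exists_end (G := G) (fun K => g • eset e (g⁻¹ • K)) (by
      intro K
      obtain ⟨x, hx, hE⟩ := eset_spec e (g⁻¹ • K)
      refine ⟨g • x, fun h => hx ?_, ?_⟩
      · rw [Finset.mem_inv_smul_finset_iff]; exact h
      · rw [hE]
        ext y
        rw [Set.mem_smul_set_iff_inv_smul_mem]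
        have e1 : g⁻¹ • y ∈ g⁻¹ • K ↔ y ∈ K := by simp
        simp only [Set.mem_ofPred_eq, e1]
        refine and_congr_right fun _ => ⟨fun h => ?_, fun h => ?_⟩
        · have := h.smul hA g
          rwa [hfin, smul_compl', smul_inv_smul, smul_inv_smul] at this
        · have := h.smul hA g⁻¹
          rwa [inv_smul_smul, smul_compl', ← hfin] at this)
    (by
      intro K K' h
      exact Set.smul_set_mono (eset_mono e (Finset.smul_finset_subset_smul_finset h)))
  refine ⟨e', fun C => ⟨?_, ?_⟩⟩
  · rintro ⟨K, hK⟩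
    rw [he', Set.smul_set_subset_smul_set_iff] at hK
    exact ⟨_, hK⟩
  · rintro ⟨K, hK⟩
    refine ⟨g • K, ?_⟩
    rw [he', inv_smul_smul]
    exact Set.smul_set_mono hK

theorem exists_cutSys_of_accessible (hc : G.Connected) (hlf : LocallyFiniteGraph G)
    (hacc : Accessible G) (hA : Acts G Γ) (htr : ∀ u v : V, ∃ g : Γ, g • u = v) :
    ∃ 𝓔, CutSys G Γ 𝓔 ∧ ∀ e e' : G.end, e ≠ e' → ∃ C ∈ 𝓔, LL G e C ∧ LL G e' Cᶜ := by
  classical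
  obtain ⟨n, hn⟩ := hacc
  obtain ⟨v0⟩ := hc.nonempty
  set Δ := (G.neighborSet v0).ncard with hΔ
  have hdeg : ∀ v, (G.neighborSet v).ncard = Δ := by
    intro v
    obtain ⟨g, rfl⟩ := htr v0 v
    have : G.neighborSet (g • v0) = g • G.neighborSet v0 := by
      ext y
      rw [Set.mem_smul_set_iff_inv_smul_mem, SimpleGraph.mem_neighborSet,
        SimpleGraph.mem_neighborSet, ← hA g v0, smul_inv_smul]
    rw [this]
    exact Set.ncard_image_of_injective _ (MulAction.injective g)
  choose ga hga using fun (g : Γ) (e : G.end) => exists_smul_end hA g e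
  refine exists_cutSys hc.preconnected (endFam G) hA ga hga (n * Δ) ?_
  intro e e' hne
  obtain ⟨K, hK, hne'⟩ := hn e e' hne
  have hdis : Disjoint (eset e K) (eset e' K) := by
    have := ComponentCompl.pairwise_disjoint hne'
    exact this
  have hsub : bd G (eset e K) ⊆ Prod.swap '' (⋃ v ∈ K, {v} ×ˢ G.neighborSet v) := by
    rintro ⟨a, b⟩ ⟨hab, ha, hb⟩
    obtain ⟨x, hx, hE⟩ := eset_spec e K
    refine ⟨(b, a), ?_, rfl⟩
    simp only [Set.mem_iUnion]
    have hbK : b ∈ K := by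
      by_contra hbK
      apply hb
      rw [hE] at ha ⊢
      exact ⟨hbK, ha.2.trans (Join.of_adj hab ha.1 hbK)⟩
    exact ⟨b, hbK, rfl, hab.symm⟩
  have hfU : (⋃ v ∈ K, ({v} : Set V) ×ˢ G.neighborSet v).Finite :=
    Set.Finite.biUnion K.finite_toSet fun v _ => (Set.finite_singleton v).prod (hlf v)
  refine ⟨eset e K, ⟨(hfU.image _).subset hsub, ⟨K, subset_rfl⟩, ⟨K, ?_⟩⟩, ?_⟩
  · exact Set.subset_compl_iff_disjoint_right.2 hdis.symm
  · unfold sz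
    refine (Set.ncard_le_ncard hsub (hfU.image _)).trans ((Set.ncard_image_le hfU).trans ?_)
    have : (⋃ v ∈ K, ({v} : Set V) ×ˢ G.neighborSet v).ncard ≤ ∑ v ∈ K, Δ := by
      refine (Finset.set_ncard_biUnion_le K _).trans (Finset.sum_le_sum fun v _ => ?_)
      rw [Set.ncard_prod, Set.ncard_singleton, hdeg, one_mul]
    rw [Finset.sum_const, smul_eq_mul] at this
    exact this.trans (Nat.mul_le_mul_right _ hK)

end TA
end

section
open scoped Pointwise
open Relation SimpleGraph

namespace TA

variable {V : Type u} {G : SimpleGraph V}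

/-! ### Distances -/

theorem dist_smul {Γ : Type*} [Group Γ] [MulAction Γ V] (hc : G.Connected) (hA : Acts G Γ)
    (g : Γ) (a b : V) : G.dist (g • a) (g • b) = G.dist a b := by
  have key : ∀ (g : Γ) (a b : V), G.dist (g • a) (g • b) ≤ G.dist a b := by
    intro g a b
    obtain ⟨p, hp⟩ := hc.exists_walk_length_eq_dist a b
    let f : G →g G := ⟨fun x => g • x, fun h => (hA g _ _).2 h⟩
    have := SimpleGraph.dist_le (p.map f)
    rw [SimpleGraph.Walk.length_map, hp] at this
    exact this
  refine le_antisymm (key g a b) ?_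
  have := key g⁻¹ (g • a) (g • b)
  rwa [inv_smul_smul, inv_smul_smul] at this

theorem walk_finite (hlf : LocallyFiniteGraph G) (n : ℕ) : ∀ v,
    {w | ∃ p : G.Walk v w, p.length ≤ n}.Finite := by
  induction n with
  | zero =>
    intro v
    refine (Set.finite_singleton v).subset ?_
    rintro w ⟨p, hp⟩
    exact (SimpleGraph.Walk.eq_of_length_eq_zero (Nat.le_zero.1 hp)).symm
  | succ n ih =>
    intro v
    refine ((Set.finite_singleton v).union ((hlf v).biUnion fun u _ => ih u)).subset ?_
    rintro w ⟨p, hp⟩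
    cases p with
    | nil => exact Or.inl rfl
    | @cons _ u _ h q =>
      right
      simp only [Set.mem_iUnion]
      refine ⟨u, h, q, ?_⟩
      rw [SimpleGraph.Walk.length_cons] at hp
      omega

theorem dist_finite (hc : G.Connected) (hlf : LocallyFiniteGraph G) (n : ℕ) (v : V) :
    {w | G.dist v w ≤ n}.Finite := by
  refine (walk_finite hlf n v).subset ?_
  intro w hw
  obtain ⟨p, hp⟩ := hc.exists_walk_length_eq_dist v w
  exact ⟨p, hp.le.trans hw⟩

/-- The `r`-neighbourhood of `C`. -/
def ball (G : SimpleGraph V) (r : ℕ) (C : Set V) : Set V := {v | ∃ c ∈ C, G.dist v c ≤ r}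

/-- The `r`-neighbourhood of the boundary of `C`. -/
def UU (G : SimpleGraph V) (r : ℕ) (C : Set V) : Set V := ball G r C ∩ ball G r Cᶜ

theorem subset_ball (r : ℕ) (C : Set V) : C ⊆ ball G r C := fun c hc =>
  ⟨c, hc, by rw [SimpleGraph.dist_self]; exact Nat.zero_le _⟩

theorem ball_mono (r : ℕ) {C D : Set V} (h : C ⊆ D) : ball G r C ⊆ ball G r D :=
  fun _ ⟨c, hc, hd⟩ => ⟨c, h hc, hd⟩

theorem UU_compl (r : ℕ) (C : Set V) : UU G r Cᶜ = UU G r C := by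
  rw [UU, UU, compl_compl, Set.inter_comm]

theorem mem_UU_of_notMem {r : ℕ} {C : Set V} {v : V} (h : v ∈ ball G r C) (h' : v ∉ C) :
    v ∈ UU G r C := ⟨h, subset_ball r _ h'⟩

theorem notMem_of_adj {r : ℕ} (hr : 1 ≤ r) {C : Set V} {v w : V} (h : G.Adj v w)
    (hv : v ∉ ball G r C) : w ∉ C := fun hw => hv ⟨w, hw, by
      rw [SimpleGraph.dist_eq_one_iff_adj.2 h]; exact hr⟩

section Act
variable {Γ : Type*} [Group Γ] [MulAction Γ V]

theorem ball_smul (hc : G.Connected) (hA : Acts G Γ) (g : Γ) (r : ℕ) (C : Set V) :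
    ball G r (g • C) = g • ball G r C := by
  ext v
  rw [Set.mem_smul_set_iff_inv_smul_mem]
  constructor
  · rintro ⟨_, ⟨c, hc', rfl⟩, hd⟩
    refine ⟨c, hc', ?_⟩
    rw [← dist_smul hc hA g, smul_inv_smul]; exact hd
  · rintro ⟨c, hc', hd⟩
    refine ⟨g • c, Set.smul_mem_smul_set hc', ?_⟩
    rw [← dist_smul hc hA g, smul_inv_smul] at hd; exact hd

theorem UU_smul (hc : G.Connected) (hA : Acts G Γ) (g : Γ) (r : ℕ) (C : Set V) :
    UU G r (g • C) = g • UU G r C := by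
  rw [UU, ← smul_compl', ball_smul hc hA, ball_smul hc hA, UU, Set.smul_set_inter]

end Act

theorem exists_exit_near {C : Set V} : ∀ {v c : V} (w : G.Walk v c), v ∈ C → c ∉ C → ∀ r,
    w.length ≤ r → ∃ a b, (a, b) ∈ bd G C ∧ (∃ p : G.Walk v a, p.length ≤ w.length) ∧
      Join G (UU G r C) v a
  | _, _, .nil, hv, hc, _, _ => absurd hv hc
  | v, c, .cons (v := x) h w, hv, hc, r, hr => by
    rw [SimpleGraph.Walk.length_cons] at hr
    by_cases hx : x ∈ C
    · obtain ⟨a, b, hab, ⟨p, hp⟩, hj⟩ := exists_exit_near w hx hc r (by omega)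
      have hvU : v ∈ UU G r C := ⟨subset_ball _ _ hv, c, hc,
        (SimpleGraph.dist_le (SimpleGraph.Walk.cons h w)).trans (by simpa using hr)⟩
      have hxU : x ∈ UU G r C := ⟨subset_ball _ _ hx, c, hc,
        (SimpleGraph.dist_le w).trans (by omega)⟩
      refine ⟨a, b, hab, ⟨.cons h p, by simpa using hp⟩, ?_⟩
      exact ReflTransGen.head ⟨h, hvU, hxU⟩ hj
    · exact ⟨v, x, ⟨h, hv, hx⟩, ⟨.nil, by simp⟩, ReflTransGen.refl⟩

end TA
end

section
open scoped Pointwise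
open Relation SimpleGraph

namespace TA

variable {V : Type u}

/-! ### Nested families and their structure trees -/

structure NF (𝓔 : Set (Set V)) : Prop where
  compl : ∀ C ∈ 𝓔, Cᶜ ∈ 𝓔
  nested : ∀ C ∈ 𝓔, ∀ D ∈ 𝓔, Nested C D
  ne : ∀ C ∈ 𝓔, C.Nonempty
  sep : ∀ v w, {C | C ∈ 𝓔 ∧ v ∈ C ∧ w ∉ C}.Finite

theorem NF.sub {𝓔 𝓕 : Set (Set V)} (h : NF 𝓔) (hs : 𝓕 ⊆ 𝓔) (hc : ∀ C ∈ 𝓕, Cᶜ ∈ 𝓕) : NF 𝓕 where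
  compl := hc
  nested C hC D hD := h.nested C (hs hC) D (hs hD)
  ne C hC := h.ne C (hs hC)
  sep v w := (h.sep v w).subset fun _ hC => ⟨hs hC.1, hC.2⟩

/-- Vertices of the structure tree. -/
structure Node (𝓔 t : Set (Set V)) : Prop where
  sub : t ⊆ 𝓔
  or : ∀ C ∈ 𝓔, C ∈ t ∨ Cᶜ ∈ t
  not : ∀ C ∈ t, Cᶜ ∉ t
  up : ∀ C ∈ t, ∀ D ∈ 𝓔, C ⊆ D → D ∈ t
  fin : ∀ v, {C | C ∈ t ∧ v ∉ C}.Finite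

def MinIn (t : Set (Set V)) (C : Set V) : Prop := C ∈ t ∧ ∀ D ∈ t, D ⊆ C → D = C

def flip (t : Set (Set V)) (C : Set V) : Set (Set V) := {D | (D ∈ t ∧ D ≠ C) ∨ D = Cᶜ}

def Ov (𝓔 : Set (Set V)) (v : V) : Set (Set V) := {C | C ∈ 𝓔 ∧ v ∈ C}

def nodeOf (𝓔 : Set (Set V)) (C : Set V) : Set (Set V) :=
  {D | D ∈ 𝓔 ∧ (C ⊆ D ∨ (Cᶜ ⊆ D ∧ D ≠ Cᶜ))}

theorem Ov_node {𝓔 : Set (Set V)} (h : NF 𝓔) (v : V) : Node 𝓔 (Ov 𝓔 v) where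
  sub _ hC := hC.1
  or C hC := by
    by_cases hv : v ∈ C
    · exact Or.inl ⟨hC, hv⟩
    · exact Or.inr ⟨h.compl C hC, hv⟩
  not C hC hC' := hC'.2 hC.2
  up C hC D hD hs := ⟨hD, hs hC.2⟩
  fin w := (h.sep v w).subset fun C hC => ⟨hC.1.1, hC.1.2, hC.2⟩

theorem flip_flip {t : Set (Set V)} {C : Set V} (hC : C ∈ t) (hn : Cᶜ ∉ t) :
    flip (flip t C) Cᶜ = t := by
  ext D
  simp only [flip, Set.mem_ofPred_eq, compl_compl]
  constructor
  · rintro (⟨(⟨h, -⟩ | h), h'⟩ | rfl)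
    · exact h
    · exact absurd h h'
    · exact hC
  · intro h
    by_cases hD : D = C
    · exact Or.inr hD
    · exact Or.inl ⟨Or.inl ⟨h, hD⟩, fun h' => hn (h' ▸ h)⟩

namespace Node
variable {𝓔 t t' : Set (Set V)} {C D : Set V}

theorem ext' (ht : Node 𝓔 t) (ht' : Node 𝓔 t') (h : t ⊆ t') : t = t' := by
  refine h.antisymm fun C hC => ?_
  rcases ht.or C (ht'.sub hC) with h1 | h1
  · exact h1
  · exact absurd (h h1) (ht'.not C hC)

theorem compl_mem_of (ht : Node 𝓔 t) (hC : C ∈ 𝓔) (h : C ∉ t) : Cᶜ ∈ t :=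
  (ht.or C hC).resolve_left h

theorem notMem_of (ht : Node 𝓔 t) (h : Cᶜ ∈ t) : C ∉ t := fun h' => ht.not C h' h

theorem trich (hN : NF 𝓔) (ht : Node 𝓔 t) (hC : C ∈ t) (hD : D ∈ t) :
    C ⊆ D ∨ D ⊆ C ∨ Cᶜ ⊆ D := by
  rcases hN.nested C (ht.sub hC) D (ht.sub hD) with h | h | h | h
  · exact Or.inl h
  · exact absurd (ht.up C hC _ (hN.compl D (ht.sub hD)) h) (ht.not D hD)
  · exact Or.inr (Or.inr h)
  · exact Or.inr (Or.inl (Set.compl_subset_compl.1 h))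

theorem exists_min (hN : NF 𝓔) (ht : Node 𝓔 t) (hC : C ∈ t) : ∃ D, MinIn t D ∧ D ⊆ C := by
  obtain ⟨v, hv⟩ := hN.ne _ (hN.compl C (ht.sub hC))
  have hf : {D | D ∈ t ∧ D ⊆ C}.Finite := (ht.fin v).subset fun D hD => ⟨hD.1, fun h => hv (hD.2 h)⟩
  obtain ⟨D, hD⟩ := hf.exists_minimal ⟨C, hC, subset_rfl⟩
  refine ⟨D, ⟨hD.1.1, fun E hE hED => ?_⟩, hD.1.2⟩
  exact hED.antisymm (hD.2 ⟨hE, hED.trans hD.1.2⟩ hED)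

theorem min_or (hN : NF 𝓔) (ht : Node 𝓔 t) (hC : MinIn t C) (hD : D ∈ t) : C ⊆ D ∨ Cᶜ ⊆ D := by
  rcases trich hN ht hC.1 hD with h | h | h
  · exact Or.inl h
  · exact Or.inl (hC.2 D hD h).ge
  · exact Or.inr h

theorem flip_node (hN : NF 𝓔) (ht : Node 𝓔 t) (hC : MinIn t C) : Node 𝓔 (flip t C) where
  sub := by
    rintro D (⟨h, -⟩ | rfl)
    · exact ht.sub h
    · exact hN.compl C (ht.sub hC.1)
  or D hD := by
    by_cases h1 : D = C
    · exact Or.inr (Or.inr (by rw [h1]))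
    by_cases h2 : D = Cᶜ
    · exact Or.inl (Or.inr h2)
    rcases ht.or D hD with h | h
    · exact Or.inl (Or.inl ⟨h, h1⟩)
    · exact Or.inr (Or.inl ⟨h, fun h' => h2 (by rw [← h', compl_compl])⟩)
  not D hD hD' := by
    rcases hD with ⟨h, h1⟩ | rfl
    · rcases hD' with ⟨h', -⟩ | h'
      · exact ht.not D h h'
      · exact h1 (compl_injective h')
    · rcases hD' with ⟨h', h1⟩ | h'
      · exact h1 (compl_compl C)
      · rw [compl_compl] at h'
        exact ht.not C hC.1 (h' ▸ hC.1)
  up D hD E hE hDE := by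
    rcases hD with ⟨h, h1⟩ | rfl
    · refine Or.inl ⟨ht.up D h E hE hDE, ?_⟩
      rintro rfl
      exact h1 (hC.2 D h hDE)
    · rcases ht.or E hE with h | h
      · refine Or.inl ⟨h, ?_⟩
        rintro rfl
        obtain ⟨v, hv⟩ := hN.ne _ (hN.compl E hE)
        exact hv (hDE hv)
      · have : Eᶜ = C := hC.2 _ h (Set.compl_subset_comm.1 hDE)
        exact Or.inr (by rw [← this, compl_compl])
  fin v := ((ht.fin v).union (Set.finite_singleton Cᶜ)).subset (by
    rintro D ⟨⟨h, -⟩ | h, hv⟩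
    · exact Or.inl ⟨h, hv⟩
    · exact Or.inr h)

theorem flip_min (hN : NF 𝓔) (ht : Node 𝓔 t) (hC : MinIn t C) : MinIn (flip t C) Cᶜ := by
  refine ⟨Or.inr rfl, ?_⟩
  rintro D (⟨h, -⟩ | h) hD
  · exact absurd (ht.up C hC.1 _ (hN.compl D (ht.sub h)) (Set.subset_compl_comm.1 hD)) (ht.not D h)
  · exact h

theorem flip_flip' (ht : Node 𝓔 t) (hC : MinIn t C) : flip (flip t C) Cᶜ = t :=
  flip_flip hC.1 (ht.not C hC.1)

theorem eq_nodeOf (hN : NF 𝓔) (ht : Node 𝓔 t) (hC : MinIn t C) (hn : Node 𝓔 (nodeOf 𝓔 C)) :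
    t = nodeOf 𝓔 C := by
  refine ht.ext' hn fun D hD => ⟨ht.sub hD, ?_⟩
  rcases min_or hN ht hC hD with h | h
  · exact Or.inl h
  · exact Or.inr ⟨h, fun h' => ht.not C hC.1 (h' ▸ hD)⟩

end Node

theorem nodeOf_node {𝓔 : Set (Set V)} (hN : NF 𝓔) {C : Set V} (hC : C ∈ 𝓔) :
    Node 𝓔 (nodeOf 𝓔 C) where
  sub _ h := h.1
  or D hD := by
    have hD' := hN.compl D hD
    rcases hN.nested C hC D hD with h | h | h | h
    · exact Or.inl ⟨hD, Or.inl h⟩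
    · exact Or.inr ⟨hD', Or.inl h⟩
    · by_cases h1 : D = Cᶜ
      · exact Or.inr ⟨hD', Or.inl (by rw [h1, compl_compl])⟩
      · exact Or.inl ⟨hD, Or.inr ⟨h, h1⟩⟩
    · by_cases h1 : Dᶜ = Cᶜ
      · exact Or.inl ⟨hD, Or.inl (by rw [compl_injective h1])⟩
      · exact Or.inr ⟨hD', Or.inr ⟨h, h1⟩⟩
  not D hD hD' := by
    obtain ⟨v, hv⟩ := hN.ne C hC
    obtain ⟨w, hw⟩ := hN.ne _ (hN.compl C hC)
    rcases hD.2 with h | ⟨h, h1⟩ <;> rcases hD'.2 with h' | ⟨h', h1'⟩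
    · exact h' hv (h hv)
    · exact h1' (h'.antisymm (Set.compl_subset_compl.2 h)).symm
    · exact h1 (Set.Subset.antisymm h (Set.subset_compl_comm.1 h')).symm
    · exact h' hw (h hw)
  up D hD E hE hDE := by
    refine ⟨hE, ?_⟩
    rcases hD.2 with h | ⟨h, h1⟩
    · exact Or.inl (h.trans hDE)
    · exact Or.inr ⟨h.trans hDE, fun h2 => h1 ((hDE.trans h2.le).antisymm h)⟩
  fin v := by
    obtain ⟨a, ha⟩ := hN.ne C hC
    obtain ⟨b, hb⟩ := hN.ne _ (hN.compl C hC)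
    refine ((hN.sep a v).union (hN.sep b v)).subset ?_
    rintro D ⟨⟨h0, h | h⟩, h2⟩
    · exact Or.inl ⟨h0, h ha, h2⟩
    · exact Or.inr ⟨h0, h.1 hb, h2⟩

theorem nodeOf_min {𝓔 : Set (Set V)} (hN : NF 𝓔) {C : Set V} (hC : C ∈ 𝓔) :
    MinIn (nodeOf 𝓔 C) C := by
  refine ⟨⟨hC, Or.inl subset_rfl⟩, ?_⟩
  rintro D ⟨hD, h | ⟨h, -⟩⟩ hs
  · exact hs.antisymm h
  · obtain ⟨w, hw⟩ := hN.ne _ (hN.compl C hC)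
    exact absurd (hs (h hw)) hw

/-! ### Rooting the structure tree -/

namespace Node
variable {𝓔 t0 t t' : Set (Set V)} {C D : Set V}

theorem diff_fin (v : V) (h0 : Node 𝓔 t0) (ht : Node 𝓔 t) : (t \ t0).Finite := by
  refine ((ht.fin v).union ((h0.fin v).image compl)).subset ?_
  rintro C ⟨h, h'⟩
  by_cases hv : v ∈ C
  · exact Or.inr ⟨Cᶜ, ⟨h0.compl_mem_of (ht.sub h) h', fun h => h hv⟩, compl_compl C⟩
  · exact Or.inl ⟨h, hv⟩

theorem diff_chain (hN : NF 𝓔) (h0 : Node 𝓔 t0) (ht : Node 𝓔 t) (hC : C ∈ t \ t0)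
    (hD : D ∈ t \ t0) : C ⊆ D ∨ D ⊆ C := by
  rcases trich hN ht hC.1 hD.1 with h | h | h
  · exact Or.inl h
  · exact Or.inr h
  · exact absurd (h0.up _ (h0.compl_mem_of (ht.sub hC.1) hC.2) D (ht.sub hD.1) h) hD.2

theorem diff_min (h0 : Node 𝓔 t0) (ht : Node 𝓔 t) (hC : C ∈ t \ t0)
    (hm : ∀ D ∈ t \ t0, C ⊆ D) : MinIn t C :=
  ⟨hC.1, fun D hD hDC => hDC.antisymm (hm D ⟨hD, fun h => hC.2 (h0.up D h C (ht.sub hC.1) hDC)⟩)⟩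

theorem exists_pe (v : V) (hN : NF 𝓔) (h0 : Node 𝓔 t0) (ht : Node 𝓔 t) (hne : t ≠ t0) :
    ∃ C, MinIn t C ∧ C ∉ t0 := by
  have hn : (t \ t0).Nonempty := by
    by_contra h
    rw [Set.not_nonempty_iff_eq_empty, Set.sdiff_eq_empty] at h
    exact hne (ht.ext' h0 h)
  obtain ⟨C, hC⟩ := (diff_fin v h0 ht).exists_minimal hn
  refine ⟨C, diff_min h0 ht hC.1 fun D hD => ?_, hC.1.2⟩
  rcases diff_chain hN h0 ht hC.1 hD with h | h
  · exact h
  · exact hC.2 hD h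

theorem pe_unique (hN : NF 𝓔) (h0 : Node 𝓔 t0) (ht : Node 𝓔 t) (hC : MinIn t C) (hC' : C ∉ t0)
    (hD : MinIn t D) (hD' : D ∉ t0) : C = D := by
  rcases diff_chain hN h0 ht ⟨hC.1, hC'⟩ ⟨hD.1, hD'⟩ with h | h
  · exact hD.2 C hC.1 h
  · exact (hC.2 D hD.1 h).symm

theorem flip_diff (h0 : Node 𝓔 t0) (ht : Node 𝓔 t) (hC : MinIn t C) (hC' : C ∉ t0) :
    flip t C \ t0 = (t \ t0) \ {C} := by
  ext D
  constructor
  · rintro ⟨⟨h, h1⟩ | h, h2⟩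
    · exact ⟨⟨h, h2⟩, h1⟩
    · exact absurd (h ▸ h0.compl_mem_of (ht.sub hC.1) hC') h2
  · rintro ⟨⟨h, h2⟩, h1⟩
    exact ⟨Or.inl ⟨h, h1⟩, h2⟩

end Node

/-- The parent edge of the node `t` in the tree rooted at `t0`. -/
noncomputable def pe (t0 t : Set (Set V)) : Set V :=
  open Classical in if h : ∃ C, MinIn t C ∧ C ∉ t0 then h.choose else ∅

noncomputable def parS (t0 t : Set (Set V)) : Set (Set V) := flip t (pe t0 t)

noncomputable def dep (t0 t : Set (Set V)) : ℕ := (t \ t0).ncard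

namespace Node
variable {𝓔 t0 t t' : Set (Set V)} {C D : Set V}

theorem pe_spec (v : V) (hN : NF 𝓔) (h0 : Node 𝓔 t0) (ht : Node 𝓔 t) (hne : t ≠ t0) :
    MinIn t (pe t0 t) ∧ pe t0 t ∉ t0 := by
  have h := exists_pe v hN h0 ht hne
  rw [pe, dif_pos h]
  exact h.choose_spec

theorem pe_eq (hN : NF 𝓔) (h0 : Node 𝓔 t0) (ht : Node 𝓔 t) (hC : MinIn t C) (hC' : C ∉ t0) :
    pe t0 t = C := by
  have h : ∃ C, MinIn t C ∧ C ∉ t0 := ⟨C, hC, hC'⟩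
  rw [pe, dif_pos h]
  exact pe_unique hN h0 ht h.choose_spec.1 h.choose_spec.2 hC hC'

theorem parS_node (v : V) (hN : NF 𝓔) (h0 : Node 𝓔 t0) (ht : Node 𝓔 t) (hne : t ≠ t0) :
    Node 𝓔 (parS t0 t) := flip_node hN ht (pe_spec v hN h0 ht hne).1

theorem dep_par (v : V) (hN : NF 𝓔) (h0 : Node 𝓔 t0) (ht : Node 𝓔 t) (hne : t ≠ t0) :
    dep t0 t = dep t0 (parS t0 t) + 1 := by
  obtain ⟨h1, h2⟩ := pe_spec v hN h0 ht hne
  rw [dep, dep, parS, flip_diff h0 ht h1 h2]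
  have hm : pe t0 t ∈ t \ t0 := ⟨h1.1, h2⟩
  exact (Set.ncard_sdiff_singleton_add_one hm (diff_fin v h0 ht)).symm

theorem dep_root : dep t0 t0 = 0 := by rw [dep, Set.sdiff_self, Set.ncard_empty]

theorem dep_zero (v : V) (h0 : Node 𝓔 t0) (ht : Node 𝓔 t) (h : dep t0 t = 0) : t = t0 := by
  rw [dep, Set.ncard_eq_zero (diff_fin v h0 ht), Set.sdiff_eq_empty] at h
  exact ht.ext' h0 h

/-- Flipping a minimal element is moving to the parent or to a child. -/
theorem flip_cases (hN : NF 𝓔) (h0 : Node 𝓔 t0) (ht : Node 𝓔 t) (hC : MinIn t C) :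
    (t ≠ t0 ∧ pe t0 t = C ∧ parS t0 t = flip t C) ∨
    (flip t C ≠ t0 ∧ pe t0 (flip t C) = Cᶜ ∧ parS t0 (flip t C) = t) := by
  by_cases h : C ∈ t0
  · right
    have h' : Cᶜ ∉ t0 := h0.not C h
    have e := pe_eq hN h0 (flip_node hN ht hC) (flip_min hN ht hC) h'
    refine ⟨fun h1 => h' (h1 ▸ Or.inr rfl), e, ?_⟩
    rw [parS, e, flip_flip' ht hC]
  · left
    have e := pe_eq hN h0 ht hC h
    exact ⟨fun h1 => h (h1 ▸ hC.1), e, by rw [parS, e]⟩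

end Node

/-! ### Rooted trees -/

structure Rooted {N : Type*} (r : N) (par : N → N) (dp : N → ℕ) : Prop where
  root : ∀ x, dp x = 0 ↔ x = r
  step : ∀ x, x ≠ r → dp x = dp (par x) + 1

namespace Rooted
variable {N : Type*} {r : N} {par : N → N} {dp : N → ℕ}

theorem induct (h : Rooted r par dp) {p : N → Prop} (h0 : p r)
    (h1 : ∀ x, x ≠ r → p (par x) → p x) (x : N) : p x := by
  obtain ⟨n, hn⟩ : ∃ n, dp x = n := ⟨_, rfl⟩
  induction n generalizing x with
  | zero => rw [(h.root x).1 hn]; exact h0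
  | succ n ih =>
    have hx : x ≠ r := fun hx => by rw [(h.root x).2 hx] at hn; omega
    exact h1 x hx (ih _ (by have := h.step x hx; omega))

theorem recursion (h : Rooted r par dp) {A : N → Type*} (a0 : A r)
    (F : ∀ x, x ≠ r → A (par x) → A x) :
    ∃ g : ∀ x, A x, g r = a0 ∧ ∀ x (hx : x ≠ r), g x = F x hx (g (par x)) := by
  classical
  let wf : WellFounded (fun x y : N => dp x < dp y) := InvImage.wf dp wellFounded_lt
  let g : ∀ x, A x := wf.fix fun x ih =>
    if hx : x = r then hx ▸ a0 else F x hx (ih (par x) (by have := h.step x hx; omega))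
  refine ⟨g, ?_, ?_⟩
  · show wf.fix _ r = a0
    rw [WellFounded.fix_eq, dif_pos rfl]
  · intro x hx
    show wf.fix _ x = _
    rw [WellFounded.fix_eq, dif_neg hx]

theorem isTree (h : Rooted r par dp) (T : SimpleGraph N)
    (hT : ∀ x y, T.Adj x y ↔ (x ≠ r ∧ par x = y) ∨ (y ≠ r ∧ par y = x)) : T.IsTree := by
  have hconn : ∀ x, T.Reachable x r :=
    h.induct (SimpleGraph.Reachable.refl _) fun x hx ih =>
      (SimpleGraph.Adj.reachable ((hT _ _).2 (Or.inl ⟨hx, rfl⟩))).trans ih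
  have : Nonempty N := ⟨r⟩
  refine ⟨⟨fun x y => (hconn x).trans (hconn y).symm⟩, ?_⟩
  rw [SimpleGraph.isAcyclic_iff_forall_adj_isBridge]
  have key : ∀ x, x ≠ r → T.IsBridge s(x, par x) := by
    intro x hx
    have hxp : T.Adj x (par x) := (hT _ _).2 (Or.inl ⟨hx, rfl⟩)
    rw [SimpleGraph.isBridge_iff]
    intro hreach
    -- the set of descendants of `x`
    have hA : ∀ y, (T \ SimpleGraph.fromEdgeSet {s(x, par x)}).Reachable x y →
        ∃ n, par^[n] y = x ∧ dp y = dp x + n := by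
      intro y hy
      have hy' := (SimpleGraph.reachable_iff_reflTransGen _ _).1 hy
      induction hy' with
      | refl => exact ⟨0, rfl, rfl⟩
      | @tail y z hxy hyz ih =>
        obtain ⟨n, hn, hd⟩ := ih ((SimpleGraph.reachable_iff_reflTransGen _ _).2 hxy)
        rw [SimpleGraph.sdiff_adj, hT] at hyz
        obtain ⟨hyz | hyz, hne⟩ := hyz
        · obtain ⟨hy0, rfl⟩ := hyz
          cases n with
          | zero =>
            exfalso
            apply hne
            have : y = x := hn
            subst this
            rw [SimpleGraph.fromEdgeSet_adj]
            exact ⟨rfl, hxp.ne⟩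
          | succ n =>
            exact ⟨n, hn, by have := h.step y hy0; omega⟩
        · obtain ⟨hz0, rfl⟩ := hyz
          exact ⟨n + 1, hn, by have := h.step z hz0; omega⟩
    obtain ⟨n, -, hd⟩ := hA _ hreach
    have := h.step x hx
    omega
  intro x y hxy
  rcases (hT x y).1 hxy with ⟨hx, rfl⟩ | ⟨hy, rfl⟩
  · exact key x hx
  · rw [Sym2.eq_swap]; exact key y hy

end Rooted

end TA
end

section
open scoped Pointwise
open Relation SimpleGraph

namespace TA

variable {V : Type u} {G : SimpleGraph V}

/-! ### The geometry of a cut system -/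

theorem join_of_walk {S : Set V} : ∀ {v w : V} (p : G.Walk v w), (∀ x ∈ p.support, x ∈ S) →
    Join G S v w
  | _, _, .nil, _ => ReflTransGen.refl
  | _, _, .cons h p, hS => ReflTransGen.head
      ⟨h, hS _ (by simp), hS _ (by simp)⟩
      (join_of_walk p fun x hx => hS x (by simp [hx]))

theorem dist_le_of_support {v w x : V} (p : G.Walk v w) (hx : x ∈ p.support) :
    G.dist v x ≤ p.length := by
  classical
  exact (SimpleGraph.dist_le (p.takeUntil x hx)).trans (p.length_takeUntil_le_length hx)

section
variable {Γ : Type*} [Group Γ] [MulAction Γ V] {𝓔 : Set (Set V)}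

theorem CutSys.sep (h : CutSys G Γ 𝓔) (hc : G.Connected) (v w : V) :
    {C | C ∈ 𝓔 ∧ v ∈ C ∧ w ∉ C}.Finite := by
  obtain ⟨p⟩ := hc.preconnected v w
  induction p with
  | nil => exact Set.finite_empty.subset fun C hC => hC.2.2 hC.2.1
  | @cons a b c hab p ih =>
    refine ((h.edge a b).union ih).subset fun C hC => ?_
    by_cases hb : b ∈ C
    · exact Or.inr ⟨hC.1, hb, hC.2.2⟩
    · exact Or.inl ⟨hC.1, hab, hC.2.1, hb⟩

theorem CutSys.nf (h : CutSys G Γ 𝓔) (hc : G.Connected) : NF 𝓔 where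
  compl := h.compl
  nested := h.nested
  ne C hC := (h.inf C hC).nonempty
  sep := h.sep hc

theorem CutSys.exists_bd (h : CutSys G Γ 𝓔) (hc : G.Connected) {C : Set V} (hC : C ∈ 𝓔) :
    ∃ a b, (a, b) ∈ bd G C := by
  obtain ⟨a, ha⟩ := (h.inf C hC).nonempty
  obtain ⟨b, hb⟩ := (h.inf _ (h.compl C hC)).nonempty
  obtain ⟨x, y, hxy, -, -, hx, hy⟩ :=
    (join_univ_of_reachable (hc.preconnected a b)).exists_exit ha hb
  exact ⟨x, y, hxy, hx, hy⟩

theorem CutSys.orbits (h : CutSys G Γ 𝓔) (hc : G.Connected) (hlf : LocallyFiniteGraph G)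
    (hA : Acts G Γ) (htr : ∀ u v : V, ∃ g : Γ, g • u = v) :
    ∃ F ⊆ 𝓔, F.Finite ∧ ∀ C ∈ 𝓔, ∃ D ∈ F, ∃ g : Γ, g • D = C := by
  obtain ⟨v0⟩ := hc.nonempty
  refine ⟨⋃ y ∈ G.neighborSet v0, {C | C ∈ 𝓔 ∧ G.Adj v0 y ∧ v0 ∈ C ∧ y ∉ C}, ?_,
    (hlf v0).biUnion fun y _ => h.edge v0 y, ?_⟩
  · intro C hC
    simp only [Set.mem_iUnion] at hC
    obtain ⟨y, _, hC⟩ := hC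
    exact hC.1
  · intro C hC
    obtain ⟨a, b, hab, ha, hb⟩ := h.exists_bd hc hC
    obtain ⟨g, rfl⟩ := htr v0 a
    refine ⟨g⁻¹ • C, ?_, g, smul_inv_smul g C⟩
    simp only [Set.mem_iUnion]
    have hadj : G.Adj v0 (g⁻¹ • b) := by
      rw [← hA g, smul_inv_smul]; exact hab
    refine ⟨g⁻¹ • b, hadj, h.smul _ C hC, hadj, ?_, ?_⟩
    · rw [Set.mem_smul_set_iff_inv_smul_mem, inv_inv]; exact ha
    · rw [Set.mem_smul_set_iff_inv_smul_mem, inv_inv, smul_inv_smul]; exact hb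

end

/-- All standing assumptions. -/
structure Dat (G : SimpleGraph V) (Γ : Type*) [Group Γ] [MulAction Γ V]
    (𝓔 : Set (Set V)) (r : ℕ) : Prop where
  hc : G.Connected
  lf : LocallyFiniteGraph G
  acts : Acts G Γ
  tr : ∀ u v : V, ∃ g : Γ, g • u = v
  cut : CutSys G Γ 𝓔
  hr : 1 ≤ r
  U : ∀ C ∈ 𝓔, Conn G (UU G r C)

section
variable {Γ : Type*} [Group Γ] [MulAction Γ V] {𝓔 : Set (Set V)} {r : ℕ}

theorem conn_UU {C : Set V} (hc : G.Connected) {L : ℕ} (hr : L + 1 ≤ r)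
    (hL : ∀ a b a' b', (a, b) ∈ bd G C → (a', b') ∈ bd G C →
      G.dist a a' ≤ L ∧ G.dist a b' ≤ L) : Conn G (UU G r C) := by
  -- every point is joined to a boundary point
  have h1 : ∀ (C : Set V) v, v ∈ UU G r C → v ∈ C →
      ∃ a b, (a, b) ∈ bd G C ∧ Join G (UU G r C) v a := by
    rintro C v ⟨-, c, hcC, hd⟩ hv
    obtain ⟨p, hp⟩ := hc.exists_walk_length_eq_dist v c
    obtain ⟨a, b, hab, -, hj⟩ := exists_exit_near p hv hcC r (hp.le.trans hd)
    exact ⟨a, b, hab, hj⟩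
  obtain hne | ⟨⟨a0, b0⟩, h0⟩ := (bd G C).eq_empty_or_nonempty
  · intro v hv
    exfalso
    by_cases h : v ∈ C
    · obtain ⟨a, b, hab, -⟩ := h1 C v hv h
      rw [hne] at hab; exact hab
    · obtain ⟨a, b, hab, -⟩ := h1 Cᶜ v (by rw [UU_compl]; exact hv) h
      rw [bd_compl, hne, Set.image_empty] at hab; exact hab
  have h2 : ∀ w, G.dist a0 w ≤ L → Join G (UU G r C) a0 w := by
    intro w hw
    obtain ⟨p, hp⟩ := hc.exists_walk_length_eq_dist a0 w
    refine join_of_walk p fun x hx => ?_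
    have hx' : G.dist x a0 ≤ L := by
      rw [SimpleGraph.dist_comm]; exact (dist_le_of_support p hx).trans (hp.le.trans hw)
    refine ⟨⟨a0, h0.2.1, by omega⟩, b0, h0.2.2, ?_⟩
    have : G.dist x b0 ≤ G.dist x a0 + G.dist a0 b0 := hc.dist_triangle
    rw [SimpleGraph.dist_eq_one_iff_adj.2 h0.1] at this
    omega
  have h3 : ∀ v ∈ UU G r C, Join G (UU G r C) a0 v := by
    intro v hv
    by_cases h : v ∈ C
    · obtain ⟨a, b, hab, hj⟩ := h1 C v hv h
      exact (h2 a (hL a0 b0 a b h0 hab).1).trans hj.symm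
    · obtain ⟨b, a, hab, hj⟩ := h1 Cᶜ v (by rw [UU_compl]; exact hv) h
      rw [UU_compl] at hj
      rw [bd_compl] at hab
      obtain ⟨⟨a', b'⟩, hab', he⟩ := hab
      cases he
      exact (h2 _ (hL a0 b0 _ _ h0 hab').2).trans hj.symm
  intro v hv w hw
  exact (h3 v hv).symm.trans (h3 w hw)

theorem exists_dat (hc : G.Connected) (hlf : LocallyFiniteGraph G) (hA : Acts G Γ)
    (htr : ∀ u v : V, ∃ g : Γ, g • u = v) (h : CutSys G Γ 𝓔) : ∃ r, Dat G Γ 𝓔 r := by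
  obtain ⟨F, hF, hFf, hor⟩ := h.orbits hc hlf hA htr
  have hb : ∀ C, ∃ L, C ∈ 𝓔 → ∀ a b a' b', (a, b) ∈ bd G C → (a', b') ∈ bd G C →
      G.dist a a' ≤ L ∧ G.dist a b' ≤ L := by
    intro C
    by_cases hC : C ∈ 𝓔
    · have hf := ((h.fin C hC).prod (h.fin C hC)).image
        (fun q : (V × V) × (V × V) => G.dist q.1.1 q.2.1 + G.dist q.1.1 q.2.2)
      obtain ⟨L, hL⟩ := hf.bddAbove
      refine ⟨L, fun _ a b a' b' hab hab' => ?_⟩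
      have := hL ⟨((a, b), (a', b')), ⟨hab, hab'⟩, rfl⟩
      simp only at this
      omega
    · exact ⟨0, fun h => absurd h hC⟩
  choose L hL using hb
  obtain ⟨M, hM⟩ := (hFf.image L).bddAbove
  refine ⟨M + 1, hc, hlf, hA, htr, h, by omega, ?_⟩
  intro C hC
  obtain ⟨D, hD, g, rfl⟩ := hor C hC
  rw [UU_smul hc hA]
  refine Conn.smul hA g (conn_UU hc (L := M) le_rfl ?_)
  intro a b a' b' hab hab'
  have := hL D (hF hD) a b a' b' hab hab'
  have hm : L D ≤ M := hM ⟨D, hD, rfl⟩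
  omega

namespace Dat

theorem sub (h : Dat G Γ 𝓔 r) {𝓕 : Set (Set V)} (hs : 𝓕 ⊆ 𝓔) (hcl : ∀ C ∈ 𝓕, Cᶜ ∈ 𝓕)
    (hsm : ∀ (g : Γ), ∀ C ∈ 𝓕, g • C ∈ 𝓕) : Dat G Γ 𝓕 r where
  hc := h.hc
  lf := h.lf
  acts := h.acts
  tr := h.tr
  cut := ⟨hcl, hsm, fun C hC D hD => h.cut.nested C (hs hC) D (hs hD),
    fun C hC => h.cut.conn C (hs hC), fun C hC => h.cut.fin C (hs hC),
    fun C hC => h.cut.inf C (hs hC),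
    fun x y => (h.cut.edge x y).subset fun C hC => ⟨hs hC.1, hC.2⟩⟩
  hr := h.hr
  U C hC := h.U C (hs hC)

theorem nf (h : Dat G Γ 𝓔 r) : NF 𝓔 := h.cut.nf h.hc

theorem bd_sub_UU (h : Dat G Γ 𝓔 r) {C : Set V} {a b : V} (hab : (a, b) ∈ bd G C) :
    a ∈ UU G r C ∧ b ∈ UU G r C := by
  have h1 : G.dist a b = 1 := SimpleGraph.dist_eq_one_iff_adj.2 hab.1
  refine ⟨⟨subset_ball _ _ hab.2.1, b, hab.2.2, h1.le.trans h.hr⟩,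
    ⟨a, hab.2.1, ?_⟩, subset_ball _ _ hab.2.2⟩
  rw [SimpleGraph.dist_comm]; exact h1.le.trans h.hr

theorem U_ne (h : Dat G Γ 𝓔 r) {C : Set V} (hC : C ∈ 𝓔) : (UU G r C).Nonempty := by
  obtain ⟨a, b, hab⟩ := h.cut.exists_bd h.hc hC
  exact ⟨a, (h.bd_sub_UU hab).1⟩

theorem U_fin (h : Dat G Γ 𝓔 r) {C : Set V} (hC : C ∈ 𝓔) : (UU G r C).Finite := by
  have key : ∀ C ∈ 𝓔, (UU G r C ∩ C).Finite := by
    intro C hC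
    refine ((h.cut.fin C hC).biUnion fun p _ => dist_finite h.hc h.lf r p.1).subset ?_
    rintro v ⟨⟨-, c, hcC, hd⟩, hv⟩
    obtain ⟨p, hp⟩ := h.hc.exists_walk_length_eq_dist v c
    obtain ⟨a, b, hab, ⟨q, hq⟩, -⟩ := exists_exit_near p hv hcC r (hp.le.trans hd)
    simp only [Set.mem_iUnion]
    refine ⟨(a, b), hab, ?_⟩
    show G.dist a v ≤ r
    rw [SimpleGraph.dist_comm]
    exact (SimpleGraph.dist_le q).trans (hq.trans (hp.le.trans hd))
  refine ((key C hC).union (key _ (h.cut.compl C hC))).subset fun v hv => ?_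
  by_cases hvC : v ∈ C
  · exact Or.inl ⟨hv, hvC⟩
  · exact Or.inr ⟨by rw [UU_compl]; exact hv, hvC⟩

theorem mem_U_fin (h : Dat G Γ 𝓔 r) (v : V) : {C | C ∈ 𝓔 ∧ v ∈ UU G r C}.Finite := by
  refine ((dist_finite h.hc h.lf r v).biUnion fun a _ =>
    (dist_finite h.hc h.lf r v).biUnion fun b _ => h.cut.sep h.hc a b).subset ?_
  rintro C ⟨hC, ⟨a, ha, hd⟩, b, hb, hd'⟩
  simp only [Set.mem_iUnion]
  exact ⟨a, hd, b, hd', hC, ha, hb⟩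

end Dat

/-- The part of `V` at the node `t`. -/
def Pt (G : SimpleGraph V) (r : ℕ) (t : Set (Set V)) : Set V := {v | ∀ C ∈ t, v ∈ ball G r C}

variable {t t' : Set (Set V)} {C : Set V}

theorem U_sub_Pt (hN : NF 𝓔) (ht : Node 𝓔 t) (hC : MinIn t C) : UU G r C ⊆ Pt G r t := by
  intro v hv D hD
  rcases Node.min_or hN ht hC hD with h | h
  · exact ball_mono r h hv.1
  · exact ball_mono r h hv.2

theorem Pt_inter_flip (hN : NF 𝓔) (ht : Node 𝓔 t) (hC : MinIn t C) :
    Pt G r t ∩ Pt G r (flip t C) = UU G r C := by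
  refine Set.Subset.antisymm ?_ ?_
  · rintro v ⟨h1, h2⟩
    exact ⟨h1 C hC.1, h2 _ (Or.inr rfl)⟩
  · intro v hv
    refine ⟨U_sub_Pt hN ht hC hv,
      U_sub_Pt hN (Node.flip_node hN ht hC) (Node.flip_min hN ht hC) ?_⟩
    rw [UU_compl]; exact hv

theorem Pt_convex {t'' : Set (Set V)} (h : t'' ⊆ t ∪ t') : Pt G r t ∩ Pt G r t' ⊆ Pt G r t'' := by
  rintro v ⟨h1, h2⟩ C hC
  rcases h hC with h | h
  · exact h1 C h
  · exact h2 C h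

theorem mem_Pt_Ov (v : V) : v ∈ Pt G r (Ov 𝓔 v) := fun _ hC => subset_ball _ _ hC.2

theorem adj_mem_Pt_Ov (hr : 1 ≤ r) {v w : V} (h : G.Adj v w) : w ∈ Pt G r (Ov 𝓔 v) := fun C hC =>
  ⟨v, hC.2, by rw [SimpleGraph.dist_eq_one_iff_adj.2 h.symm]; exact hr⟩

theorem mem_of_mem_Pt (ht : Node 𝓔 t) {v : V} (hv : v ∈ Pt G r t) (hC : C ∈ 𝓔) (hvC : v ∈ C)
    (hU : v ∉ UU G r C) : C ∈ t := by
  rcases ht.or C hC with h | h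
  · exact h
  · exact absurd ⟨subset_ball _ _ hvC, hv _ h⟩ hU

theorem node_determined (ht : Node 𝓔 t) (v : V) :
    t = {C | C ∈ 𝓔 ∧ ((v ∉ C ∧ C ∈ {C | C ∈ t ∧ v ∉ C}) ∨ (v ∈ C ∧ Cᶜ ∉ {C | C ∈ t ∧ v ∉ C}))} := by
  ext C
  constructor
  · intro h
    refine ⟨ht.sub h, ?_⟩
    by_cases hv : v ∈ C
    · exact Or.inr ⟨hv, fun h' => ht.not C h h'.1⟩
    · exact Or.inl ⟨hv, h, hv⟩
  · rintro ⟨h, ⟨-, h1⟩ | ⟨h1, h2⟩⟩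
    · exact h1.1
    · by_contra hC
      exact h2 ⟨ht.compl_mem_of h hC, fun h => h h1⟩

theorem Dat.nodes_fin (h : Dat G Γ 𝓔 r) (v : V) : {t | Node 𝓔 t ∧ v ∈ Pt G r t}.Finite := by
  refine Set.Finite.of_finite_image (f := fun t => {C | C ∈ t ∧ v ∉ C})
    ((h.mem_U_fin v).powerset.subset ?_) ?_
  · rintro _ ⟨t, ⟨ht, hv⟩, rfl⟩ C hC
    exact ⟨ht.sub hC.1, mem_UU_of_notMem (hv C hC.1) hC.2⟩
  · intro t ht t' ht' he
    simp only at he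
    rw [node_determined ht.1 v, node_determined ht'.1 v, he]

theorem Dat.Pt_ne (h : Dat G Γ 𝓔 r) (ht : Node 𝓔 t) : (Pt G r t).Nonempty := by
  obtain rfl | ⟨C, hC⟩ := t.eq_empty_or_nonempty
  · obtain ⟨v⟩ := h.hc.nonempty
    exact ⟨v, fun C hC => absurd hC (Set.notMem_empty C)⟩
  · obtain ⟨D, hD, -⟩ := Node.exists_min h.nf ht hC
    obtain ⟨v, hv⟩ := h.U_ne (ht.sub hD.1)
    exact ⟨v, U_sub_Pt h.nf ht hD hv⟩

/-! ### Equivariance -/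

theorem Node.smul (hs : ∀ (g : Γ), ∀ C ∈ 𝓔, g • C ∈ 𝓔) (ht : Node 𝓔 t) (g : Γ) :
    Node 𝓔 (g • t) where
  sub := by
    rintro _ ⟨C, hC, rfl⟩
    exact hs g C (ht.sub hC)
  or C hC := by
    rcases ht.or _ (hs g⁻¹ C hC) with h | h
    · exact Or.inl (Set.mem_smul_set_iff_inv_smul_mem.2 h)
    · refine Or.inr (Set.mem_smul_set_iff_inv_smul_mem.2 ?_)
      rw [smul_compl']; exact h
  not := by
    rintro C hC hC'
    rw [Set.mem_smul_set_iff_inv_smul_mem] at hC hC'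
    rw [smul_compl'] at hC'
    exact ht.not _ hC hC'
  up C hC D hD hCD := by
    rw [Set.mem_smul_set_iff_inv_smul_mem] at hC ⊢
    exact ht.up _ hC _ (hs g⁻¹ D hD) (Set.smul_set_mono hCD)
  fin v := by
    refine ((ht.fin (g⁻¹ • v)).image (g • ·)).subset ?_
    rintro C ⟨hC, hv⟩
    refine ⟨g⁻¹ • C, ⟨Set.mem_smul_set_iff_inv_smul_mem.1 hC, ?_⟩, smul_inv_smul g C⟩
    rwa [Set.smul_mem_smul_set_iff]

theorem MinIn.smul (h : MinIn t C) (g : Γ) : MinIn (g • t) (g • C) := by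
  refine ⟨Set.smul_mem_smul_set h.1, ?_⟩
  rintro _ ⟨D, hD, rfl⟩ hs
  simp only at hs ⊢
  rw [h.2 D hD (Set.smul_set_subset_smul_set_iff.1 hs)]

theorem flip_smul (g : Γ) : flip (g • t) (g • C) = g • flip t C := by
  ext D
  rw [Set.mem_smul_set_iff_inv_smul_mem]
  simp only [flip, Set.mem_ofPred_eq, Set.mem_smul_set_iff_inv_smul_mem, ne_eq]
  rw [inv_smul_eq_iff, inv_smul_eq_iff, smul_compl']

theorem Pt_smul (hc : G.Connected) (hA : Acts G Γ) (g : Γ) : Pt G r (g • t) = g • Pt G r t := by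
  ext v
  rw [Set.mem_smul_set_iff_inv_smul_mem]
  constructor
  · intro h C hC
    have := h _ (Set.smul_mem_smul_set (a := g) hC)
    rwa [ball_smul hc hA, Set.mem_smul_set_iff_inv_smul_mem] at this
  · rintro h _ ⟨C, hC, rfl⟩
    simp only
    rw [ball_smul hc hA, Set.mem_smul_set_iff_inv_smul_mem]
    exact h C hC

theorem nodeOf_smul (hN : NF 𝓔) (hs : ∀ (g : Γ), ∀ C ∈ 𝓔, g • C ∈ 𝓔) (hC : C ∈ 𝓔) (g : Γ) :
    nodeOf 𝓔 (g • C) = g • nodeOf 𝓔 C :=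
  (Node.eq_nodeOf hN (Node.smul hs (nodeOf_node hN hC) g) ((nodeOf_min hN hC).smul g)
    (nodeOf_node hN (hs g C hC))).symm

/-! ### Walks inside the parts -/

theorem Dat.joinPt (h : Dat G Γ 𝓔 r) (ht : Node 𝓔 t) {S S' : Set V} (hS : S ⊆ S')
    (hU : ∀ C ∈ 𝓔, (UU G r C ∩ S).Nonempty → UU G r C ⊆ S') {v w : V} (hv : v ∈ Pt G r t)
    (hw : w ∈ Pt G r t) (hvS : v ∉ S') (hj : Join G S'ᶜ v w) : Join G (Pt G r t \ S) v w := by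
  -- from a point of `UU C` outside `S'` one reaches all of `UU C`
  have hstep : ∀ C, MinIn t C → ∀ x ∈ UU G r C, x ∉ S' → ∀ u ∈ UU G r C,
      Join G (Pt G r t \ S) x u := by
    intro C hC x hx hxS u hu
    refine (h.U C (ht.sub hC.1) x hx u hu).mono fun y hy => ⟨U_sub_Pt h.nf ht hC hy, fun hyS => ?_⟩
    exact hxS (hU C (ht.sub hC.1) ⟨y, hy, hyS⟩ hx)
  suffices H : (w ∈ Pt G r t → Join G (Pt G r t \ S) v w) ∧
      ∀ C, MinIn t C → w ∉ C → ∀ u ∈ UU G r C, Join G (Pt G r t \ S) v u from H.1 hw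
  clear hw
  induction hj with
  | refl =>
    refine ⟨fun _ => ReflTransGen.refl, fun C hC hvC => ?_⟩
    exact hstep C hC v (mem_UU_of_notMem (hv C hC.1) hvC) hvS
  | @tail x y hvx hxy ih =>
    obtain ⟨hadj, hx, hy⟩ := hxy
    refine ⟨fun hyP => ?_, fun C hC hyC u hu => ?_⟩
    · by_cases hxP : x ∈ Pt G r t
      · exact (ih.1 hxP).trans (Join.of_adj hadj ⟨hxP, fun h => hx (hS h)⟩
          ⟨hyP, fun h => hy (hS h)⟩)
      · have : ∃ C ∈ t, x ∉ ball G r C := by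
          by_contra hcon
          push Not at hcon
          exact hxP hcon
        obtain ⟨C, hC, hxC⟩ := this
        obtain ⟨D, hD, hDC⟩ := Node.exists_min h.nf ht hC
        have hxD : x ∉ ball G r D := fun h' => hxC (ball_mono r hDC h')
        have hyD : y ∉ D := notMem_of_adj h.hr hadj hxD
        exact ih.2 D hD (fun h' => hxD (subset_ball _ _ h')) y (mem_UU_of_notMem (hyP D hD.1) hyD)
    · by_cases hxC : x ∈ C
      · have hxU := (h.bd_sub_UU (show (x, y) ∈ bd G C from ⟨hadj, hxC, hyC⟩)).1
        exact (ih.1 (U_sub_Pt h.nf ht hC hxU)).trans (hstep C hC x hxU hx u hu)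
      · exact ih.2 C hC hxC u hu

theorem Dat.conn_Pt (h : Dat G Γ 𝓔 r) (ht : Node 𝓔 t) : Conn G (Pt G r t) := by
  intro v hv w hw
  have := h.joinPt ht (S := ∅) (S' := ∅) subset_rfl
    (fun C _ ⟨x, hx⟩ => absurd hx.2 (Set.notMem_empty x)) hv hw (Set.notMem_empty v)
    (by rw [Set.compl_empty]; exact join_univ_of_reachable (h.hc.preconnected v w))
  exact this.mono Set.sdiff_subset

theorem Dat.connected_Pt (h : Dat G Γ 𝓔 r) (ht : Node 𝓔 t) :
    (G.induce (Pt G r t)).Connected := by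
  have : Nonempty (Pt G r t) := (h.Pt_ne ht).to_subtype
  exact ⟨fun x y => (h.conn_Pt ht x x.2 y y.2).reachable_induce x.2 y.2⟩

/-- A far away part of `Pt t` is joined outside any finite set. -/
theorem Dat.crit_Pt (h : Dat G Γ 𝓔 r) (hfull : ∀ e e' : G.end, e ≠ e' →
    ∃ C ∈ 𝓔, LL G e C ∧ LL G e' Cᶜ) (ht : Node 𝓔 t) (S : Finset V) :
    ∃ K : Finset V, ∀ x y, x ∈ Pt G r t → y ∈ Pt G r t → x ∉ K → y ∉ K →
      Join G (Pt G r t \ ↑S) x y := by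
  classical
  have hends : ∀ e e' : G.end, (∀ K, (eset e K ∩ Pt G r t).Infinite) →
      (∀ K, (eset e' K ∩ Pt G r t).Infinite) → e = e' := by
    intro e e' he he'
    by_contra hne
    have key : ∀ C ∈ t, ∀ e : G.end, (∀ K, (eset e K ∩ Pt G r t).Infinite) → ¬ LL G e Cᶜ := by
      rintro C hC e he ⟨K, hK⟩
      refine he K ((h.U_fin (ht.sub hC)).subset ?_)
      rintro v ⟨hv, hvP⟩
      exact mem_UU_of_notMem (hvP C hC) (hK hv)
    obtain ⟨C, hC, h1, h2⟩ := hfull e e' hne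
    rcases ht.or C hC with h3 | h3
    · exact key C h3 e' he' h2
    · exact key _ h3 e he (by rw [compl_compl]; exact h1)
  set S' : Set V := ↑S ∪ ⋃ v ∈ S, ⋃ C ∈ {C | C ∈ 𝓔 ∧ v ∈ UU G r C}, UU G r C with hS'
  have hfin : S'.Finite := S.finite_toSet.union
    (S.finite_toSet.biUnion fun v _ => (h.mem_U_fin v).biUnion fun C hC => h.U_fin hC.1)
  obtain ⟨K, hK⟩ := crit_of_ends h.hc h.lf _ hends hfin.toFinset
  refine ⟨K ∪ hfin.toFinset, fun x y hx hy hxK hyK => ?_⟩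
  rw [Finset.mem_union, not_or, Set.Finite.mem_toFinset] at hxK hyK
  refine h.joinPt ht (S' := S') Set.subset_union_left ?_ hx hy hxK.2 ?_
  · rintro C hC ⟨v, hv, hvS⟩ x hx
    right
    simp only [Set.mem_iUnion]
    exact ⟨v, hvS, C, ⟨hC, hv⟩, hx⟩
  · have := hK x y hx hy hxK.1 hyK.1
    rwa [Set.Finite.coe_toFinset] at this

theorem join_induce {P S : Set V} {x y : V} (hx : x ∈ P) (hy : y ∈ P)
    (hj : Join G (P \ S) x y) : Join (G.induce P) (Subtype.val ⁻¹' S)ᶜ ⟨x, hx⟩ ⟨y, hy⟩ := by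
  induction hj with
  | refl => exact ReflTransGen.refl
  | @tail a b _ hab ih =>
    exact (ih hab.2.1.1).tail ⟨hab.1, hab.2.1.2, hab.2.2.2⟩

theorem Dat.end_Pt (h : Dat G Γ 𝓔 r) (hfull : ∀ e e' : G.end, e ≠ e' →
    ∃ C ∈ 𝓔, LL G e C ∧ LL G e' Cᶜ) (ht : Node 𝓔 t) : Subsingleton (G.induce (Pt G r t)).end := by
  classical
  refine Crit.subsingleton fun S => ?_
  obtain ⟨K, hK⟩ := h.crit_Pt hfull ht (S.image Subtype.val)
  refine ⟨K.preimage Subtype.val Subtype.val_injective.injOn, fun x y hx hy => ?_⟩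
  rw [Finset.mem_preimage] at hx hy
  have := join_induce x.2 y.2 (hK x y x.2 y.2 hx hy)
  refine this.mono fun z hz hzS => hz ?_
  exact Finset.mem_coe.2 (Finset.mem_image_of_mem _ hzS)

theorem lf_induce (hlf : LocallyFiniteGraph G) (P : Set V) : LocallyFiniteGraph (G.induce P) := by
  intro v
  refine Set.Finite.of_finite_image (f := Subtype.val) ((hlf v).subset ?_)
    Subtype.val_injective.injOn
  rintro _ ⟨w, hw, rfl⟩
  exact hw

/-- An element of the group preserving a set induces an automorphism. -/
noncomputable def autOf (hA : Acts G Γ) (g : Γ) {P Q : Set V} (h : g • P = Q) :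
    G.induce P ≃g G.induce Q where
  toFun x := ⟨g • x.1, h ▸ Set.smul_mem_smul_set x.2⟩
  invFun x := ⟨g⁻¹ • x.1, Set.mem_smul_set_iff_inv_smul_mem.1 (by rw [h]; exact x.2)⟩
  left_inv x := Subtype.ext (inv_smul_smul g x.1)
  right_inv x := Subtype.ext (smul_inv_smul g x.1)
  map_rel_iff' := by
    intro a b
    exact hA g a b

end

end TA
end

section
open scoped Pointwise
open Relation SimpleGraph

namespace TA

variable {V : Type u} {G : SimpleGraph V}

/-! ### Recognising tree amalgamations -/

/-- The hypotheses for recognising a tree amalgamation inside `G`. -/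
structure AmH (G : SimpleGraph V) (Γ : Type*) [Group Γ] [MulAction Γ V] {X : Type u}
    [MulAction Γ X] (P : X → Set V) (Q : Subgroup Γ) (A B : Set X) (a0 b0 : X)
    (E : X → X → Prop) (r : X) (par : X → X) (dp : X → ℕ) (W : Set V) (n : ℕ) : Prop where
  acts : Acts G Γ
  hP : ∀ (g : Γ) x, P (g • x) = g • P x
  QA : ∀ g ∈ Q, ∀ x ∈ A, g • x ∈ A
  QB : ∀ g ∈ Q, ∀ x ∈ B, g • x ∈ B
  disj : ∀ x ∈ A, x ∉ B
  a0m : a0 ∈ A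
  b0m : b0 ∈ B
  trA : ∀ a ∈ A, ∃ g ∈ Q, g • a0 = a
  trB : ∀ b ∈ B, ∃ g ∈ Q, g • b0 = b
  Einv : ∀ g ∈ Q, ∀ a b, E a b → E (g • a) (g • b)
  rm : r ∈ A ∪ B
  par_mem : ∀ x ∈ A ∪ B, x ≠ r → par x ∈ A ∪ B
  par_side : ∀ x ∈ A ∪ B, x ≠ r → (x ∈ A ↔ par x ∈ B)
  dp_par : ∀ x ∈ A ∪ B, x ≠ r → dp x = dp (par x) + 1
  dp_root : dp r = 0
  E_iff : ∀ a ∈ A, ∀ b ∈ B, E a b ↔ (a ≠ r ∧ par a = b) ∨ (b ≠ r ∧ par b = a)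
  cover : ∀ v, v ∈ W ↔ ∃ x ∈ A ∪ B, v ∈ P x
  edge : ∀ v w, v ∈ W → w ∈ W → G.Adj v w → ∃ x ∈ A ∪ B, v ∈ P x ∧ w ∈ P x
  conn : ∀ v, ∀ x ∈ A ∪ B, ∀ y ∈ A ∪ B, v ∈ P x → v ∈ P y →
    ReflTransGen (fun x y => v ∈ P y ∧ y ∈ A ∪ B ∧
      ((x ∈ A ∧ y ∈ B ∧ E x y) ∨ (y ∈ A ∧ x ∈ B ∧ E y x))) x y
  finS : ∀ v, {x | x ∈ A ∪ B ∧ v ∈ P x}.Finite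
  adh : ∀ a ∈ A, ∀ b ∈ B, E a b →
    (P a ∩ P b).Finite ∧ (P a ∩ P b).Nonempty ∧ (P a ∩ P b).ncard = n
  orbA : ∃ s : Set V, s.Finite ∧ ∀ v ∈ P a0, ∃ u ∈ s, u ∈ P a0 ∧ ∃ g ∈ Q, g • a0 = a0 ∧ g • u = v
  orbB : ∃ s : Set V, s.Finite ∧ ∀ v ∈ P b0, ∃ u ∈ s, u ∈ P b0 ∧ ∃ g ∈ Q, g • b0 = b0 ∧ g • u = v

/-- The orbit condition gives a good action. -/
theorem goodAction_of {Γ : Type*} [Group Γ] [MulAction Γ V] {X : Type u} [MulAction Γ X]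
    {P : X → Set V} (hA : Acts G Γ) (hP : ∀ (g : Γ) x, P (g • x) = g • P x) (Q : Subgroup Γ)
    (B : Set X) (hQB : ∀ g ∈ Q, ∀ x ∈ B, g • x ∈ B) (a0 : X)
    (E : X → Prop) (hE : ∀ g ∈ Q, g • a0 = a0 → ∀ b, E b → E (g • b))
    (hfin : ∀ v, {x | x ∈ B ∧ v ∈ P x}.Finite)
    (hne : ∀ b ∈ B, E b → (P a0 ∩ P b).Nonempty)
    (horb : ∃ s : Set V, s.Finite ∧ ∀ v ∈ P a0, ∃ u ∈ s, u ∈ P a0 ∧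
      ∃ g ∈ Q, g • a0 = a0 ∧ g • u = v) :
    GoodAction (G.induce (P a0)) (fun k : {b // b ∈ B ∧ E b} => {x : P a0 | x.1 ∈ P k.1}) := by
  obtain ⟨s, hs, horb⟩ := horb
  refine ⟨⊤, ⟨Subtype.val ⁻¹' s, hs.preimage Subtype.val_injective.injOn, ?_⟩,
    {k | ∃ v ∈ s, v ∈ P k.1}, ?_, ?_⟩
  · intro v
    obtain ⟨u, hu, hu', g, hg, hga, hgu⟩ := horb v.1 v.2
    exact ⟨⟨u, hu'⟩, hu, autOf hA g (by rw [← hP, hga]), trivial, Subtype.ext hgu⟩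
  · have hf : (⋃ v ∈ s, {x | x ∈ B ∧ v ∈ P x}).Finite := hs.biUnion fun v _ => hfin v
    refine Set.Finite.of_finite_image (f := Subtype.val) (hf.subset ?_)
      Subtype.val_injective.injOn
    rintro _ ⟨k, ⟨v, hv, hvk⟩, rfl⟩
    simp only [Set.mem_iUnion]
    exact ⟨v, hv, k.2.1, hvk⟩
  · rintro ⟨b, hb, hEb⟩
    obtain ⟨x, hx, hxb⟩ := hne b hb hEb
    obtain ⟨u, hu, hu', g, hg, hga, hgu⟩ := horb x hx
    have hga' : g⁻¹ • a0 = a0 := by rw [inv_smul_eq_iff, hga]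
    refine ⟨⟨g⁻¹ • b, hQB _ (Q.inv_mem hg) b hb, hE _ (Q.inv_mem hg) hga' b hEb⟩,
      ⟨u, hu, ?_⟩, autOf hA g (by rw [← hP, hga]), trivial, ?_⟩
    · show u ∈ P (g⁻¹ • b)
      rw [hP, Set.mem_smul_set_iff_inv_smul_mem, inv_inv, hgu]; exact hxb
    · ext y
      constructor
      · rintro ⟨z, hz, rfl⟩
        have hz : z.1 ∈ P (g⁻¹ • b) := hz
        rw [hP, Set.mem_smul_set_iff_inv_smul_mem, inv_inv] at hz
        exact hz
      · intro hy
        have hy : y.1 ∈ P b := hy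
        refine ⟨⟨g⁻¹ • y.1, ?_⟩, ?_, Subtype.ext (smul_inv_smul g y.1)⟩
        · have := Set.smul_mem_smul_set (a := g⁻¹) y.2
          rwa [← hP, hga'] at this
        · show g⁻¹ • y.1 ∈ P (g⁻¹ • b)
          rw [hP]; exact Set.smul_mem_smul_set hy

theorem AmH.exists_g {Γ : Type*} [Group Γ] [MulAction Γ V] {X : Type u}
    [MulAction Γ X] {P : X → Set V} {Q : Subgroup Γ} {A B : Set X} {a0 b0 : X}
    {E : X → X → Prop} {r : X} {par : X → X} {dp : X → ℕ} {W : Set V} {n : ℕ}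
    (h : AmH G Γ P Q A B a0 b0 E r par dp W n) :
    (bipGraph fun (a : A) (b : B) => E a b).IsTree ∧
    ∃ (g : X → Γ) (γ : X → X → Γ), (∀ x ∈ A ∪ B, g x ∈ Q) ∧ (∀ a ∈ A, g a • a0 = a) ∧
      (∀ b ∈ B, g b • b0 = b) ∧
      ∀ a ∈ A, ∀ b ∈ B, E a b → γ ((g a)⁻¹ • b) ((g b)⁻¹ • a) = (g b)⁻¹ * g a := by
  classical
  let N := A ⊕ B
  let val : N → X := Sum.elim Subtype.val Subtype.val
  have hvm : ∀ x : N, val x ∈ A ∪ B := by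
    rintro (x | x)
    · exact Or.inl x.2
    · exact Or.inr x.2
  have hinj : Function.Injective val := by
    rintro (x | x) (y | y) hxy
    · exact congrArg _ (Subtype.ext hxy)
    · have hxy : x.1 = y.1 := hxy
      exact absurd (hxy ▸ y.2) (h.disj x.1 x.2)
    · have hxy : x.1 = y.1 := hxy
      exact absurd (hxy ▸ x.2) (h.disj y.1 y.2)
    · exact congrArg _ (Subtype.ext hxy)
  have hsur : ∀ x ∈ A ∪ B, ∃ y : N, val y = x := by
    rintro x (hx | hx)
    · exact ⟨Sum.inl ⟨x, hx⟩, rfl⟩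
    · exact ⟨Sum.inr ⟨x, hx⟩, rfl⟩
  have hpar : ∀ x : N, ∃ y : N, val x ≠ r → val y = par (val x) := by
    intro x
    by_cases hx : val x = r
    · exact ⟨x, fun h => absurd hx h⟩
    · obtain ⟨y, hy⟩ := hsur _ (h.par_mem _ (hvm x) hx)
      exact ⟨y, fun _ => hy⟩
  choose parN hparN using hpar
  obtain ⟨r', hr'⟩ := hsur r h.rm
  have hne : ∀ {x : N}, x ≠ r' ↔ val x ≠ r := by
    intro x; rw [← hr', ne_eq, ne_eq, hinj.eq_iff]
  have hR : Rooted r' parN (fun x => dp (val x)) := by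
    refine ⟨fun x => ?_, fun x hx => ?_⟩
    · constructor
      · intro h0
        by_contra hx
        have := h.dp_par _ (hvm x) (hne.1 hx)
        omega
      · rintro rfl
        rw [hr']; exact h.dp_root
    · rw [hparN x (hne.1 hx)]
      exact h.dp_par _ (hvm x) (hne.1 hx)
  have hpeq : ∀ x y : N, x ≠ r' → (parN x = y ↔ par (val x) = val y) := by
    intro x y hx
    rw [← hparN x (hne.1 hx), hinj.eq_iff]
  refine ⟨hR.isTree _ ?_, ?_⟩
  · have hside := fun x : N => fun hx : x ≠ r' => h.par_side _ (hvm x) (hne.1 hx)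
    have hside' : ∀ x : N, x ≠ r' → (val x ∈ A ↔ val (parN x) ∈ B) := by
      intro x hx
      rw [hparN x (hne.1 hx)]; exact hside x hx
    rintro (a | a) (b | b)
    · simp only [bipGraph, fromRel_adj]
      constructor
      · rintro ⟨-, hf | hf⟩ <;> exact hf.elim
      · rintro (⟨h1, h2⟩ | ⟨h1, h2⟩)
        · have := (hside' _ h1).1 a.2
          rw [h2] at this
          exact absurd this (h.disj _ b.2)
        · have := (hside' _ h1).1 b.2
          rw [h2] at this
          exact absurd this (h.disj _ a.2)
    · simp only [bipGraph, fromRel_adj]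
      constructor
      · rintro ⟨-, hf | hf⟩
        · rcases (h.E_iff a a.2 b b.2).1 hf with ⟨h1, h2⟩ | ⟨h1, h2⟩
          · have h3 : (Sum.inl a : N) ≠ r' := hne.2 h1
            exact Or.inl ⟨h3, (hpeq _ _ h3).2 h2⟩
          · have h3 : (Sum.inr b : N) ≠ r' := hne.2 h1
            exact Or.inr ⟨h3, (hpeq _ _ h3).2 h2⟩
        · exact hf.elim
      · intro hh
        refine ⟨by simp, Or.inl ((h.E_iff a a.2 b b.2).2 ?_)⟩
        rcases hh with ⟨h1, h2⟩ | ⟨h1, h2⟩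
        · exact Or.inl ⟨hne.1 h1, (hpeq _ _ h1).1 h2⟩
        · exact Or.inr ⟨hne.1 h1, (hpeq _ _ h1).1 h2⟩
    · simp only [bipGraph, fromRel_adj]
      constructor
      · rintro ⟨-, hf | hf⟩
        · exact hf.elim
        · rcases (h.E_iff b b.2 a a.2).1 hf with ⟨h1, h2⟩ | ⟨h1, h2⟩
          · have h3 : (Sum.inl b : N) ≠ r' := hne.2 h1
            exact Or.inr ⟨h3, (hpeq _ _ h3).2 h2⟩
          · have h3 : (Sum.inr a : N) ≠ r' := hne.2 h1
            exact Or.inl ⟨h3, (hpeq _ _ h3).2 h2⟩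
      · intro hh
        refine ⟨by simp, Or.inr ((h.E_iff b b.2 a a.2).2 ?_)⟩
        rcases hh with ⟨h1, h2⟩ | ⟨h1, h2⟩
        · exact Or.inr ⟨hne.1 h1, (hpeq _ _ h1).1 h2⟩
        · exact Or.inl ⟨hne.1 h1, (hpeq _ _ h1).1 h2⟩
    · simp only [bipGraph, fromRel_adj]
      constructor
      · rintro ⟨-, hf | hf⟩ <;> exact hf.elim
      · rintro (⟨h1, h2⟩ | ⟨h1, h2⟩)
        · have hb : val (parN (Sum.inr a)) ∈ B := by rw [h2]; exact b.2
          exact absurd a.2 (h.disj _ ((hside' _ h1).2 hb))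
        · have hb : val (parN (Sum.inr b)) ∈ B := by rw [h2]; exact a.2
          exact absurd b.2 (h.disj _ ((hside' _ h1).2 hb))
  · -- the gluing elements
    have hγ : ∀ k l : X, ∃ γ : Γ, (∃ γ ∈ Q, γ • a0 = l ∧ γ • k = b0) →
        γ ∈ Q ∧ γ • a0 = l ∧ γ • k = b0 := by
      intro k l
      by_cases hkl : ∃ γ ∈ Q, γ • a0 = l ∧ γ • k = b0
      · obtain ⟨γ, hγ⟩ := hkl
        exact ⟨γ, fun _ => hγ⟩
      · exact ⟨1, fun h => absurd h hkl⟩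
    choose γ hγ using hγ
    have hkex : ∀ k ∈ B, ∃ l, ∃ γ ∈ Q, γ • a0 = l ∧ γ • k = b0 := by
      intro k hk
      obtain ⟨g, hg, hgk⟩ := h.trB k hk
      exact ⟨g⁻¹ • a0, g⁻¹, Q.inv_mem hg, rfl, by rw [inv_smul_eq_iff, hgk]⟩
    have hlex : ∀ l ∈ A, ∃ k, ∃ γ ∈ Q, γ • a0 = l ∧ γ • k = b0 := by
      intro l hl
      obtain ⟨g, hg, hgl⟩ := h.trA l hl
      exact ⟨g⁻¹ • b0, g, hg, hgl, by rw [smul_inv_smul]⟩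
    let bs : N → X := Sum.elim (fun _ => a0) (fun _ => b0)
    let F : N → Type _ := fun x => {g : Γ // g ∈ Q ∧ g • bs x = val x}
    have hstart : Nonempty (F r') := by
      obtain a | b := r'
      · obtain ⟨g, hg, hga⟩ := h.trA a.1 a.2
        exact ⟨⟨g, hg, hga⟩⟩
      · obtain ⟨g, hg, hga⟩ := h.trB b.1 b.2
        exact ⟨⟨g, hg, hga⟩⟩
    obtain ⟨s0⟩ := hstart
    -- the relation between a site and its parent
    let rel : N → Γ → N → Γ → Prop := fun x g p gp =>
      (∀ a b, x = Sum.inl a → p = Sum.inr b → γ (g⁻¹ • b.1) (gp⁻¹ • a.1) = gp⁻¹ * g) ∧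
      (∀ a b, x = Sum.inr b → p = Sum.inl a → γ (gp⁻¹ • b.1) (g⁻¹ • a.1) = g⁻¹ * gp)
    have hstep : ∀ x : N, x ≠ r' → ∀ gp : F (parN x), ∃ g : F x, rel x g.1 (parN x) gp.1 := by
      intro x hx gp
      obtain ⟨gp, hgpQ, hgp⟩ := gp
      have hside := h.par_side _ (hvm x) (hne.1 hx)
      rw [← hparN x (hne.1 hx)] at hside
      simp only
      generalize parN x = p at *
      rcases x with a | b
      · rcases p with a' | b
        · exact absurd (hside.1 a.2) (h.disj _ a'.2)
        · have hgp : gp • b0 = b.1 := hgp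
          obtain ⟨k, hk⟩ := hlex (gp⁻¹ • a.1) (h.QA _ (Q.inv_mem hgpQ) _ a.2)
          obtain ⟨h1, h2, h3⟩ := hγ k _ hk
          refine ⟨⟨gp * γ k (gp⁻¹ • a.1), Q.mul_mem hgpQ h1, ?_⟩, ?_, ?_⟩
          · show (gp * γ k (gp⁻¹ • a.1)) • a0 = a.1
            rw [mul_smul, h2, smul_inv_smul]
          · rintro a' b' ha hb
            cases ha; cases hb
            have : (gp * γ k (gp⁻¹ • a.1))⁻¹ • b.1 = k := by
              rw [inv_smul_eq_iff, mul_smul, h3, hgp]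
            simp only [this, inv_mul_cancel_left]
          · rintro a' b' ha
            cases ha
      · rcases p with a | b'
        · have hgp : gp • a0 = a.1 := hgp
          obtain ⟨l, hl⟩ := hkex (gp⁻¹ • b.1) (h.QB _ (Q.inv_mem hgpQ) _ b.2)
          obtain ⟨h1, h2, h3⟩ := hγ _ l hl
          refine ⟨⟨gp * (γ (gp⁻¹ • b.1) l)⁻¹, Q.mul_mem hgpQ (Q.inv_mem h1), ?_⟩, ?_, ?_⟩
          · show (gp * (γ (gp⁻¹ • b.1) l)⁻¹) • b0 = b.1
            rw [mul_smul, ← h3, inv_smul_smul, smul_inv_smul]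
          · rintro a' b' ha
            cases ha
          · rintro a' b' ha hb
            cases ha; cases hb
            have : (gp * (γ (gp⁻¹ • b.1) l)⁻¹)⁻¹ • a.1 = l := by
              rw [inv_smul_eq_iff, mul_smul, ← hgp, smul_left_cancel_iff, eq_inv_smul_iff, h2]
            simp only [this]
            group
        · exact absurd b.2 (h.disj _ (hside.2 b'.2))
    choose stp hstp using hstep
    obtain ⟨g, -, hg⟩ := hR.recursion (A := F) s0 stp
    have hinv : ∀ x : X, ∃ y : N, x ∈ A ∪ B → val y = x := by
      intro x
      by_cases hx : x ∈ A ∪ B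
      · obtain ⟨y, hy⟩ := hsur x hx
        exact ⟨y, fun _ => hy⟩
      · exact ⟨r', fun h => absurd h hx⟩
    choose inv hinv using hinv
    have hinvA : ∀ a (ha : a ∈ A), inv a = Sum.inl ⟨a, ha⟩ := fun a ha =>
      hinj (hinv a (Or.inl ha))
    have hinvB : ∀ a (ha : a ∈ B), inv a = Sum.inr ⟨a, ha⟩ := fun a ha =>
      hinj (hinv a (Or.inr ha))
    refine ⟨fun x => (g (inv x)).1, γ, fun x hx => (g (inv x)).2.1, fun a ha => ?_,
      fun b hb => ?_, fun a ha b hb hE => ?_⟩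
    · have := (g (inv a)).2.2
      simp only
      rw [hinvA a ha] at this ⊢
      exact this
    · have := (g (inv b)).2.2
      simp only
      rw [hinvB b hb] at this ⊢
      exact this
    · simp only
      rw [hinvA a ha, hinvB b hb]
      rcases (h.E_iff a ha b hb).1 hE with ⟨h1, h2⟩ | ⟨h1, h2⟩
      · have hx : (Sum.inl ⟨a, ha⟩ : N) ≠ r' := hne.2 h1
        have hp : parN (Sum.inl ⟨a, ha⟩) = Sum.inr ⟨b, hb⟩ := (hpeq _ _ hx).2 h2
        have h3 := hstp _ hx (g (parN (Sum.inl ⟨a, ha⟩)))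
        rw [← hg _ hx] at h3
        have h4 := h3.1 ⟨a, ha⟩ ⟨b, hb⟩ rfl hp
        rw [hp] at h4
        exact h4
      · have hx : (Sum.inr ⟨b, hb⟩ : N) ≠ r' := hne.2 h1
        have hp : parN (Sum.inr ⟨b, hb⟩) = Sum.inl ⟨a, ha⟩ := (hpeq _ _ hx).2 h2
        have h3 := hstp _ hx (g (parN (Sum.inr ⟨b, hb⟩)))
        rw [← hg _ hx] at h3
        have h4 := h3.2 ⟨a, ha⟩ ⟨b, hb⟩ rfl hp
        rw [hp] at h4
        exact h4

end TA
end

section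
open scoped Pointwise
open Relation SimpleGraph

namespace TA

variable {V : Type u} {G : SimpleGraph V}

theorem val_preimage_bijOn {α β : Type*} [Nonempty β] {s : Set α} {t : Set β} (hs : s.Finite)
    (ht : t.Finite) (h : s.ncard = t.ncard) : ∃ f : α → β, Set.BijOn f s t := by
  refine hs.exists_bijOn_of_encard_eq ?_
  rw [← hs.cast_ncard_eq, ← ht.cast_ncard_eq, h]

theorem AmH.exists_glue {Γ : Type*} [Group Γ] [MulAction Γ V] {X : Type u}
    [MulAction Γ X] {P : X → Set V} {Q : Subgroup Γ} {A B : Set X} {a0 b0 : X}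
    {E : X → X → Prop} {r : X} {par : X → X} {dp : X → ℕ} {W : Set V} {n : ℕ}
    (h : AmH G Γ P Q A B a0 b0 E r par dp W n) (γ : X → X → Γ) (k l : X)
    (hk : k ∈ B ∧ E a0 k) (hl : l ∈ A ∧ E l b0) :
    ∃ f : P a0 → P b0, Set.BijOn f {x | x.1 ∈ P k} {y | y.1 ∈ P l} ∧
      (γ k l • a0 = l → γ k l • k = b0 → ∀ x : P a0, x.1 ∈ P k → (f x).1 = γ k l • x.1) := by
  classical
  obtain ⟨hf1, hn1, hc1⟩ := h.adh a0 h.a0m k hk.1 hk.2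
  obtain ⟨hf2, ⟨y0, hy0⟩, hc2⟩ := h.adh l hl.1 b0 h.b0m hl.2
  have hne : Nonempty (P b0) := ⟨⟨y0, hy0.2⟩⟩
  have e1 : Subtype.val '' {x : P a0 | x.1 ∈ P k} = P a0 ∩ P k := by
    ext x; constructor
    · rintro ⟨y, hy, rfl⟩; exact ⟨y.2, hy⟩
    · rintro ⟨h1, h2⟩; exact ⟨⟨x, h1⟩, h2, rfl⟩
  have e2 : Subtype.val '' {x : P b0 | x.1 ∈ P l} = P l ∩ P b0 := by
    ext x; constructor
    · rintro ⟨y, hy, rfl⟩; exact ⟨hy, y.2⟩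
    · rintro ⟨h1, h2⟩; exact ⟨⟨x, h2⟩, h1, rfl⟩
  by_cases hc : γ k l • a0 = l ∧ γ k l • k = b0
  · obtain ⟨h1, h2⟩ := hc
    have hm : ∀ x : P a0, x.1 ∈ P k → γ k l • x.1 ∈ P b0 := by
      intro x hx
      rw [← h2, h.hP]; exact Set.smul_mem_smul_set hx
    refine ⟨fun x => if hx : x.1 ∈ P k then ⟨γ k l • x.1, hm x hx⟩ else ⟨y0, hy0.2⟩,
      ⟨?_, ?_, ?_⟩, ?_⟩
    · intro x hx
      have hx : x.1 ∈ P k := hx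
      simp only [hx, dite_true, Set.mem_ofPred_eq]
      have := Set.smul_mem_smul_set (a := γ k l) x.2
      rwa [← h.hP, h1] at this
    · intro x hx y hy hxy
      have hx : x.1 ∈ P k := hx
      have hy : y.1 ∈ P k := hy
      simp only [hx, hy, dite_true, Subtype.mk.injEq, smul_left_cancel_iff] at hxy
      exact Subtype.ext hxy
    · intro y hy
      have hy : y.1 ∈ P l := hy
      have hyb : y.1 ∈ P b0 := y.2
      have hxk : (γ k l)⁻¹ • y.1 ∈ P k := by
        have := Set.smul_mem_smul_set (a := (γ k l)⁻¹) y.2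
        rwa [← h.hP, inv_smul_eq_iff.2 h2.symm] at this
      have hxa : (γ k l)⁻¹ • y.1 ∈ P a0 := by
        have := Set.smul_mem_smul_set (a := (γ k l)⁻¹) hy
        rwa [← h.hP, inv_smul_eq_iff.2 h1.symm] at this
      refine ⟨⟨(γ k l)⁻¹ • y.1, hxa⟩, hxk, ?_⟩
      simp [hxk]
    · intro _ _ x hx
      simp [hx]
  · obtain ⟨f, hf⟩ := val_preimage_bijOn (s := {x : P a0 | x.1 ∈ P k})
      (t := {x : P b0 | x.1 ∈ P l})
      (Set.Finite.of_finite_image (f := Subtype.val) (e1 ▸ hf1) Subtype.val_injective.injOn)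
      (Set.Finite.of_finite_image (f := Subtype.val) (e2 ▸ hf2) Subtype.val_injective.injOn)
      (by
        rw [← Set.ncard_image_of_injective _ Subtype.val_injective, e1, hc1,
          ← Set.ncard_image_of_injective _ Subtype.val_injective, e2, hc2])
    exact ⟨f, hf, fun h1 h2 => absurd ⟨h1, h2⟩ hc⟩

theorem AmH.step {Γ : Type*} [Group Γ] [MulAction Γ V] {X : Type u}
    [MulAction Γ X] {P : X → Set V} {Q : Subgroup Γ} {A B : Set X} {a0 b0 : X}
    {E : X → X → Prop} {r : X} {par : X → X} {dp : X → ℕ} {W : Set V} {n : ℕ}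
    (h : AmH G Γ P Q A B a0 b0 E r par dp W n) :
    GoodAmalgStep ⟨P a0, G.induce (P a0)⟩ ⟨P b0, G.induce (P b0)⟩ ⟨W, G.induce W⟩ := by
  classical
  obtain ⟨htree, g, γ, gQ, gA, gB, hγ⟩ := h.exists_g
  have hglue := fun (k : {b // b ∈ B ∧ E a0 b}) (l : {a // a ∈ A ∧ E a b0}) =>
    h.exists_glue γ k.1 l.1 k.2 l.2
  choose glue hglue1 hglue2 using hglue
  have gA' : ∀ a ∈ A, (g a)⁻¹ • a = a0 := fun a ha => by rw [inv_smul_eq_iff, gA a ha]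
  have gB' : ∀ a ∈ B, (g a)⁻¹ • a = b0 := fun a ha => by rw [inv_smul_eq_iff, gB a ha]
  have gi : ∀ x ∈ A ∪ B, (g x)⁻¹ ∈ Q := fun x hx => Q.inv_mem (gQ x hx)
  have m1 : ∀ (a : A) (b : B), E a b → (g a)⁻¹ • b.1 ∈ B ∧ E a0 ((g a)⁻¹ • b.1) := by
    intro a b hE
    refine ⟨h.QB _ (gi _ (Or.inl a.2)) _ b.2, ?_⟩
    have := h.Einv _ (gi _ (Or.inl a.2)) _ _ hE
    rwa [gA' _ a.2] at this
  have m2 : ∀ (a : A) (b : B), E a b → (g b)⁻¹ • a.1 ∈ A ∧ E ((g b)⁻¹ • a.1) b0 := by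
    intro a b hE
    refine ⟨h.QA _ (gi _ (Or.inr b.2)) _ a.2, ?_⟩
    have := h.Einv _ (gi _ (Or.inr b.2)) _ _ hE
    rwa [gB' _ b.2] at this
  let D : TreeAmalgData (G.induce (P a0)) (G.induce (P b0)) :=
    { VT1 := A, VT2 := B, K1 := {b // b ∈ B ∧ E a0 b}, K2 := {a // a ∈ A ∧ E a b0}
      Tadj := fun a b => E a.1 b.1
      isTree := htree
      lab1 := fun a b hE => ⟨_, m1 a b hE⟩
      lab2 := fun a b hE => ⟨_, m2 a b hE⟩
      lab1_bij := by
        intro a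
        constructor
        · rintro ⟨b, hb⟩ ⟨b', hb'⟩ hbb
          have := congrArg Subtype.val hbb
          simp only [smul_left_cancel_iff] at this
          exact Subtype.ext (Subtype.ext this)
        · rintro ⟨b, hb, hE⟩
          refine ⟨⟨⟨g a • b, h.QB _ (gQ _ (Or.inl a.2)) _ hb⟩, ?_⟩, Subtype.ext (inv_smul_smul _ _)⟩
          have := h.Einv _ (gQ _ (Or.inl a.2)) _ _ hE
          rwa [gA _ a.2] at this
      lab2_bij := by
        intro b
        constructor
        · rintro ⟨a, ha⟩ ⟨a', ha'⟩ hbb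
          have := congrArg Subtype.val hbb
          simp only [smul_left_cancel_iff] at this
          exact Subtype.ext (Subtype.ext this)
        · rintro ⟨a, ha, hE⟩
          refine ⟨⟨⟨g b • a, h.QA _ (gQ _ (Or.inr b.2)) _ ha⟩, ?_⟩, Subtype.ext (inv_smul_smul _ _)⟩
          have := h.Einv _ (gQ _ (Or.inr b.2)) _ _ hE
          rwa [gB _ b.2] at this
      S1 := fun k => {x | x.1 ∈ P k.1}
      S2 := fun l => {x | x.1 ∈ P l.1}
      S1_nonempty := by
        rintro ⟨b, hb, hE⟩
        obtain ⟨x, hx⟩ := (h.adh a0 h.a0m b hb hE).2.1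
        exact ⟨⟨x, hx.1⟩, hx.2⟩
      glue := glue
      glue_bij := hglue1 }
  -- the projection to `V`
  let pr : D.PlusV → V := fun p => match p with
    | Sum.inl p => g p.1.1 • p.2.1
    | Sum.inr p => g p.1.1 • p.2.1
  let sx : D.PlusV → X := fun p => match p with
    | Sum.inl p => p.1.1
    | Sum.inr p => p.1.1
  have hsx : ∀ p, sx p ∈ A ∪ B := by
    rintro (p | p)
    · exact Or.inl p.1.2
    · exact Or.inr p.1.2
  have hpr : ∀ p, pr p ∈ P (sx p) := by
    rintro (⟨a, x⟩ | ⟨a, x⟩)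
    · have := Set.smul_mem_smul_set (a := g a.1) x.2
      rwa [← h.hP, gA _ a.2] at this
    · have := Set.smul_mem_smul_set (a := g a.1) x.2
      rwa [← h.hP, gB _ a.2] at this
  have hex : ∀ x ∈ A ∪ B, ∀ v ∈ P x, ∃ p, sx p = x ∧ pr p = v := by
    rintro x (hx | hx) v hv
    · refine ⟨Sum.inl (⟨x, hx⟩, ⟨(g x)⁻¹ • v, ?_⟩), rfl, smul_inv_smul _ _⟩
      have := Set.smul_mem_smul_set (a := (g x)⁻¹) hv
      rwa [← h.hP, gA' _ hx] at this
    · refine ⟨Sum.inr (⟨x, hx⟩, ⟨(g x)⁻¹ • v, ?_⟩), rfl, smul_inv_smul _ _⟩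
      have := Set.smul_mem_smul_set (a := (g x)⁻¹) hv
      rwa [← h.hP, gB' _ hx] at this
  have huniq : ∀ p q, sx p = sx q → pr p = pr q → p = q := by
    rintro (⟨a, x⟩ | ⟨a, x⟩) (⟨b, y⟩ | ⟨b, y⟩) h1 h2
    · obtain rfl : a = b := Subtype.ext h1
      have h2 : g a.1 • x.1 = g a.1 • y.1 := h2
      rw [smul_left_cancel_iff] at h2
      rw [Subtype.ext h2]
    · have h1 : a.1 = b.1 := h1
      exact absurd (h1 ▸ b.2) (h.disj _ a.2)
    · have h1 : a.1 = b.1 := h1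
      exact absurd (h1 ▸ a.2) (h.disj _ b.2)
    · obtain rfl : a = b := Subtype.ext h1
      have h2 : g a.1 • x.1 = g a.1 • y.1 := h2
      rw [smul_left_cancel_iff] at h2
      rw [Subtype.ext h2]
  -- the crossing relation
  have hgl : ∀ (a : A) (b : B) (hE : E a b) (x : P a0), x.1 ∈ P ((g a)⁻¹ • b.1) →
      g b • (glue ⟨_, m1 a b hE⟩ ⟨_, m2 a b hE⟩ x).1 = g a • x.1 := by
    intro a b hE x hx
    have hg := hγ a.1 a.2 b.1 b.2 hE
    rw [hglue2 ⟨_, m1 a b hE⟩ ⟨_, m2 a b hE⟩ ?_ ?_ x hx]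
    · simp only [hg]
      rw [mul_smul, smul_inv_smul]
    · simp only [hg]
      rw [mul_smul, gA _ a.2]
    · simp only [hg]
      rw [mul_smul, smul_inv_smul, gB' _ b.2]
  have hcross : ∀ p q, D.cross p q → pr (Sum.inl p) = pr (Sum.inr q) := by
    rintro ⟨a, x⟩ ⟨b, y⟩ ⟨hE, hx, hy⟩
    have hy : y = glue ⟨_, m1 a b hE⟩ ⟨_, m2 a b hE⟩ x := hy
    show g a.1 • x.1 = g b.1 • y.1
    rw [hy]
    exact (hgl a b hE x hx).symm
  have hcross' : ∀ p q, E p.1.1 q.1.1 → pr (Sum.inl p) = pr (Sum.inr q) → D.cross p q := by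
    rintro ⟨a, x⟩ ⟨b, y⟩ hE hpq
    have hpq : g a.1 • x.1 = g b.1 • y.1 := hpq
    have hx : x.1 ∈ P ((g a)⁻¹ • b.1) := by
      rw [h.hP, Set.mem_smul_set_iff_inv_smul_mem, inv_inv, hpq]
      have := Set.smul_mem_smul_set (a := g b.1) y.2
      rwa [← h.hP, gB _ b.2] at this
    refine ⟨hE, hx, Subtype.ext ?_⟩
    have := hgl a b hE x hx
    rw [hpq, smul_left_cancel_iff] at this
    exact this.symm
  have hinj : ∀ p q, pr p = pr q → D.toAmalg p = D.toAmalg q := by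
    intro p q hpq
    have hc := h.conn (pr p) (sx p) (hsx p) (sx q) (hsx q) (hpr p) (hpq ▸ hpr q)
    suffices H : ∀ y, ReflTransGen (fun x y => pr p ∈ P y ∧ y ∈ A ∪ B ∧
        ((x ∈ A ∧ y ∈ B ∧ E x y) ∨ (y ∈ A ∧ x ∈ B ∧ E y x))) (sx p) y →
        (pr p ∈ P y ∧ y ∈ A ∪ B) ∧ ∀ q, sx q = y → pr p = pr q → D.toAmalg p = D.toAmalg q from
      (H _ hc).2 q rfl hpq
    intro y hy
    induction hy with
    | refl => exact ⟨⟨hpr p, hsx p⟩, fun q h1 h2 => by rw [huniq p q h1.symm h2]⟩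
    | @tail y z _ hyz ih =>
      refine ⟨⟨hyz.1, hyz.2.1⟩, fun q h1 h2 => ?_⟩
      obtain ⟨q', hq', hpq'⟩ := hex y ih.1.2 _ ih.1.1
      rw [ih.2 q' hq' hpq'.symm]
      rcases hyz.2.2 with ⟨hyA, hzB, hE⟩ | ⟨hzA, hyB, hE⟩
      · rcases q' with q' | q'
        · rcases q with q | q
          · have h1 : q.1.1 = z := h1
            exact absurd hzB (h.disj _ (h1 ▸ q.1.2))
          · have h1 : q.1.1 = z := h1
            have hq' : q'.1.1 = y := hq'
            refine Quot.sound ⟨q', q, rfl, rfl, hcross' _ _ ?_ (hpq'.trans h2)⟩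
            rw [h1, hq']; exact hE
        · have hq' : q'.1.1 = y := hq'
          exact absurd (hq' ▸ q'.1.2) (h.disj _ hyA)
      · rcases q' with q' | q'
        · have hq' : q'.1.1 = y := hq'
          exact absurd hyB (h.disj _ (hq' ▸ q'.1.2))
        · rcases q with q | q
          · have h1 : q.1.1 = z := h1
            have hq' : q'.1.1 = y := hq'
            refine (Quot.sound ⟨q, q', rfl, rfl, hcross' _ _ ?_ (hpq'.trans h2).symm⟩).symm
            rw [h1, hq']; exact hE
          · have h1 : q.1.1 = z := h1
            exact absurd (h1 ▸ q.1.2) (h.disj _ hzA)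
  have hprW : ∀ p, pr p ∈ W := fun p => (h.cover _).2 ⟨_, hsx p, hpr p⟩
  let Φ : D.AmalgV → W := Quot.lift (fun p => ⟨pr p, hprW p⟩) (by
    rintro _ _ ⟨p, q, rfl, rfl, hpq⟩
    exact Subtype.ext (hcross p q hpq))
  have hΦ : ∀ p, (Φ (D.toAmalg p)).1 = pr p := fun p => rfl
  have hbij : Function.Bijective Φ := by
    constructor
    · rintro ⟨p⟩ ⟨q⟩ hpq
      exact hinj p q (congrArg Subtype.val hpq)
    · rintro ⟨v, hv⟩
      obtain ⟨x, hx, hvx⟩ := (h.cover v).1 hv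
      obtain ⟨p, -, hp⟩ := hex x hx v hvx
      exact ⟨D.toAmalg p, Subtype.ext hp⟩
  have hrel : ∀ p q, D.plusRel p q → D.toAmalg p = D.toAmalg q ∨ G.Adj (pr p) (pr q) := by
    rintro (⟨a, x⟩ | ⟨a, x⟩) (⟨b, y⟩ | ⟨b, y⟩) hpq
    · obtain ⟨h1, h2⟩ := hpq
      obtain rfl : a = b := h1
      exact Or.inr ((h.acts _ _ _).2 h2)
    · exact Or.inl (hinj _ _ (hcross _ _ hpq))
    · exact hpq.elim
    · obtain ⟨h1, h2⟩ := hpq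
      obtain rfl : a = b := h1
      exact Or.inr ((h.acts _ _ _).2 h2)
  have hadj1 : ∀ p q, D.toAmalg p ≠ D.toAmalg q → D.plusGraph.Adj p q → G.Adj (pr p) (pr q) := by
    intro p q hne hpq
    rw [TreeAmalgData.plusGraph, fromRel_adj] at hpq
    rcases hpq.2 with h1 | h1
    · exact (hrel _ _ h1).resolve_left hne
    · exact ((hrel _ _ h1).resolve_left hne.symm).symm
  have hadj : ∀ x y : D.AmalgV, G.Adj (Φ x).1 (Φ y).1 ↔ D.amalgGraph.Adj x y := by
    intro x y
    rw [TreeAmalgData.amalgGraph, fromRel_adj]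
    constructor
    · intro hxy
      obtain ⟨z, hz, h1, h2⟩ := h.edge _ _ (Φ x).2 (Φ y).2 hxy
      obtain ⟨p, hp, hp'⟩ := hex z hz _ h1
      obtain ⟨q, hq, hq'⟩ := hex z hz _ h2
      have ex : x = D.toAmalg p := hbij.1 (Subtype.ext hp'.symm)
      have ey : y = D.toAmalg q := hbij.1 (Subtype.ext hq'.symm)
      refine ⟨fun h' => hxy.ne (by rw [h']), Or.inl ⟨p, q, ex, ey, ?_⟩⟩
      rw [← hp', ← hq'] at hxy
      rw [TreeAmalgData.plusGraph, fromRel_adj]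
      refine ⟨fun h' => hxy.ne (by rw [h']), Or.inl ?_⟩
      clear ex ey hp' hq' h1 h2
      rcases p with ⟨a, x⟩ | ⟨a, x⟩ <;> rcases q with ⟨b, y⟩ | ⟨b, y⟩
      · obtain rfl : a = b := Subtype.ext (hp.trans hq.symm)
        exact ⟨rfl, (h.acts _ _ _).1 hxy⟩
      · have h1 : a.1 = b.1 := hp.trans hq.symm
        exact absurd (h1 ▸ b.2) (h.disj _ a.2)
      · have h1 : a.1 = b.1 := hp.trans hq.symm
        exact absurd (h1 ▸ a.2) (h.disj _ b.2)
      · obtain rfl : a = b := Subtype.ext (hp.trans hq.symm)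
        exact ⟨rfl, (h.acts _ _ _).1 hxy⟩
    · rintro ⟨hne, ⟨p, q, rfl, rfl, hpq⟩ | ⟨p, q, rfl, rfl, hpq⟩⟩
      · exact hadj1 _ _ hne hpq
      · exact (hadj1 _ _ hne.symm hpq).symm
  refine ⟨D, ⟨?_, ?_⟩, ?_, ?_, ?_, ?_⟩
  · rintro ⟨b, hb, hE⟩
    refine Set.Finite.of_finite_image (f := Subtype.val)
      ((h.adh a0 h.a0m b hb hE).1.subset ?_) Subtype.val_injective.injOn
    rintro _ ⟨x, hx, rfl⟩
    exact ⟨x.2, hx⟩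
  · rintro ⟨b, hb, hE⟩
    refine Set.Finite.of_finite_image (f := Subtype.val)
      ((h.adh b hb b0 h.b0m hE).1.subset ?_) Subtype.val_injective.injOn
    rintro _ ⟨x, hx, rfl⟩
    exact ⟨hx, x.2⟩
  · intro x
    refine Set.Finite.of_finite_image (f := Sum.elim Subtype.val Subtype.val)
      ((h.finS (Φ x).1).subset ?_) ?_
    · rintro _ ⟨t, ⟨p, rfl, rfl⟩, rfl⟩
      have : Sum.elim Subtype.val Subtype.val (D.site p) = sx p := by
        rcases p with p | p <;> rfl
      rw [this, hΦ]
      exact ⟨hsx p, hpr p⟩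
    · rintro (a | a) - (b | b) - hab
      · exact congrArg _ (Subtype.ext hab)
      · have h1 : a.1 = b.1 := hab
        exact absurd (h1 ▸ b.2) (h.disj _ a.2)
      · have h1 : a.1 = b.1 := hab
        exact absurd (h1 ▸ a.2) (h.disj _ b.2)
      · exact congrArg _ (Subtype.ext hab)
  · exact goodAction_of h.acts h.hP Q B h.QB a0 (fun b => E a0 b)
      (fun g hg hga b hb => by have := h.Einv g hg _ _ hb; rwa [hga] at this)
      (fun v => (h.finS v).subset fun x hx => ⟨Or.inr hx.1, hx.2⟩)
      (fun b hb hE => (h.adh a0 h.a0m b hb hE).2.1) h.orbA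
  · exact goodAction_of h.acts h.hP Q A h.QA b0 (fun a => E a b0)
      (fun g hg hga b hb => by have := h.Einv g hg _ _ hb; rwa [hga] at this)
      (fun v => (h.finS v).subset fun x hx => ⟨Or.inl hx.1, hx.2⟩)
      (fun b hb hE => by rw [Set.inter_comm]; exact (h.adh b hb b0 h.b0m hE).2.1) h.orbB
  · exact ⟨(RelIso.mk (Equiv.ofBijective Φ hbij) fun {x y} => hadj x y).symm⟩

end TA
end

section
open scoped Pointwise
open Relation SimpleGraph

namespace TA

variable {V : Type u} {G : SimpleGraph V}

/-! ### Refining a node -/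

/-- A node of the finer system above `t`, steered by `v`. -/
def extN (𝓕' t : Set (Set V)) (v : V) : Set (Set V) :=
  {C | C ∈ 𝓕' ∧ ((∃ D ∈ t, D ⊆ C) ∨ (v ∈ C ∧ ¬ ∃ D ∈ t, D ⊆ Cᶜ))}

section
variable {Γ : Type*} [Group Γ] [MulAction Γ V] {𝓕 𝓕' t s s' : Set (Set V)} {r : ℕ} {C D : Set V}

theorem extN_node (hN : NF 𝓕') (hs : 𝓕 ⊆ 𝓕') (ht : Node 𝓕 t) (hcl : ∀ C ∈ 𝓕, Cᶜ ∈ 𝓕) (v : V) :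
    Node 𝓕' (extN 𝓕' t v) where
  sub := fun C hC => hC.1
  or C hC := by
    by_cases h1 : ∃ D ∈ t, D ⊆ C
    · exact Or.inl ⟨hC, Or.inl h1⟩
    by_cases h2 : ∃ D ∈ t, D ⊆ Cᶜ
    · exact Or.inr ⟨hN.compl C hC, Or.inl h2⟩
    by_cases hv : v ∈ C
    · exact Or.inl ⟨hC, Or.inr ⟨hv, h2⟩⟩
    · exact Or.inr ⟨hN.compl C hC, Or.inr ⟨hv, by rwa [compl_compl]⟩⟩
  not := by
    rintro C ⟨hC, h1⟩ ⟨hC', h2⟩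
    rw [compl_compl] at h2
    rcases h1 with h1 | h1 <;> rcases h2 with h2 | h2
    · obtain ⟨D, hD, hDC⟩ := h1
      obtain ⟨D', hD', hDC'⟩ := h2
      refine ht.not D' hD' (ht.up D hD _ (hcl _ (ht.sub hD')) ?_)
      exact fun x hx hx' => hDC' hx' (hDC hx)
    · exact h2.2 h1
    · exact h1.2 h2
    · exact h2.1 h1.1
  up := by
    rintro C ⟨hC, h1⟩ D hD hCD
    refine ⟨hD, ?_⟩
    rcases h1 with ⟨E, hE, hEC⟩ | ⟨h1, h2⟩
    · exact Or.inl ⟨E, hE, hEC.trans hCD⟩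
    · refine Or.inr ⟨hCD h1, ?_⟩
      rintro ⟨E, hE, hED⟩
      exact h2 ⟨E, hE, hED.trans (Set.compl_subset_compl.2 hCD)⟩
  fin w := by
    have h1 : ∀ D : Set V, ∃ d, D ∈ t → d ∈ D := by
      intro D
      by_cases hD : D ∈ t
      · obtain ⟨d, hd⟩ := hN.ne D (hs (ht.sub hD))
        exact ⟨d, fun _ => hd⟩
      · exact ⟨w, fun h => absurd h hD⟩
    choose d hd using h1
    refine (((ht.fin w).biUnion fun D _ => hN.sep (d D) w).union (hN.sep v w)).subset ?_
    rintro C ⟨⟨hC, ⟨D, hD, hDC⟩ | ⟨h1, -⟩⟩, hw⟩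
    · refine Or.inl ?_
      simp only [Set.mem_iUnion]
      exact ⟨D, ⟨hD, fun h => hw (hDC h)⟩, hC, hDC (hd D hD), hw⟩
    · exact Or.inr ⟨hC, h1, hw⟩

theorem sub_extN (hs : 𝓕 ⊆ 𝓕') (ht : Node 𝓕 t) (v : V) : t ⊆ extN 𝓕' t v := fun C hC =>
  ⟨hs (ht.sub hC), Or.inl ⟨C, hC, subset_rfl⟩⟩

theorem mem_Pt_extN {v w : V} (hv : v ∈ Pt G r t) (hw : ∀ C, w ∈ C → v ∈ ball G r C) :
    v ∈ Pt G r (extN 𝓕' t w) := by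
  rintro C ⟨-, ⟨D, hD, hDC⟩ | ⟨h1, -⟩⟩
  · exact ball_mono r hDC (hv D hD)
  · exact hw C h1

theorem mem_of_sub (hs : 𝓕 ⊆ 𝓕') (ht : Node 𝓕 t) (hN : Node 𝓕' s) (hts : t ⊆ s) (hC : C ∈ s)
    (hCF : C ∈ 𝓕) : C ∈ t := by
  by_contra h
  exact hN.not C hC (hts (ht.compl_mem_of hCF h))

theorem flip_path (v : V) (hN : NF 𝓕') (hs' : Node 𝓕' s') : ∀ (n : ℕ) (x : Set (Set V)),
    Node 𝓕' x → dep s' x = n → x ⊆ s ∪ s' →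
    ReflTransGen (fun x y => Node 𝓕' x ∧ Node 𝓕' y ∧ x ⊆ s ∪ s' ∧ y ⊆ s ∪ s' ∧
      ∃ C, MinIn x C ∧ C ∉ s' ∧ C ∈ s ∧ y = flip x C) x s' := by
  intro n
  induction n with
  | zero =>
    intro x hx hd _
    rw [Node.dep_zero v hs' hx hd]
  | succ n ih =>
    intro x hx hd hsub
    have hne : x ≠ s' := by
      rintro rfl
      rw [Node.dep_root] at hd
      omega
    have hp := Node.pe_spec v hN hs' hx hne
    have hn := Node.parS_node v hN hs' hx hne
    have hdp := Node.dep_par v hN hs' hx hne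
    have hsub' : parS s' x ⊆ s ∪ s' := by
      rintro C (hC | rfl)
      · exact hsub hC.1
      · exact Or.inr (hs'.compl_mem_of (hx.sub hp.1.1) hp.2)
    refine ReflTransGen.head ⟨hx, hn, hsub, hsub', pe s' x, hp.1, hp.2, ?_, rfl⟩
      (ih _ hn (by omega) hsub')
    exact (hsub hp.1.1).resolve_right hp.2

theorem stab_of (hs : 𝓕 ⊆ 𝓕') (hsm : ∀ (g : Γ), ∀ C ∈ 𝓕, g • C ∈ 𝓕)
    (hsm' : ∀ (g : Γ), ∀ C ∈ 𝓕', g • C ∈ 𝓕') (ht : Node 𝓕 t)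
    (hN : Node 𝓕' s) (hts : t ⊆ s) (g : Γ) (hg : t ⊆ g • s) : g • t = t := by
  have h1 := Node.smul hsm ht g
  refine Node.ext' h1 ht fun C hC => ?_
  exact mem_of_sub hs ht (Node.smul hsm' hN g) hg (Set.smul_set_mono hts hC) (h1.sub hC)

/-- Orbits of a site stabiliser. -/
theorem orb_sites {X : Type*} [MulAction Γ X] {P : X → Set V} (v0 : V)
    (htr : ∀ u v : V, ∃ g : Γ, g • u = v) (hP : ∀ (g : Γ) x, P (g • x) = g • P x) (Sx : Set X)
    (hS : ∀ (g : Γ), ∀ x ∈ Sx, g • x ∈ Sx) (hfin : ∀ v, {x | x ∈ Sx ∧ v ∈ P x}.Finite) (a0 : X)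
    (ha0 : a0 ∈ Sx) : ∃ s : Set V, s.Finite ∧ ∀ v ∈ P a0, ∃ u ∈ s, u ∈ P a0 ∧
      ∃ g : Γ, g • a0 = a0 ∧ g • u = v := by
  have h1 : ∀ x : X, ∃ u : V, (∃ u ∈ P a0, ∃ g : Γ, g • a0 = x ∧ g • u = v0) →
      u ∈ P a0 ∧ ∃ g : Γ, g • a0 = x ∧ g • u = v0 := by
    intro x
    by_cases hx : ∃ u ∈ P a0, ∃ g : Γ, g • a0 = x ∧ g • u = v0
    · obtain ⟨u, hu⟩ := hx
      exact ⟨u, fun _ => hu⟩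
    · exact ⟨v0, fun h => absurd h hx⟩
  choose f hf using h1
  refine ⟨f '' {x | x ∈ Sx ∧ v0 ∈ P x}, (hfin v0).image f, fun v hv => ?_⟩
  obtain ⟨g, hg⟩ := htr v v0
  obtain ⟨h1, g', h2, h3⟩ := hf (g • a0) ⟨v, hv, g, rfl, hg⟩
  refine ⟨f (g • a0), ⟨g • a0, ⟨hS g _ ha0, ?_⟩, rfl⟩, h1, g⁻¹ * g', ?_, ?_⟩
  · rw [hP, ← hg]; exact Set.smul_mem_smul_set hv
  · rw [mul_smul, h2, inv_smul_smul]
  · rw [mul_smul, h3, ← hg, inv_smul_smul]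

end

/-- Data for one refinement step. -/
structure StepH (G : SimpleGraph V) (Γ : Type*) [Group Γ] [MulAction Γ V]
    (𝓕 𝓕' : Set (Set V)) (r : ℕ) (t : Set (Set V)) (C0 : Set V) : Prop where
  h : Dat G Γ 𝓕 r
  h' : Dat G Γ 𝓕' r
  sub : 𝓕 ⊆ 𝓕'
  ht : Node 𝓕 t
  C0m : C0 ∈ 𝓕'
  C0n : C0 ∉ 𝓕
  orb : ∀ C ∈ 𝓕', C ∉ 𝓕 → ∃ g : Γ, C = g • C0 ∨ C = g • C0ᶜ
  tC : t ⊆ nodeOf 𝓕' C0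

namespace StepH
variable {Γ : Type*} [Group Γ] [MulAction Γ V] {𝓕 𝓕' t s : Set (Set V)} {r : ℕ} {C C0 D : Set V}

theorem notF (H : StepH G Γ 𝓕 𝓕' r t C0) (h : C ∉ 𝓕) : Cᶜ ∉ 𝓕 := fun h' =>
  h (by have := H.h.cut.compl _ h'; rwa [compl_compl] at this)

theorem smulF (H : StepH G Γ 𝓕 𝓕' r t C0) (g : Γ) (h : C ∉ 𝓕) : g • C ∉ 𝓕 := fun h' =>
  h (by have := H.h.cut.smul g⁻¹ _ h'; rwa [inv_smul_smul] at this)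

theorem sub_flip (H : StepH G Γ 𝓕 𝓕' r t C0) (hts : t ⊆ s) (hC : C ∉ 𝓕) : t ⊆ flip s C :=
  fun D hD => Or.inl ⟨hts hD, fun h => hC (h ▸ H.ht.sub hD)⟩

theorem flip_nodeOf (H : StepH G Γ 𝓕 𝓕' r t C0) (hC : C ∈ 𝓕') :
    flip (nodeOf 𝓕' C) C = nodeOf 𝓕' Cᶜ :=
  have h1 := nodeOf_node H.h'.nf hC
  have h2 := nodeOf_min H.h'.nf hC
  Node.eq_nodeOf H.h'.nf (Node.flip_node H.h'.nf h1 h2) (Node.flip_min H.h'.nf h1 h2)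
    (nodeOf_node H.h'.nf (H.h'.cut.compl C hC))

theorem eqn (H : StepH G Γ 𝓕 𝓕' r t C0) (hs : Node 𝓕' s) (hC : MinIn s C) : s = nodeOf 𝓕' C :=
  Node.eq_nodeOf H.h'.nf hs hC (nodeOf_node H.h'.nf (hs.sub hC.1))

theorem kk (H : StepH G Γ 𝓕 𝓕' r t C0) (hs : Node 𝓕' s) (hC : MinIn s C) (hF : C ∉ 𝓕) :
    (∃ g : Γ, C = g • C0 ∧ s = g • nodeOf 𝓕' C0 ∧ flip s C = g • nodeOf 𝓕' C0ᶜ) ∨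
    (∃ g : Γ, C = g • C0ᶜ ∧ s = g • nodeOf 𝓕' C0ᶜ ∧ flip s C = g • nodeOf 𝓕' C0) := by
  have hC' := hs.sub hC.1
  have hs' := H.eqn hs hC
  subst hs'
  rw [H.flip_nodeOf hC']
  obtain ⟨g, rfl | rfl⟩ := H.orb C hC' hF
  · refine Or.inl ⟨g, rfl, nodeOf_smul H.h'.nf H.h'.cut.smul H.C0m g, ?_⟩
    rw [← smul_compl', nodeOf_smul H.h'.nf H.h'.cut.smul (H.h'.cut.compl _ H.C0m) g]
  · refine Or.inr ⟨g, rfl, nodeOf_smul H.h'.nf H.h'.cut.smul (H.h'.cut.compl _ H.C0m) g, ?_⟩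
    rw [← smul_compl', compl_compl, nodeOf_smul H.h'.nf H.h'.cut.smul H.C0m g]

theorem tC' (H : StepH G Γ 𝓕 𝓕' r t C0) : t ⊆ nodeOf 𝓕' C0ᶜ := by
  rw [← H.flip_nodeOf H.C0m]; exact H.sub_flip H.tC H.C0n

theorem ncard_U (H : StepH G Γ 𝓕 𝓕' r t C0) (hC : C ∈ 𝓕') (hF : C ∉ 𝓕) :
    (UU G r C).ncard = (UU G r C0).ncard := by
  obtain ⟨g, rfl | rfl⟩ := H.orb C hC hF
  · rw [UU_smul H.h.hc H.h.acts, Set.ncard_smul_set]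
  · rw [UU_smul H.h.hc H.h.acts, Set.ncard_smul_set, UU_compl]

theorem n0 (H : StepH G Γ 𝓕 𝓕' r t C0) : Node 𝓕' (nodeOf 𝓕' C0) := nodeOf_node H.h'.nf H.C0m

theorem n1 (H : StepH G Γ 𝓕 𝓕' r t C0) : Node 𝓕' (nodeOf 𝓕' C0ᶜ) :=
  nodeOf_node H.h'.nf (H.h'.cut.compl _ H.C0m)

theorem notF_of (H : StepH G Γ 𝓕 𝓕' r t C0) {s s' : Set (Set V)} (hs : Node 𝓕' s)
    (hts : t ⊆ s) (hts' : t ⊆ s') (hC : C ∈ s) (hC' : C ∉ s') : C ∉ 𝓕 := fun h =>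
  hC' (hts' (mem_of_sub H.sub H.ht hs hts hC h))

/-- Every node above `t` is a translate of one of the two basic ones. -/
theorem two (H : StepH G Γ 𝓕 𝓕' r t C0) (v : V) (hs : Node 𝓕' s) (hts : t ⊆ s) :
    ∃ g : Γ, g • t = t ∧ (s = g • nodeOf 𝓕' C0 ∨ s = g • nodeOf 𝓕' C0ᶜ) := by
  by_cases he : s = nodeOf 𝓕' C0
  · exact ⟨1, one_smul _ _, Or.inl (by rw [he, one_smul])⟩
  · have hp := Node.pe_spec v H.h'.nf H.n0 hs he
    rcases H.kk hs hp.1 (H.notF_of hs hts H.tC hp.1.1 hp.2) with ⟨g, -, h1, -⟩ | ⟨g, -, h1, -⟩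
    · exact ⟨g, stab_of H.sub H.h.cut.smul H.h'.cut.smul H.ht H.n0 H.tC g (h1 ▸ hts), Or.inl h1⟩
    · exact ⟨g, stab_of H.sub H.h.cut.smul H.h'.cut.smul H.ht H.n1 H.tC' g (h1 ▸ hts), Or.inr h1⟩

theorem Pt_sub (hts : t ⊆ s) : Pt G r s ⊆ Pt G r t := fun _ hv C hC => hv C (hts hC)

theorem cover' (H : StepH G Γ 𝓕 𝓕' r t C0) (v : V) (hv : v ∈ Pt G r t) :
    ∃ s, Node 𝓕' s ∧ t ⊆ s ∧ v ∈ Pt G r s ∧ ∀ w, w ∈ Pt G r t → G.Adj v w → w ∈ Pt G r s :=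
  ⟨extN 𝓕' t v, extN_node H.h'.nf H.sub H.ht H.h.cut.compl v, sub_extN H.sub H.ht v,
    mem_Pt_extN hv fun _ h => subset_ball _ _ h, fun w hw hvw => mem_Pt_extN hw fun C hC =>
      ⟨v, hC, by rw [SimpleGraph.dist_eq_one_iff_adj.2 hvw.symm]; exact H.h.hr⟩⟩

theorem path (H : StepH G Γ 𝓕 𝓕' r t C0) (v : V) {s s' : Set (Set V)} (hs : Node 𝓕' s)
    (hs' : Node 𝓕' s') (hts : t ⊆ s) (hts' : t ⊆ s') (hv : v ∈ Pt G r s) (hv' : v ∈ Pt G r s') :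
    ReflTransGen (fun x y => Node 𝓕' x ∧ Node 𝓕' y ∧ v ∈ Pt G r x ∧ v ∈ Pt G r y ∧
      ∃ C, MinIn x C ∧ C ∉ 𝓕 ∧ y = flip x C) s s' := by
  refine ReflTransGen.mono ?_ _ _ (flip_path v H.h'.nf hs' _ s hs rfl Set.subset_union_left)
  rintro x y ⟨h1, h2, h3, h4, C, h5, h6, h7, h8⟩
  exact ⟨h1, h2, Pt_convex h3 ⟨hv, hv'⟩, Pt_convex h4 ⟨hv, hv'⟩, C, h5,
    H.notF_of hs hts hts' h7 h6, h8⟩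

theorem smul_sub (g : Γ) (hg : g • t = t) (hts : t ⊆ s) : t ⊆ g • s := by
  rw [← hg]; exact Set.smul_set_mono hts

end StepH

end TA
end

section
open scoped Pointwise
open Relation SimpleGraph

namespace TA

variable {V : Type u} {G : SimpleGraph V}

namespace StepH
variable {Γ : Type*} [Group Γ] [MulAction Γ V] {𝓕 𝓕' t s : Set (Set V)} {r : ℕ} {C C0 : Set V}

theorem stab_mem (g : Γ) : g ∈ MulAction.stabilizer Γ t ↔ g • t = t := Iff.rfl

/-- Two orbits of nodes above `t`. -/
theorem caseII (H : StepH G Γ 𝓕 𝓕' r t C0)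
    (hno : ¬ ∃ g : Γ, nodeOf 𝓕' C0ᶜ = g • nodeOf 𝓕' C0) :
    GoodAmalgStep ⟨Pt G r (nodeOf 𝓕' C0), G.induce (Pt G r (nodeOf 𝓕' C0))⟩
      ⟨Pt G r (nodeOf 𝓕' C0ᶜ), G.induce (Pt G r (nodeOf 𝓕' C0ᶜ))⟩
      ⟨Pt G r t, G.induce (Pt G r t)⟩ := by
  have hhc := H.h.hc
  have hN := H.h'.nf
  have hne : Nonempty V := hhc.nonempty
  obtain ⟨v0⟩ := hne
  set a := nodeOf 𝓕' C0 with ha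
  set b := nodeOf 𝓕' C0ᶜ with hb
  set A : Set (Set (Set V)) := {s | Node 𝓕' s ∧ t ⊆ s ∧ ∃ g : Γ, s = g • a} with hA
  set B : Set (Set (Set V)) := {s | Node 𝓕' s ∧ t ⊆ s ∧ ∃ g : Γ, s = g • b} with hB
  have hAB : ∀ s, Node 𝓕' s → t ⊆ s → s ∈ A ∪ B := by
    intro s hs hts
    obtain ⟨g, -, h1 | h1⟩ := H.two v0 hs hts
    · exact Or.inl ⟨hs, hts, g, h1⟩
    · exact Or.inr ⟨hs, hts, g, h1⟩
  have hAB' : ∀ s ∈ A ∪ B, Node 𝓕' s ∧ t ⊆ s := by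
    rintro s (h | h)
    · exact ⟨h.1, h.2.1⟩
    · exact ⟨h.1, h.2.1⟩
  have hdisj : ∀ x ∈ A, x ∉ B := by
    rintro x ⟨-, -, g, hg⟩ ⟨-, -, g', hg'⟩
    refine hno ⟨g'⁻¹ * g, ?_⟩
    rw [mul_smul, ← hg, hg', inv_smul_smul]
  -- flipping a new cut changes the side
  have hside : ∀ x C, Node 𝓕' x → t ⊆ x → MinIn x C → C ∉ 𝓕 →
      (x ∈ A ∧ flip x C ∈ B) ∨ (x ∈ B ∧ flip x C ∈ A) := by
    intro x C hx htx hC hCF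
    have hf := Node.flip_node hN hx hC
    have htf := H.sub_flip htx hCF
    rcases H.kk hx hC hCF with ⟨g, -, h1, h2⟩ | ⟨g, -, h1, h2⟩
    · exact Or.inl ⟨⟨hx, htx, g, h1⟩, ⟨hf, htf, g, h2⟩⟩
    · exact Or.inr ⟨⟨hx, htx, g, h1⟩, ⟨hf, htf, g, h2⟩⟩
  have hpe : ∀ x ∈ A ∪ B, x ≠ a → MinIn x (pe a x) ∧ pe a x ∉ 𝓕 := by
    intro x hx hxa
    obtain ⟨h1, h2⟩ := hAB' x hx
    have hp := Node.pe_spec v0 hN H.n0 h1 hxa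
    exact ⟨hp.1, H.notF_of h1 h2 H.tC hp.1.1 hp.2⟩
  refine AmH.step (Γ := Γ) (P := Pt G r) (Q := MulAction.stabilizer Γ t) (A := A) (B := B)
    (a0 := a) (b0 := b) (E := fun x y => ∃ C, MinIn x C ∧ C ∉ 𝓕 ∧ y = flip x C) (r := a)
    (par := parS a) (dp := dep a) (W := Pt G r t) (n := (UU G r C0).ncard) ?_
  constructor
  · exact H.h.acts
  · exact fun g x => Pt_smul hhc H.h.acts g
  · rintro g hg x ⟨h1, h2, g', h3⟩
    exact ⟨Node.smul H.h'.cut.smul h1 g, smul_sub g hg h2, g * g', by rw [mul_smul, h3]⟩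
  · rintro g hg x ⟨h1, h2, g', h3⟩
    exact ⟨Node.smul H.h'.cut.smul h1 g, smul_sub g hg h2, g * g', by rw [mul_smul, h3]⟩
  · exact hdisj
  · exact ⟨H.n0, H.tC, 1, (one_smul _ _).symm⟩
  · exact ⟨H.n1, H.tC', 1, (one_smul _ _).symm⟩
  · rintro x ⟨h1, h2, g, rfl⟩
    exact ⟨g, stab_of H.sub H.h.cut.smul H.h'.cut.smul H.ht H.n0 H.tC g h2, rfl⟩
  · rintro x ⟨h1, h2, g, rfl⟩
    exact ⟨g, stab_of H.sub H.h.cut.smul H.h'.cut.smul H.ht H.n1 H.tC' g h2, rfl⟩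
  · rintro g - x y ⟨C, h1, h2, rfl⟩
    exact ⟨g • C, h1.smul g, H.smulF g h2, (flip_smul g).symm⟩
  · exact hAB a H.n0 H.tC
  · intro x hx hxa
    obtain ⟨h1, h2⟩ := hAB' x hx
    exact hAB _ (Node.parS_node v0 hN H.n0 h1 hxa) (H.sub_flip h2 (hpe x hx hxa).2)
  · intro x hx hxa
    obtain ⟨h1, h2⟩ := hAB' x hx
    rcases hside x (pe a x) h1 h2 (hpe x hx hxa).1 (hpe x hx hxa).2 with h | h
    · exact ⟨fun _ => h.2, fun _ => h.1⟩
    · exact ⟨fun h' => absurd h.1 (hdisj x h'), fun h' => absurd h' (hdisj _ h.2)⟩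
  · intro x hx hxa
    exact Node.dep_par v0 hN H.n0 (hAB' x hx).1 hxa
  · exact Node.dep_root
  · intro x hx y hy
    constructor
    · rintro ⟨C, h1, h2, rfl⟩
      rcases Node.flip_cases hN H.n0 hx.1 h1 with h | h
      · exact Or.inl ⟨h.1, h.2.2⟩
      · exact Or.inr ⟨h.1, h.2.2⟩
    · rintro (⟨h1, h2⟩ | ⟨h1, h2⟩)
      · have := hpe x (Or.inl hx) h1
        exact ⟨pe a x, this.1, this.2, h2.symm⟩
      · have h3 := hpe y (Or.inr hy) h1
        refine ⟨(pe a y)ᶜ, ?_, H.notF h3.2, ?_⟩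
        · rw [← h2]; exact Node.flip_min hN hy.1 h3.1
        · rw [← h2]; exact (Node.flip_flip' hy.1 h3.1).symm
  · intro v
    constructor
    · intro hv
      obtain ⟨s, h1, h2, h3, -⟩ := H.cover' v hv
      exact ⟨s, hAB s h1 h2, h3⟩
    · rintro ⟨s, hs, hv⟩
      exact Pt_sub (hAB' s hs).2 hv
  · intro v w hv hw hvw
    obtain ⟨s, h1, h2, h3, h4⟩ := H.cover' v hv
    exact ⟨s, hAB s h1 h2, h3, h4 w hw hvw⟩
  · intro v x hx y hy hvx hvy
    obtain ⟨hx1, hx2⟩ := hAB' x hx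
    obtain ⟨hy1, hy2⟩ := hAB' y hy
    have key : ∀ z, ReflTransGen (fun x y => Node 𝓕' x ∧ Node 𝓕' y ∧ v ∈ Pt G r x ∧ v ∈ Pt G r y ∧
      ∃ C, MinIn x C ∧ C ∉ 𝓕 ∧ y = flip x C) x z → t ⊆ z ∧ ReflTransGen (fun x y => v ∈ Pt G r y ∧
        y ∈ A ∪ B ∧ ((x ∈ A ∧ y ∈ B ∧ (∃ C, MinIn x C ∧ C ∉ 𝓕 ∧ y = flip x C)) ∨
        (y ∈ A ∧ x ∈ B ∧ (∃ C, MinIn y C ∧ C ∉ 𝓕 ∧ x = flip y C)))) x z := by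
      intro z hz
      induction hz with
      | refl => exact ⟨hx2, ReflTransGen.refl⟩
      | tail _ h ih =>
        obtain ⟨h1, h2, h3, h4, C, h5, h6, rfl⟩ := h
        have h7 := H.sub_flip ih.1 h6
        refine ⟨h7, ih.2.tail ⟨h4, hAB _ h2 h7, ?_⟩⟩
        rcases hside _ C h1 ih.1 h5 h6 with h | h
        · exact Or.inl ⟨h.1, h.2, C, h5, h6, rfl⟩
        · exact Or.inr ⟨h.2, h.1, Cᶜ, Node.flip_min hN h1 h5, H.notF h6,
            (Node.flip_flip' h1 h5).symm⟩
    exact (key y (H.path v hx1 hy1 hx2 hy2 hvx hvy)).2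
  · intro v
    refine (H.h'.nodes_fin v).subset ?_
    rintro x ⟨hx, hv⟩
    exact ⟨(hAB' x hx).1, hv⟩
  · rintro x hx y hy ⟨C, h1, h2, rfl⟩
    rw [Pt_inter_flip hN hx.1 h1]
    have hC := hx.1.sub h1.1
    exact ⟨H.h'.U_fin hC, H.h'.U_ne hC, H.ncard_U hC h2⟩
  · obtain ⟨s, hs, h⟩ := orb_sites (P := Pt G r) v0 H.h.tr
      (fun g x => Pt_smul hhc H.h.acts g) {s | Node 𝓕' s}
      (fun g x hx => Node.smul H.h'.cut.smul hx g) (fun v => H.h'.nodes_fin v) a H.n0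
    refine ⟨s, hs, fun v hv => ?_⟩
    obtain ⟨u, hu, hu', g, hg, hgu⟩ := h v hv
    exact ⟨u, hu, hu', g, stab_of H.sub H.h.cut.smul H.h'.cut.smul H.ht H.n0 H.tC g
      (by rw [hg]; exact H.tC), hg, hgu⟩
  · obtain ⟨s, hs, h⟩ := orb_sites (P := Pt G r) v0 H.h.tr
      (fun g x => Pt_smul hhc H.h.acts g) {s | Node 𝓕' s}
      (fun g x hx => Node.smul H.h'.cut.smul hx g) (fun v => H.h'.nodes_fin v) b H.n1
    refine ⟨s, hs, fun v hv => ?_⟩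
    obtain ⟨u, hu, hu', g, hg, hgu⟩ := h v hv
    exact ⟨u, hu, hu', g, stab_of H.sub H.h.cut.smul H.h'.cut.smul H.ht H.n1 H.tC' g
      (by rw [hg]; exact H.tC'), hg, hgu⟩

/-- The hub of an edge of the structure tree. -/
def hub (C : Set V) : Set (Set V) := {C, Cᶜ}

theorem hub_compl (C : Set V) : hub Cᶜ = hub C := by
  rw [hub, hub, compl_compl, Set.pair_comm]

theorem hub_smul (g : Γ) (C : Set V) : g • hub C = hub (g • C) := by
  rw [hub, hub, ← Set.image_smul, Set.image_pair, smul_compl']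

theorem Pt_hub (C : Set V) : Pt G r (hub C) = UU G r C := by
  ext v
  constructor
  · intro h
    exact ⟨h C (Or.inl rfl), h Cᶜ (Or.inr rfl)⟩
  · rintro ⟨h1, h2⟩ D (rfl | rfl)
    · exact h1
    · exact h2

theorem hub_not_node (C : Set V) : ¬ Node 𝓕' (hub C) := fun h =>
  h.not C (Or.inl rfl) (Or.inr rfl)

/-- the away side of a hub -/
noncomputable def cc (a h : Set (Set V)) : Set V :=
  open Classical in if hh : ∃ C ∈ h, C ∉ a then hh.choose else ∅

theorem cc_hub {a : Set (Set V)} (ha : Node 𝓕' a) (hC : C ∈ 𝓕') (hCa : C ∉ a) :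
    cc a (hub C) = C := by
  have hh : ∃ D ∈ hub C, D ∉ a := ⟨C, Or.inl rfl, hCa⟩
  rw [cc, dif_pos hh]
  obtain ⟨h1, h2⟩ := hh.choose_spec
  rcases h1 with h1 | h1
  · exact h1
  · exact absurd (ha.compl_mem_of hC hCa) (by rw [h1] at h2; exact h2)

/-- One orbit of nodes above `t`. -/
theorem caseI (H : StepH G Γ 𝓕 𝓕' r t C0) {g1 : Γ}
    (hg1 : nodeOf 𝓕' C0ᶜ = g1 • nodeOf 𝓕' C0) :
    GoodAmalgStep ⟨Pt G r (nodeOf 𝓕' C0), G.induce (Pt G r (nodeOf 𝓕' C0))⟩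
      ⟨Pt G r (hub C0), G.induce (Pt G r (hub C0))⟩
      ⟨Pt G r t, G.induce (Pt G r t)⟩ := by
  classical
  have hhc := H.h.hc
  have hN := H.h'.nf
  have hne : Nonempty V := hhc.nonempty
  obtain ⟨v0⟩ := hne
  set a := nodeOf 𝓕' C0 with ha
  set A : Set (Set (Set V)) := {s | Node 𝓕' s ∧ t ⊆ s} with hA
  set B : Set (Set (Set V)) := {h | ∃ C, C ∈ 𝓕' ∧ C ∉ 𝓕 ∧ t ⊆ nodeOf 𝓕' C ∧ h = hub C} with hB
  have hnB : ∀ x ∈ B, ¬ Node 𝓕' x := by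
    rintro x ⟨C, -, -, -, rfl⟩; exact hub_not_node C
  have hBc : ∀ C, C ∈ 𝓕' → C ∉ 𝓕 → t ⊆ nodeOf 𝓕' C → t ⊆ nodeOf 𝓕' Cᶜ := by
    intro C hC hCF ht
    rw [← H.flip_nodeOf hC]; exact H.sub_flip ht hCF
  -- normal form of a hub
  have hBn : ∀ x ∈ B, ∃ C, C ∈ 𝓕' ∧ C ∉ 𝓕 ∧ t ⊆ nodeOf 𝓕' C ∧ x = hub C ∧ C ∉ a := by
    rintro x ⟨C, h1, h2, h3, rfl⟩
    by_cases hCa : C ∈ a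
    · exact ⟨Cᶜ, hN.compl C h1, H.notF h2, hBc C h1 h2 h3, (hub_compl C).symm, H.n0.not C hCa⟩
    · exact ⟨C, h1, h2, h3, rfl, hCa⟩
  have hpe : ∀ x ∈ A, x ≠ a → MinIn x (pe a x) ∧ pe a x ∉ 𝓕 ∧ pe a x ∉ a := by
    rintro x ⟨h1, h2⟩ hxa
    have hp := Node.pe_spec v0 hN H.n0 h1 hxa
    exact ⟨hp.1, H.notF_of h1 h2 H.tC hp.1.1 hp.2, hp.2⟩
  have hEB : ∀ x ∈ A, ∀ C, MinIn x C → C ∉ 𝓕 → hub C ∈ B := fun x hx C hC hCF =>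
    ⟨C, hx.1.sub hC.1, hCF, by rw [← H.eqn hx.1 hC]; exact hx.2, rfl⟩
  set par : Set (Set V) → Set (Set V) := fun x =>
    if Node 𝓕' x then hub (pe a x) else nodeOf 𝓕' (cc a x)ᶜ with hpar
  set dp : Set (Set V) → ℕ := fun x =>
    if Node 𝓕' x then 2 * dep a x else 2 * dep a (nodeOf 𝓕' (cc a x)ᶜ) + 1 with hdp
  have parN : ∀ x, Node 𝓕' x → par x = hub (pe a x) := fun x hx => if_pos hx
  have dpN : ∀ x, Node 𝓕' x → dp x = 2 * dep a x := fun x hx => if_pos hx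
  have parH : ∀ C, C ∈ 𝓕' → C ∉ a → par (hub C) = nodeOf 𝓕' Cᶜ := fun C hC hCa => by
    rw [hpar]
    simp only
    rw [if_neg (hub_not_node C), cc_hub H.n0 hC hCa]
  have dpH : ∀ C, C ∈ 𝓕' → C ∉ a → dp (hub C) = 2 * dep a (nodeOf 𝓕' Cᶜ) + 1 :=
    fun C hC hCa => by
      rw [hdp]
      simp only
      rw [if_neg (hub_not_node C), cc_hub H.n0 hC hCa]
  have parS_eq : ∀ x ∈ A, x ≠ a → parS a x = nodeOf 𝓕' (pe a x)ᶜ := by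
    intro x hx hxa
    have h1 := (hpe x hx hxa).1
    have h2 := H.eqn hx.1 h1
    rw [← H.flip_nodeOf (hx.1.sub h1.1), ← h2]; rfl
  have trA : ∀ x ∈ A, ∃ g ∈ MulAction.stabilizer Γ t, g • a = x := by
    rintro x ⟨h1, h2⟩
    have : ∃ g : Γ, x = g • a := by
      obtain ⟨g, -, h | h⟩ := H.two v0 h1 h2
      · exact ⟨g, h⟩
      · exact ⟨g * g1, by rw [h, hg1, mul_smul]⟩
    obtain ⟨g, rfl⟩ := this
    exact ⟨g, stab_of H.sub H.h.cut.smul H.h'.cut.smul H.ht H.n0 H.tC g h2, rfl⟩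
  refine AmH.step (Γ := Γ) (P := Pt G r) (Q := MulAction.stabilizer Γ t) (A := A) (B := B)
    (a0 := a) (b0 := hub C0) (E := fun x y => ∃ C, MinIn x C ∧ C ∉ 𝓕 ∧ y = hub C) (r := a)
    (par := par) (dp := dp) (W := Pt G r t) (n := (UU G r C0).ncard) ?_
  constructor
  · exact H.h.acts
  · exact fun g x => Pt_smul hhc H.h.acts g
  · rintro g hg x ⟨h1, h2⟩
    exact ⟨Node.smul H.h'.cut.smul h1 g, smul_sub g hg h2⟩
  · rintro g hg x ⟨C, h1, h2, h3, rfl⟩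
    refine ⟨g • C, H.h'.cut.smul g C h1, H.smulF g h2, ?_, hub_smul g C⟩
    rw [nodeOf_smul hN H.h'.cut.smul h1]
    exact smul_sub g hg h3
  · exact fun x hx hx' => hnB x hx' hx.1
  · exact ⟨H.n0, H.tC⟩
  · exact ⟨C0, H.C0m, H.C0n, H.tC, rfl⟩
  · exact trA
  · rintro x ⟨C, h1, h2, h3, rfl⟩
    obtain ⟨g, rfl | rfl⟩ := H.orb C h1 h2
    · rw [nodeOf_smul hN H.h'.cut.smul H.C0m] at h3
      exact ⟨g, stab_of H.sub H.h.cut.smul H.h'.cut.smul H.ht H.n0 H.tC g h3, hub_smul g _⟩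
    · rw [nodeOf_smul hN H.h'.cut.smul (hN.compl _ H.C0m)] at h3
      exact ⟨g, stab_of H.sub H.h.cut.smul H.h'.cut.smul H.ht H.n1 H.tC' g h3, by
        rw [hub_smul, smul_compl', hub_compl]⟩
  · rintro g - x y ⟨C, h1, h2, rfl⟩
    exact ⟨g • C, h1.smul g, H.smulF g h2, hub_smul g C⟩
  · exact Or.inl ⟨H.n0, H.tC⟩
  · rintro x (hx | hx) hxa
    · rw [parN x hx.1]
      exact Or.inr (hEB x hx _ (hpe x hx hxa).1 (hpe x hx hxa).2.1)
    · obtain ⟨C, h1, h2, h3, rfl, h4⟩ := hBn x hx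
      rw [parH C h1 h4]
      exact Or.inl ⟨nodeOf_node hN (hN.compl C h1), hBc C h1 h2 h3⟩
  · rintro x (hx | hx) hxa
    · rw [parN x hx.1]
      exact ⟨fun _ => hEB x hx _ (hpe x hx hxa).1 (hpe x hx hxa).2.1, fun _ => hx⟩
    · refine ⟨fun h => absurd h.1 (hnB x hx), fun h => ?_⟩
      obtain ⟨C, h1, h2, h3, rfl, h4⟩ := hBn x hx
      rw [parH C h1 h4] at h
      exact absurd (nodeOf_node hN (hN.compl C h1)) (hnB _ h)
  · rintro x (hx | hx) hxa
    · obtain ⟨h1, h2, h3⟩ := hpe x hx hxa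
      rw [parN x hx.1, dpN x hx.1, dpH _ (hx.1.sub h1.1) h3, Node.dep_par v0 hN H.n0 hx.1 hxa,
        parS_eq x hx hxa]
      ring
    · obtain ⟨C, h1, h2, h3, rfl, h4⟩ := hBn x hx
      rw [parH C h1 h4, dpH C h1 h4, dpN _ (nodeOf_node hN (hN.compl C h1))]
  · rw [dpN a H.n0, Node.dep_root]
  · intro x hx y hy
    constructor
    · rintro ⟨C, h1, h2, rfl⟩
      by_cases hCa : C ∈ a
      · refine Or.inr ⟨fun h => hnB _ hy (h ▸ H.n0), ?_⟩
        rw [← hub_compl, parH Cᶜ (hN.compl C (hx.1.sub h1.1)) (H.n0.not C hCa), compl_compl,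
          ← H.eqn hx.1 h1]
      · refine Or.inl ⟨fun h => hCa (h ▸ h1.1), ?_⟩
        rw [parN x hx.1, Node.pe_eq hN H.n0 hx.1 h1 hCa]
    · rintro (⟨h1, h2⟩ | ⟨h1, h2⟩)
      · have := hpe x hx h1
        exact ⟨pe a x, this.1, this.2.1, by rw [← h2, parN x hx.1]⟩
      · obtain ⟨C, h3, h4, h5, rfl, h6⟩ := hBn y hy
        rw [parH C h3 h6] at h2
        refine ⟨Cᶜ, ?_, H.notF h4, (hub_compl C).symm⟩
        rw [← h2]; exact nodeOf_min hN (hN.compl C h3)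
  · intro v
    constructor
    · intro hv
      obtain ⟨s, h1, h2, h3, -⟩ := H.cover' v hv
      exact ⟨s, Or.inl ⟨h1, h2⟩, h3⟩
    · rintro ⟨s, hs | ⟨C, h1, h2, h3, rfl⟩, hv⟩
      · exact Pt_sub hs.2 hv
      · rw [Pt_hub] at hv
        exact Pt_sub h3 (U_sub_Pt hN (nodeOf_node hN h1) (nodeOf_min hN h1) hv)
  · intro v w hv hw hvw
    obtain ⟨s, h1, h2, h3, h4⟩ := H.cover' v hv
    exact ⟨s, Or.inl ⟨h1, h2⟩, h3, h4 w hw hvw⟩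
  · intro v
    set R : Set (Set V) → Set (Set V) → Prop := fun x y => v ∈ Pt G r y ∧
        y ∈ A ∪ B ∧ ((x ∈ A ∧ y ∈ B ∧ (∃ C, MinIn x C ∧ C ∉ 𝓕 ∧ y = hub C)) ∨
        (y ∈ A ∧ x ∈ B ∧ (∃ C, MinIn y C ∧ C ∉ 𝓕 ∧ x = hub C))) with hR
    have step1 : ∀ x ∈ A, ∀ C, MinIn x C → C ∉ 𝓕 → v ∈ UU G r C → R x (hub C) := by
      intro x hx C hC hCF hv
      have := hEB x hx C hC hCF
      exact ⟨by rw [Pt_hub]; exact hv, Or.inr this, Or.inl ⟨hx, this, C, hC, hCF, rfl⟩⟩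
    have step2 : ∀ x ∈ A, ∀ C, MinIn x C → C ∉ 𝓕 → v ∈ UU G r C → R (hub C) x := by
      intro x hx C hC hCF hv
      have := hEB x hx C hC hCF
      exact ⟨U_sub_Pt hN hx.1 hC hv, Or.inl hx, Or.inr ⟨hx, this, C, hC, hCF, rfl⟩⟩
    have key : ∀ x ∈ A, ∀ y ∈ A, v ∈ Pt G r x → v ∈ Pt G r y → ReflTransGen R x y := by
      intro x hx y hy hvx hvy
      have key : ∀ z, ReflTransGen (fun x y => Node 𝓕' x ∧ Node 𝓕' y ∧ v ∈ Pt G r x ∧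
        v ∈ Pt G r y ∧ ∃ C, MinIn x C ∧ C ∉ 𝓕 ∧ y = flip x C) x z →
          t ⊆ z ∧ ReflTransGen R x z := by
        intro z hz
        induction hz with
        | refl => exact ⟨hx.2, ReflTransGen.refl⟩
        | @tail b c _ h ih =>
          obtain ⟨h1, h2, h3, h4, C, h5, h6, rfl⟩ := h
          have h7 := H.sub_flip ih.1 h6
          have hv : v ∈ UU G r C := by
            rw [← Pt_inter_flip hN h1 h5]; exact ⟨h3, h4⟩
          refine ⟨h7, (ih.2.tail (step1 b ⟨h1, ih.1⟩ C h5 h6 hv)).tail ?_⟩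
          rw [← hub_compl]
          exact step2 _ ⟨h2, h7⟩ Cᶜ (Node.flip_min hN h1 h5) (H.notF h6) (by rwa [UU_compl])
      exact (key y (H.path v hx.1 hy.1 hx.2 hy.2 hvx hvy)).2
    have toA : ∀ x ∈ A ∪ B, v ∈ Pt G r x → ∃ y ∈ A, v ∈ Pt G r y ∧ ReflTransGen R x y ∧
        ReflTransGen R y x := by
      rintro x (hx | ⟨C, h1, h2, h3, rfl⟩) hv
      · exact ⟨x, hx, hv, ReflTransGen.refl, ReflTransGen.refl⟩
      · rw [Pt_hub] at hv
        have hn := nodeOf_node hN h1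
        have hm := nodeOf_min hN h1
        exact ⟨nodeOf 𝓕' C, ⟨hn, h3⟩, U_sub_Pt hN hn hm hv,
          ReflTransGen.single (step2 _ ⟨hn, h3⟩ C hm h2 hv),
          ReflTransGen.single (step1 _ ⟨hn, h3⟩ C hm h2 hv)⟩
    intro x hx y hy hvx hvy
    obtain ⟨x', h1, h2, h3, -⟩ := toA x hx hvx
    obtain ⟨y', h4, h5, -, h6⟩ := toA y hy hvy
    exact (h3.trans (key x' h1 y' h4 h2 h5)).trans h6
  · intro v
    refine ((H.h'.nodes_fin v).union ((H.h'.mem_U_fin v).image hub)).subset ?_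
    rintro x ⟨hx | ⟨C, h1, h2, h3, rfl⟩, hv⟩
    · exact Or.inl ⟨hx.1, hv⟩
    · rw [Pt_hub] at hv
      exact Or.inr ⟨C, ⟨h1, hv⟩, rfl⟩
  · rintro x hx y hy ⟨C, h1, h2, rfl⟩
    have h3 : Pt G r x ∩ Pt G r (hub C) = UU G r C := by
      rw [Pt_hub]; exact Set.inter_eq_right.2 (U_sub_Pt hN hx.1 h1)
    rw [h3]
    have hC := hx.1.sub h1.1
    exact ⟨H.h'.U_fin hC, H.h'.U_ne hC, H.ncard_U hC h2⟩
  · obtain ⟨s, hs, h⟩ := orb_sites (P := Pt G r) v0 H.h.tr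
      (fun g x => Pt_smul hhc H.h.acts g) {s | Node 𝓕' s}
      (fun g x hx => Node.smul H.h'.cut.smul hx g) (fun v => H.h'.nodes_fin v) a H.n0
    refine ⟨s, hs, fun v hv => ?_⟩
    obtain ⟨u, hu, hu', g, hg, hgu⟩ := h v hv
    exact ⟨u, hu, hu', g, stab_of H.sub H.h.cut.smul H.h'.cut.smul H.ht H.n0 H.tC g
      (by rw [hg]; exact H.tC), hg, hgu⟩
  · obtain ⟨s, hs, h⟩ := orb_sites (P := Pt G r) v0 H.h.tr
      (fun g x => Pt_smul hhc H.h.acts g) {s | ∃ C ∈ 𝓕', s = hub C}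
      (by
        rintro g x ⟨C, hC, rfl⟩
        exact ⟨g • C, H.h'.cut.smul g C hC, hub_smul g C⟩)
      (by
        intro v
        refine ((H.h'.mem_U_fin v).image hub).subset ?_
        rintro x ⟨⟨C, hC, rfl⟩, hv⟩
        rw [Pt_hub] at hv
        exact ⟨C, ⟨hC, hv⟩, rfl⟩) (hub C0) ⟨C0, H.C0m, rfl⟩
    refine ⟨s, hs, fun v hv => ?_⟩
    obtain ⟨u, hu, hu', g, hg, hgu⟩ := h v hv
    refine ⟨u, hu, hu', g, stab_of H.sub H.h.cut.smul H.h'.cut.smul H.ht H.n0 H.tC g ?_, hg, hgu⟩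
    have h1 : g • C0 ∈ hub C0 := by
      have h2 : g • C0 ∈ g • hub C0 := Set.smul_mem_smul_set (Or.inl rfl)
      rwa [hg] at h2
    rw [← nodeOf_smul hN H.h'.cut.smul H.C0m]
    rcases h1 with h1 | h1
    · rw [h1]; exact H.tC
    · rw [h1]; exact H.tC'

end StepH

end TA
end

section
open scoped Pointwise
open Relation SimpleGraph

namespace TA

variable {V : Type u} {G : SimpleGraph V}

/-! ### The terminal factorisation -/

theorem Join.map_iso {W : Type*} {G' : SimpleGraph W} (e : G ≃g G') {S : Set V} {S' : Set W}
    (h : ∀ x ∈ S, e x ∈ S') {x y : V} (hj : Join G S x y) : Join G' S' (e x) (e y) := by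
  induction hj with
  | refl => exact ReflTransGen.refl
  | tail _ h1 ih => exact ih.tail ⟨e.map_rel_iff.2 h1.1, h _ h1.2.1, h _ h1.2.2⟩

theorem Crit.iso {W : Type*} {G' : SimpleGraph W} (e : G ≃g G') (h : Crit G) : Crit G' := by
  classical
  intro K
  obtain ⟨K', hK'⟩ := h (K.image e.symm)
  refine ⟨K'.image e, fun x y hx hy => ?_⟩
  have key : ∀ z, z ∉ K'.image e → e.symm z ∉ K' := fun z hz hz' =>
    hz (Finset.mem_image.2 ⟨_, hz', e.apply_symm_apply z⟩)
  have := Join.map_iso e (S' := (↑K : Set W)ᶜ) ?_ (hK' _ _ (key x hx) (key y hy))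
  · rwa [e.apply_symm_apply, e.apply_symm_apply] at this
  · intro z hz hz'
    exact hz (Finset.mem_coe.2 (Finset.mem_image.2 ⟨_, hz', e.symm_apply_apply z⟩))

/-- Good factors. -/
def GoodF (X : BGraph.{u}) : Prop :=
  X.G.Connected ∧ LocallyFiniteGraph X.G ∧ QuasiTransitive X.G ∧ Crit X.G

section
variable {Γ : Type*} [Group Γ] [MulAction Γ V] {𝓔 𝓕 𝓕' t s : Set (Set V)} {r : ℕ} {C D : Set V}

theorem Dat.crit_ind (h : Dat G Γ 𝓔 r) (hfull : ∀ e e' : G.end, e ≠ e' →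
    ∃ C ∈ 𝓔, LL G e C ∧ LL G e' Cᶜ) (ht : Node 𝓔 t) : Crit (G.induce (Pt G r t)) := by
  classical
  intro S
  obtain ⟨K, hK⟩ := h.crit_Pt hfull ht (S.image Subtype.val)
  refine ⟨K.preimage Subtype.val Subtype.val_injective.injOn, fun x y hx hy => ?_⟩
  rw [Finset.mem_preimage] at hx hy
  have := join_induce x.2 y.2 (hK x y x.2 y.2 hx hy)
  refine this.mono fun z hz hzS => hz ?_
  exact Finset.mem_coe.2 (Finset.mem_image_of_mem _ hzS)

theorem Dat.qt_ind (h : Dat G Γ 𝓔 r) (ht : Node 𝓔 t) : QuasiTransitive (G.induce (Pt G r t)) := by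
  obtain ⟨v0⟩ := h.hc.nonempty
  obtain ⟨s, hs, hh⟩ := orb_sites (P := Pt G r) v0 h.tr
      (fun g x => Pt_smul h.hc h.acts g) {s | Node 𝓔 s}
      (fun g x hx => Node.smul h.cut.smul hx g) (fun v => h.nodes_fin v) t ht
  refine ⟨Subtype.val ⁻¹' s, hs.preimage Subtype.val_injective.injOn, fun v => ?_⟩
  obtain ⟨u, hu, hu', g, hg, hgu⟩ := hh v v.2
  exact ⟨⟨u, hu'⟩, hu, autOf h.acts g (by rw [← Pt_smul h.hc h.acts, hg]), Subtype.ext hgu⟩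

theorem Dat.goodF (h : Dat G Γ 𝓔 r) (hfull : ∀ e e' : G.end, e ≠ e' →
    ∃ C ∈ 𝓔, LL G e C ∧ LL G e' Cᶜ) (ht : Node 𝓔 t) :
    GoodF ⟨Pt G r t, G.induce (Pt G r t)⟩ :=
  ⟨h.connected_Pt ht, lf_induce h.lf _, h.qt_ind ht, h.crit_ind hfull ht⟩

theorem Dat.goodF_hub (h : Dat G Γ 𝓔 r) (hC : C ∈ 𝓔) :
    GoodF ⟨Pt G r (StepH.hub C), G.induce (Pt G r (StepH.hub C))⟩ := by
  have hfin : Finite (Pt G r (StepH.hub C)) := by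
    rw [StepH.Pt_hub]; exact h.U_fin hC
  have hne : Nonempty (Pt G r (StepH.hub C)) := by
    rw [StepH.Pt_hub]; exact (h.U_ne hC).to_subtype
  have hU := h.U C hC
  rw [← StepH.Pt_hub] at hU
  refine ⟨⟨fun x y => (hU x x.2 y y.2).reachable_induce x.2 y.2⟩,
    lf_induce h.lf _, ⟨Set.univ, Set.finite_univ, fun v => ⟨v, trivial, RelIso.refl _, rfl⟩⟩, ?_⟩
  have := Fintype.ofFinite (Pt G r (StepH.hub C))
  exact fun K => ⟨Finset.univ, fun x y hx => absurd (Finset.mem_univ x) hx⟩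

theorem Node.restrict (hs : 𝓕 ⊆ 𝓔) (hcl : ∀ C ∈ 𝓕, Cᶜ ∈ 𝓕) (ht : Node 𝓔 t) :
    Node 𝓕 (t ∩ 𝓕) where
  sub := Set.inter_subset_right
  or C hC := (ht.or C (hs hC)).imp (fun h => ⟨h, hC⟩) fun h => ⟨h, hcl C hC⟩
  not C hC hC' := ht.not C hC.1 hC'.1
  up C hC D hD hCD := ⟨ht.up C hC.1 D (hs hD) hCD, hD⟩
  fin v := (ht.fin v).subset fun _ hC => ⟨hC.1.1, hC.2⟩

theorem fact_aux (h : Dat G Γ 𝓔 r) (hfull : ∀ e e' : G.end, e ≠ e' →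
    ∃ C ∈ 𝓔, LL G e C ∧ LL G e' Cᶜ) {F : Set (Set V)} (hFE : F ⊆ 𝓔) (hF : F.Finite)
    (hFo : ∀ C ∈ 𝓔, ∃ D ∈ F, ∃ g : Γ, g • D = C) : ∀ (n : ℕ) (𝓕 : Set (Set V)), 𝓕 ⊆ 𝓔 →
    (∀ C ∈ 𝓕, Cᶜ ∈ 𝓕) → (∀ (g : Γ), ∀ C ∈ 𝓕, g • C ∈ 𝓕) → (F \ 𝓕).ncard ≤ n → ∀ t, Node 𝓕 t →
    ∃ l : List BGraph.{u}, GoodIterAmalg ⟨Pt G r t, G.induce (Pt G r t)⟩ l ∧ (∀ X ∈ l, GoodF X) ∧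
      ∀ s, Node 𝓔 s → t ⊆ s → ∃ Y ∈ l, Nonempty (G.induce (Pt G r s) ≃g Y.G) := by
  obtain ⟨v0⟩ := h.hc.nonempty
  have base : ∀ 𝓕 : Set (Set V), 𝓕 ⊆ 𝓔 → (∀ (g : Γ), ∀ C ∈ 𝓕, g • C ∈ 𝓕) → F \ 𝓕 = ∅ →
      ∀ t, Node 𝓕 t → ∃ l : List BGraph.{u},
        GoodIterAmalg ⟨Pt G r t, G.induce (Pt G r t)⟩ l ∧ (∀ X ∈ l, GoodF X) ∧
      ∀ s, Node 𝓔 s → t ⊆ s → ∃ Y ∈ l, Nonempty (G.induce (Pt G r s) ≃g Y.G) := by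
    intro 𝓕 hs hsm hem t ht
    have : 𝓕 = 𝓔 := by
      refine hs.antisymm fun C hC => ?_
      obtain ⟨D, hD, g, rfl⟩ := hFo C hC
      exact hsm g D (by by_contra hh; exact Set.eq_empty_iff_forall_notMem.1 hem D ⟨hD, hh⟩)
    subst this
    refine ⟨[_], GoodIterAmalg.single _, ?_, fun s hs hts => ⟨_, List.mem_singleton.2 rfl, ?_⟩⟩
    · intro X hX
      rw [List.mem_singleton.1 hX]
      exact h.goodF hfull ht
    · rw [Node.ext' ht hs hts]; exact ⟨RelIso.refl _⟩
  intro n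
  induction n with
  | zero =>
    intro 𝓕 hs hcl hsm hn
    refine base 𝓕 hs hsm ?_
    rwa [Nat.le_zero, Set.ncard_eq_zero (hF.subset Set.sdiff_subset)] at hn
  | succ n ih =>
    intro 𝓕 hs hcl hsm hn t ht
    by_cases hem : F \ 𝓕 = ∅
    · exact base 𝓕 hs hsm hem t ht
    obtain ⟨D, hD, hDF⟩ := Set.nonempty_iff_ne_empty.2 hem
    set 𝓕' : Set (Set V) := 𝓕 ∪ {C | ∃ g : Γ, C = g • D ∨ C = g • Dᶜ} with h𝓕'
    have hsub : 𝓕 ⊆ 𝓕' := Set.subset_union_left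
    have hs' : 𝓕' ⊆ 𝓔 := by
      rintro C (hC | ⟨g, rfl | rfl⟩)
      · exact hs hC
      · exact h.cut.smul g _ (hFE hD)
      · exact h.cut.smul g _ (h.cut.compl _ (hFE hD))
    have hcl' : ∀ C ∈ 𝓕', Cᶜ ∈ 𝓕' := by
      rintro C (hC | ⟨g, rfl | rfl⟩)
      · exact Or.inl (hcl C hC)
      · exact Or.inr ⟨g, Or.inr (smul_compl' g D).symm⟩
      · exact Or.inr ⟨g, Or.inl (by rw [smul_compl', compl_compl])⟩
    have hsm' : ∀ (g : Γ), ∀ C ∈ 𝓕', g • C ∈ 𝓕' := by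
      rintro g C (hC | ⟨g', rfl | rfl⟩)
      · exact Or.inl (hsm g C hC)
      · exact Or.inr ⟨g * g', Or.inl (mul_smul _ _ _).symm⟩
      · exact Or.inr ⟨g * g', Or.inr (mul_smul _ _ _).symm⟩
    have hn' : (F \ 𝓕').ncard ≤ n := by
      have : (F \ 𝓕').ncard < (F \ 𝓕).ncard := by
        refine Set.ncard_lt_ncard ⟨Set.sdiff_subset_sdiff_right hsub, fun hh => ?_⟩
          (hF.subset Set.sdiff_subset)
        exact (hh ⟨hD, hDF⟩).2 (Or.inr ⟨1, Or.inl (one_smul _ _).symm⟩)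
      omega
    have hd := h.sub hs hcl hsm
    have hd' := h.sub hs' hcl' hsm'
    have hN' := hd'.nf
    have ih' := ih 𝓕' hs' hcl' hsm' hn'
    by_cases h0 : ∃ s C, Node 𝓕' s ∧ t ⊆ s ∧ MinIn s C ∧ C ∉ 𝓕
    · obtain ⟨s, C0, hsn, hts, hC0, hC0F⟩ := h0
      have hC0m := hsn.sub hC0.1
      have H : StepH G Γ 𝓕 𝓕' r t C0 := by
        refine ⟨hd, hd', hsub, ht, hC0m, hC0F, ?_, ?_⟩
        · intro C hC hCF
          have h1 := hC.resolve_left hCF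
          have h2 := hC0m.resolve_left hC0F
          obtain ⟨g, h1⟩ := h1
          obtain ⟨g0, h2⟩ := h2
          refine ⟨g * g0⁻¹, ?_⟩
          rcases h2 with rfl | rfl <;> rcases h1 with rfl | rfl
          · exact Or.inl (by rw [mul_smul, inv_smul_smul])
          · exact Or.inr (by rw [← smul_compl', mul_smul, inv_smul_smul])
          · exact Or.inr (by rw [← smul_compl', compl_compl, mul_smul, inv_smul_smul])
          · exact Or.inl (by rw [mul_smul, inv_smul_smul])
        · rwa [← Node.eq_nodeOf hN' hsn hC0 (nodeOf_node hN' hC0m)]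
      have tr : ∀ (g : Γ) (a s : Set (Set V)), Node 𝓔 s → s ∩ 𝓕' = g • a →
          ∀ l : List BGraph.{u},
          (∀ s, Node 𝓔 s → a ⊆ s → ∃ Y ∈ l, Nonempty (G.induce (Pt G r s) ≃g Y.G)) →
          ∃ Y ∈ l, Nonempty (G.induce (Pt G r s) ≃g Y.G) := by
        intro g a s hs hsa l hl
        obtain ⟨Y, hY, ⟨e⟩⟩ := hl (g⁻¹ • s) (Node.smul h.cut.smul hs g⁻¹) (by
          rw [Set.subset_smul_set_iff, inv_inv, ← hsa]
          exact Set.inter_subset_left)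
        exact ⟨Y, hY, ⟨(autOf h.acts g⁻¹ (Pt_smul h.hc h.acts g⁻¹).symm).trans e⟩⟩
      obtain ⟨l1, hl1, hg1, hc1⟩ := ih' _ H.n0
      by_cases hno : ∃ g : Γ, nodeOf 𝓕' C0ᶜ = g • nodeOf 𝓕' C0
      · obtain ⟨g1, hg⟩ := hno
        refine ⟨l1 ++ [⟨Pt G r (StepH.hub C0), G.induce (Pt G r (StepH.hub C0))⟩],
          GoodIterAmalg.step hl1 (GoodIterAmalg.single _) (H.caseI hg), ?_, ?_⟩
        · intro X hX
          rcases List.mem_append.1 hX with hX | hX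
          · exact hg1 X hX
          · rw [List.mem_singleton.1 hX]
            exact hd'.goodF_hub hC0m
        · intro s hs hts
          have h1 : Node 𝓕' (s ∩ 𝓕') := Node.restrict hs' hcl' hs
          have h2 : t ⊆ s ∩ 𝓕' := Set.subset_inter hts (ht.sub.trans hsub)
          have h3 : ∃ g : Γ, s ∩ 𝓕' = g • nodeOf 𝓕' C0 := by
            obtain ⟨g, -, h3 | h3⟩ := H.two v0 h1 h2
            · exact ⟨g, h3⟩
            · exact ⟨g * g1, by rw [h3, hg, mul_smul]⟩
          obtain ⟨g, h3⟩ := h3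
          obtain ⟨Y, hY, e⟩ := tr g _ s hs h3 l1 hc1
          exact ⟨Y, List.mem_append_left _ hY, e⟩
      · obtain ⟨l2, hl2, hg2, hc2⟩ := ih' _ H.n1
        refine ⟨l1 ++ l2, GoodIterAmalg.step hl1 hl2 (H.caseII hno), ?_, ?_⟩
        · intro X hX
          rcases List.mem_append.1 hX with hX | hX
          · exact hg1 X hX
          · exact hg2 X hX
        · intro s hs hts
          have h1 : Node 𝓕' (s ∩ 𝓕') := Node.restrict hs' hcl' hs
          have h2 : t ⊆ s ∩ 𝓕' := Set.subset_inter hts (ht.sub.trans hsub)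
          obtain ⟨g, -, h3 | h3⟩ := H.two v0 h1 h2
          · obtain ⟨Y, hY, e⟩ := tr g _ s hs h3 l1 hc1
            exact ⟨Y, List.mem_append_left _ hY, e⟩
          · obtain ⟨Y, hY, e⟩ := tr g _ s hs h3 l2 hc2
            exact ⟨Y, List.mem_append_right _ hY, e⟩
    · push Not at h0
      have hsn := extN_node hN' hsub ht hcl v0
      have hts := sub_extN (𝓕' := 𝓕') hsub ht v0
      set s := extN 𝓕' t v0 with hsdef
      have hPt : Pt G r s = Pt G r t := by
        refine Set.Subset.antisymm (StepH.Pt_sub hts) fun v hv C hC => ?_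
        obtain ⟨E, hE, hEC⟩ := Node.exists_min hN' hsn hC
        have h1 := h0 s E hsn hts hE
        exact ball_mono r hEC (hv E (mem_of_sub hsub ht hsn hts hE.1 h1))
      obtain ⟨l, hl, hg, hcc⟩ := ih' s hsn
      rw [hPt] at hl
      refine ⟨l, hl, hg, fun s' hs1 hts' => hcc s' hs1 ?_⟩
      have h1 : Node 𝓕' (s' ∩ 𝓕') := Node.restrict hs' hcl' hs1
      have h2 : t ⊆ s' ∩ 𝓕' := Set.subset_inter hts' (ht.sub.trans hsub)
      have h3 : s' ∩ 𝓕' = s := by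
        by_contra hne
        obtain ⟨C, hC, hCs⟩ := Node.exists_pe v0 hN' hsn h1 hne
        exact hCs (hts (mem_of_sub hsub ht h1 h2 hC.1 (h0 _ C h1 h2 hC)))
      rw [← h3]; exact Set.inter_subset_left

theorem GoodAmalgStep.iso {X Y Z Z' : BGraph.{u}} (h : GoodAmalgStep X Y Z) (e : Z'.G ≃g Z.G) :
    GoodAmalgStep X Y Z' := by
  obtain ⟨D, h1, h2, h3, h4, ⟨e'⟩⟩ := h
  exact ⟨D, h1, h2, h3, h4, ⟨e.trans e'⟩⟩

theorem GoodIterAmalg.iso {Z Z' : BGraph.{u}} {l : List BGraph.{u}} (h : GoodIterAmalg Z l)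
    (e : Z'.G ≃g Z.G) : GoodIterAmalg Z' l ∨ l = [Z] := by
  cases h with
  | single => exact Or.inr rfl
  | step h1 h2 h3 => exact Or.inl (GoodIterAmalg.step h1 h2 (GoodAmalgStep.iso h3 e))

/-- The terminal factorisation of `G`. -/
theorem terminal_fact (h : Dat G Γ 𝓔 r) (hfull : ∀ e e' : G.end, e ≠ e' →
    ∃ C ∈ 𝓔, LL G e C ∧ LL G e' Cᶜ) (hqt : QuasiTransitive G) :
    ∃ l : List BGraph.{u}, IsFactorisation ⟨V, G⟩ l ∧ IsTerminal l ∧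
      ∀ s, Node 𝓔 s → ∃ Y ∈ l, Nonempty (G.induce (Pt G r s) ≃g Y.G) := by
  obtain ⟨F, hFE, hF, hFo⟩ := h.cut.orbits h.hc h.lf h.acts h.tr
  obtain ⟨l, hl, hg, hcc⟩ := fact_aux h hfull hFE hF hFo _ ∅ (Set.empty_subset _)
    (fun C hC => absurd hC (Set.notMem_empty C)) (fun g C hC => absurd hC (Set.notMem_empty C))
    le_rfl ∅ ⟨subset_rfl, fun C hC => absurd hC (Set.notMem_empty C),
      fun C hC => absurd hC (Set.notMem_empty C), fun C hC => absurd hC (Set.notMem_empty C),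
      fun v => Set.finite_empty.subset fun C hC => hC.1⟩
  have hPt : ∀ v, v ∈ Pt G r (∅ : Set (Set V)) := fun v C hC => absurd hC (Set.notMem_empty C)
  let e : G ≃g G.induce (Pt G r (∅ : Set (Set V))) :=
    { toFun := fun v => ⟨v, hPt v⟩
      invFun := fun v => v.1
      left_inv := fun v => rfl
      right_inv := fun v => rfl
      map_rel_iff' := by intro a b; rfl }
  rcases GoodIterAmalg.iso (Z' := ⟨V, G⟩) hl e with h1 | h1
  · refine ⟨l, ⟨fun X hX => ⟨(hg X hX).1, (hg X hX).2.1, (hg X hX).2.2.1⟩, h1⟩,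
      fun X hX => Crit.subsingleton (hg X hX).2.2.2, fun s hs => hcc s hs (Set.empty_subset _)⟩
  · subst h1
    refine ⟨[⟨V, G⟩], ⟨?_, GoodIterAmalg.single _⟩, ?_, ?_⟩
    · intro X hX
      rw [List.mem_singleton.1 hX]
      exact ⟨h.hc, h.lf, hqt⟩
    · intro X hX
      rw [List.mem_singleton.1 hX]
      exact Crit.subsingleton (Crit.iso e.symm (hg _ (List.mem_singleton.2 rfl)).2.2.2)
    · intro s hs
      obtain ⟨Y, hY, ⟨e'⟩⟩ := hcc s hs (Set.empty_subset _)
      rw [List.mem_singleton.1 hY] at e'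
      exact ⟨_, List.mem_singleton.2 rfl, ⟨e'.trans e.symm⟩⟩

end

end TA
end

section
open Relation SimpleGraph

namespace TA

/-! ### Coarse equivalences -/

section
variable {V W X : Type*} {G : SimpleGraph V} {H : SimpleGraph W} {K : SimpleGraph X}

theorem edist_tri {a b c : V} {m n k : ℕ} (h1 : G.edist a b ≤ m) (h2 : G.edist b c ≤ n)
    (hk : m + n ≤ k) : G.edist a c ≤ k := by
  refine (SimpleGraph.edist_triangle (v := b)).trans ((add_le_add h1 h2).trans ?_)
  exact_mod_cast hk

theorem edist_symm {a b : V} {m : ℕ} (h1 : G.edist a b ≤ m) : G.edist b a ≤ m := by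
  rwa [SimpleGraph.edist_comm]

theorem edist_mono {a b : V} {m n : ℕ} (h1 : G.edist a b ≤ m) (h : m ≤ n) : G.edist a b ≤ n :=
  h1.trans (by exact_mod_cast h)

theorem edist_self' {a : V} {m : ℕ} : G.edist a a ≤ m := by
  rw [SimpleGraph.edist_self]; exact zero_le

theorem edist_adj {a b : V} (h : G.Adj a b) {m : ℕ} (hm : 1 ≤ m) : G.edist a b ≤ m := by
  rw [SimpleGraph.edist_eq_one_iff_adj.2 h]
  exact_mod_cast hm

theorem exists_walk_of_edist {a b : V} {m : ℕ} (h : G.edist a b ≤ m) :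
    ∃ p : G.Walk a b, p.length ≤ m := by
  have hr : G.Reachable a b := by
    by_contra hr
    rw [SimpleGraph.edist_eq_top_of_not_reachable hr] at h
    exact absurd h (by simp)
  obtain ⟨p, hp⟩ := hr.exists_walk_length_eq_edist
  exact ⟨p, by rw [← hp] at h; exact_mod_cast h⟩

theorem edist_of_walk {a b : V} (p : G.Walk a b) {m : ℕ} (h : p.length ≤ m) : G.edist a b ≤ m :=
  (SimpleGraph.edist_le p).trans (by exact_mod_cast h)

theorem edist_of_dist (hc : G.Connected) {a b : V} {m : ℕ} (h : G.dist a b ≤ m) :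
    G.edist a b ≤ m := by
  obtain ⟨p, hp⟩ := hc.exists_walk_length_eq_dist a b
  exact edist_of_walk p (hp ▸ h)

theorem dist_of_edist {a b : V} {m : ℕ} (h : G.edist a b ≤ m) : G.dist a b ≤ m := by
  obtain ⟨p, hp⟩ := exists_walk_of_edist h
  exact (SimpleGraph.dist_le p).trans hp

theorem edist_lip {f : V → W} {c : ℕ} (hf : ∀ x y, G.Adj x y → H.edist (f x) (f y) ≤ c) {x y : V}
    {n : ℕ} (h : G.edist x y ≤ n) : H.edist (f x) (f y) ≤ (c * n : ℕ) := by
  obtain ⟨p, hp⟩ := exists_walk_of_edist h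
  clear h
  have : H.edist (f x) (f y) ≤ (c * p.length : ℕ) := by
    clear hp
    induction p with
    | nil => exact edist_self'
    | cons h p ih =>
      refine edist_tri (hf _ _ h) ih ?_
      rw [Walk.length_cons, mul_add, mul_one, add_comm]
  exact edist_mono this (Nat.mul_le_mul_left c hp)

/-- Coarse equivalence. -/
def CoarseEq (G : SimpleGraph V) (H : SimpleGraph W) : Prop :=
  ∃ (f : V → W) (h : W → V) (c : ℕ), (∀ x y, G.Adj x y → H.edist (f x) (f y) ≤ c) ∧
    (∀ x y, H.Adj x y → G.edist (h x) (h y) ≤ c) ∧ (∀ x, G.edist (h (f x)) x ≤ c) ∧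
    ∀ y, H.edist (f (h y)) y ≤ c

theorem CoarseEq.symm (h : CoarseEq G H) : CoarseEq H G := by
  obtain ⟨f, h, c, h1, h2, h3, h4⟩ := h
  exact ⟨h, f, c, h2, h1, h4, h3⟩

theorem CoarseEq.trans (h : CoarseEq G H) (h' : CoarseEq H K) : CoarseEq G K := by
  obtain ⟨f, h, c, h1, h2, h3, h4⟩ := h
  obtain ⟨f', h', c', h1', h2', h3', h4'⟩ := h'
  refine ⟨f' ∘ f, h ∘ h', c' * c + c * c' + c + c', fun x y hxy => ?_, fun x y hxy => ?_,
    fun x => ?_, fun x => ?_⟩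
  · exact edist_mono (edist_lip h1' (h1 x y hxy)) (by omega)
  · exact edist_mono (edist_lip h2 (h2' x y hxy)) (by omega)
  · exact edist_tri (edist_lip h2 (h3' (f x))) (h3 x) (by omega)
  · exact edist_tri (edist_lip h1' (h4 (h' x))) (h4' x) (by omega)

theorem CoarseEq.qi (h : CoarseEq G H) (hG : G.Connected) (hH : H.Connected) :
    QuasiIsometric G H := by
  obtain ⟨f, h, c, h1, h2, h3, h4⟩ := h
  have hd : ∀ {a b : V}, G.edist a b ≤ G.dist a b := fun {a b} => edist_of_dist hG le_rfl
  have hd' : ∀ {a b : W}, H.edist a b ≤ H.dist a b := fun {a b} => edist_of_dist hH le_rfl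
  refine ⟨c + 1, 2 * c, f, by simp, by positivity, fun u v => ⟨?_, ?_⟩, fun w => ⟨h w, ?_⟩⟩
  · have e1 := edist_lip h2 (hd' (a := f u) (b := f v))
    have e2 := edist_tri (edist_symm (h3 u)) e1 le_rfl
    have e3 := dist_of_edist (edist_tri e2 (h3 v) le_rfl)
    have e4 : (G.dist u v : ℝ) ≤ c + c * H.dist (f u) (f v) + c := by exact_mod_cast e3
    have hc : (0 : ℝ) < c + 1 := by positivity
    have hnn : (0 : ℝ) ≤ H.dist (f u) (f v) := by positivity
    have hcn : (0 : ℝ) ≤ c := by positivity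
    rw [sub_le_iff_le_add, inv_mul_le_iff₀ hc]
    nlinarith
  · have e1 := dist_of_edist (edist_lip h1 (hd (a := u) (b := v)))
    have e2 : (H.dist (f u) (f v) : ℝ) ≤ c * G.dist u v := by exact_mod_cast e1
    have hnn : (0 : ℝ) ≤ G.dist u v := by positivity
    have hcn : (0 : ℝ) ≤ c := by positivity
    nlinarith
  · have e1 := dist_of_edist (edist_symm (h4 w))
    have e2 : (H.dist w (f (h w)) : ℝ) ≤ c := by exact_mod_cast e1
    have hcn : (0 : ℝ) ≤ c := by positivity
    linarith

theorem coarseEq_of_qi (h : QuasiIsometric G H) (hG : G.Connected) (hH : H.Connected) :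
    CoarseEq G H := by
  obtain ⟨γ, c, f, hγ, hc, h1, h2⟩ := h
  choose g hg using h2
  have hγ0 : 0 < γ := by linarith
  have low : ∀ u v, (G.dist u v : ℝ) ≤ γ * (H.dist (f u) (f v) + c) := by
    intro u v
    have := (h1 u v).1
    rw [sub_le_iff_le_add, inv_mul_le_iff₀ hγ0] at this
    exact this
  obtain ⟨n, hn⟩ := exists_nat_ge (γ + c + γ * (1 + 2 * c + c))
  have hn1 : γ + c ≤ n := by
    have : 0 ≤ γ * (1 + 2 * c + c) := by positivity
    linarith
  have hn2 : γ * (1 + 2 * c + c) ≤ n := by linarith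
  have hgf : ∀ a b k, (H.dist a b : ℝ) ≤ k → (H.dist (f (g a)) b : ℝ) ≤ k + c := by
    intro a b k hab
    have e1 := hH.dist_triangle (u := f (g a)) (v := a) (w := b)
    have e2 : (H.dist (f (g a)) b : ℝ) ≤ H.dist (f (g a)) a + H.dist a b := by exact_mod_cast e1
    rw [SimpleGraph.dist_comm] at e2
    have e3 := hg a
    rw [SimpleGraph.dist_comm (u := f (g a)) (v := a)] at e2
    rw [SimpleGraph.dist_comm (u := b)] at e2
    linarith
  refine ⟨f, g, n, fun x y hxy => ?_, fun x y hxy => ?_, fun x => ?_, fun y => ?_⟩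
  · refine edist_of_dist hH ?_
    have := (h1 x y).2
    rw [SimpleGraph.dist_eq_one_iff_adj.2 hxy] at this
    have : (H.dist (f x) (f y) : ℝ) ≤ n := by push_cast at this; linarith
    exact_mod_cast this
  · refine edist_of_dist hG ?_
    have e0 : (H.dist x y : ℝ) ≤ 1 := by
      rw [SimpleGraph.dist_eq_one_iff_adj.2 hxy]; norm_num
    have e1 := hgf x y 1 e0
    rw [SimpleGraph.dist_comm] at e1
    have e2 := hgf y _ _ e1
    rw [SimpleGraph.dist_comm] at e2
    have e3 := low (g x) (g y)
    have : (G.dist (g x) (g y) : ℝ) ≤ n := by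
      refine e3.trans (le_trans ?_ hn2)
      refine mul_le_mul_of_nonneg_left ?_ hγ0.le
      linarith
    exact_mod_cast this
  · refine edist_of_dist hG ?_
    have e3 := low (g (f x)) x
    have e2 := hg (f x)
    rw [SimpleGraph.dist_comm] at e2
    have : (G.dist (g (f x)) x : ℝ) ≤ n := by
      refine e3.trans (le_trans ?_ hn2)
      refine mul_le_mul_of_nonneg_left ?_ hγ0.le
      linarith
    exact_mod_cast this
  · refine edist_of_dist hH ?_
    have e2 := hg y
    rw [SimpleGraph.dist_comm] at e2
    have : (H.dist (f (g y)) y : ℝ) ≤ n := by linarith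
    exact_mod_cast this

end

section
variable {Γ : Type u} [Group Γ] {S : Set Γ}

theorem cay_mul {g s : Γ} (hs : s ∈ S) : (cayleyGraph Γ S).edist g (g * s) ≤ (1 : ℕ) := by
  by_cases h : g = g * s
  · rw [← h]; exact edist_self'
  · refine edist_adj ?_ le_rfl
    rw [cayleyGraph, SimpleGraph.fromRel_adj]
    exact ⟨h, Or.inl (by rwa [inv_mul_cancel_left])⟩

theorem cay_adj {g h : Γ} (ha : (cayleyGraph Γ S).Adj g h) :
    (∃ s ∈ S, h = g * s) ∨ (∃ s ∈ S, g = h * s) := by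
  rw [cayleyGraph, SimpleGraph.fromRel_adj] at ha
  rcases ha.2 with h1 | h1
  · exact Or.inl ⟨_, h1, (mul_inv_cancel_left g h).symm⟩
  · exact Or.inr ⟨_, h1, (mul_inv_cancel_left h g).symm⟩

/-- A map out of a Cayley graph is Lipschitz if it is so on generators. -/
theorem cay_lip {W : Type*} {K : SimpleGraph W} {f : Γ → W} {c : ℕ}
    (hf : ∀ g, ∀ s ∈ S, K.edist (f g) (f (g * s)) ≤ c) (g h : Γ)
    (ha : (cayleyGraph Γ S).Adj g h) : K.edist (f g) (f h) ≤ c := by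
  rcases cay_adj ha with ⟨s, hs, rfl⟩ | ⟨s, hs, rfl⟩
  · exact hf g s hs
  · exact edist_symm (hf h s hs)

theorem cay_left {a g h : Γ} {n : ℕ} (hd : (cayleyGraph Γ S).edist g h ≤ n) :
    (cayleyGraph Γ S).edist (a * g) (a * h) ≤ n := by
  have := edist_lip (H := cayleyGraph Γ S) (f := fun x => a * x) (c := 1) (cay_lip fun x s hs => by
    rw [← mul_assoc]; exact cay_mul hs) hd
  rwa [one_mul] at this

theorem cay_connected (hS : Subgroup.closure S = ⊤) : (cayleyGraph Γ S).Connected := by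
  have key : ∀ g : Γ, ∃ n : ℕ, (cayleyGraph Γ S).edist 1 g ≤ n := by
    intro g
    have hg : g ∈ Subgroup.closure S := hS ▸ Subgroup.mem_top g
    induction hg using Subgroup.closure_induction with
    | mem x hx => exact ⟨1, by have := cay_mul (g := 1) hx; rwa [one_mul] at this⟩
    | one => exact ⟨0, edist_self'⟩
    | mul x y _ _ hx hy =>
      obtain ⟨n, hn⟩ := hx
      obtain ⟨m, hm⟩ := hy
      refine ⟨n + m, edist_tri hn ?_ le_rfl⟩
      have := cay_left (a := x) hm
      rwa [mul_one] at this
    | inv x _ hx =>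
      obtain ⟨n, hn⟩ := hx
      refine ⟨n, edist_symm ?_⟩
      have := cay_left (a := x⁻¹) hn
      rwa [mul_one, inv_mul_cancel] at this
  have : Nonempty Γ := ⟨1⟩
  refine ⟨fun g h => ?_⟩
  obtain ⟨n, hn⟩ := key g
  obtain ⟨m, hm⟩ := key h
  obtain ⟨p, -⟩ := exists_walk_of_edist (edist_tri (edist_symm hn) hm le_rfl)
  exact ⟨p⟩

/-- Balls in a finitely generated Cayley graph are finite. -/
theorem cay_ball (hS : S.Finite) (n : ℕ) : {g : Γ | (cayleyGraph Γ S).edist 1 g ≤ n}.Finite := by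
  induction n with
  | zero =>
    refine (Set.finite_singleton (1 : Γ)).subset fun g hg => ?_
    obtain ⟨p, hp⟩ := exists_walk_of_edist hg
    exact (Walk.eq_of_length_eq_zero (Nat.le_zero.1 hp)).symm
  | succ n ih =>
    refine ((ih.union (Set.Finite.image2 (fun g s => g * s) ih hS)).union
      (Set.Finite.image2 (fun g s => g * s⁻¹) ih hS)).subset fun g hg => ?_
    obtain ⟨p, hp⟩ := exists_walk_of_edist hg
    rw [← p.reverse_reverse] at hp
    rw [Walk.length_reverse] at hp
    cases hq : p.reverse with
    | nil => exact Or.inl (Or.inl edist_self')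
    | @cons _ b _ h q =>
      rw [hq, Walk.length_cons] at hp
      have hb : (cayleyGraph Γ S).edist 1 b ≤ n := edist_symm (edist_of_walk q (by omega))
      rcases cay_adj h with ⟨s, hs, h1⟩ | ⟨s, hs, h1⟩
      · exact Or.inr ⟨b, hb, s, hs, by rw [h1]; simp⟩
      · exact Or.inl (Or.inr ⟨b, hb, s, hs, h1.symm⟩)

end

end TA
end

section
open Relation SimpleGraph

namespace TA

/-! ### Trees of groups and free products -/

section
open Monoid

variable {N : Type u} {J : Type} [DecidableEq J] {Q : ℕ} {H : J → Type u} [∀ j, Group (H j)]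
  {ty : N → J} {t0 : N}

/-- The free product of `Q` copies of each group `H j`. -/
abbrev FP (H : J → Type u) [∀ j, Group (H j)] (Q : ℕ) : Type u :=
  CoprodI (fun a : J × Fin Q => H a.1)

theorem rec_lt {A : Type*} (t0 : N) (dp : N → ℕ) (np : N → N)
    (hnp : ∀ t, t ≠ t0 → dp (np t) < dp t) (a0 : A) (F : N → A → A) :
    ∃ g : N → A, g t0 = a0 ∧ ∀ t, t ≠ t0 → g t = F t (g (np t)) := by
  classical
  let wf : WellFounded (fun x y : N => dp x < dp y) := InvImage.wf dp wellFounded_lt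
  let g : N → A := wf.fix (C := fun _ => A) fun x ih => if hx : x = t0 then a0 else F x (ih (np x) (hnp x hx))
  refine ⟨g, ?_, ?_⟩
  · show wf.fix (C := fun _ => A) _ t0 = a0
    rw [WellFounded.fix_eq, dif_pos rfl]
  · intro x hx
    show wf.fix (C := fun _ => A) _ x = _
    rw [WellFounded.fix_eq, dif_neg hx]

theorem fp_tree (dp : N → ℕ) (slot : N → Σ p, H (ty p)) (ix : N → J × Fin (Q + 1))
    (hdp : ∀ t, t ≠ t0 → dp (slot t).1 < dp t)
    (hv : ∀ t, t ≠ t0 → (slot t).2 ≠ 1 ∨ (slot t).1 = t0)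
    (hix : ∀ t, t ≠ t0 → ix t ≠ (ty (slot t).1, 0))
    (hty : ∀ t, t ≠ t0 → (ix t).1 = ty t)
    (hinj : ∀ t t', t ≠ t0 → t' ≠ t0 → slot t = slot t' → ix t = ix t' → t = t')
    (hsurj : ∀ (x : Σ p, H (ty p)) y, (x.2 ≠ 1 ∨ x.1 = t0) → y ≠ (ty x.1, 0) →
      ∃ t, t ≠ t0 ∧ slot t = x ∧ ix t = y) :
    ∃ (lab : N → Fin (Q + 1)) (ψ : (Σ t, H (ty t)) → FP H (Q + 1)),
      (∀ t h, ψ ⟨t, h⟩ = ψ ⟨t, 1⟩ *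
        CoprodI.of (M := fun a : J × Fin (Q + 1) => H a.1) (i := (ty t, lab t)) h) ∧
      (∀ t, t ≠ t0 → ψ ⟨t, 1⟩ = ψ (slot t)) ∧
      (∀ x y, (x.2 ≠ 1 ∨ x.1 = t0) → (y.2 ≠ 1 ∨ y.1 = t0) → ψ x = ψ y → x = y) ∧
      (∀ x β, (x.2 ≠ 1 ∨ x.1 = t0) → β ≠ (ty x.1, lab x.1) →
        ∃ t, t ≠ t0 ∧ slot t = x ∧ (ty t, lab t) = β) ∧
      ∀ g, ∃ x, (x.2 ≠ 1 ∨ x.1 = t0) ∧ ψ x = g := by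
  classical
  obtain ⟨lab, hl0, hl⟩ := rec_lt t0 dp (fun t => (slot t).1) hdp (0 : Fin (Q + 1))
    (fun t a => (Equiv.swap (ty (slot t).1, (0 : Fin (Q + 1))) (ty (slot t).1, a) (ix t)).2)
  have hsw : ∀ (j : J) (a b : Fin (Q + 1)) y, (Equiv.swap (j, a) (j, b) y).1 = y.1 := by
    intro j a b y
    rw [Equiv.swap_apply_def]
    split_ifs with h1 h2
    · rw [h1]
    · rw [h2]
    · rfl
  have hα : ∀ t, t ≠ t0 → (ty t, lab t) =
      Equiv.swap (ty (slot t).1, (0 : Fin (Q + 1))) (ty (slot t).1, lab (slot t).1) (ix t) := by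
    intro t ht
    refine Prod.ext ?_ (hl t ht)
    rw [hsw]; exact (hty t ht).symm
  have hαne : ∀ t, t ≠ t0 → (ty t, lab t) ≠ (ty (slot t).1, lab (slot t).1) := by
    intro t ht h
    rw [hα t ht] at h
    have := (Equiv.swap_apply_eq_iff).1 h
    rw [Equiv.swap_apply_right] at this
    exact hix t ht this
  obtain ⟨B, hB0, hB⟩ := rec_lt (A := FP H (Q + 1)) t0 dp (fun t => (slot t).1) hdp 1
    (fun t b => b * CoprodI.of (M := fun a : J × Fin (Q + 1) => H a.1)
      (i := (ty (slot t).1, lab (slot t).1)) (slot t).2)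
  set ψ : (Σ t, H (ty t)) → FP H (Q + 1) := fun x => B x.1 *
    CoprodI.of (M := fun a : J × Fin (Q + 1) => H a.1) (i := (ty x.1, lab x.1)) x.2 with hψ
  have hψ1 : ∀ t, ψ ⟨t, 1⟩ = B t := by
    intro t
    simp only [hψ]
    rw [map_one, mul_one]
  have hex : ∀ x β, (x.2 ≠ 1 ∨ x.1 = t0) → β ≠ (ty x.1, lab x.1) →
      ∃ t, t ≠ t0 ∧ slot t = x ∧ (ty t, lab t) = β := by
    intro x β hx hβ
    obtain ⟨t, ht, h1, h2⟩ := hsurj x (Equiv.swap (ty x.1, (0 : Fin (Q + 1))) (ty x.1, lab x.1) β)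
      hx (fun h => hβ (by
        have := (Equiv.swap_apply_eq_iff).1 h
        rwa [Equiv.swap_apply_left] at this))
    refine ⟨t, ht, h1, ?_⟩
    rw [hα t ht, h1, h2, Equiv.swap_apply_self]
  -- the words
  have hw : ∀ n t, dp t ≤ n → ∃ w : CoprodI.Word (fun a : J × Fin (Q + 1) => H a.1),
      w.prod = (B t)⁻¹ ∧ w.fstIdx ≠ some (ty t, lab t) := by
    intro n
    induction n with
    | zero =>
      intro t ht
      have : t = t0 := by
        by_contra h
        have := hdp t h
        omega
      subst this
      exact ⟨CoprodI.Word.empty, by rw [CoprodI.Word.prod_empty, hB0, inv_one], by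
        simp [CoprodI.Word.fstIdx, CoprodI.Word.empty]⟩
    | succ n ih =>
      intro t ht
      by_cases h0 : t = t0
      · subst h0
        exact ⟨CoprodI.Word.empty, by rw [CoprodI.Word.prod_empty, hB0, inv_one], by
          simp [CoprodI.Word.fstIdx, CoprodI.Word.empty]⟩
      · obtain ⟨w, hw1, hw2⟩ := ih (slot t).1 (by have := hdp t h0; omega)
        by_cases h1 : (slot t).2 = 1
        · have h2 := (hv t h0).resolve_left (fun h => h h1)
          refine ⟨CoprodI.Word.empty, ?_, by
            simp [CoprodI.Word.fstIdx, CoprodI.Word.empty]⟩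
          rw [CoprodI.Word.prod_empty, hB t h0, h1, map_one, mul_one, h2, hB0, inv_one]
        · refine ⟨CoprodI.Word.cons (i := (ty (slot t).1, lab (slot t).1)) ((slot t).2)⁻¹ w hw2
            (inv_ne_one.2 h1), ?_, ?_⟩
          · rw [CoprodI.Word.prod_cons, hw1, hB t h0, mul_inv_rev, map_inv]
          · rw [CoprodI.Word.fstIdx_cons]
            intro h
            exact hαne t h0 (Option.some.inj h).symm
  have hpinj : ∀ w w' : CoprodI.Word (fun a : J × Fin (Q + 1) => H a.1), w.prod = w'.prod →
      w = w' := fun w w' h => CoprodI.Word.equiv.symm.injective h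
  have hlist : ∀ x : Σ t, H (ty t), x.2 ≠ 1 → ∃ w w' : CoprodI.Word (fun a : J × Fin (Q + 1) => H a.1),
      w.prod = (ψ x)⁻¹ ∧ w'.prod = (B x.1)⁻¹ ∧
      w.toList = ⟨(ty x.1, lab x.1), (x.2)⁻¹⟩ :: w'.toList := by
    intro x hx
    obtain ⟨w, hw1, hw2⟩ := hw _ x.1 le_rfl
    refine ⟨CoprodI.Word.cons (i := (ty x.1, lab x.1)) (x.2)⁻¹ w hw2 (inv_ne_one.2 hx), w, ?_, hw1,
      rfl⟩
    rw [CoprodI.Word.prod_cons, hw1, hψ, mul_inv_rev, map_inv]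
  have hψs : ∀ t, t ≠ t0 → B t = ψ (slot t) := fun t ht => hB t ht
  have hψ00 : ∀ x : Σ t, H (ty t), x.2 = 1 → x.1 = t0 → ψ x = 1 := by
    intro x h1 h2
    simp only [hψ]
    rw [h1, h2, map_one, mul_one, hB0]
  have hne1 : ∀ x : Σ t, H (ty t), x.2 ≠ 1 → ψ x ≠ 1 := by
    intro x hx h
    obtain ⟨w, w', h1, h2, h3⟩ := hlist x hx
    have := hpinj w CoprodI.Word.empty (by rw [h1, h, CoprodI.Word.prod_empty, inv_one])
    rw [this] at h3
    simp [CoprodI.Word.empty] at h3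
  have hinjψ : ∀ n, ∀ x y : Σ t, H (ty t), dp x.1 + dp y.1 ≤ n → (x.2 ≠ 1 ∨ x.1 = t0) →
      (y.2 ≠ 1 ∨ y.1 = t0) → ψ x = ψ y → x = y := by
    intro n
    induction n using Nat.strong_induction_on with
    | _ n ih =>
    intro x y hn hx hy hxy
    have hext : ∀ x y : Σ t, H (ty t), x.1 = y.1 → x.2 = 1 → y.2 = 1 → x = y := by
      rintro ⟨t, h⟩ ⟨t', h'⟩ h1 h2 h3
      simp only at h1 h2 h3
      subst h1
      rw [h2, h3]
    by_cases hx1 : x.2 = 1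
    · have hx0 := hx.resolve_left (fun h => h hx1)
      by_cases hy1 : y.2 = 1
      · have hy0 := hy.resolve_left (fun h => h hy1)
        exact hext x y (hx0.trans hy0.symm) hx1 hy1
      · exact absurd (hxy ▸ hψ00 x hx1 hx0) (hne1 y hy1)
    · by_cases hy1 : y.2 = 1
      · have hy0 := hy.resolve_left (fun h => h hy1)
        exact absurd (hxy ▸ hψ00 y hy1 hy0) (hne1 x hx1)
      · obtain ⟨w, w', h1, h2, h3⟩ := hlist x hx1
        obtain ⟨v, v', g1, g2, g3⟩ := hlist y hy1
        have hwv : w = v := hpinj w v (by rw [h1, g1, hxy])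
        rw [hwv, g3] at h3
        obtain ⟨h4, h5⟩ := List.cons.inj h3
        have hB' : B x.1 = B y.1 := by
          have : v' = w' := CoprodI.Word.ext h5
          rw [← this, g2] at h2
          exact (inv_injective h2).symm
        have hα' : (ty y.1, lab y.1) = (ty x.1, lab x.1) := (Sigma.mk.inj h4).1
        have hnode : x.1 = y.1 := by
          by_cases hx0 : x.1 = t0
          · by_cases hy0 : y.1 = t0
            · rw [hx0, hy0]
            · exfalso
              have e1 := ih (dp x.1 + dp (slot y.1).1) (by have := hdp _ hy0; omega) ⟨x.1, 1⟩
                (slot y.1) le_rfl (Or.inr hx0) (hv _ hy0) (by rw [hψ1, hB', hψs _ hy0])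
              have := hαne _ hy0
              rw [← e1] at this
              exact this hα'
          · by_cases hy0 : y.1 = t0
            · exfalso
              have e1 := ih (dp (slot x.1).1 + dp y.1) (by have := hdp _ hx0; omega) (slot x.1)
                ⟨y.1, 1⟩ le_rfl (hv _ hx0) (Or.inr hy0) (by rw [hψ1, ← hB', hψs _ hx0])
              have := hαne _ hx0
              rw [e1] at this
              exact this hα'.symm
            · have e1 := ih (dp (slot x.1).1 + dp (slot y.1).1)
                (by have := hdp _ hx0; have := hdp _ hy0; omega) (slot x.1)
                (slot y.1) le_rfl (hv _ hx0) (hv _ hy0) (by rw [← hψs _ hx0, ← hψs _ hy0, hB'])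
              refine hinj _ _ hx0 hy0 e1 ?_
              rw [hα _ hx0, hα _ hy0, e1] at hα'
              exact (Equiv.injective _ hα').symm
        clear h3 h5 hα' hB' h1 g1 g3 h2 g2 hxy
        obtain ⟨t, h⟩ := x
        obtain ⟨t', h'⟩ := y
        simp only at hnode
        subst hnode
        have h6 : h'⁻¹ = h⁻¹ := eq_of_heq (Sigma.mk.inj h4).2
        rw [inv_injective h6]
  have hnorm : ∀ x : Σ t, H (ty t), ∃ x' : Σ t, H (ty t), (x'.2 ≠ 1 ∨ x'.1 = t0) ∧ ψ x' = ψ x := by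
    rintro ⟨t, h⟩
    by_cases hh : h ≠ 1 ∨ t = t0
    · exact ⟨⟨t, h⟩, hh, rfl⟩
    · rw [not_or, not_not] at hh
      obtain ⟨rfl, h0⟩ := hh
      exact ⟨slot t, hv t h0, by rw [hψ1, hψs t h0]⟩
  refine ⟨lab, ψ, ?_, ?_, ?_, hex, ?_⟩
  · intro t h
    rw [hψ1]
  · intro t ht
    rw [hψ1, hψs t ht]
  · intro x y hx hy h
    exact hinjψ _ x y le_rfl hx hy h
  · have key : ∀ g : FP H (Q + 1), ∀ x, ∃ y, ψ y = ψ x * g := by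
      intro g
      induction g using CoprodI.induction_on with
      | one => exact fun x => ⟨x, (mul_one _).symm⟩
      | mul a b ha hb =>
        intro x
        obtain ⟨y, hy⟩ := ha x
        obtain ⟨z, hz⟩ := hb y
        exact ⟨z, by rw [hz, hy, mul_assoc]⟩
      | of β h =>
        intro x
        obtain ⟨x', hx', h1⟩ := hnorm x
        rw [← h1]
        by_cases hβ : β = (ty x'.1, lab x'.1)
        · subst hβ
          refine ⟨⟨x'.1, x'.2 * h⟩, ?_⟩
          simp only [hψ]
          rw [map_mul, mul_assoc]
        · obtain ⟨t, ht, h2, h3⟩ := hex x' β hx' hβ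
          subst h3
          refine ⟨⟨t, h⟩, ?_⟩
          rw [← h2, ← hψs t ht]
    intro g
    obtain ⟨y, hy⟩ := key g ⟨t0, 1⟩
    obtain ⟨x, hx, h1⟩ := hnorm y
    refine ⟨x, hx, ?_⟩
    rw [h1, hy, hψ1, hB0, one_mul]

end

end TA
end

section
open Relation SimpleGraph

namespace TA

section
open Monoid

variable {N : Type u} {J : Type} {H : J → Type u} [∀ j, Group (H j)]

inductive TSRel (S : ∀ j, Set (H j)) (ty : N → J) (t0 : N) (par : N → N)
    (att : ∀ t, H (ty (par t))) : (Σ t, H (ty t)) → (Σ t, H (ty t)) → Prop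
  | inn (t : N) (h : H (ty t)) (s : H (ty t)) (hs : s ∈ S (ty t)) :
      TSRel S ty t0 par att ⟨t, h⟩ ⟨t, h * s⟩
  | out (t : N) (ht : t ≠ t0) : TSRel S ty t0 par att ⟨par t, att t⟩ ⟨t, 1⟩

/-- The tree of Cayley graphs. -/
def TS (S : ∀ j, Set (H j)) (ty : N → J) (t0 : N) (par : N → N)
    (att : ∀ t, H (ty (par t))) : SimpleGraph (Σ t, H (ty t)) :=
  SimpleGraph.fromRel (TSRel S ty t0 par att)

variable {S : ∀ j, Set (H j)} {ty : N → J} {t0 : N} {par : N → N} {att : ∀ t, H (ty (par t))}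

theorem TS_rel {x y : Σ t, H (ty t)} (h : TSRel S ty t0 par att x y) :
    (TS S ty t0 par att).edist x y ≤ (1 : ℕ) := by
  by_cases hxy : x = y
  · rw [hxy]; exact edist_self'
  · refine edist_adj ?_ le_rfl
    rw [TS, SimpleGraph.fromRel_adj]
    exact ⟨hxy, Or.inl h⟩

theorem TS_lip {W : Type*} {K : SimpleGraph W} {f : (Σ t, H (ty t)) → W} {c : ℕ}
    (h1 : ∀ t h, ∀ s ∈ S (ty t), K.edist (f ⟨t, h⟩) (f ⟨t, h * s⟩) ≤ c)
    (h2 : ∀ t, t ≠ t0 → K.edist (f ⟨par t, att t⟩) (f ⟨t, 1⟩) ≤ c)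
    (x y : Σ t, H (ty t)) (ha : (TS S ty t0 par att).Adj x y) : K.edist (f x) (f y) ≤ c := by
  have key : ∀ x y, TSRel S ty t0 par att x y → K.edist (f x) (f y) ≤ c := by
    intro x y h
    cases h with
    | inn t h s hs => exact h1 t h s hs
    | out t ht => exact h2 t ht
  rw [TS, SimpleGraph.fromRel_adj] at ha
  rcases ha.2 with h | h
  · exact key _ _ h
  · exact edist_symm (key _ _ h)

theorem TS_cay {t : N} {g h : H (ty t)} {n : ℕ}
    (hd : (cayleyGraph (H (ty t)) (S (ty t))).edist g h ≤ n) :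
    (TS S ty t0 par att).edist ⟨t, g⟩ ⟨t, h⟩ ≤ n := by
  have := edist_lip (H := TS S ty t0 par att) (f := fun g : H (ty t) => (⟨t, g⟩ : Σ t, H (ty t)))
    (c := 1) (cay_lip fun x s hs => TS_rel (TSRel.inn t x s hs)) hd
  rwa [one_mul] at this

/-- The generators of the free product. -/
def FPgen (S : ∀ j, Set (H j)) (Q : ℕ) : Set (FP H Q) :=
  ⋃ a : J × Fin Q, (fun s => CoprodI.of (M := fun a : J × Fin Q => H a.1) (i := a) s) '' S a.1

theorem FPgen_finite [Finite J] (hS : ∀ j, (S j).Finite) (Q : ℕ) : (FPgen S Q).Finite :=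
  Set.finite_iUnion fun a => (hS a.1).image _

theorem FPgen_closure (hS : ∀ j, Subgroup.closure (S j) = ⊤) (Q : ℕ) :
    Subgroup.closure (FPgen S Q) = ⊤ := by
  rw [eq_top_iff]
  rintro g -
  induction g using CoprodI.induction_on with
  | one => exact one_mem _
  | mul a b ha hb => exact mul_mem ha hb
  | of a h =>
    have h1 : h ∈ Subgroup.closure (S a.1) := by rw [hS]; exact Subgroup.mem_top _
    have h2 : Subgroup.closure (S a.1) ≤ (Subgroup.closure (FPgen S Q)).comap
        (CoprodI.of (M := fun a : J × Fin Q => H a.1) (i := a)) := by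
      rw [Subgroup.closure_le]
      intro s hs
      exact Subgroup.subset_closure (Set.mem_iUnion.2 ⟨a, s, hs, rfl⟩)
    exact h2 h1

/-- The coarse equivalence between the tree of Cayley graphs and the free product. -/
theorem TS_coarse [DecidableEq J] {Q : ℕ} (slot : N → Σ p, H (ty p)) (lab : N → Fin (Q + 1))
    (ψ : (Σ t, H (ty t)) → FP H (Q + 1))
    (hv : ∀ t, t ≠ t0 → (slot t).2 ≠ 1 ∨ (slot t).1 = t0)
    (h1 : ∀ t h, ψ ⟨t, h⟩ = ψ ⟨t, 1⟩ *
        CoprodI.of (M := fun a : J × Fin (Q + 1) => H a.1) (i := (ty t, lab t)) h)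
    (h2 : ∀ t, t ≠ t0 → ψ ⟨t, 1⟩ = ψ (slot t))
    (h3 : ∀ x y, (x.2 ≠ 1 ∨ x.1 = t0) → (y.2 ≠ 1 ∨ y.1 = t0) → ψ x = ψ y → x = y)
    (h4 : ∀ x β, (x.2 ≠ 1 ∨ x.1 = t0) → β ≠ (ty x.1, lab x.1) →
        ∃ t, t ≠ t0 ∧ slot t = x ∧ (ty t, lab t) = β)
    (h5 : ∀ g, ∃ x, (x.2 ≠ 1 ∨ x.1 = t0) ∧ ψ x = g) (c c' : ℕ)
    (hM : ∀ t, t ≠ t0 → (TS S ty t0 par att).edist ⟨t, 1⟩ (slot t) ≤ c)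
    (hM' : ∀ t, t ≠ t0 → (cayleyGraph (FP H (Q + 1)) (FPgen S (Q + 1))).edist
      (ψ ⟨par t, att t⟩) (ψ ⟨t, 1⟩) ≤ c') :
    CoarseEq (TS S ty t0 par att) (cayleyGraph (FP H (Q + 1)) (FPgen S (Q + 1))) := by
  choose r hr1 hr2 using h5
  have hgen : ∀ t, ∀ s ∈ S (ty t), CoprodI.of (M := fun a : J × Fin (Q + 1) => H a.1)
      (i := (ty t, lab t)) s ∈ FPgen S (Q + 1) := fun t s hs =>
    Set.mem_iUnion.2 ⟨(ty t, lab t), s, hs, rfl⟩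
  have hmul : ∀ t (h s : H (ty t)), ψ ⟨t, h * s⟩ = ψ ⟨t, h⟩ *
      CoprodI.of (M := fun a : J × Fin (Q + 1) => H a.1) (i := (ty t, lab t)) s := by
    intro t h s
    rw [h1 t (h * s), h1 t h, mul_assoc, ← map_mul]
  have hnear : ∀ x, (TS S ty t0 par att).edist (r (ψ x)) x ≤ c := by
    rintro ⟨t, h⟩
    by_cases hh : h ≠ 1 ∨ t = t0
    · rw [h3 _ ⟨t, h⟩ (hr1 _) hh (hr2 _)]; exact edist_self'
    · rw [not_or, not_not] at hh
      obtain ⟨rfl, h0⟩ := hh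
      have : r (ψ ⟨t, 1⟩) = slot t := h3 _ _ (hr1 _) (hv t h0) (by rw [hr2, h2 t h0])
      rw [this]
      exact edist_symm (hM t h0)
  refine ⟨ψ, r, max (2 * c + 1) (max c' 1), ?_, ?_, ?_, ?_⟩
  · refine TS_lip ?_ ?_
    · intro t h s hs
      rw [hmul]
      exact edist_mono (cay_mul (hgen t s hs)) (by omega)
    · intro t ht
      exact edist_mono (hM' t ht) (by omega)
  · refine cay_lip ?_
    rintro g _ hs0
    obtain ⟨β, s, hs, rfl⟩ := Set.mem_iUnion.1 hs0
    refine edist_mono ?_ (le_max_left _ _)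
    generalize hx : r g = x
    have hg : g = ψ x := by rw [← hx, hr2]
    have hxv : x.2 ≠ 1 ∨ x.1 = t0 := by rw [← hx]; exact hr1 g
    clear hx
    subst hg
    show (TS S ty t0 par att).edist x (r (ψ x *
      CoprodI.of (M := fun a : J × Fin (Q + 1) => H a.1) (i := β) s)) ≤ _
    by_cases hβ : β = (ty x.1, lab x.1)
    · subst hβ
      have h6 := hnear ⟨x.1, x.2 * s⟩
      rw [hmul] at h6
      exact edist_tri (TS_rel (TSRel.inn x.1 x.2 s hs)) (edist_symm h6) (by omega)
    · obtain ⟨t, ht, h7, h8⟩ := h4 x β hxv hβ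
      subst h8 h7
      have h6 := hnear ⟨t, 1 * s⟩
      rw [hmul, h2 t ht] at h6
      exact edist_tri (edist_symm (hM t ht)) (edist_tri (TS_rel (TSRel.inn t 1 s hs))
        (edist_symm h6) le_rfl) (by omega)
  · intro x
    exact edist_mono (hnear x) (by omega)
  · intro g
    rw [hr2]; exact edist_self'

theorem FP_cay {Q : ℕ} {lab : N → Fin (Q + 1)} {ψ : (Σ t, H (ty t)) → FP H (Q + 1)}
    (h1 : ∀ t h, ψ ⟨t, h⟩ = ψ ⟨t, 1⟩ *
        CoprodI.of (M := fun a : J × Fin (Q + 1) => H a.1) (i := (ty t, lab t)) h)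
    {t : N} {g h : H (ty t)} {n : ℕ}
    (hd : (cayleyGraph (H (ty t)) (S (ty t))).edist g h ≤ n) :
    (cayleyGraph (FP H (Q + 1)) (FPgen S (Q + 1))).edist (ψ ⟨t, g⟩) (ψ ⟨t, h⟩) ≤ n := by
  have := edist_lip (H := cayleyGraph (FP H (Q + 1)) (FPgen S (Q + 1)))
    (f := fun g : H (ty t) => ψ ⟨t, g⟩) (c := 1) (cay_lip fun x s hs => by
      rw [h1 t (x * s), map_mul, ← mul_assoc, ← h1 t x]
      exact cay_mul (Set.mem_iUnion.2 ⟨(ty t, lab t), s, hs, rfl⟩)) hd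
  rwa [one_mul] at this

end

end TA
end

section
open Relation SimpleGraph

namespace TA

section
open Monoid

variable {N : Type u} {J : Type} {H : J → Type u} [∀ j, Group (H j)]
variable {S : ∀ j, Set (H j)} {ty : N → J} {t0 : N} {par : N → N} {att : ∀ t, H (ty (par t))}

/-- `t` is a near child of its parent. -/
def Near (S : ∀ j, Set (H j)) (ty : N → J) (t0 : N) (par : N → N)
    (att : ∀ t, H (ty (par t))) (ρ : ℕ) (t : N) : Prop :=
  t ≠ t0 ∧ (cayleyGraph (H (ty (par t))) (S (ty (par t)))).edist 1 (att t) ≤ ρ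

/-- There is a path of `n` near children from `t` to a node of type `j`. -/
def Rch (S : ∀ j, Set (H j)) (ty : N → J) (t0 : N) (par : N → N)
    (att : ∀ t, H (ty (par t))) (ρ : ℕ) (j : J) : ℕ → N → Prop
  | 0, t => ty t = j
  | n + 1, t => ∃ t', par t' = t ∧ Near S ty t0 par att ρ t' ∧ Rch S ty t0 par att ρ j n t'

/-- red steps -/
theorem exists_red {ρ L : ℕ} (hL : ∀ t j, ∃ n < L, Rch S ty t0 par att ρ j (n + 1) t) :
    ∃ δ : J → N → N, ∀ t j, ∃ t' n, 1 ≤ n ∧ n ≤ L ∧ ty t' = j ∧ par^[n] t' = t ∧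
      ∀ i < n, Near S ty t0 par att ρ (par^[i] t') ∧
        ∃ j, par^[i] t' = δ j (par (par^[i] t')) := by
  classical
  have hL' : ∀ t j, ∃ n, Rch S ty t0 par att ρ j (n + 1) t := fun t j =>
    let ⟨n, _, h⟩ := hL t j; ⟨n, h⟩
  let dd : J → N → ℕ := fun j t => Nat.find (hL' t j)
  have hdd : ∀ j t, ∃ t', par t' = t ∧ Near S ty t0 par att ρ t' ∧
      Rch S ty t0 par att ρ j (dd j t) t' := fun j t => Nat.find_spec (hL' t j)
  have hle : ∀ j t n, Rch S ty t0 par att ρ j (n + 1) t → dd j t ≤ n := fun j t n h =>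
    Nat.find_min' (hL' t j) h
  choose δ h1 h2 h3 using hdd
  refine ⟨δ, fun t j => ?_⟩
  have key : ∀ m t, dd j t ≤ m → ∃ t' n, 1 ≤ n ∧ n ≤ m + 1 ∧ ty t' = j ∧ par^[n] t' = t ∧
      ∀ i < n, Near S ty t0 par att ρ (par^[i] t') ∧
        ∃ j, par^[i] t' = δ j (par (par^[i] t')) := by
    intro m
    induction m with
    | zero =>
      intro t hm
      refine ⟨δ j t, 1, le_rfl, le_rfl, ?_, h1 j t, ?_⟩
      · have := h3 j t
        rw [Nat.le_zero.1 hm] at this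
        exact this
      · intro i hi
        obtain rfl : i = 0 := by omega
        exact ⟨h2 j t, j, by simp [h1 j t]⟩
    | succ m ih =>
      intro t hm
      by_cases hz : dd j t = 0
      · obtain ⟨t', n, g1, g2, g3⟩ := ih t (by omega)
        exact ⟨t', n, g1, by omega, g3⟩
      · obtain ⟨n, hn⟩ := Nat.exists_eq_succ_of_ne_zero hz
        have := h3 j t
        rw [hn] at this
        have hd := hle j _ _ this
        obtain ⟨t', n', g1, g2, g3, g4, g5⟩ := ih (δ j t) (by omega)
        refine ⟨t', n' + 1, by omega, by omega, g3, ?_, ?_⟩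
        · rw [Function.iterate_succ_apply', g4, h1]
        · intro i hi
          by_cases hi' : i < n'
          · exact g5 i hi'
          · obtain rfl : i = n' := by omega
            rw [g4]
            exact ⟨h2 j t, j, by rw [h1]⟩
  obtain ⟨n, hn, hr⟩ := hL t j
  obtain ⟨t', n', g1, g2, g3⟩ := key n t (hle j t n hr)
  exact ⟨t', n', g1, by omega, g3⟩

theorem exists_chain {ρ L : ℕ} {δ : J → N → N}
    (hδ : ∀ t j, ∃ t' n, 1 ≤ n ∧ n ≤ L ∧ ty t' = j ∧ par^[n] t' = t ∧
      ∀ i < n, Near S ty t0 par att ρ (par^[i] t') ∧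
        ∃ j, par^[i] t' = δ j (par (par^[i] t'))) (k : N) (τ : ℕ → J) :
    ∃ (w : ℕ → N) (l : ℕ → ℕ), StrictMono l ∧ ∀ n, ty (w n) = τ n ∧ 1 ≤ l n ∧ l n ≤ L * (n + 1) ∧
      par^[l n] (w n) = k ∧ ∀ i < l n, Near S ty t0 par att ρ (par^[i] (w n)) ∧
        ∃ j, par^[i] (w n) = δ j (par (par^[i] (w n))) := by
  choose r len h1 h2 h3 h4 h5 using hδ
  let P : ℕ → N × ℕ := fun n => Nat.rec (k, 0) (fun n x => (r x.1 (τ n), len x.1 (τ n) + x.2)) n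
  have hP : ∀ n, (P n).2 ≤ L * n ∧ par^[(P n).2] (P n).1 = k ∧
      ∀ i < (P n).2, Near S ty t0 par att ρ (par^[i] (P n).1) ∧
        ∃ j, par^[i] (P n).1 = δ j (par (par^[i] (P n).1)) := by
    intro n
    induction n with
    | zero => exact ⟨le_rfl, rfl, fun i hi => absurd hi (Nat.not_lt_zero i)⟩
    | succ n ih =>
      obtain ⟨g1, g2, g3⟩ := ih
      have e1 : (P (n + 1)).1 = r (P n).1 (τ n) := rfl
      have e2 : (P (n + 1)).2 = len (P n).1 (τ n) + (P n).2 := rfl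
      have hit : ∀ i, par^[i + len (P n).1 (τ n)] (r (P n).1 (τ n)) = par^[i] (P n).1 := by
        intro i
        rw [Function.iterate_add_apply, h4]
      rw [e1, e2]
      refine ⟨?_, ?_, ?_⟩
      · have := h2 (P n).1 (τ n)
        rw [Nat.mul_succ]; omega
      · rw [add_comm, hit, g2]
      · intro i hi
        by_cases hi' : i < len (P n).1 (τ n)
        · exact h5 _ _ i hi'
        · obtain ⟨m, rfl⟩ := Nat.exists_eq_add_of_le (not_lt.1 hi')
          rw [add_comm, hit]
          exact g3 m (by omega)
  refine ⟨fun n => (P (n + 1)).1, fun n => (P (n + 1)).2, strictMono_nat_of_lt_succ fun n => ?_,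
    fun n => ⟨h3 _ _, ?_, (hP (n + 1)).1, (hP (n + 1)).2⟩⟩
  · have := h1 (P (n + 1)).1 (τ (n + 1))
    show (P (n + 1)).2 < len (P (n + 1)).1 (τ (n + 1)) + (P (n + 1)).2
    omega
  · have := h1 (P n).1 (τ n)
    show 1 ≤ len (P n).1 (τ n) + (P n).2
    omega

end

end TA
end

section
open Relation SimpleGraph

namespace TA

section
open Monoid

variable {N : Type u} {J : Type} {H : J → Type u} [∀ j, Group (H j)]
variable {S : ∀ j, Set (H j)} {ty : N → J} {t0 : N} {par : N → N} {att : ∀ t, H (ty (par t))}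

/-- The tree of Cayley graphs is coarsely a Cayley graph. -/
theorem TS_cayley [Fintype J] (hSf : ∀ j, (S j).Finite) (hSg : ∀ j, Subgroup.closure (S j) = ⊤)
    {dp : N → ℕ} (hR : Rooted t0 par dp) (hatt : ∀ t, t ≠ t0 → att t ≠ 1)
    (D : ℕ) (q : N → Fin D) (hq : ∀ t t', t ≠ t0 → t' ≠ t0 →
      (⟨par t, att t⟩ : Σ p, H (ty p)) = ⟨par t', att t'⟩ → q t = q t' → t = t')
    (ρ L : ℕ) (hK : ∀ (x : Σ p, H (ty p)) (F : Finset N), F.card ≤ Fintype.card J →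
      ∃ k, k ∉ F ∧ k ≠ t0 ∧ ∃ g, (cayleyGraph (H (ty (par k))) (S (ty (par k)))).edist 1 g ≤ ρ ∧
        x = ⟨par k, att k * g⟩)
    (hL : ∀ t j, ∃ n < L, Rch S ty t0 par att ρ j (n + 1) t) :
    CoarseEq (TS S ty t0 par att) (cayleyGraph (FP H (D + 1)) (FPgen S (D + 1))) := by
  classical
  obtain ⟨δ, hδ⟩ := exists_red hL
  -- the blue child near a vertex
  have hblue : ∀ x : Σ p, H (ty p), ∃ k, (∀ j, k ≠ δ j (par k)) ∧ k ≠ t0 ∧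
      ∃ g, (cayleyGraph (H (ty (par k))) (S (ty (par k)))).edist 1 g ≤ ρ ∧
        x = ⟨par k, att k * g⟩ := by
    intro x
    obtain ⟨k, h1, h2, g, h3, h4⟩ := hK x (Finset.univ.image fun j => δ j x.1)
      (Finset.card_image_le.trans (by simp))
    refine ⟨k, fun j hj => h1 ?_, h2, g, h3, h4⟩
    rw [Finset.mem_image]
    refine ⟨j, Finset.mem_univ _, ?_⟩
    rw [h4]; exact hj.symm
  choose K hKb hK0 gg hg1 hg2 using hblue
  -- the demands
  let Dem : Type u := {d : (Σ p, H (ty p)) × (J × Fin (D + 1)) //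
    (d.1.2 ≠ 1 ∨ d.1.1 = t0) ∧ d.2 ≠ (ty d.1.1, 0)}
  -- a code for demands in a cell
  let E : Type u := (Σ j, {g : H j | (cayleyGraph (H j) (S j)).edist 1 g ≤ ρ}) × (J × Fin (D + 1))
  have : ∀ j, Finite {g : H j | (cayleyGraph (H j) (S j)).edist 1 g ≤ ρ} :=
    fun j => (cay_ball (hSf j) ρ).to_subtype
  have : Finite E := by
    change Finite ((Σ j, {g : H j | (cayleyGraph (H j) (S j)).edist 1 g ≤ ρ}) × (J × Fin (D + 1)))
    infer_instance
  obtain ⟨M, ⟨enc⟩⟩ := Finite.exists_equiv_fin E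
  let idx : Dem → ℕ := fun d => enc (⟨ty (par (K d.1.1)), gg d.1.1, hg1 d.1.1⟩, d.1.2)
  have hidxM : ∀ d, idx d < M := fun d => (enc _).2
  have hidx : ∀ d d' : Dem, K d.1.1 = K d'.1.1 → idx d = idx d' → d = d' := by
    intro d d' h1 h2
    have h3 := enc.injective (Fin.ext h2)
    obtain ⟨h4, h5⟩ := Prod.mk.inj h3
    have aux : ∀ k k' (g : H (ty (par k))) (g' : H (ty (par k'))) p p', k = k' →
        (⟨ty (par k), ⟨g, p⟩⟩ : Σ j, {g : H j | (cayleyGraph (H j) (S j)).edist 1 g ≤ ρ}) =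
          ⟨ty (par k'), ⟨g', p'⟩⟩ →
        (⟨par k, att k * g⟩ : Σ p, H (ty p)) = ⟨par k', att k' * g'⟩ := by
      intro k k' g g' p p' hk h
      subst hk
      have := eq_of_heq (Sigma.mk.inj h).2
      rw [Subtype.mk.inj this]
    have h6 := aux _ _ _ _ _ _ h1 h4
    rw [← hg2, ← hg2] at h6
    exact Subtype.ext (Prod.ext h6 h5)
  have hτ : ∀ k, ∃ τ : ℕ → J, ∀ d : Dem, K d.1.1 = k → τ (idx d) = d.1.2.1 := by
    intro k
    by_cases hJ : Nonempty J
    · obtain ⟨j0⟩ := hJ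
      refine ⟨fun n => if h : ∃ d : Dem, K d.1.1 = k ∧ idx d = n then h.choose.1.2.1 else j0,
        fun d hd => ?_⟩
      have hex : ∃ d' : Dem, K d'.1.1 = k ∧ idx d' = idx d := ⟨d, hd, rfl⟩
      beta_reduce
      rw [dif_pos hex]
      rw [hidx _ d (hex.choose_spec.1.trans hd.symm) hex.choose_spec.2]
    · exact absurd ⟨ty t0⟩ hJ
  choose τ hτ using hτ
  choose w l hl hw1 hw2 hw3 hw4 hw5 using fun k => exists_chain hδ k (τ k)
  let f0 : Dem → N := fun d => w (K d.1.1) (idx d)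
  let ℓ : Dem → ℕ := fun d => l (K d.1.1) (idx d)
  have hℓ1 : ∀ d, 1 ≤ ℓ d := fun d => hw2 _ _
  have hℓ2 : ∀ d, ℓ d ≤ L * M := fun d => (hw3 _ _).trans (Nat.mul_le_mul_left _ (hidxM d))
  have hpar : ∀ d, par^[ℓ d] (f0 d) = K d.1.1 := fun d => hw4 _ _
  have hgood : ∀ d, ∀ i < ℓ d, Near S ty t0 par att ρ (par^[i] (f0 d)) ∧
        ∃ j, par^[i] (f0 d) = δ j (par (par^[i] (f0 d))) := fun d => hw5 _ _
  have hf0 : ∀ d, f0 d ≠ t0 := fun d => (hgood d 0 (hℓ1 d)).1.1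
  have hfty : ∀ d, ty (f0 d) = d.1.2.1 := fun d => (hw1 _ _).trans (hτ _ d rfl)
  have hℓu : ∀ d n, n ≤ ℓ d → (∀ j, par^[n] (f0 d) ≠ δ j (par (par^[n] (f0 d)))) → n = ℓ d := by
    intro d n hn h
    by_contra hne
    obtain ⟨-, j, hj⟩ := hgood d n (by omega)
    exact h j hj
  have hfinj : ∀ d d', f0 d = f0 d' → d = d' := by
    intro d d' h
    have hll : ℓ d = ℓ d' := by
      rcases le_total (ℓ d) (ℓ d') with h1 | h1
      · exact hℓu d' _ h1 (by rw [← h, hpar]; exact hKb _)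
      · exact (hℓu d _ h1 (by rw [h, hpar]; exact hKb _)).symm
    have hkk : K d.1.1 = K d'.1.1 := by rw [← hpar d, ← hpar d', hll, h]
    refine hidx d d' hkk ?_
    have h7 : l (K d.1.1) (idx d) = l (K d'.1.1) (idx d') := hll
    rw [hkk] at h7
    exact (hl _).injective h7
  -- the staying map
  let stay : {t // t ≠ t0} → Dem := fun t => ⟨(⟨par t, att t⟩, (ty t, (q t).succ)),
    Or.inl (hatt t t.2), fun h => Fin.succ_ne_zero _ (Prod.mk.inj h).2⟩
  have hstay : Function.Injective stay := by
    intro t t' h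
    obtain ⟨h1, h2⟩ := Prod.mk.inj (Subtype.mk.inj h)
    exact Subtype.ext (hq _ _ t.2 t'.2 h1 (Fin.succ_injective _ (Prod.mk.inj h2).2))
  let f : Dem → {t // t ≠ t0} := fun d => ⟨f0 d, hf0 d⟩
  have hf : Function.Injective f := fun d d' h => hfinj d d' (Subtype.mk.inj h)
  obtain ⟨e, he, hee⟩ := Function.Embedding.schroeder_bernstein_of_rel hstay hf
    (fun t d => d = stay t ∨ f d = t) (fun t => Or.inl rfl) (fun d => Or.inr rfl)
  let slot : N → Σ p, H (ty p) := fun t => if ht : t = t0 then ⟨t0, 1⟩ else (e ⟨t, ht⟩).1.1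
  let ix : N → J × Fin (D + 1) := fun t => if ht : t = t0 then (ty t0, 0) else (e ⟨t, ht⟩).1.2
  have hslot : ∀ t (ht : t ≠ t0), slot t = (e ⟨t, ht⟩).1.1 := fun t ht => dif_neg ht
  have hixe : ∀ t (ht : t ≠ t0), ix t = (e ⟨t, ht⟩).1.2 := fun t ht => dif_neg ht
  have hcase : ∀ t (ht : t ≠ t0), (slot t = ⟨par t, att t⟩ ∧ (ix t).1 = ty t) ∨
      ∃ d, f0 d = t ∧ slot t = d.1.1 ∧ ix t = d.1.2 := by
    intro t ht
    rw [hslot t ht, hixe t ht]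
    rcases hee ⟨t, ht⟩ with h | h
    · left; rw [h]; exact ⟨rfl, rfl⟩
    · right; exact ⟨_, Subtype.mk.inj h, rfl, rfl⟩
  -- depths
  have hdepth : ∀ n u, (∀ i < n, Near S ty t0 par att ρ (par^[i] u)) →
      dp u = dp (par^[n] u) + n := by
    intro n
    induction n with
    | zero => intro u _; rfl
    | succ n ih =>
      intro u hu
      rw [ih u fun i hi => hu i (by omega), Function.iterate_succ_apply',
        hR.step _ (hu n (by omega)).1]
      omega
  have hv : ∀ t, t ≠ t0 → (slot t).2 ≠ 1 ∨ (slot t).1 = t0 := by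
    intro t ht
    rw [hslot t ht]; exact (e ⟨t, ht⟩).2.1
  have hpK : ∀ x : Σ p, H (ty p), par (K x) = x.1 := fun x => (congrArg Sigma.fst (hg2 x)).symm
  obtain ⟨lab, ψ, h1, h2, h3, h4, h5⟩ := fp_tree (t0 := t0) dp slot ix (by
      intro t ht
      rcases hcase t ht with ⟨h, -⟩ | ⟨d, rfl, h, -⟩
      · rw [h, hR.step t ht]; exact Nat.lt_succ_self _
      · rw [h, hdepth _ _ fun i hi => (hgood d i hi).1, hpar, hR.step _ (hK0 _), hpK]
        omega) hv (by
      intro t ht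
      rw [hslot t ht, hixe t ht]; exact (e ⟨t, ht⟩).2.2) (by
      intro t ht
      rcases hcase t ht with ⟨-, h⟩ | ⟨d, rfl, -, h⟩
      · exact h
      · rw [h, hfty]) (by
      intro t t' ht ht' g1 g2
      rw [hslot t ht, hslot t' ht'] at g1
      rw [hixe t ht, hixe t' ht'] at g2
      exact Subtype.mk.inj (he.1 (Subtype.ext (Prod.ext g1 g2)))) (by
      intro x y hx hy
      obtain ⟨⟨t, ht⟩, h⟩ := he.2 ⟨(x, y), hx, hy⟩
      exact ⟨t, ht, by rw [hslot t ht, h], by rw [hixe t ht, h]⟩)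
  -- a general path estimate
  have hpath : ∀ {W : Type u} (A : SimpleGraph W) (φ : (Σ t, H (ty t)) → W) (c n : ℕ) (u : N),
      (∀ t (g h : H (ty t)), (cayleyGraph (H (ty t)) (S (ty t))).edist g h ≤ ρ →
        A.edist (φ ⟨t, g⟩) (φ ⟨t, h⟩) ≤ ρ) →
      (∀ i < n, Near S ty t0 par att ρ (par^[i] u) ∧
        A.edist (φ ⟨par (par^[i] u), att (par^[i] u)⟩) (φ ⟨par^[i] u, 1⟩) ≤ c) →
      A.edist (φ ⟨u, 1⟩) (φ ⟨par^[n] u, 1⟩) ≤ ((c + ρ) * n : ℕ) := by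
    intro W A φ c n u hφ
    induction n with
    | zero => intro _; exact edist_self'
    | succ n ih =>
      intro h
      refine edist_tri (ih fun i hi => h i (by omega)) ?_ (Nat.mul_succ _ _).ge
      rw [Function.iterate_succ_apply']
      exact edist_tri (edist_symm (h n (by omega)).2)
        (hφ _ _ _ (edist_symm (h n (by omega)).1.2)) le_rfl
  have hKx : ∀ {W : Type u} (A : SimpleGraph W) (φ : (Σ t, H (ty t)) → W),
      (∀ t (g h : H (ty t)), (cayleyGraph (H (ty t)) (S (ty t))).edist g h ≤ ρ →
        A.edist (φ ⟨t, g⟩) (φ ⟨t, h⟩) ≤ ρ) → ∀ x : Σ t, H (ty t),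
      A.edist (φ ⟨par (K x), att (K x)⟩) (φ x) ≤ ρ := by
    intro W A φ hφ x
    have := hφ (par (K x)) (att (K x)) (att (K x) * gg x) (by
      have := cay_left (a := att (K x)) (hg1 x)
      rwa [mul_one] at this)
    exact (congrArg (fun z => A.edist (φ ⟨par (K x), att (K x)⟩) (φ z) ≤ ρ) (hg2 x)).mpr this
  have hTS : ∀ t (g h : H (ty t)), (cayleyGraph (H (ty t)) (S (ty t))).edist g h ≤ ρ →
        (TS S ty t0 par att).edist (id ⟨t, g⟩) (id ⟨t, h⟩) ≤ ρ := fun t g h hh => TS_cay hh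
  have hFP : ∀ t (g h : H (ty t)), (cayleyGraph (H (ty t)) (S (ty t))).edist g h ≤ ρ →
        (cayleyGraph (FP H (D + 1)) (FPgen S (D + 1))).edist (ψ ⟨t, g⟩) (ψ ⟨t, h⟩) ≤ ρ :=
    fun t g h hh => FP_cay h1 hh
  have hM'n : ∀ n, ∃ c, ∀ t, t ≠ t0 → ∀ m ≤ n, (∀ i < m, ∃ j, par^[i] t = δ j (par (par^[i] t))) →
      (∀ j, par^[m] t ≠ δ j (par (par^[m] t))) →
      (cayleyGraph (FP H (D + 1)) (FPgen S (D + 1))).edist (ψ ⟨par t, att t⟩) (ψ ⟨t, 1⟩) ≤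
        (c : ℕ) := by
    have hstayer : ∀ t, t ≠ t0 → slot t = ⟨par t, att t⟩ → ∀ c : ℕ,
      (cayleyGraph (FP H (D + 1)) (FPgen S (D + 1))).edist (ψ ⟨par t, att t⟩) (ψ ⟨t, 1⟩) ≤ c := by
      intro t ht h c
      rw [h2 t ht, h]; exact edist_self'
    intro n
    induction n with
    | zero =>
      refine ⟨0, fun t ht m hm _ hm2 => ?_⟩
      obtain rfl : m = 0 := by omega
      rcases hcase t ht with ⟨h, -⟩ | ⟨d, rfl, h, -⟩
      · exact hstayer t ht h 0
      · have := hℓu d 0 (by omega) hm2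
        have := hℓ1 d
        omega
    | succ n ih =>
      obtain ⟨c, hc⟩ := ih
      refine ⟨ρ + (c + ρ) * (n + 1) + c + ρ, fun t ht m hm hm1 hm2 => ?_⟩
      rcases hcase t ht with ⟨h, -⟩ | ⟨d, rfl, h, -⟩
      · exact hstayer t ht h _
      · have hml : m = ℓ d := by
          rcases le_total m (ℓ d) with g | g
          · exact hℓu d m g hm2
          · by_contra hne
            obtain ⟨j, hj⟩ := hm1 (ℓ d) (by omega)
            rw [hpar] at hj
            exact hKb _ j hj
        subst hml
        obtain ⟨m, hm'⟩ := Nat.exists_eq_succ_of_ne_zero (Nat.one_le_iff_ne_zero.1 (hℓ1 d))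
        have hp : par^[m] (par (f0 d)) = K d.1.1 := by
          have := hpar d
          rw [hm'] at this
          exact this
        rw [h2 _ ht, h]
        have e1 := hFP _ _ _ (edist_symm (hgood d 0 (hℓ1 d)).1.2)
        have e2 := hpath _ ψ c m (par (f0 d)) hFP (fun i hi => by
          have hg := (hgood d (i + 1) (by omega)).1
          rw [Function.iterate_succ_apply] at hg
          refine ⟨hg, hc _ hg.1 (m - i) (by omega) ?_ ?_⟩
          · intro i' hi'
            rw [← Function.iterate_add_apply, ← Function.iterate_succ_apply]
            exact hm1 _ (by omega)
          · rw [← Function.iterate_add_apply, Nat.sub_add_cancel hi.le, hp]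
            exact hKb _)
        rw [hp] at e2
        have e3 := hc (K d.1.1) (hK0 _) 0 (by omega) (fun i hi => absurd hi (Nat.not_lt_zero i))
          (hKb _)
        have e4 := hKx _ ψ hFP d.1.1
        refine edist_tri e1 (edist_tri (edist_mono (n := (c + ρ) * (n + 1)) e2 (Nat.mul_le_mul_left _ (by omega)))
          (edist_tri (edist_symm e3) e4 le_rfl) le_rfl) ?_
        have : m ≤ n + 1 := by omega
        omega
  obtain ⟨c', hc'⟩ := hM'n (L * M)
  refine TS_coarse slot lab ψ hv h1 h2 h3 h4 h5 ((1 + ρ) * (L * M) + 1 + ρ) c' ?_ ?_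
  · intro t ht
    rcases hcase t ht with ⟨h, -⟩ | ⟨d, rfl, h, -⟩
    · rw [h]
      exact edist_mono (edist_symm (TS_rel (TSRel.out t ht))) (by omega)
    · rw [h]
      have e1 := hpath (TS S ty t0 par att) id 1 (ℓ d) (f0 d) hTS (fun i hi =>
        ⟨(hgood d i hi).1, TS_rel (TSRel.out _ (hgood d i hi).1.1)⟩)
      rw [hpar] at e1
      exact edist_tri (edist_mono e1 (Nat.mul_le_mul_left _ (hℓ2 d)))
        (edist_tri (edist_symm (TS_rel (TSRel.out _ (hK0 _)))) (hKx _ id hTS d.1.1) le_rfl)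
        (by omega)
  · intro t ht
    rcases hcase t ht with ⟨h, -⟩ | ⟨d, rfl, h, -⟩
    · rw [h2 t ht, h]; exact edist_self'
    · exact hc' _ ht (ℓ d) (hℓ2 d) (fun i hi => (hgood d i hi).2) (by rw [hpar]; exact hKb _)

end

end TA
end

section
open Relation SimpleGraph

namespace TA

/-- Decomposing a rooted tree into bounded pieces, each containing exactly one special node. -/
theorem exists_heads {N : Type*} {r : N} {par : N → N} {dp : N → ℕ} (hR : Rooted r par dp)
    (Sp : N → Prop) (k0 : ℕ)
    (hgap : ∀ u, ∃ n ≤ k0, ∃ s, Sp s ∧ par^[n] s = u ∧ ∀ i < n, par^[i] s ≠ r) :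
    ∃ (hd σ : N → N) (c : N → ℕ), hd r = r ∧ (∀ u, hd (hd u) = hd u) ∧
      (∀ u, hd u = u ∨ (u ≠ r ∧ hd u = hd (par u) ∧ ¬ Sp (par u))) ∧
      (∀ u, σ (hd u) = σ u) ∧ (∀ u, Sp (σ u)) ∧ (∀ u, Sp u → σ u = u) ∧
      (∀ u, hd (σ u) = hd u) ∧ (∀ u, Sp (par u) → hd u = u) ∧
      (∀ u, ∃ i ≤ k0, par^[i] (σ u) = u ∧ (∀ i', 1 ≤ i' → i' ≤ i → ¬ Sp (par^[i'] (σ u))) ∧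
        ∀ i' < i, par^[i'] (σ u) ≠ r) ∧
      (∀ u, c u = 0 ↔ hd u = r) ∧ (∀ u, hd u = u → u ≠ r → c u = c (hd (par u)) + 1) := by
  classical
  let P : N → ℕ → Prop := fun u n => ∃ s, Sp s ∧ par^[n] s = u ∧ ∀ i < n, par^[i] s ≠ r
  have hP : ∀ u, ∃ n, P u n := fun u => let ⟨n, _, h⟩ := hgap u; ⟨n, h⟩
  let g : N → ℕ := fun u => Nat.find (hP u)
  have hgk : ∀ u, g u ≤ k0 := fun u => by
    obtain ⟨n, hn, h⟩ := hgap u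
    exact (Nat.find_min' (hP u) h).trans hn
  have hheir : ∀ u, ∃ h, ¬ Sp u → par h = u ∧ h ≠ r ∧ g h < g u := by
    intro u
    by_cases hu : Sp u
    · exact ⟨u, fun h => absurd hu h⟩
    obtain ⟨s, hs, h1, h2⟩ : P u (g u) := Nat.find_spec (hP u)
    rcases hgu : g u with _ | m
    · rw [hgu] at h1
      exact absurd (h1 ▸ hs) hu
    · rw [hgu] at h1 h2
      refine ⟨par^[m] s, fun _ => ⟨?_, h2 m (by omega), ?_⟩⟩
      · rw [← Function.iterate_succ_apply' par]; exact h1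
      · exact Nat.lt_succ_of_le (Nat.find_min' (hP _) ⟨s, hs, rfl, fun i hi => h2 i (by omega)⟩)
  choose heir hheir using hheir
  have hσ : ∃ σ : N → N, ∀ u, σ u = if Sp u then u else σ (heir u) := by
    let wf : WellFounded (fun x y : N => g x < g y) := InvImage.wf g wellFounded_lt
    refine ⟨wf.fix (C := fun _ => N) fun u ih =>
      if hx : Sp u then u else ih (heir u) (hheir u hx).2.2, fun u => ?_⟩
    rw [WellFounded.fix_eq]
    split_ifs <;> rfl
  obtain ⟨σ, hσ⟩ := hσ
  have hσ1 : ∀ u, Sp u → σ u = u := fun u hu => by rw [hσ, if_pos hu]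
  have hσ2 : ∀ u, ¬ Sp u → σ u = σ (heir u) := fun u hu => by rw [hσ, if_neg hu]
  have ind : ∀ p : N → Prop, (∀ u, Sp u → p u) → (∀ u, ¬ Sp u → p (heir u) → p u) →
      ∀ u, p u := by
    intro p h1 h2 u
    induction hn : g u using Nat.strong_induction_on generalizing u with
    | _ n ih =>
      subst hn
      by_cases hu : Sp u
      · exact h1 u hu
      · exact h2 u hu (ih _ (hheir u hu).2.2 _ rfl)
  have hdp : ∀ t, t ≠ r → dp (par t) < dp t := fun t ht => by rw [hR.step t ht]; omega
  obtain ⟨hd, hd0, hd1⟩ := rec_lt r dp par hdp r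
    (fun u a => if ¬ Sp (par u) ∧ u = heir (par u) then a else u)
  have hdc : ∀ u, hd u = u ∨
      (u ≠ r ∧ hd u = hd (par u) ∧ ¬ Sp (par u) ∧ u = heir (par u)) := by
    intro u
    by_cases hu : u = r
    · subst hu; exact Or.inl hd0
    · have := hd1 u hu
      split_ifs at this with h
      · exact Or.inr ⟨hu, this, h⟩
      · exact Or.inl this
  have hdh : ∀ u, ¬ Sp u → hd (heir u) = hd u := by
    intro u hu
    obtain ⟨h1, h2, -⟩ := hheir u hu
    have := hd1 _ h2
    rw [h1, if_pos ⟨hu, rfl⟩] at this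
    exact this
  obtain ⟨c, hc0, hc1⟩ := rec_lt r dp par hdp 0
    (fun u a => a + if hd u = u then 1 else 0)
  have hidem : ∀ u, hd (hd u) = hd u := by
    refine hR.induct ?_ ?_
    · rw [hd0, hd0]
    · intro u hu ih
      rcases hdc u with h | ⟨-, h, -⟩
      · rw [h, h]
      · rw [h, ih]
  have hchd : ∀ u, c (hd u) = c u := by
    refine hR.induct ?_ ?_
    · rw [hd0]
    · intro u hu ih
      rcases hdc u with h | ⟨-, h, -⟩
      · rw [h]
      · by_cases hh : hd u = u
        · rw [hh]
        · rw [h, ih, hc1 u hu, if_neg hh, add_zero]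
  have hstep : ∀ u, hd u = u → u ≠ r → c u = c (hd (par u)) + 1 := by
    intro u h1 h2
    rw [hc1 u h2, if_pos h1, hchd]
  refine ⟨hd, σ, c, hd0, hidem, ?_, ?_, ?_, hσ1, ?_, ?_, ?_, ?_, hstep⟩
  · intro u
    rcases hdc u with h | ⟨h1, h2, h3, -⟩
    · exact Or.inl h
    · exact Or.inr ⟨h1, h2, h3⟩
  · refine hR.induct (by rw [hd0]) ?_
    intro u hu ih
    rcases hdc u with h | ⟨-, h2, h3, h4⟩
    · rw [h]
    · rw [h2, ih, hσ2 _ h3, ← h4]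
  · exact ind _ (fun u hu => by rw [hσ1 u hu]; exact hu) (fun u hu ih => by rw [hσ2 u hu]; exact ih)
  · exact ind _ (fun u hu => by rw [hσ1 u hu]) (fun u hu ih => by rw [hσ2 u hu, ih, hdh u hu])
  · intro u hu
    rcases hdc u with h | ⟨-, -, h3, -⟩
    · exact h
    · exact absurd hu h3
  · suffices h : ∀ u, ∃ i ≤ g u, par^[i] (σ u) = u ∧
        (∀ i', 1 ≤ i' → i' ≤ i → ¬ Sp (par^[i'] (σ u))) ∧ ∀ i' < i, par^[i'] (σ u) ≠ r by
      intro u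
      obtain ⟨i, h1, h2⟩ := h u
      exact ⟨i, h1.trans (hgk u), h2⟩
    refine ind _ ?_ ?_
    · intro u hu
      exact ⟨0, Nat.zero_le _, by rw [hσ1 u hu]; rfl, fun i h1 h2 => by omega,
        fun i hi => absurd hi (Nat.not_lt_zero i)⟩
    · rintro u hu ⟨i, h1, h2, h3, h4⟩
      obtain ⟨e1, e2, e3⟩ := hheir u hu
      rw [← hσ2 u hu] at h2 h3 h4
      have h5 : par^[i + 1] (σ u) = u := by rw [Function.iterate_succ_apply', h2, e1]
      refine ⟨i + 1, by omega, h5, ?_, ?_⟩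
      · intro i' g1 g2
        rcases Nat.lt_or_ge i i' with h | h
        · obtain rfl : i' = i + 1 := by omega
          rw [h5]; exact hu
        · exact h3 _ g1 h
      · intro i' g1
        rcases Nat.lt_or_ge i' i with h | h
        · exact h4 _ h
        · obtain rfl : i' = i := by omega
          rw [h2]; exact e2
  · intro u
    constructor
    · intro h
      by_contra hne
      have := hstep (hd u) (hidem u) hne
      rw [hchd] at this
      omega
    · intro h
      rw [← hchd, h, hc0]

end TA
end

section
open Relation SimpleGraph

namespace TA

section
variable {V N : Type u} {J : Type} {H : J → Type u} [∀ j, Group (H j)]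

/-- The graph on the nodes whose edges are the tree edges with `w` in the adhesion set. -/
def SG (r : N) (par : N → N) (U : N → Set V) (w : V) : SimpleGraph N :=
  SimpleGraph.fromRel fun u u' => u ≠ r ∧ par u = u' ∧ w ∈ U u

/-- An abstract tree of spaces. -/
structure TSys (G : SimpleGraph V) (r : N) (par : N → N) (dp : N → ℕ) (Sp : N → Prop)
    (P U : N → Set V) (home : V → N) [Fintype J] (S : ∀ j, Set (H j)) (jt : N → J)
    (κ : ∀ s, V → H (jt s)) (π : ∀ s, H (jt s) → V) (y0 : N → V) (c k0 n0 : ℕ)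
    (cf Nf : ℕ → ℕ) (gg : ∀ j, H j) : Prop where
  hc : G.Connected
  root : Rooted r par dp
  spr : Sp r
  U1 : ∀ k, k ≠ r → ∀ y ∈ U k, y ∈ P k ∧ y ∈ P (par k)
  U2 : ∀ k, k ≠ r → (U k).Nonempty
  U3 : ∀ k, k ≠ r → ∀ y ∈ U k, ∀ y' ∈ U k, G.edist y y' ≤ c
  fin : ∀ u, ¬ Sp u → ∀ x ∈ P u, ∀ y ∈ P u, G.edist x y ≤ c
  pi1 : ∀ s, Sp s → ∀ h, π s h ∈ P s
  pi2 : ∀ s, Sp s → ∀ h, ∀ g ∈ S (jt s), G.edist (π s h) (π s (h * g)) ≤ c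
  kap : ∀ s, Sp s → ∀ (R : ℕ), ∀ x ∈ P s, ∀ x' ∈ P s, G.edist x x' ≤ R →
    (cayleyGraph (H (jt s)) (S (jt s))).edist (κ s x) (κ s x') ≤ cf R
  pik : ∀ s, Sp s → ∀ x ∈ P s, G.edist (π s (κ s x)) x ≤ c
  kpi : ∀ s, Sp s → ∀ h, (cayleyGraph (H (jt s)) (S (jt s))).edist (κ s (π s h)) h ≤ c
  y01 : ∀ s, Sp s → y0 s ∈ P s
  y02 : ∀ s, Sp s → s ≠ r → y0 s ∈ U s
  y03 : ∀ s, Sp s → κ s (y0 s) = 1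
  home0 : ∀ v, v ∈ P (home v)
  home1 : ∀ v w, G.Adj v w → w ∈ P (home v)
  path : ∀ w u, w ∈ P u → (SG r par U w).edist u (home w) ≤ n0
  kids : ∀ s, Sp s → ∀ x ∈ P s, ∀ F : Finset N, F.card ≤ Fintype.card J →
    ∃ k, k ∉ F ∧ k ≠ r ∧ par k = s ∧ ∃ y ∈ U k, G.edist x y ≤ c
  count : ∀ (R : ℕ) (z : V), {k | k ≠ r ∧ ∃ y ∈ U k, G.edist z y ≤ R}.Finite ∧
    {k | k ≠ r ∧ ∃ y ∈ U k, G.edist z y ≤ R}.ncard ≤ Nf R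
  down : ∀ k, k ≠ r → ∀ j, ∃ s n, Sp s ∧ jt s = j ∧ n ≤ k0 ∧ par^[n] s = k ∧
    ∀ i < n, par^[i] s ≠ r ∧ ∀ y ∈ U (par^[i] s), ∀ y' ∈ U k, G.edist y y' ≤ c
  gg1 : ∀ j, gg j ≠ 1
  gg2 : ∀ j, (cayleyGraph (H j) (S j)).edist 1 (gg j) ≤ c
  Sf : ∀ j, (S j).Finite
  Sg : ∀ j, Subgroup.closure (S j) = ⊤

variable {G : SimpleGraph V} {r : N} {par : N → N} {dp : N → ℕ} {Sp : N → Prop}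
    {P U : N → Set V} {home : V → N} [Fintype J] {S : ∀ j, Set (H j)} {jt : N → J}
    {κ : ∀ s, V → H (jt s)} {π : ∀ s, H (jt s) → V} {y0 : N → V} {c k0 n0 : ℕ}
    {cf Nf : ℕ → ℕ} {gg : ∀ j, H j}

theorem TSys.gap (h : TSys G r par dp Sp P U home S jt κ π y0 c k0 n0 cf Nf gg) (u : N) :
    ∃ n ≤ k0, ∃ s, Sp s ∧ par^[n] s = u ∧ ∀ i < n, par^[i] s ≠ r := by
  by_cases hu : u = r
  · exact ⟨0, Nat.zero_le _, r, h.spr, hu.symm, fun i hi => absurd hi (Nat.not_lt_zero i)⟩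
  · obtain ⟨s, n, h1, -, h2, h3, h4⟩ := h.down u hu (jt r)
    exact ⟨n, h2, s, h1, h3, fun i hi => (h4 i hi).1⟩

theorem cay_left1 {Γ : Type*} [Group Γ] {S : Set Γ} {a b : Γ} {n : ℕ}
    (hd : (cayleyGraph Γ S).edist a b ≤ n) : (cayleyGraph Γ S).edist 1 (a⁻¹ * b) ≤ n := by
  have := cay_left (a := a⁻¹) hd
  rwa [inv_mul_cancel] at this

theorem TSys.main (h : TSys G r par dp Sp P U home S jt κ π y0 c k0 n0 cf Nf gg) :
    ∃ Q : ℕ, CoarseEq G (cayleyGraph (FP H Q) (FPgen S Q)) := by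
  classical
  obtain ⟨hd, σ, dc, hd0, hidem, hcase, hσhd, hσS, hσe, hhσ, hpS, hchain, hc0, hc1⟩ :=
    exists_heads h.root Sp k0 h.gap
  have hσu : ∀ u, Sp u → σ (hd u) = u := fun u hu => by rw [hσhd, hσe u hu]
  -- nonspecial nodes lie close to the special node of their piece
  have hA : ∀ u, ¬ Sp u → ∀ x ∈ P u, G.edist (y0 (σ u)) x ≤ (k0 * c : ℕ) := by
    intro u hu
    obtain ⟨i, hik, h1, h2, h3⟩ := hchain u
    have key : ∀ m, m < i → ∀ x ∈ P (par^[m + 1] (σ u)),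
        G.edist (y0 (σ u)) x ≤ ((m + 1) * c : ℕ) := by
      intro m
      induction m with
      | zero =>
        intro hm x hx
        have e1 := h.y02 _ (hσS u) (h3 0 hm)
        have e2 := (h.U1 _ (h3 0 hm) _ e1).2
        exact edist_mono (h.fin _ (h2 1 le_rfl (by omega)) _ e2 _ hx) (by omega)
      | succ m ih =>
        intro hm x hx
        obtain ⟨z, hz⟩ := h.U2 _ (h3 (m + 1) hm)
        have e2 := h.U1 _ (h3 (m + 1) hm) _ hz
        have e3 := ih (by omega) z e2.1
        rw [← Function.iterate_succ_apply' par] at e2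
        exact edist_tri e3 (h.fin _ (h2 _ (by omega) (by omega)) _ e2.2 _ hx)
          (by rw [Nat.succ_mul (m + 1)])
    rcases i with _ | i
    · exact absurd (h1 ▸ hσS u) hu
    · intro x hx
      rw [← h1] at hx
      exact edist_mono (key i (by omega) x hx) (Nat.mul_le_mul_right _ hik)
  have hπ1 : ∀ s, Sp s → G.edist (π s 1) (y0 s) ≤ c := fun s hs => by
    have := h.pik s hs _ (h.y01 s hs)
    rwa [h.y03 s hs] at this
  have hπl : ∀ s, Sp s → ∀ (n : ℕ) a b, (cayleyGraph (H (jt s)) (S (jt s))).edist a b ≤ n →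
      G.edist (π s a) (π s b) ≤ (c * n : ℕ) := fun s hs n a b hab =>
    edist_lip (cay_lip fun g t ht => h.pi2 s hs g t ht) hab
  -- the tree
  let T := {t : N // hd t = t}
  let r' : T := ⟨r, hd0⟩
  let tp : N → T := fun u => ⟨hd u, hidem u⟩
  let par' : T → T := fun t => tp (par t.1)
  let ty : T → J := fun t => jt (σ t.1)
  have hR' : Rooted r' par' (fun t : T => dc t.1) := by
    constructor
    · intro t
      rw [hc0, t.2]
      exact ⟨fun e => Subtype.ext e, fun e => congrArg Subtype.val e⟩
    · intro t ht
      exact hc1 t.1 t.2 (fun e => ht (Subtype.ext e))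
  have hne : ∀ t : T, t ≠ r' → t.1 ≠ r := fun t ht e => ht (Subtype.ext e)
  have hyy : ∀ t : T, ∃ y, t ≠ r' → y ∈ U t.1 := fun t => by
    by_cases ht : t = r'
    · exact ⟨y0 t.1, fun h => absurd ht h⟩
    · obtain ⟨y, hy⟩ := h.U2 _ (hne t ht)
      exact ⟨y, fun _ => hy⟩
  choose yy hyy using hyy
  have hatt : ∀ t : T, ∃ a : H (ty (par' t)), a ≠ 1 ∧
      (Sp (par t.1) → (cayleyGraph (H (ty (par' t))) (S (ty (par' t)))).edist
        (κ (σ (par' t).1) (yy t)) a ≤ c) ∧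
      (¬ Sp (par t.1) → (cayleyGraph (H (ty (par' t))) (S (ty (par' t)))).edist 1 a ≤ c) := by
    intro t
    by_cases ht : Sp (par t.1) ∧ κ (σ (par' t).1) (yy t) ≠ 1
    · exact ⟨_, ht.2, fun _ => edist_self', fun e => absurd ht.1 e⟩
    · refine ⟨gg _, h.gg1 _, fun e => ?_, fun _ => h.gg2 _⟩
      have e1 : κ (σ (par' t).1) (yy t) = 1 := by
        by_contra e2; exact ht ⟨e, e2⟩
      rw [e1]
      exact h.gg2 _
  choose att hatt1 hatt2 hatt3 using hatt
  let K := TS S ty r' par' att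
  -- child in the position of a special parent
  have hspar : ∀ t : T, Sp (par t.1) → σ (par' t).1 = par t.1 := fun t ht => hσu _ ht
  have hPσ : ∀ u, Sp u → P (σ (hd u)) = P u := fun u hu => by rw [hσu u hu]
  have hkap : ∀ u, Sp u → ∀ (R : ℕ), ∀ x ∈ P u, ∀ x' ∈ P u, G.edist x x' ≤ R →
      (cayleyGraph (H (jt (σ (hd u)))) (S (jt (σ (hd u))))).edist
        (κ (σ (hd u)) x) (κ (σ (hd u)) x') ≤ cf R := by
    intro u hu R x hx x' hx' hxx
    rw [← hPσ u hu] at hx hx'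
    exact h.kap _ (hσS _) R x hx x' hx' hxx
  have hpik : ∀ u, Sp u → ∀ x ∈ P u, G.edist (π (σ (hd u)) (κ (σ (hd u)) x)) x ≤ c := by
    intro u hu x hx
    rw [← hPσ u hu] at hx
    exact h.pik _ (hσS _) x hx
  let pi : (Σ t : T, H (ty t)) → V := fun x => π (σ x.1.1) x.2
  -- attaching points are near the adhesion sets
  have hz : ∀ t : T, t ≠ r' → ∀ y ∈ U t.1,
      G.edist (pi ⟨par' t, att t⟩) y ≤ (c * c + c + (k0 + 1) * c : ℕ) := by
    intro t ht y hy
    have hyP := (h.U1 _ (hne t ht) _ hy).2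
    by_cases hs : Sp (par t.1)
    · have e1 := hπl _ (hσS (par' t).1) c _ _ (edist_symm (hatt2 t hs))
      have e2 := hpik _ hs _ (h.U1 _ (hne t ht) _ (hyy t ht)).2
      have e3 := h.U3 _ (hne t ht) _ (hyy t ht) _ hy
      refine edist_tri e1 (edist_tri e2 e3 le_rfl) ?_
      rw [Nat.succ_mul]
      omega
    · have e1 := hπl _ (hσS (par' t).1) c _ _ (edist_symm (hatt3 t hs))
      have e2 := hπ1 _ (hσS (par' t).1)
      have e3 := hA _ hs _ hyP
      rw [← hσhd] at e3
      refine edist_tri e1 (edist_tri e2 e3 le_rfl) ?_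
      rw [Nat.succ_mul]
      omega
  have hw : ∀ u, u ≠ r → ∀ w ∈ U u, ∀ (x) (hx : Sp u → x = κ (σ (hd u)) w) (hx' : ¬ Sp u → x = 1),
      K.edist ⟨tp u, x⟩ ⟨tp u, 1⟩ ≤ cf c := by
    intro u hu w hw x hx hx'
    by_cases hs : Sp u
    · rw [hx hs]
      have e0 := h.y02 _ hs hu
      have e1 := hkap u hs c w (h.U1 _ hu _ hw).1 _ (h.y01 _ hs) (h.U3 _ hu _ hw _ e0)
      have e2 : κ (σ (hd u)) (y0 u) = 1 := by
        have := h.y03 _ (hσS (hd u))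
        rwa [congrArg y0 (hσu u hs)] at this
      rw [e2] at e1
      exact TS_cay e1
    · rw [hx' hs]; exact edist_self'
  let loc : N → V → Σ t : T, H (ty t) := fun u x =>
    ⟨tp u, if Sp u then κ (σ (hd u)) x else 1⟩
  have hstep : ∀ u, u ≠ r → ∀ w ∈ U u,
      K.edist (loc u w) (loc (par u) w) ≤ (cf c + 1 + cf c + c : ℕ) := by
    intro u hu w hwu
    have e1 := hw u hu w hwu (if Sp u then κ (σ (hd u)) w else 1) (fun e => if_pos e)
      (fun e => if_neg e)
    by_cases hh : hd u = u
    · have hr' : tp u ≠ r' := fun e => hu (by rw [← hh]; exact congrArg Subtype.val e)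
      have e2 := TS_rel (TSRel.out (S := S) (ty := ty) (t0 := r') (par := par') (att := att) (tp u) hr')
      have e3 : K.edist ⟨par' (tp u), att (tp u)⟩ (loc (par u) w) ≤ (cf c + c : ℕ) := by
        have e4 : tp u = ⟨u, hh⟩ := Subtype.ext hh
        have hr'' := hr'
        rw [e4] at hr'' ⊢
        show K.edist ⟨tp (par u), att ⟨u, hh⟩⟩ ⟨tp (par u), _⟩ ≤ _
        by_cases hs : Sp (par u)
        · rw [if_pos hs]
          have f1 := edist_symm (hatt2 ⟨u, hh⟩ hs)
          have f2 := hkap (par u) hs c (yy ⟨u, hh⟩) (h.U1 _ hu _ (hyy ⟨u, hh⟩ hr'')).2 w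
            (h.U1 _ hu _ hwu).2 (h.U3 _ hu _ (hyy ⟨u, hh⟩ hr'') _ hwu)
          exact TS_cay (edist_tri f1 f2 (by omega))
        · rw [if_neg hs]
          exact edist_mono (TS_cay (edist_symm (hatt3 ⟨u, hh⟩ hs))) (by omega)
      exact edist_tri e1 (edist_tri (edist_symm e2) e3 le_rfl) (by omega)
    · rcases hcase u with h1 | ⟨-, h2, h3⟩
      · exact absurd h1 hh
      · have e4 : tp u = tp (par u) := Subtype.ext h2
        have e5 : loc (par u) w = ⟨tp u, 1⟩ := by
          show (⟨tp (par u), _⟩ : Σ t : T, H (ty t)) = _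
          rw [if_neg h3, e4]
        rw [e5]
        exact edist_mono e1 (by omega)
  have hpath : ∀ w u, w ∈ P u →
      K.edist (loc u w) (loc (home w) w) ≤ ((cf c + 1 + cf c + c) * n0 : ℕ) := by
    intro w u hwu
    refine edist_lip (f := fun u => loc u w) ?_ (h.path w u hwu)
    intro a b hab
    rw [SG, SimpleGraph.fromRel_adj] at hab
    rcases hab.2 with ⟨h1, h2, h3⟩ | ⟨h1, h2, h3⟩
    · rw [← h2]; exact hstep a h1 w h3
    · rw [← h2]; exact edist_symm (hstep b h1 w h3)
  have hloc : ∀ u, ∀ x ∈ P u, ∀ x' ∈ P u, ∀ R : ℕ, G.edist x x' ≤ R →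
      K.edist (loc u x) (loc u x') ≤ cf R := by
    intro u x hx x' hx' R hR
    by_cases hs : Sp u
    · show K.edist ⟨tp u, _⟩ ⟨tp u, _⟩ ≤ _
      rw [if_pos hs, if_pos hs]
      exact TS_cay (hkap u hs R x hx x' hx' hR)
    · have : loc u x = loc u x' := by
        show (⟨tp u, _⟩ : Σ t : T, H (ty t)) = ⟨tp u, _⟩
        rw [if_neg hs, if_neg hs]
      rw [this]; exact edist_self'
  -- the coarse equivalence with the tree of Cayley graphs
  have hco : CoarseEq G K := by
    let A : ℕ := (cf c + 1 + cf c + c) * n0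
    let B : ℕ := c * c + c + (k0 + 1) * c
    refine ⟨fun v => loc (home v) v, pi, (cf 1 + A) + (B + (B + c)) + (A + c), ?_, ?_, ?_, ?_⟩
    · intro v w hvw
      exact edist_tri (hloc (home v) v (h.home0 v) w (h.home1 v w hvw) 1 (edist_adj hvw le_rfl))
        (hpath w _ (h.home1 v w hvw)) (by omega)
    · refine TS_lip ?_ ?_
      · intro t g s hs
        exact edist_mono (h.pi2 _ (hσS _) g s hs) (by omega)
      · intro t ht
        have e1 := hz t ht _ (hyy t ht)
        have e2 : G.edist (yy t) (y0 (σ t.1)) ≤ ((k0 + 1) * c : ℕ) := by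
          by_cases hs : Sp t.1
          · have := h.U3 _ (hne t ht) _ (hyy t ht) _ (h.y02 _ hs (hne t ht))
            rw [hσe _ hs]
            exact edist_mono this (by rw [Nat.succ_mul]; omega)
          · refine edist_mono (edist_symm (hA _ hs _ (h.U1 _ (hne t ht) _ (hyy t ht)).1)) ?_
            exact Nat.mul_le_mul_right _ (Nat.le_succ _)
        have e3 := edist_symm (hπ1 _ (hσS t.1))
        refine edist_tri e1 (edist_tri e2 e3 le_rfl) ?_
        have : (k0 + 1) * c ≤ B := Nat.le_add_left _ _
        omega
    · intro v
      show G.edist (π (σ (hd (home v))) (if Sp (home v) then κ (σ (hd (home v))) v else 1)) v ≤ _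
      by_cases hs : Sp (home v)
      · rw [if_pos hs]
        exact edist_mono (hpik _ hs v (h.home0 v)) (by omega)
      · rw [if_neg hs]
        have e3 := hA _ hs _ (h.home0 v)
        rw [← hσhd] at e3
        refine edist_tri (hπ1 _ (hσS _)) e3 ?_
        have : (k0 + 1) * c ≤ B := Nat.le_add_left _ _
        have : k0 * c ≤ (k0 + 1) * c := Nat.mul_le_mul_right _ (Nat.le_succ _)
        omega
    · rintro ⟨t, g⟩
      have hp := h.pi1 _ (hσS t.1) g
      have e1 := edist_symm (hpath _ _ hp)
      refine edist_tri e1 (n := c) ?_ (by omega)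
      have e2 : tp (σ t.1) = t := Subtype.ext ((hhσ t.1).trans t.2)
      have e3 : ∀ (s : N) (t' : T) (hs : Sp s) (hst : tp s = t') (w : V)
          (g : H (ty t')) (_ : (cayleyGraph (H (ty t')) (S (ty t'))).edist (κ (σ t'.1) w) g ≤ c),
          K.edist (loc s w) ⟨t', g⟩ ≤ c := by
        intro s t' hs hst w g hg
        subst hst
        show K.edist ⟨tp s, _⟩ _ ≤ _
        rw [if_pos hs]
        exact TS_cay hg
      exact e3 _ _ (hσS _) e2 _ g (h.kpi _ (hσS _) g)
  have hnear : ∀ t : T, t ≠ r' → Sp (par t.1) → ∀ x ∈ P (par t.1), G.edist (yy t) x ≤ (c + c : ℕ) →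
      (cayleyGraph (H (ty (par' t))) (S (ty (par' t)))).edist (att t) (κ (σ (par' t).1) x) ≤
        (c + cf (c + c) : ℕ) := by
    intro t ht hs x hx hxy
    exact edist_tri (edist_symm (hatt2 t hs)) (hkap _ hs _ _ (h.U1 _ (hne t ht) _ (hyy t ht)).2 _
      hx hxy) le_rfl
  have hkid : ∀ (t : T) (g : H (ty t)) (F : Finset T), F.card ≤ Fintype.card J →
      ∃ k : T, k ∉ F ∧ k ≠ r' ∧ ∃ e : t = par' k,
        (cayleyGraph (H (ty (par' k))) (S (ty (par' k)))).edist (att k) (e ▸ g) ≤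
          (c + cf (c + c) + c : ℕ) := by
    intro t g F hF
    obtain ⟨k, hkF, hkr, hkp, y, hy, hyd⟩ := h.kids _ (hσS t.1) _ (h.pi1 _ (hσS t.1) g)
      (F.image Subtype.val) (Finset.card_image_le.trans hF)
    have hks : Sp (par k) := by rw [hkp]; exact hσS _
    have hk : hd k = k := hpS k hks
    have e : t = par' ⟨k, hk⟩ := by
      refine Subtype.ext ?_
      show t.1 = hd (par k)
      rw [hkp, hhσ, t.2]
    have hkr' : (⟨k, hk⟩ : T) ≠ r' := fun e => hkr (congrArg Subtype.val e)
    refine ⟨⟨k, hk⟩, fun e => hkF (Finset.mem_image_of_mem Subtype.val e), hkr', e, ?_⟩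
    subst e
    have hp := h.pi1 _ (hσS (par' ⟨k, hk⟩).1) g
    have f1 := hnear ⟨k, hk⟩ hkr' hks (π (σ (par' ⟨k, hk⟩).1) g) ((hPσ _ hks).subset hp)
      (edist_tri (h.U3 _ hkr _ (hyy ⟨k, hk⟩ hkr') _ hy) (edist_symm hyd) le_rfl)
    exact edist_tri f1 (h.kpi _ (hσS _) g) le_rfl
  let B : ℕ := c * c + c + (k0 + 1) * c
  -- numbering of the children
  have hq : ∃ q : V → N → Fin (Nf B + 1), ∀ z k k', k ≠ r → k' ≠ r →
      (∃ y ∈ U k, G.edist z y ≤ B) → (∃ y ∈ U k', G.edist z y ≤ B) → q z k = q z k' → k = k' := by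
    have : ∀ z, ∃ q : N → Fin (Nf B + 1), ∀ k k', k ≠ r → k' ≠ r →
      (∃ y ∈ U k, G.edist z y ≤ B) → (∃ y ∈ U k', G.edist z y ≤ B) → q k = q k' → k = k' := by
      intro z
      obtain ⟨hf, hn⟩ := h.count B z
      obtain ⟨e⟩ : Nonempty ({k | k ≠ r ∧ ∃ y ∈ U k, G.edist z y ≤ B} ↪ Fin (Nf B + 1)) := by
        have := hf.fintype
        refine Function.Embedding.nonempty_of_card_le ?_
        rw [Fintype.card_fin, ← Nat.card_eq_fintype_card, Nat.card_coe_set_eq]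
        omega
      refine ⟨fun k => if hk : k ≠ r ∧ ∃ y ∈ U k, G.edist z y ≤ B then e ⟨k, hk⟩ else 0, ?_⟩
      intro k k' h1 h2 h3 h4 h5
      dsimp only at h5
      rw [dif_pos ⟨h1, h3⟩, dif_pos ⟨h2, h4⟩] at h5
      exact congrArg Subtype.val (e.injective h5)
    choose q hq using this
    exact ⟨q, hq⟩
  obtain ⟨q, hq⟩ := hq
  refine ⟨_, hco.trans (TS_cayley h.Sf h.Sg hR' (fun t _ => hatt1 t) (Nf B + 1)
    (fun t => q (pi ⟨par' t, att t⟩) t.1) ?_ (c + cf (c + c) + c) (k0 + 1) ?_ ?_)⟩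
  · intro t t' ht ht' he hqq
    have hzz : ∀ t : T, t ≠ r' → ∃ y ∈ U t.1, G.edist (pi ⟨par' t, att t⟩) y ≤ B :=
      fun t ht => ⟨_, hyy t ht, hz t ht _ (hyy t ht)⟩
    have h1 := hzz t ht
    have h2 := hzz t' ht'
    rw [he] at h1 hqq
    exact Subtype.ext (hq _ _ _ (hne t ht) (hne t' ht') h1 h2 hqq)
  · rintro ⟨t, g⟩ F hF
    obtain ⟨k, h1, h2, e, h3⟩ := hkid t g F hF
    subst e
    refine ⟨k, h1, h2, (att k)⁻¹ * g, cay_left1 h3, ?_⟩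
    rw [mul_inv_cancel_left]
  · intro t j
    obtain ⟨k, -, hkr, e, h3⟩ := hkid t 1 ∅ (Nat.zero_le _)
    subst e
    obtain ⟨s, n, hs1, hs2, hn, hs3, hs4⟩ := h.down k.1 (hne k hkr) j
    have claim : ∀ i, i ≤ n → ∃ m ≤ i, Rch S ty r' par' att (c + cf (c + c) + c) j m
        (tp (par^[i] s)) := by
      intro i
      induction i with
      | zero =>
        intro _
        refine ⟨0, le_rfl, ?_⟩
        show jt (σ (hd s)) = j
        rw [hσu s hs1, hs2]
      | succ i ih =>
        intro hi
        obtain ⟨m, hm, hRch⟩ := ih (by omega)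
        rw [Function.iterate_succ_apply']
        obtain ⟨hur, hUk⟩ := hs4 i (by omega)
        have hUp : ∀ y ∈ U (par^[i] s), ∀ y' ∈ U (par (par^[i] s)), G.edist y y' ≤ (c + c : ℕ) := by
          intro y hy y' hy'
          obtain ⟨w, hw⟩ := h.U2 _ (hne k hkr)
          rw [← Function.iterate_succ_apply' par] at hy'
          rcases Nat.lt_or_ge (i + 1) n with g | g
          · exact edist_tri (hUk y hy w hw) (edist_symm ((hs4 (i + 1) g).2 y' hy' w hw)) le_rfl
          · have : i + 1 = n := by omega
            rw [Nat.succ_eq_add_one, this, hs3] at hy'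
            exact edist_mono (hUk y hy y' hy') (by omega)
        have hpr : par (par^[i] s) ≠ r := by
          rw [← Function.iterate_succ_apply' par]
          rcases Nat.lt_or_ge (i + 1) n with g | g
          · exact (hs4 (i + 1) g).1
          · have : i + 1 = n := by omega
            rw [Nat.succ_eq_add_one, this, hs3]
            exact hne k hkr
        generalize par^[i] s = u at *
        by_cases hh : hd u = u
        · have e4 : tp u = ⟨u, hh⟩ := Subtype.ext hh
          rw [e4] at hRch
          have hur' : (⟨u, hh⟩ : T) ≠ r' := fun e => hur (congrArg Subtype.val e)
          refine ⟨m + 1, by omega, ⟨u, hh⟩, rfl, ⟨hur', ?_⟩, hRch⟩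
          by_cases hs : Sp (par u)
          · have g0 := h.y02 _ hs hpr
            have g1 := hnear ⟨u, hh⟩ hur' hs _ (h.y01 _ hs) (hUp _ (hyy _ hur') _ g0)
            have g2 : κ (σ (par' ⟨u, hh⟩).1) (y0 (par u)) = 1 := by
              have := h.y03 _ (hσS (par' ⟨u, hh⟩).1)
              rwa [congrArg y0 (hspar ⟨u, hh⟩ hs)] at this
            rw [g2] at g1
            exact edist_mono (edist_symm g1) (by omega)
          · exact edist_mono (hatt3 ⟨u, hh⟩ hs) (by omega)
        · rcases hcase u with h1 | ⟨-, h2, h3⟩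
          · exact absurd h1 hh
          · have e4 : tp u = tp (par u) := Subtype.ext h2
            rw [e4] at hRch
            exact ⟨m, by omega, hRch⟩
    obtain ⟨m, hm, hRch⟩ := claim n le_rfl
    have e5 : tp (par^[n] s) = k := by rw [hs3]; exact Subtype.ext k.2
    rw [e5] at hRch
    exact ⟨m, by omega, k, rfl, ⟨hkr, edist_symm h3⟩, hRch⟩

end

end TA
end

section
open scoped Pointwise
open Relation SimpleGraph

namespace TA

section
variable {V : Type u} {G : SimpleGraph V}
variable {Γ : Type*} [Group Γ] [MulAction Γ V] {𝓔 : Set (Set V)} {r : ℕ}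

theorem edist_smul (hA : Acts G Γ) (g : Γ) {a b : V} {n : ℕ} (h : G.edist a b ≤ n) :
    G.edist (g • a) (g • b) ≤ n := by
  have := edist_lip (H := G) (f := fun x => g • x) (c := 1)
    (fun x y hxy => edist_adj ((hA g x y).2 hxy) le_rfl) h
  rwa [one_mul] at this

theorem edist_smul' (hA : Acts G Γ) (g : Γ) {a b : V} {n : ℕ}
    (h : G.edist (g • a) (g • b) ≤ n) : G.edist a b ≤ n := by
  have := edist_smul hA g⁻¹ h
  rwa [inv_smul_smul, inv_smul_smul] at this

theorem edist_ex (hc : G.Connected) (a b : V) : ∃ n : ℕ, G.edist a b ≤ n :=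
  ⟨G.dist a b, edist_of_dist hc le_rfl⟩

/-- Uniform bound over a finite set. -/
theorem unif_fin {A : Type*} {s : Set A} (hs : s.Finite) (Q : A → ℕ → Prop)
    (mono : ∀ a m n, m ≤ n → Q a m → Q a n) (ex : ∀ a ∈ s, ∃ n, Q a n) :
    ∃ n, ∀ a ∈ s, Q a n := by
  classical
  have : ∀ a, ∃ n, a ∈ s → Q a n := fun a => by
    by_cases ha : a ∈ s
    · obtain ⟨n, hn⟩ := ex a ha; exact ⟨n, fun _ => hn⟩
    · exact ⟨0, fun h => absurd h ha⟩
  choose f hf using this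
  exact ⟨hs.toFinset.sup f, fun a ha => mono a _ _ (Finset.le_sup (hs.mem_toFinset.2 ha)) (hf a ha)⟩

theorem Dat.unif (h : Dat G Γ 𝓔 r) (Q : Set (Set V) → V → ℕ → Prop)
    (mono : ∀ s x m n, m ≤ n → Q s x m → Q s x n)
    (inv : ∀ (g : Γ) s x n, Node 𝓔 s → Q (g • s) (g • x) n → Q s x n)
    (ex : ∀ s x, Node 𝓔 s → x ∈ Pt G r s → ∃ n, Q s x n) :
    ∃ n, ∀ s x, Node 𝓔 s → x ∈ Pt G r s → Q s x n := by
  obtain ⟨v0⟩ := h.hc.nonempty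
  obtain ⟨n, hn⟩ := unif_fin (h.nodes_fin v0) (fun s n => Q s v0 n) (fun s => mono s v0)
    (fun s hs => ex s v0 hs.1 hs.2)
  refine ⟨n, fun s x hs hx => ?_⟩
  obtain ⟨g, rfl⟩ := h.tr x v0
  refine inv g s x n hs (hn _ ⟨hs.smul h.cut.smul g, ?_⟩)
  rw [Pt_smul h.hc h.acts]
  exact Set.smul_mem_smul_set hx

theorem Dat.unifC (h : Dat G Γ 𝓔 r) (Q : Set V → ℕ → Prop)
    (mono : ∀ C m n, m ≤ n → Q C m → Q C n)
    (inv : ∀ (g : Γ) C n, C ∈ 𝓔 → Q C n → Q (g • C) n)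
    (ex : ∀ C ∈ 𝓔, ∃ n, Q C n) : ∃ n, ∀ C ∈ 𝓔, Q C n := by
  obtain ⟨F, hF, hfin, horb⟩ := h.cut.orbits h.hc h.lf h.acts h.tr
  obtain ⟨n, hn⟩ := unif_fin hfin Q mono (fun C hC => ex C (hF hC))
  refine ⟨n, fun C hC => ?_⟩
  obtain ⟨D, hD, g, rfl⟩ := horb C hC
  exact inv g D n (hF hD) (hn D hD)

theorem Dat.unifV (h : Dat G Γ 𝓔 r) (Q : V → ℕ → Prop)
    (inv : ∀ (g : Γ) x n, Q x n → Q (g • x) n)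
    (ex : ∀ x, ∃ n, Q x n) : ∃ n, ∀ x, Q x n := by
  obtain ⟨v0⟩ := h.hc.nonempty
  obtain ⟨n, hn⟩ := ex v0
  refine ⟨n, fun x => ?_⟩
  obtain ⟨g, rfl⟩ := h.tr v0 x
  exact inv g v0 n hn

/-- distance bound inside an induced subgraph -/
def ed (G : SimpleGraph V) (P : Set V) (x x' : V) (n : ℕ) : Prop :=
  ∃ (hx : x ∈ P) (hx' : x' ∈ P), (G.induce P).edist ⟨x, hx⟩ ⟨x', hx'⟩ ≤ n

theorem ed.mono {P : Set V} {x x' : V} {m n : ℕ} (h : ed G P x x' m) (hmn : m ≤ n) :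
    ed G P x x' n :=
  let ⟨a, b, c⟩ := h; ⟨a, b, edist_mono c hmn⟩

theorem ed.edist {P : Set V} {x x' : V} {n : ℕ} (h : ed G P x x' n) : G.edist x x' ≤ n := by
  obtain ⟨hx, hx', h⟩ := h
  have := edist_lip (H := G) (f := fun x : P => x.1) (c := 1)
    (fun x y (hxy : G.Adj x.1 y.1) => edist_adj hxy le_rfl) h
  rwa [one_mul] at this

theorem ed.smul {P : Set V} {x x' : V} {n : ℕ} (hA : Acts G Γ) (g : Γ) (h : ed G P x x' n) :
    ed G (g • P) (g • x) (g • x') n := by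
  obtain ⟨hx, hx', h⟩ := h
  refine ⟨Set.smul_mem_smul_set hx, Set.smul_mem_smul_set hx', ?_⟩
  have := edist_lip (H := G.induce (g • P)) (f := autOf hA g (rfl : g • P = g • P)) (c := 1)
    (fun x y hxy => edist_adj ((autOf hA g (rfl : g • P = g • P)).map_rel_iff.2 hxy) le_rfl) h
  rwa [one_mul] at this

theorem ed.smul' {P : Set V} {x x' : V} {n : ℕ} (hA : Acts G Γ) (g : Γ)
    (h : ed G (g • P) (g • x) (g • x') n) : ed G P x x' n := by
  have := h.smul hA g⁻¹
  rwa [inv_smul_smul, inv_smul_smul, inv_smul_smul] at this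

theorem Dat.ed_unif (h : Dat G Γ 𝓔 r) (R : ℕ) : ∃ n, ∀ s, Node 𝓔 s → ∀ x ∈ Pt G r s,
    ∀ x' ∈ Pt G r s, G.edist x x' ≤ R → ed G (Pt G r s) x x' n := by
  refine Exists.imp (fun n hn => fun s hs x hx => hn s x hs hx)
    (h.unif (fun s x n => ∀ x' ∈ Pt G r s, G.edist x x' ≤ R →
    ed G (Pt G r s) x x' n) ?_ ?_ ?_)
  · intro s x m n hmn hm x' hx' hd
    exact (hm x' hx' hd).mono hmn
  · intro g s x n hs hQ x' hx' hd
    have := hQ (g • x') (by rw [Pt_smul h.hc h.acts]; exact Set.smul_mem_smul_set hx')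
      (edist_smul h.acts g hd)
    rw [Pt_smul h.hc h.acts] at this
    exact this.smul' h.acts g
  · intro s x hs hx
    have hfin : {x' | x' ∈ Pt G r s ∧ G.edist x x' ≤ R}.Finite :=
      (dist_finite h.hc h.lf R x).subset fun x' hx' => dist_of_edist hx'.2
    obtain ⟨n, hn⟩ := unif_fin hfin (fun x' n => ed G (Pt G r s) x x' n)
      (fun a m n hmn hm => hm.mono hmn) (fun x' hx' => by
        obtain ⟨n, hn⟩ := edist_ex (h.connected_Pt hs) ⟨x, hx⟩ ⟨x', hx'.1⟩
        exact ⟨n, hx, hx'.1, hn⟩)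
    exact ⟨n, fun x' h1 h2 => hn x' ⟨h1, h2⟩⟩

theorem Dat.U_diam (h : Dat G Γ 𝓔 r) : ∃ n : ℕ, ∀ C ∈ 𝓔, ∀ y ∈ UU G r C, ∀ y' ∈ UU G r C,
    G.edist y y' ≤ n := by
  refine h.unifC (fun C n => ∀ y ∈ UU G r C, ∀ y' ∈ UU G r C, G.edist y y' ≤ n) ?_ ?_ ?_
  · intro C m n hmn hm y hy y' hy'
    exact edist_mono (hm y hy y' hy') hmn
  · intro g C n hC hQ y hy y' hy'
    rw [UU_smul h.hc h.acts] at hy hy'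
    obtain ⟨a, ha, rfl⟩ := hy
    obtain ⟨b, hb, rfl⟩ := hy'
    exact edist_smul h.acts g (hQ a ha b hb)
  · intro C hC
    have hf := (h.U_fin hC).prod (h.U_fin hC)
    obtain ⟨n, hn⟩ := unif_fin hf (fun (p : V × V) (n : ℕ) => G.edist p.1 p.2 ≤ n)
      (fun a m n hmn hm => edist_mono hm hmn) (fun p _ => edist_ex h.hc p.1 p.2)
    exact ⟨n, fun y hy y' hy' => hn (y, y') ⟨hy, hy'⟩⟩

theorem Dat.fin_diam (h : Dat G Γ 𝓔 r) (SpS : Set (Set V) → Prop)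
    (hinv : ∀ (g : Γ) s, SpS (g • s) → SpS s)
    (hfin : ∀ s, Node 𝓔 s → ¬ SpS s → (Pt G r s).Finite) :
    ∃ n : ℕ, ∀ s, Node 𝓔 s → ¬ SpS s → ∀ x ∈ Pt G r s, ∀ y ∈ Pt G r s, G.edist x y ≤ n := by
  refine Exists.imp (fun n hn => fun s hs h1 x hx => hn s x hs hx h1)
    (h.unif (fun s x n => ¬ SpS s → ∀ y ∈ Pt G r s, G.edist x y ≤ n) ?_ ?_ ?_)
  · intro s x m n hmn hm h1 y hy
    exact edist_mono (hm h1 y hy) hmn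
  · intro g s x n hs hQ h1 y hy
    exact edist_smul' h.acts g (hQ (fun h2 => h1 (hinv g s h2)) _
      (by rw [Pt_smul h.hc h.acts]; exact Set.smul_mem_smul_set hy))
  · intro s x hs hx
    by_cases h1 : SpS s
    · exact ⟨0, fun h2 => absurd h1 h2⟩
    obtain ⟨n, hn⟩ := unif_fin (hfin s hs h1) (fun y (n : ℕ) => G.edist x y ≤ n)
      (fun a m n hmn hm => edist_mono hm hmn) (fun p _ => edist_ex h.hc x p)
    exact ⟨n, fun _ => hn⟩

theorem Dat.path (h : Dat G Γ 𝓔 r) : ∃ n0 : ℕ, ∀ w, {C | C ∈ 𝓔 ∧ w ∈ UU G r C}.ncard ≤ n0 := by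
  refine h.unifV _ ?_ (fun x => ⟨_, le_rfl⟩)
  intro g x n hn
  refine le_trans (le_of_eq ?_) hn
  have : {C | C ∈ 𝓔 ∧ g • x ∈ UU G r C} = (fun C => g • C) '' {C | C ∈ 𝓔 ∧ x ∈ UU G r C} := by
    ext C
    constructor
    · rintro ⟨h1, h2⟩
      refine ⟨g⁻¹ • C, ⟨h.cut.smul _ _ h1, ?_⟩, smul_inv_smul g C⟩
      rw [UU_smul h.hc h.acts, Set.mem_inv_smul_set_iff]
      exact h2
    · rintro ⟨D, ⟨h1, h2⟩, rfl⟩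
      refine ⟨h.cut.smul _ _ h1, ?_⟩
      show _ ∈ UU G r (g • D)
      rw [UU_smul h.hc h.acts]
      exact Set.smul_mem_smul_set h2
  rw [this, Set.ncard_image_of_injective _ (MulAction.injective g)]

theorem Dat.count (h : Dat G Γ 𝓔 r) (R : ℕ) : (∀ z, {C | C ∈ 𝓔 ∧ ∃ y ∈ UU G r C,
      G.edist z y ≤ R}.Finite) ∧
    ∃ n0 : ℕ, ∀ z, {C | C ∈ 𝓔 ∧ ∃ y ∈ UU G r C, G.edist z y ≤ R}.ncard ≤ n0 := by
  constructor
  · intro z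
    refine ((dist_finite h.hc h.lf R z).biUnion fun y _ => h.mem_U_fin y).subset ?_
    rintro C ⟨hC, y, hy, hd⟩
    exact Set.mem_biUnion (show y ∈ {w | G.dist z w ≤ R} from dist_of_edist hd) ⟨hC, hy⟩
  refine h.unifV _ ?_ (fun x => ⟨_, le_rfl⟩)
  intro g x n hn
  refine le_trans (le_of_eq ?_) hn
  have : {C | C ∈ 𝓔 ∧ ∃ y ∈ UU G r C, G.edist (g • x) y ≤ R} =
      (fun C => g • C) '' {C | C ∈ 𝓔 ∧ ∃ y ∈ UU G r C, G.edist x y ≤ R} := by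
    ext C
    constructor
    · rintro ⟨h1, y, h2, h3⟩
      refine ⟨g⁻¹ • C, ⟨h.cut.smul _ _ h1, g⁻¹ • y, ?_, ?_⟩, smul_inv_smul g C⟩
      · rw [UU_smul h.hc h.acts]
        exact Set.smul_mem_smul_set h2
      · refine edist_smul' h.acts g ?_
        rw [smul_inv_smul]
        exact h3
    · rintro ⟨D, ⟨h1, y, h2, h3⟩, rfl⟩
      refine ⟨h.cut.smul _ _ h1, g • y, ?_, edist_smul h.acts g h3⟩
      show _ ∈ UU G r (g • D)
      rw [UU_smul h.hc h.acts]
      exact Set.smul_mem_smul_set h2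
  rw [this, Set.ncard_image_of_injective _ (MulAction.injective g)]

theorem Dat.kids (h : Dat G Γ 𝓔 r) (SpS : Set (Set V) → Prop)
    (hinv : ∀ (g : Γ) s, SpS s → SpS (g • s)) (m : ℕ)
    (many : ∀ s, Node 𝓔 s → SpS s → ∃ A : Finset (Set V), m < A.card ∧ ∀ C ∈ A, MinIn s C) :
    ∃ n : ℕ, ∀ s, Node 𝓔 s → SpS s → ∀ x ∈ Pt G r s, ∀ F : Finset (Set V), F.card ≤ m →
      ∃ C, C ∉ F ∧ MinIn s C ∧ ∃ y ∈ UU G r C, G.edist x y ≤ n := by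
  classical
  refine Exists.imp (fun n hn => fun s hs h1 x hx => hn s x hs hx h1)
    (h.unif (fun s x n => SpS s → ∀ F : Finset (Set V), F.card ≤ m →
      ∃ C, C ∉ F ∧ MinIn s C ∧ ∃ y ∈ UU G r C, G.edist x y ≤ n) ?_ ?_ ?_)
  · intro s x m n hmn hm h1 F hF
    obtain ⟨C, h1, h2, y, h3, h4⟩ := hm h1 F hF
    exact ⟨C, h1, h2, y, h3, edist_mono h4 hmn⟩
  · intro g s x n hs hQ h1 F hF
    obtain ⟨C, h1, h2, y, h3, h4⟩ := hQ (hinv g s h1) (F.image fun C => g • C)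
      (Finset.card_image_le.trans hF)
    refine ⟨g⁻¹ • C, fun hC => h1 ?_, ?_, g⁻¹ • y, ?_, ?_⟩
    · have := Finset.mem_image_of_mem (fun C => g • C) hC
      rwa [smul_inv_smul] at this
    · have := h2.smul g⁻¹
      rwa [inv_smul_smul] at this
    · rw [UU_smul h.hc h.acts]
      exact Set.smul_mem_smul_set h3
    · refine edist_smul' h.acts g ?_
      rw [smul_inv_smul]
      exact h4
  · intro s x hs hx
    by_cases h1 : SpS s
    · obtain ⟨A, hA, hmin⟩ := many s hs h1
      obtain ⟨n, hn⟩ := unif_fin A.finite_toSet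
        (fun C n => ∃ y ∈ UU G r C, G.edist x y ≤ n)
        (fun C m n hmn ⟨y, h1, h2⟩ => ⟨y, h1, edist_mono h2 hmn⟩)
        (fun C hC => by
          obtain ⟨y, hy⟩ := h.U_ne (hs.sub (hmin C hC).1)
          obtain ⟨n, hn⟩ := edist_ex h.hc x y
          exact ⟨n, y, hy, hn⟩)
      refine ⟨n, fun _ F hF => ?_⟩
      obtain ⟨C, hC, hCF⟩ := Finset.exists_mem_notMem_of_card_lt_card (lt_of_le_of_lt hF hA)
      exact ⟨C, hCF, hmin C hC, hn C hC⟩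
    · exact ⟨0, fun h2 => absurd h2 h1⟩

theorem Dat.down (h : Dat G Γ 𝓔 r) (τ : Set (Set V)) (hτ : Node 𝓔 τ) :
    ∃ n : ℕ, ∀ C ∈ 𝓔, ∃ g : Γ, C ∈ g • τ ∧ (g • τ \ nodeOf 𝓔 C).ncard ≤ n ∧
      ∀ D ∈ g • τ \ nodeOf 𝓔 C, ∀ y ∈ UU G r D, ∀ y' ∈ UU G r C, G.edist y y' ≤ n := by
  refine h.unifC (fun C n => ∃ g : Γ, C ∈ g • τ ∧ (g • τ \ nodeOf 𝓔 C).ncard ≤ n ∧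
      ∀ D ∈ g • τ \ nodeOf 𝓔 C, ∀ y ∈ UU G r D, ∀ y' ∈ UU G r C, G.edist y y' ≤ n) ?_ ?_ ?_
  · rintro C m n hmn ⟨g, h1, h2, h3⟩
    exact ⟨g, h1, h2.trans hmn, fun D hD y hy y' hy' => edist_mono (h3 D hD y hy y' hy') hmn⟩
  · rintro k C n hC ⟨g, h1, h2, h3⟩
    have e : (k * g) • τ \ nodeOf 𝓔 (k • C) = k • (g • τ \ nodeOf 𝓔 C) := by
      rw [nodeOf_smul h.nf h.cut.smul hC, Set.smul_set_sdiff, mul_smul]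
    refine ⟨k * g, ?_, ?_, ?_⟩
    · rw [mul_smul]; exact Set.smul_mem_smul_set h1
    · rw [e, ← Set.image_smul, Set.ncard_image_of_injective _ (MulAction.injective k)]
      exact h2
    · rw [e]
      rintro _ ⟨D, hD, rfl⟩ y hy y' hy'
      simp only at hy
      rw [UU_smul h.hc h.acts] at hy hy'
      obtain ⟨a, ha, rfl⟩ := hy
      obtain ⟨b, hb, rfl⟩ := hy'
      exact edist_smul h.acts k (h3 D hD a ha b hb)
  · intro C hC
    obtain ⟨v, hv, hvU⟩ : ∃ v ∈ C, v ∉ UU G r C := by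
      by_contra hcon
      push Not at hcon
      exact h.cut.inf C hC ((h.U_fin hC).subset hcon)
    obtain ⟨x, hx⟩ := h.Pt_ne hτ
    obtain ⟨g, rfl⟩ := h.tr x v
    have hgt := hτ.smul h.cut.smul g
    have hd := Node.diff_fin x (nodeOf_node h.nf hC) hgt
    have hf : ((g • τ \ nodeOf 𝓔 C).Finite) := hd
    obtain ⟨n, hn⟩ := unif_fin hf (fun D n => ∀ y ∈ UU G r D, ∀ y' ∈ UU G r C, G.edist y y' ≤ n)
      (fun D m n hmn hm y hy y' hy' => edist_mono (hm y hy y' hy') hmn) (fun D hD => by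
        have hf := (h.U_fin (hgt.sub hD.1)).prod (h.U_fin hC)
        obtain ⟨n, hn⟩ := unif_fin hf (fun (p : V × V) (n : ℕ) => G.edist p.1 p.2 ≤ n)
          (fun a m n hmn hm => edist_mono hm hmn) (fun p _ => edist_ex h.hc p.1 p.2)
        exact ⟨n, fun y hy y' hy' => hn (y, y') ⟨hy, hy'⟩⟩)
    refine ⟨n + (g • τ \ nodeOf 𝓔 C).ncard, g, ?_, by omega, fun D hD y hy y' hy' =>
      edist_mono (hn D hD y hy y' hy') (by omega)⟩
    exact mem_of_mem_Pt hgt (by rw [Pt_smul h.hc h.acts]; exact Set.smul_mem_smul_set hx) hC hv hvU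

end

end TA
end

section
open scoped Pointwise
open Relation SimpleGraph

namespace TA

section
variable {V : Type u} {G : SimpleGraph V}
variable {Γ : Type*} [Group Γ] [MulAction Γ V] {𝓔 : Set (Set V)} {r : ℕ}

theorem kpi_data (hA : Acts G Γ) {P Q : Set V} (g : Γ) (hPQ : g • P = Q)
    {H : Type*} [Group H] {S : Set H} {f : P → H} {fi : H → P} {c : ℕ}
    (h1 : ∀ x y, (G.induce P).Adj x y → (cayleyGraph H S).edist (f x) (f y) ≤ c)
    (h2 : ∀ x y, (cayleyGraph H S).Adj x y → (G.induce P).edist (fi x) (fi y) ≤ c)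
    (h3 : ∀ x, (G.induce P).edist (fi (f x)) x ≤ c)
    (h4 : ∀ y, (cayleyGraph H S).edist (f (fi y)) y ≤ c)
    {cf : ℕ → ℕ} (hcf : ∀ R : ℕ, ∀ x ∈ Q, ∀ x' ∈ Q, G.edist x x' ≤ R → ed G Q x x' (cf R))
    (y0 : V) (hy0 : y0 ∈ Q) :
    ∃ (κ : V → H) (π : H → V), (∀ h, π h ∈ Q) ∧
      (∀ h, ∀ s ∈ S, G.edist (π h) (π (h * s)) ≤ c) ∧
      (∀ R : ℕ, ∀ x ∈ Q, ∀ x' ∈ Q, G.edist x x' ≤ R →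
        (cayleyGraph H S).edist (κ x) (κ x') ≤ (c * cf R : ℕ)) ∧
      (∀ x ∈ Q, G.edist (π (κ x)) x ≤ c) ∧
      (∀ h, (cayleyGraph H S).edist (κ (π h)) h ≤ c) ∧ κ y0 = 1 := by
  classical
  subst hPQ
  let κ' : V → H := fun x => if hx : g⁻¹ • x ∈ P then f ⟨g⁻¹ • x, hx⟩ else 1
  have hκ : ∀ x : P, κ' (g • x.1) = f x := by
    intro x
    have : g⁻¹ • g • x.1 ∈ P := by rw [inv_smul_smul]; exact x.2
    show dite _ _ _ = _
    rw [dif_pos this]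
    congr 1
    exact Subtype.ext (inv_smul_smul g x.1)
  have hQ : ∀ x ∈ g • P, ∃ a : P, g • a.1 = x := by
    rintro _ ⟨a, ha, rfl⟩
    exact ⟨⟨a, ha⟩, rfl⟩
  let a := κ' y0
  have hed : ∀ (x y : P) (n : ℕ), (G.induce P).edist x y ≤ n → G.edist (g • x.1) (g • y.1) ≤ n :=
    fun x y n hn => edist_smul hA g (ed.edist ⟨x.2, y.2, hn⟩)
  refine ⟨fun x => a⁻¹ * κ' x, fun h => g • (fi (a * h)).1, ?_, ?_, ?_, ?_, ?_, ?_⟩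
  · intro h
    exact Set.smul_mem_smul_set (fi (a * h)).2
  · intro h s hs
    refine hed _ _ _ ?_
    have := edist_lip h2 (cay_mul (g := a * h) hs)
    rwa [mul_one, mul_assoc] at this
  · intro R x hx x' hx' hd
    obtain ⟨b, rfl⟩ := hQ x hx
    obtain ⟨b', rfl⟩ := hQ x' hx'
    obtain ⟨e1, e2, e3⟩ := (hcf R _ hx _ hx' hd).smul' hA g
    refine cay_left ?_
    rw [hκ, hκ]
    exact edist_lip h1 e3
  · intro x hx
    obtain ⟨b, rfl⟩ := hQ x hx
    refine hed _ b _ ?_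
    show (G.induce P).edist (fi (a * (a⁻¹ * κ' (g • b.1)))) b ≤ c
    rw [hκ, mul_inv_cancel_left]
    exact h3 b
  · intro h
    show (cayleyGraph H S).edist (a⁻¹ * κ' (g • (fi (a * h)).1)) h ≤ c
    rw [hκ]
    have := cay_left (a := a⁻¹) (h4 (a * h))
    rwa [inv_mul_cancel_left] at this
  · exact inv_mul_cancel a

theorem Dat.cayley (h : Dat G Γ 𝓔 r) (SpS : Set (Set V) → Prop)
    (hinv : ∀ (g : Γ) s, SpS (g • s) ↔ SpS s)
    (hfin : ∀ s, Node 𝓔 s → ¬ SpS s → (Pt G r s).Finite)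
    {J : Type} [Fintype J] [Nonempty J] (τ : J → Set (Set V)) (hτ : ∀ j, Node 𝓔 (τ j))
    (hτS : ∀ j, SpS (τ j)) (horb : ∀ s, Node 𝓔 s → SpS s → ∃ j, ∃ g : Γ, g • τ j = s)
    (hdis : ∀ j j' (g g' : Γ), g • τ j = g' • τ j' → j = j')
    (many : ∀ s, Node 𝓔 s → SpS s → ∃ A : Finset (Set V), Fintype.card J + 1 < A.card ∧
      ∀ C ∈ A, MinIn s C)
    {H : J → Type u} [∀ j, Group (H j)] {S : ∀ j, Set (H j)} (Sf : ∀ j, (S j).Finite)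
    (Sg : ∀ j, Subgroup.closure (S j) = ⊤)
    (hco : ∀ j, CoarseEq (G.induce (Pt G r (τ j))) (cayleyGraph (H j) (S j)))
    (hnt : ∀ j, Nontrivial (H j)) :
    ∃ Q : ℕ, CoarseEq G (cayleyGraph (FP H Q) (FPgen S Q)) := by
  classical
  obtain ⟨v0⟩ := h.hc.nonempty
  obtain ⟨j0⟩ := ‹Nonempty J›
  -- constants
  obtain ⟨c1, hU3⟩ := h.U_diam
  obtain ⟨c2, hfd⟩ := h.fin_diam SpS (fun g s => (hinv g s).1) hfin
  obtain ⟨c3, hkids⟩ := h.kids SpS (fun g s => (hinv g s).2) _ many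
  choose hcf1 hcf2 using h.count
  choose Nf hNf using hcf2
  choose cf hcf using h.ed_unif
  obtain ⟨n0, hn0⟩ := h.path
  obtain ⟨c4, hdown⟩ := unif_fin (Set.finite_univ (α := J)) (fun j n => ∀ C ∈ 𝓔, ∃ g : Γ, C ∈ g • τ j ∧
      (g • τ j \ nodeOf 𝓔 C).ncard ≤ n ∧
      ∀ D ∈ g • τ j \ nodeOf 𝓔 C, ∀ y ∈ UU G r D, ∀ y' ∈ UU G r C, G.edist y y' ≤ n)
      (fun j m n hmn hm C hC => by
        obtain ⟨g, e1, e2, e3⟩ := hm C hC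
        exact ⟨g, e1, e2.trans hmn, fun D hD y hy y' hy' => edist_mono (e3 D hD y hy y' hy') hmn⟩)
      (fun j _ => h.down (τ j) (hτ j))
  choose f fi cc hco1 hco2 hco3 hco4 using hco
  have hgg : ∀ j, ∃ g : H j, g ≠ 1 := fun j => exists_ne 1
  choose gg hgg1 using hgg
  obtain ⟨c5, hgg2⟩ := unif_fin (Set.finite_univ (α := J))
    (fun j (n : ℕ) => (cayleyGraph (H j) (S j)).edist 1 (gg j) ≤ n)
    (fun j m n hmn hm => edist_mono hm hmn) (fun j _ => edist_ex (cay_connected (Sg j)) _ _)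
  obtain ⟨c6, hc6⟩ := unif_fin (Set.finite_univ (α := J)) (fun j (n : ℕ) => cc j ≤ n)
    (fun j m n hmn hm => hm.trans hmn) (fun j _ => ⟨_, le_rfl⟩)
  let c := c1 + c2 + c3 + c4 + c5 + c6
  -- the tree
  let t0 := τ j0
  have h0 : Node 𝓔 t0 := hτ j0
  let N := {t : Set (Set V) // Node 𝓔 t}
  let rt : N := ⟨t0, h0⟩
  have hne : ∀ k : N, k ≠ rt → k.1 ≠ t0 := fun k hk e => hk (Subtype.ext e)
  let par : N → N := fun k => if hk : k = rt then rt else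
    ⟨parS t0 k.1, Node.parS_node v0 h.nf h0 k.2 (hne k hk)⟩
  have hpar : ∀ k, k ≠ rt → (par k).1 = parS t0 k.1 := fun k hk => by
    show (dite _ _ _ : N).1 = _
    rw [dif_neg hk]
  have hroot : Rooted rt par (fun k => dep t0 k.1) := by
    constructor
    · intro k
      exact ⟨fun e => Subtype.ext (Node.dep_zero v0 h0 k.2 e), fun e => by rw [e]; exact Node.dep_root⟩
    · intro k hk
      rw [hpar k hk]
      exact Node.dep_par v0 h.nf h0 k.2 (hne k hk)
  let P : N → Set V := fun k => Pt G r k.1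
  let U : N → Set V := fun k => UU G r (pe t0 k.1)
  have hpe : ∀ k : N, k ≠ rt → MinIn k.1 (pe t0 k.1) ∧ pe t0 k.1 ∉ t0 := fun k hk =>
    Node.pe_spec v0 h.nf h0 k.2 (hne k hk)
  have hpe𝓔 : ∀ k : N, k ≠ rt → pe t0 k.1 ∈ 𝓔 := fun k hk => k.2.sub (hpe k hk).1.1
  have hU1 : ∀ k, k ≠ rt → ∀ y ∈ U k, y ∈ P k ∧ y ∈ P (par k) := by
    intro k hk y hy
    have := Pt_inter_flip (G := G) (r := r) h.nf k.2 (hpe k hk).1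
    have hy' : y ∈ UU G r (pe t0 k.1) := hy
    rw [← this] at hy'
    refine ⟨hy'.1, ?_⟩
    show y ∈ Pt G r (par k).1
    rw [hpar k hk]
    exact hy'.2
  have hpeinj : ∀ k k' : N, k ≠ rt → k' ≠ rt → pe t0 k.1 = pe t0 k'.1 → k = k' := by
    intro k k' hk hk' e
    refine Subtype.ext ?_
    rw [Node.eq_nodeOf h.nf k.2 (hpe k hk).1 (nodeOf_node h.nf (hpe𝓔 k hk)),
      Node.eq_nodeOf h.nf k'.2 (hpe k' hk').1 (nodeOf_node h.nf (hpe𝓔 k' hk')), e]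
  -- types
  have hjt : ∀ k : N, ∃ j, SpS k.1 → ∃ g : Γ, g • τ j = k.1 := fun k => by
    by_cases hk : SpS k.1
    · obtain ⟨j, hj⟩ := horb k.1 k.2 hk
      exact ⟨j, fun _ => hj⟩
    · exact ⟨j0, fun e => absurd e hk⟩
  choose jt hjt using hjt
  have hy0 : ∀ k : N, ∃ y ∈ P k, k ≠ rt → y ∈ U k := fun k => by
    by_cases hk : k = rt
    · obtain ⟨y, hy⟩ := h.Pt_ne k.2
      exact ⟨y, hy, fun e => absurd hk e⟩
    · obtain ⟨y, hy⟩ := h.U_ne (hpe𝓔 k hk)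
      exact ⟨y, (hU1 k hk y hy).1, fun _ => hy⟩
  choose y0 hy01 hy02 using hy0
  have hkp : ∀ k : N, ∃ (κ : V → H (jt k)) (π : H (jt k) → V), SpS k.1 →
      (∀ h, π h ∈ P k) ∧
      (∀ h, ∀ s ∈ S (jt k), G.edist (π h) (π (h * s)) ≤ (cc (jt k))) ∧
      (∀ R : ℕ, ∀ x ∈ P k, ∀ x' ∈ P k, G.edist x x' ≤ R →
        (cayleyGraph (H (jt k)) (S (jt k))).edist (κ x) (κ x') ≤ (cc (jt k) * cf R : ℕ)) ∧
      (∀ x ∈ P k, G.edist (π (κ x)) x ≤ (cc (jt k))) ∧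
      (∀ h, (cayleyGraph (H (jt k)) (S (jt k))).edist (κ (π h)) h ≤ (cc (jt k))) ∧ κ (y0 k) = 1 := by
    intro k
    by_cases hk : SpS k.1
    · obtain ⟨g, hg⟩ := hjt k hk
      obtain ⟨κ, π, hh⟩ := kpi_data h.acts g (P := Pt G r (τ (jt k))) (Q := P k)
        (by rw [← Pt_smul h.hc h.acts, hg]) (hco1 (jt k)) (hco2 (jt k)) (hco3 (jt k)) (hco4 (jt k))
        (cf := cf) (fun R x hx x' hx' hd => hcf R k.1 k.2 x hx x' hx' hd) (y0 k) (hy01 k)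
      exact ⟨κ, π, fun _ => hh⟩
    · exact ⟨fun _ => 1, fun _ => v0, fun e => absurd e hk⟩
  choose κ π hkp using hkp
  have hcc : ∀ j, cc j ≤ c := fun j => (hc6 j (Set.mem_univ j)).trans (Nat.le_add_left _ _)
  have hsys : TSys G rt par (fun k => dep t0 k.1) (fun k => SpS k.1) P U
      (fun v => ⟨Ov 𝓔 v, Ov_node h.nf v⟩) S jt κ π y0 c c4 n0 (fun R => c * cf R) Nf gg := by
    refine ⟨h.hc, hroot, hτS j0, hU1, fun k hk => h.U_ne (hpe𝓔 k hk), ?_, ?_,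
      fun s hs => (hkp s hs).1, ?_, ?_, ?_, ?_, fun s _ => hy01 s, fun s _ => hy02 s,
      fun s hs => (hkp s hs).2.2.2.2.2, fun v => mem_Pt_Ov v, fun v w hvw => adj_mem_Pt_Ov h.hr hvw,
      ?_, ?_, ?_, ?_, hgg1, ?_, Sf, Sg⟩
    · intro k hk y hy y' hy'
      exact edist_mono (hU3 _ (hpe𝓔 k hk) y hy y' hy') (by omega)
    · intro u hu x hx y hy
      exact edist_mono (hfd u.1 u.2 hu x hx y hy) (by omega)
    · intro s hs a g hg
      exact edist_mono ((hkp s hs).2.1 a g hg) (hcc _)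
    · intro s hs R x hx x' hx' hd
      exact edist_mono ((hkp s hs).2.2.1 R x hx x' hx' hd) (Nat.mul_le_mul_right _ (hcc _))
    · intro s hs x hx
      exact edist_mono ((hkp s hs).2.2.2.1 x hx) (hcc _)
    · intro s hs a
      exact edist_mono ((hkp s hs).2.2.2.2.1 a) (hcc _)
    · -- paths
      intro w u hwu
      have hw := Ov_node h.nf w
      have key : ∀ m, ∀ u : N, w ∈ P u → dep (Ov 𝓔 w) u.1 ≤ m →
          (SG rt par U w).edist u ⟨Ov 𝓔 w, hw⟩ ≤ m := by
        intro m
        induction m with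
        | zero =>
          intro u hu hm
          have : u = ⟨Ov 𝓔 w, hw⟩ := Subtype.ext (Node.dep_zero w hw u.2 (Nat.le_zero.1 hm))
          rw [this]; exact edist_self'
        | succ m ih =>
          intro u hu hm
          by_cases he : u.1 = Ov 𝓔 w
          · have : u = ⟨Ov 𝓔 w, hw⟩ := Subtype.ext he
            rw [this]; exact edist_self'
          obtain ⟨hD, hD'⟩ := Node.pe_spec w h.nf hw u.2 he
          have hdp := Node.dep_par w h.nf hw u.2 he
          have hpn := Node.parS_node w h.nf hw u.2 he
          have hparS : parS (Ov 𝓔 w) u.1 = flip u.1 (pe (Ov 𝓔 w) u.1) := rfl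
          set D := pe (Ov 𝓔 w) u.1 with hDdef
          have hwD : w ∉ D := fun e => hD' ⟨u.2.sub hD.1, e⟩
          have hwU : w ∈ UU G r D := mem_UU_of_notMem (hu D hD.1) hwD
          have hwU' := hwU
          rw [← Pt_inter_flip h.nf u.2 hD] at hwU'
          have e2 := ih ⟨_, hpn⟩ hwU'.2 (by show dep _ (parS _ _) ≤ _; omega)
          refine edist_tri (m := 1) ?_ e2 (by omega)
          have hneq : u ≠ ⟨_, hpn⟩ := by
            intro e
            have := congrArg (fun k : N => dep (Ov 𝓔 w) k.1) e
            simp only at this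
            omega
          refine edist_adj ?_ le_rfl
          rw [SG, SimpleGraph.fromRel_adj]
          refine ⟨hneq, ?_⟩
          rcases Node.flip_cases h.nf h0 u.2 hD with ⟨g1, g2, g3⟩ | ⟨g1, g2, g3⟩
          · left
            have hur : u ≠ rt := fun e => g1 (congrArg Subtype.val e)
            refine ⟨hur, Subtype.ext ?_, ?_⟩
            · rw [hpar u hur]
              show parS t0 u.1 = parS _ _
              rw [g3, hparS]
            · show w ∈ UU G r (pe t0 u.1)
              rw [g2]; exact hwU
          · right
            have hur : (⟨_, hpn⟩ : N) ≠ rt := fun e => g1 (congrArg Subtype.val e)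
            refine ⟨hur, Subtype.ext ?_, ?_⟩
            · rw [hpar _ hur]
              show parS t0 (parS _ _) = _
              rw [hparS, g3]
            · show w ∈ UU G r (pe t0 (parS _ _))
              rw [hparS, g2, UU_compl]; exact hwU
      refine key n0 u hwu (le_trans (Set.ncard_le_ncard ?_ (h.mem_U_fin w)) (hn0 w))
      rintro D ⟨hD, hD'⟩
      exact ⟨u.2.sub hD, mem_UU_of_notMem (hwu D hD) fun e => hD' ⟨u.2.sub hD, e⟩⟩
    · -- kids
      intro s hs x hx F hF
      obtain ⟨C, hCF, hC, y, hy, hd⟩ := hkids s.1 s.2 hs x hx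
        (insert (pe t0 s.1) (F.image fun k : N => (pe t0 k.1)ᶜ))
        ((Finset.card_insert_le _ _).trans (Nat.succ_le_succ (Finset.card_image_le.trans hF)))
      rcases Node.flip_cases h.nf h0 s.2 hC with ⟨g1, g2, g3⟩ | ⟨g1, g2, g3⟩
      · exact absurd (Finset.mem_insert.2 (Or.inl g2.symm)) hCF
      · let k : N := ⟨flip s.1 C, s.2.flip_node h.nf hC⟩
        have hk : k ≠ rt := fun e => g1 (congrArg Subtype.val e)
        refine ⟨k, fun e => hCF ?_, hk, Subtype.ext ?_, y, ?_, edist_mono hd (by omega)⟩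
        · refine Finset.mem_insert.2 (Or.inr (Finset.mem_image.2 ⟨k, e, ?_⟩))
          show (pe t0 (flip s.1 C))ᶜ = C
          rw [g2, compl_compl]
        · rw [hpar k hk]; exact g3
        · show y ∈ UU G r (pe t0 (flip s.1 C))
          rw [g2, UU_compl]; exact hy
    · -- count
      intro R z
      have hinj : Set.InjOn (fun k : N => pe t0 k.1)
          {k | k ≠ rt ∧ ∃ y ∈ U k, G.edist z y ≤ R} :=
        fun k hk k' hk' e => hpeinj k k' hk.1 hk'.1 e
      have hsub : (fun k : N => pe t0 k.1) '' {k | k ≠ rt ∧ ∃ y ∈ U k, G.edist z y ≤ R} ⊆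
          {C | C ∈ 𝓔 ∧ ∃ y ∈ UU G r C, G.edist z y ≤ R} := by
        rintro _ ⟨k, ⟨hk, y, hy, hd⟩, rfl⟩
        exact ⟨hpe𝓔 k hk, y, hy, hd⟩
      refine ⟨Set.Finite.of_finite_image ((hcf1 R z).subset hsub) hinj, ?_⟩
      rw [← Set.ncard_image_of_injOn hinj]
      exact (Set.ncard_le_ncard hsub (hcf1 R z)).trans (hNf R z)
    · -- down
      intro k hk j
      obtain ⟨g, hg1, hg2, hg3⟩ := hdown j (Set.mem_univ j) _ (hpe𝓔 k hk)
      have hkn := Node.eq_nodeOf h.nf k.2 (hpe k hk).1 (nodeOf_node h.nf (hpe𝓔 k hk))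
      rw [← hkn] at hg2 hg3
      have hgn := (hτ j).smul h.cut.smul g
      have hsp : SpS (g • τ j) := (hinv g _).2 (hτS j)
      have key : ∀ m, ∀ s : N, pe t0 k.1 ∈ s.1 → dep k.1 s.1 = m → par^[m] s = k ∧
          ∀ i < m, par^[i] s ≠ rt ∧ pe t0 (par^[i] s).1 ∈ s.1 \ k.1 := by
        intro m
        induction m with
        | zero =>
          intro s _ hm
          exact ⟨Subtype.ext (Node.dep_zero v0 k.2 s.2 hm), fun i hi => absurd hi (Nat.not_lt_zero i)⟩
        | succ m ih =>
          intro s hs hm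
          have hsr : s ≠ rt := by
            intro e
            rw [e] at hs
            exact (hpe k hk).2 hs
          have hsk : s.1 ≠ k.1 := by
            intro e
            rw [e, Node.dep_root] at hm
            omega
          obtain ⟨hD, hD'⟩ := Node.pe_spec v0 h.nf k.2 s.2 hsk
          have hdp := Node.dep_par v0 h.nf k.2 s.2 hsk
          have hparS : parS k.1 s.1 = flip s.1 (pe k.1 s.1) := rfl
          set D := pe k.1 s.1 with hDdef
          have hDt0 : D ∉ t0 := by
            intro e
            have hDc := k.2.compl_mem_of (s.2.sub hD.1) hD'
            rcases Node.min_or h.nf k.2 (hpe k hk).1 hDc with h1 | h1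
            · have h2 : D ⊆ (pe t0 k.1)ᶜ := by
                rw [← compl_compl D]; exact Set.compl_subset_compl.2 h1
              exact s.2.not _ hs (s.2.up D hD.1 _ (h.cut.compl _ (hpe𝓔 k hk)) h2)
            · have h2 : D ⊆ pe t0 k.1 := Set.compl_subset_compl.1 h1
              exact (hpe k hk).2 (h0.up D e _ (hpe𝓔 k hk) h2)
          have hpeD : pe t0 s.1 = D := Node.pe_eq h.nf h0 s.2 hD hDt0
          have hps : (par s).1 = parS k.1 s.1 := by
            rw [hpar s hsr, hparS]
            show flip s.1 (pe t0 s.1) = _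
            rw [hpeD]
          have hmem : pe t0 k.1 ∈ (par s).1 := by
            rw [hps, hparS]
            refine Or.inl ⟨hs, fun e => hD' ?_⟩
            rw [← e]; exact (hpe k hk).1.1
          obtain ⟨i1, i2⟩ := ih (par s) hmem (by rw [hps]; omega)
          refine ⟨by rw [Function.iterate_succ_apply]; exact i1, ?_⟩
          intro i hi
          rcases i with _ | i
          · refine ⟨hsr, ?_⟩
            show pe t0 s.1 ∈ _
            rw [hpeD]
            exact ⟨hD.1, hD'⟩
          · rw [Function.iterate_succ_apply]
            obtain ⟨a1, a2, a3⟩ := i2 i (by omega)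
            refine ⟨a1, ?_, a3⟩
            have : pe t0 (par^[i] (par s)).1 ∈ (par s).1 \ k.1 := ⟨a2, a3⟩
            rw [hps, hparS, Node.flip_diff k.2 s.2 hD hD'] at this
            exact this.1.1
      obtain ⟨k1, k2⟩ := key _ ⟨g • τ j, hgn⟩ hg1 rfl
      refine ⟨⟨g • τ j, hgn⟩, _, hsp, ?_, hg2, k1, ?_⟩
      · obtain ⟨g', hg'⟩ := hjt ⟨g • τ j, hgn⟩ hsp
        exact hdis _ _ _ _ hg'
      · intro i hi
        obtain ⟨a1, a2⟩ := k2 i hi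
        exact ⟨a1, fun y hy y' hy' => edist_mono (hg3 _ a2 y hy y' hy') (by omega)⟩
    · intro j
      exact edist_mono (hgg2 j (Set.mem_univ j)) (by omega)
  exact hsys.main

end

end TA
end

section
open scoped Pointwise
open Relation SimpleGraph

namespace TA

theorem fin_reps {Γ X : Type*} [Group Γ] [MulAction Γ X] {A : Set X} (hA : A.Finite) :
    ∃ (n : ℕ) (τ : Fin n → X), (∀ i, τ i ∈ A) ∧ (∀ a ∈ A, ∃ i, ∃ g : Γ, g • τ i = a) ∧
      ∀ i j (g g' : Γ), g • τ i = g' • τ j → i = j := by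
  classical
  have hB : (MulAction.orbit Γ '' A).Finite := hA.image _
  have := hB.to_subtype
  let e := Finite.equivFin (MulAction.orbit Γ '' A)
  have hx : ∀ b : (MulAction.orbit Γ '' A), ∃ a ∈ A, MulAction.orbit Γ a = b.1 := fun b => b.2
  choose ρ h1 h2 using hx
  refine ⟨_, fun i => ρ (e.symm i), fun i => h1 _, ?_, ?_⟩
  · intro a ha
    have hm : MulAction.orbit Γ a ∈ MulAction.orbit Γ '' A := Set.mem_image_of_mem _ ha
    have h3 : a ∈ MulAction.orbit Γ (ρ ⟨_, hm⟩) := by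
      rw [h2 ⟨_, hm⟩]; exact MulAction.mem_orbit_self a
    refine ⟨e ⟨_, hm⟩, ?_⟩
    show ∃ g : Γ, g • ρ (e.symm (e ⟨_, hm⟩)) = a
    rw [Equiv.symm_apply_apply]
    exact h3
  · intro i j g g' hg
    apply e.symm.injective
    apply Subtype.ext
    rw [← h2, ← h2]
    rw [MulAction.orbit_eq_iff]
    refine ⟨g⁻¹ * g', ?_⟩
    show (g⁻¹ * g') • ρ _ = ρ _
    rw [mul_smul, ← hg, inv_smul_smul]

theorem bdd_of_finite {V : Type*} {G : SimpleGraph V} [Finite V] (hc : G.Connected) :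
    ∃ n : ℕ, ∀ x y, G.edist x y ≤ n := by
  obtain ⟨n, hn⟩ := unif_fin (Set.finite_univ (α := V × V)) (fun p n => G.edist p.1 p.2 ≤ n)
    (fun a m n hmn h => edist_mono h hmn) (fun a _ => edist_ex hc _ _)
  exact ⟨n, fun x y => hn (x, y) trivial⟩

theorem coarseEq_bdd {V W : Type*} {G : SimpleGraph V} {H : SimpleGraph W} [Nonempty V] [Nonempty W]
    {m n : ℕ} (hm : ∀ x y, G.edist x y ≤ m) (hn : ∀ x y, H.edist x y ≤ n) : CoarseEq G H := by
  refine ⟨fun _ => Classical.arbitrary W, fun _ => Classical.arbitrary V, m + n, ?_, ?_, ?_, ?_⟩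
  · exact fun _ _ _ => edist_self'
  · exact fun _ _ _ => edist_self'
  · exact fun x => edist_mono (hm _ _) (by omega)
  · exact fun x => edist_mono (hn _ _) (by omega)

theorem coarseEq_finite {V W : Type*} {G : SimpleGraph V} {H : SimpleGraph W} [Finite V] [Finite W]
    (hG : G.Connected) (hH : H.Connected) : CoarseEq G H := by
  obtain ⟨m, hm⟩ := bdd_of_finite hG
  obtain ⟨n, hn⟩ := bdd_of_finite hH
  have := hG.nonempty
  have := hH.nonempty
  exact coarseEq_bdd hm hn

section
variable {V : Type u} {G : SimpleGraph V}
variable {Γ : Type*} [Group Γ] [MulAction Γ V] {𝓔 : Set (Set V)} {r : ℕ}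

theorem Dat.node_reps (h : Dat G Γ 𝓔 r) (SpS : Set (Set V) → Prop)
    (hinv : ∀ (g : Γ) s, SpS (g • s) ↔ SpS s) :
    ∃ (n : ℕ) (τ : Fin n → Set (Set V)), (∀ j, Node 𝓔 (τ j)) ∧ (∀ j, SpS (τ j)) ∧
      (∀ s, Node 𝓔 s → SpS s → ∃ j, ∃ g : Γ, g • τ j = s) ∧
      (∀ j j' (g g' : Γ), g • τ j = g' • τ j' → j = j') := by
  obtain ⟨v0⟩ := h.hc.nonempty
  obtain ⟨n, τ, h1, h2, h3⟩ := fin_reps (Γ := Γ) (A := {t | (Node 𝓔 t ∧ v0 ∈ Pt G r t) ∧ SpS t})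
    ((h.nodes_fin v0).subset fun t ht => ht.1)
  refine ⟨n, τ, fun j => (h1 j).1.1, fun j => (h1 j).2, ?_, h3⟩
  intro s hs hS
  obtain ⟨x, hx⟩ := h.Pt_ne hs
  obtain ⟨g, rfl⟩ := h.tr v0 x
  have : g⁻¹ • s ∈ {t | (Node 𝓔 t ∧ v0 ∈ Pt G r t) ∧ SpS t} := by
    refine ⟨⟨Node.smul h.cut.smul hs _, ?_⟩, (hinv _ _).2 hS⟩
    rw [Pt_smul h.hc h.acts, Set.mem_inv_smul_set_iff]
    exact hx
  obtain ⟨i, k, hk⟩ := h2 _ this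
  exact ⟨i, g * k, by rw [mul_smul, hk, smul_inv_smul]⟩

theorem Dat.mem_U_min (h : Dat G Γ 𝓔 r) (hne : 𝓔.Nonempty) {s : Set (Set V)} (hs : Node 𝓔 s)
    {x : V} (hx : x ∈ Pt G r s) : ∃ E, MinIn s E ∧ x ∈ UU G r E := by
  obtain ⟨D, hD⟩ := hne
  obtain ⟨y, hy⟩ := h.U_ne hD
  obtain ⟨g, hg⟩ := h.tr y x
  have hxD : x ∈ UU G r (g • D) := by
    rw [UU_smul h.hc h.acts, ← hg]; exact Set.smul_mem_smul_set hy
  have key : ∀ D ∈ s, x ∈ UU G r D → ∃ E, MinIn s E ∧ x ∈ UU G r E := by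
    intro D hD hxD
    obtain ⟨E, hE, hED⟩ := Node.exists_min h.nf hs hD
    refine ⟨E, hE, hx E hE.1, ?_⟩
    exact ball_mono r (Set.compl_subset_compl.2 hED) hxD.2
  rcases hs.or _ (h.cut.smul g D hD) with h1 | h1
  · exact key _ h1 hxD
  · exact key _ h1 (by rw [UU_compl]; exact hxD)

theorem Dat.many_of_inf (h : Dat G Γ 𝓔 r) (hne : 𝓔.Nonempty) {s : Set (Set V)} (hs : Node 𝓔 s)
    (hi : (Pt G r s).Infinite) (n : ℕ) :
    ∃ A : Finset (Set V), n < A.card ∧ ∀ C ∈ A, MinIn s C := by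
  have : {C | MinIn s C}.Infinite := by
    intro hf
    refine hi ((hf.biUnion (t := fun C => UU G r C) fun C hC => h.U_fin (hs.sub hC.1)).subset ?_)
    intro x hx
    obtain ⟨E, h1, h2⟩ := h.mem_U_min hne hs hx
    exact Set.mem_biUnion h1 h2
  obtain ⟨A, hA, hn⟩ := this.exists_subset_card_eq (n + 1)
  exact ⟨A, by omega, fun C hC => hA hC⟩

theorem fin_of_bdd {W : Type*} {Y : SimpleGraph W} (hc : Y.Connected) (hlf : LocallyFiniteGraph Y)
    {n : ℕ} (h : ∀ x y, Y.edist x y ≤ n) : Finite W := by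
  obtain ⟨v⟩ := hc.nonempty
  refine Set.finite_univ_iff.1 ((dist_finite hc hlf n v).subset fun w _ => ?_)
  exact dist_of_edist (h v w)

/-- Infinite parts. -/
theorem Dat.cayley_inf (h : Dat G Γ 𝓔 r) (hne : 𝓔.Nonempty)
    (hex : ∃ s, Node 𝓔 s ∧ (Pt G r s).Infinite)
    (hco : ∀ s, Node 𝓔 s → (Pt G r s).Infinite → ∃ (H : Type u) (_ : Group H) (S : Set H),
      S.Finite ∧ Subgroup.closure S = ⊤ ∧ CoarseEq (G.induce (Pt G r s)) (cayleyGraph H S)) :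
    ∃ (H : Type u) (_ : Group H) (S : Set H),
      S.Finite ∧ Subgroup.closure S = ⊤ ∧ CoarseEq G (cayleyGraph H S) := by
  have hinv : ∀ (g : Γ) s, (Pt G r (g • s)).Infinite ↔ (Pt G r s).Infinite := by
    intro g s
    rw [Pt_smul h.hc h.acts, Set.infinite_smul_set]
  obtain ⟨n, τ, h1, h2, h3, h4⟩ := h.node_reps (fun s => (Pt G r s).Infinite) hinv
  have : Nonempty (Fin n) := by
    obtain ⟨s, hs, hi⟩ := hex
    obtain ⟨j, _⟩ := h3 s hs hi
    exact ⟨j⟩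
  choose H iH S hS1 hS2 hS3 using fun j => hco (τ j) (h1 j) (h2 j)
  obtain ⟨Q, hQ⟩ := h.cayley (fun s => (Pt G r s).Infinite) hinv
    (fun s _ hs => Set.not_infinite.1 hs) τ h1 h2 h3 h4
    (fun s hs hi => h.many_of_inf hne hs hi _) hS1 hS2 hS3 (by
      intro j
      by_contra hn
      rw [not_nontrivial_iff_subsingleton] at hn
      obtain ⟨f, fi, c, g1, g2, g3, g4⟩ := hS3 j
      have hb : ∀ x y, (G.induce (Pt G r (τ j))).edist x y ≤ (c + c : ℕ) := by
        intro x y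
        refine edist_tri (edist_symm (g3 x)) ?_ le_rfl
        rw [Subsingleton.elim (f x) (f y)]
        exact g3 y
      have := fin_of_bdd (h.connected_Pt (h1 j)) (lf_induce h.lf _) hb
      exact h2 j (Set.toFinite _))
  exact ⟨_, _, _, FPgen_finite hS1 Q, FPgen_closure hS2 Q, hQ⟩

/-- Finite parts, branching. -/
theorem Dat.cayley_fin (h : Dat G Γ 𝓔 r) (hfin : ∀ s, Node 𝓔 s → (Pt G r s).Finite)
    {t : Set (Set V)} (ht : Node 𝓔 t) {A : Finset (Set V)} (hA : 2 < A.card)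
    (hA' : ∀ C ∈ A, MinIn t C) :
    ∃ (H : Type u) (_ : Group H) (S : Set H),
      S.Finite ∧ Subgroup.closure S = ⊤ ∧ CoarseEq G (cayleyGraph H S) := by
  classical
  have hZ : Subgroup.closure (Set.univ : Set (ULift.{u} (Multiplicative (ZMod 2)))) = ⊤ :=
    Subgroup.closure_univ
  have := (hfin t ht).to_subtype
  have hJ : ∀ _ : Unit, CoarseEq (G.induce (Pt G r t))
    (cayleyGraph (ULift.{u} (Multiplicative (ZMod 2))) Set.univ) := fun _ =>
    coarseEq_finite (h.connected_Pt ht) (cay_connected hZ)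
  obtain ⟨Q, hQ⟩ := h.cayley (fun s => ∃ g : Γ, g • t = s) (by
      intro g s
      constructor
      · rintro ⟨k, hk⟩
        exact ⟨g⁻¹ * k, by rw [mul_smul, hk, inv_smul_smul]⟩
      · rintro ⟨k, hk⟩
        exact ⟨g * k, by rw [mul_smul, hk]⟩)
    (fun s hs _ => hfin s hs) (J := Unit) (fun _ => t) (fun _ => ht) (fun _ => ⟨1, one_smul _ _⟩)
    (fun s _ hs => ⟨(), hs⟩) (fun _ _ _ _ _ => rfl) (by
      rintro s hs ⟨g, rfl⟩
      refine ⟨A.image (fun C => g • C), ?_, ?_⟩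
      · rw [Finset.card_image_of_injective _ (MulAction.injective g)]
        simpa using hA
      · intro C hC
        obtain ⟨D, hD, rfl⟩ := Finset.mem_image.1 hC
        exact (hA' D hD).smul g)
    (fun _ => Set.toFinite _) (fun _ => hZ) hJ (fun _ => inferInstance)
  exact ⟨_, _, _, FPgen_finite (fun _ => Set.toFinite _) Q, FPgen_closure (fun _ => hZ) Q, hQ⟩
end
end TA
end

section
open scoped Pointwise
open Relation SimpleGraph

namespace TA

theorem Z_closure : Subgroup.closure ({ULift.up (Multiplicative.ofAdd 1)} :
    Set (ULift.{u} (Multiplicative ℤ))) = ⊤ := by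
  rw [Subgroup.eq_top_iff']
  have key : ∀ n : ℤ, (ULift.up (Multiplicative.ofAdd n) : ULift.{u} (Multiplicative ℤ)) =
      (ULift.up (Multiplicative.ofAdd 1)) ^ n := by
    intro n
    induction n using Int.induction_on with
    | zero => rw [zpow_zero]; rfl
    | succ k ih => rw [zpow_add_one, ← ih]; rfl
    | pred k ih => rw [zpow_sub_one, ← ih]; rfl
  rintro ⟨x⟩
  have hx := key (Multiplicative.toAdd x)
  rw [ofAdd_toAdd] at hx
  rw [hx]
  exact Subgroup.zpow_mem _ (Subgroup.subset_closure (Set.mem_singleton _)) _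

theorem Z_dist (a : ℤ) (k : ℕ) : (cayleyGraph (ULift.{u} (Multiplicative ℤ))
    {ULift.up (Multiplicative.ofAdd 1)}).edist (ULift.up (Multiplicative.ofAdd a))
      (ULift.up (Multiplicative.ofAdd (a + k))) ≤ k := by
  induction k with
  | zero => simp
  | succ k ih =>
    refine edist_tri ih ?_ le_rfl
    have := cay_mul (S := {(ULift.up (Multiplicative.ofAdd 1) : ULift.{u} (Multiplicative ℤ))})
      (g := ULift.up (Multiplicative.ofAdd (a + k))) rfl
    convert this using 2
    push_cast
    rw [← add_assoc]
    rfl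

theorem Z_dist' (a b : ℤ) (k : ℕ) (h : |a - b| ≤ k) : (cayleyGraph (ULift.{u} (Multiplicative ℤ))
    {ULift.up (Multiplicative.ofAdd 1)}).edist (ULift.up (Multiplicative.ofAdd a))
      (ULift.up (Multiplicative.ofAdd b)) ≤ k := by
  rw [abs_le] at h
  rcases le_total a b with h' | h'
  · obtain ⟨m, rfl⟩ := Int.le.dest h'
    exact edist_mono (Z_dist a m) (by omega)
  · obtain ⟨m, rfl⟩ := Int.le.dest h'
    exact edist_symm (edist_mono (Z_dist b m) (by omega))

section
variable {V : Type u} {G : SimpleGraph V}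
variable {Γ : Type*} [Group Γ] [MulAction Γ V] {𝓔 : Set (Set V)} {r : ℕ}

/-- A translation along a cut. -/
theorem cayley_trans (h : Dat G Γ 𝓔 r) {E : Set V} (hE : E ∈ 𝓔) (g : Γ) (hg : g • E ⊆ E)
    (hne : (E \ g • E).Nonempty) (hF : (E \ g • E).Finite) :
    ∃ (H : Type u) (_ : Group H) (S : Set H),
      S.Finite ∧ Subgroup.closure S = ⊤ ∧ CoarseEq G (cayleyGraph H S) := by
  classical
  obtain ⟨v0, hv0, hv0'⟩ := hne
  have hstep : ∀ n : ℤ, g ^ (n + 1) • E ⊆ g ^ n • E := by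
    intro n
    rw [zpow_add_one, mul_smul]
    exact Set.smul_set_mono hg
  have hanti : Antitone fun n : ℤ => g ^ n • E := antitone_int_of_succ_le hstep
  have hstrict : ∀ n : ℤ, g ^ n • v0 ∈ g ^ n • E ∧ g ^ n • v0 ∉ g ^ (n + 1) • E := by
    intro n
    refine ⟨Set.smul_mem_smul_set hv0, ?_⟩
    rw [zpow_add_one, mul_smul, Set.smul_mem_smul_set_iff]
    exact hv0'
  have hinj : Function.Injective fun n : ℤ => g ^ n • E := by
    have key : ∀ m n : ℤ, m < n → g ^ m • E ≠ g ^ n • E := by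
      intro m n hmn e
      apply (hstrict m).2
      have h1 := (hstrict m).1
      rw [e] at h1
      exact hanti (show m + 1 ≤ n by omega) h1
    intro m n e
    rcases lt_trichotomy m n with h' | h' | h'
    · exact absurd e (key m n h')
    · exact h'
    · exact absurd e.symm (key n m h')
  have hmem : ∀ n : ℤ, g ^ n • E ∈ 𝓔 := fun n => h.cut.smul _ E hE
  have ex1 : ∀ x, ∃ n : ℤ, x ∉ g ^ n • E := by
    intro x
    by_contra! hx
    have hf := h.nf.sep x (g • v0)
    refine (Set.infinite_range_of_injective (f := fun k : ℕ => g ^ ((k : ℤ) + 2) • E) ?_)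
      (hf.subset ?_)
    · intro a b e
      have := hinj e
      omega
    · rintro _ ⟨k, rfl⟩
      refine ⟨hmem _, hx _, fun e => ?_⟩
      have := (hstrict 1).2
      rw [zpow_one] at this
      exact this (hanti (show (1 : ℤ) + 1 ≤ (k : ℤ) + 2 by omega) e)
  have ex2 : ∀ x, ∃ n : ℤ, x ∈ g ^ n • E := by
    intro x
    by_contra! hx
    have hf := h.nf.sep v0 x
    refine (Set.infinite_range_of_injective (f := fun k : ℕ => g ^ (-(k : ℤ)) • E) ?_)
      (hf.subset ?_)
    · intro a b e
      have := hinj e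
      omega
    · rintro _ ⟨k, rfl⟩
      refine ⟨hmem _, ?_, hx _⟩
      have := (hstrict 0).1
      rw [zpow_zero, one_smul, one_smul] at this
      have h2 := hanti (show -(k : ℤ) ≤ 0 by omega)
      simp only [zpow_zero, one_smul] at h2
      exact h2 this
  have exn : ∀ x, ∃ n : ℤ, x ∈ g ^ n • E ∧ x ∉ g ^ (n + 1) • E := by
    intro x
    obtain ⟨a, ha⟩ := ex1 x
    obtain ⟨b, hb⟩ := ex2 x
    by_contra! hx
    have : ∀ k : ℕ, x ∈ g ^ (b + k) • E := by
      intro k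
      induction k with
      | zero => simpa using hb
      | succ k ih =>
        have := hx _ ih
        push_cast
        rwa [← add_assoc]
    apply ha
    have h2 := this (a - b).toNat
    refine hanti ?_ h2
    omega
  choose ψ hψ using exn
  have huniq : ∀ x (n : ℤ), x ∈ g ^ n • E → x ∉ g ^ (n + 1) • E → ψ x = n := by
    intro x n h1 h2
    obtain ⟨h3, h4⟩ := hψ x
    by_contra hne
    rcases lt_or_gt_of_ne hne with h' | h'
    · exact h4 (hanti (show ψ x + 1 ≤ n by omega) h1)
    · exact h2 (hanti (show n + 1 ≤ ψ x by omega) h3)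
  have hψg : ∀ x (n : ℤ), ψ (g ^ n • x) = n + ψ x := by
    intro x n
    obtain ⟨h3, h4⟩ := hψ x
    refine huniq _ _ ?_ ?_
    · rw [zpow_add, mul_smul]
      exact Set.smul_mem_smul_set h3
    · rw [add_assoc, zpow_add, mul_smul, Set.smul_mem_smul_set_iff]
      exact h4
  have hx0 : ∀ x, g ^ (-ψ x) • x ∈ E \ g • E := by
    intro x
    obtain ⟨h3, h4⟩ := hψ (g ^ (-ψ x) • x)
    rw [hψg, neg_add_cancel] at h3 h4
    rw [zpow_zero, one_smul] at h3
    rw [zero_add, zpow_one] at h4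
    exact ⟨h3, h4⟩
  -- constants
  obtain ⟨c1, hc1⟩ := edist_ex h.hc v0 (g • v0)
  obtain ⟨c2, hc2⟩ := unif_fin hF (fun x n => G.edist v0 x ≤ n)
    (fun a m n hmn h => edist_mono h hmn) (fun a _ => edist_ex h.hc _ _)
  obtain ⟨c3, hc3⟩ := unif_fin hF (fun x (n : ℕ) => ∀ y, G.Adj x y → |ψ x - ψ y| ≤ n)
    (fun a m n hmn h y hy => (h y hy).trans (by exact_mod_cast hmn)) (by
      intro x hx
      obtain ⟨n, hn⟩ := unif_fin (h.lf x) (fun y (n : ℕ) => |ψ x - ψ y| ≤ n)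
        (fun a m n hmn h => h.trans (by exact_mod_cast hmn))
        (fun y _ => ⟨(|ψ x - ψ y|).toNat, Int.self_le_toNat _⟩)
      exact ⟨n, fun y hy => hn y hy⟩)
  refine ⟨ULift.{u} (Multiplicative ℤ), inferInstance, {ULift.up (Multiplicative.ofAdd 1)},
    Set.finite_singleton _, Z_closure, fun x => ULift.up (Multiplicative.ofAdd (ψ x)),
    fun k => g ^ (k.down.toAdd) • v0, c1 + c2 + c3, ?_, ?_, ?_, ?_⟩
  · intro x y hxy
    refine edist_mono (Z_dist' _ _ c3 ?_) (by omega)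
    have := hc3 _ (hx0 x) (g ^ (-ψ x) • y) ((h.acts _ _ _).2 hxy)
    rw [hψg, hψg, add_sub_add_left_eq_sub] at this
    exact this
  · refine cay_lip ?_
    rintro ⟨k⟩ s rfl
    show G.edist (g ^ (Multiplicative.toAdd k) • v0) (g ^ (Multiplicative.toAdd k + 1) • v0) ≤ _
    rw [zpow_add_one, mul_smul]
    exact edist_mono (edist_smul h.acts _ hc1) (by omega)
  · intro x
    show G.edist (g ^ ψ x • v0) x ≤ _
    have := edist_smul h.acts (g ^ ψ x) (hc2 _ (hx0 x))
    rw [← mul_smul, ← zpow_add, add_neg_cancel, zpow_zero, one_smul] at this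
    exact edist_mono this (by omega)
  · rintro ⟨k⟩
    have : ψ (g ^ (Multiplicative.toAdd k) • v0) = Multiplicative.toAdd k :=
      huniq _ _ (hstrict _).1 (hstrict _).2
    show (cayleyGraph _ _).edist (ULift.up (Multiplicative.ofAdd (ψ (g ^ (Multiplicative.toAdd k) • v0)))) _ ≤ _
    rw [this]
    exact edist_self'

/-- Finite parts, no branching. -/
theorem Dat.cayley_line (h : Dat G Γ 𝓔 r) (hne : 𝓔.Nonempty)
    (hfin : ∀ s, Node 𝓔 s → (Pt G r s).Finite)
    (htwo : ∀ t, Node 𝓔 t → ∀ A : Finset (Set V), (∀ C ∈ A, MinIn t C) → A.card ≤ 2) :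
    ∃ (H : Type u) (_ : Group H) (S : Set H),
      S.Finite ∧ Subgroup.closure S = ⊤ ∧ CoarseEq G (cayleyGraph H S) := by
  classical
  have hf : ∀ C : 𝓔, ∃ D : 𝓔, D.1 ⊂ C.1 ∧ (C.1 \ D.1).Finite := by
    rintro ⟨C, hC⟩
    have ht := nodeOf_node h.nf hC
    have hm := nodeOf_min h.nf hC
    have h2 : ∃ C2, MinIn (nodeOf 𝓔 C) C2 ∧ C2 ≠ C := by
      by_contra! hcon
      refine (h.cut.inf C hC) ((hfin _ ht).subset fun x hx D hD => subset_ball _ _ ?_)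
      obtain ⟨E, h1, h2⟩ := Node.exists_min h.nf ht hD
      rw [hcon E h1] at h2
      exact h2 hx
    obtain ⟨C2, h2, h2'⟩ := h2
    have hC2 := ht.sub h2.1
    have hsub : Cᶜ ⊆ C2 := by
      rcases Node.min_or h.nf ht hm h2.1 with h3 | h3
      · exact absurd (h2.2 C hm.1 h3).symm h2'
      · exact h3
    have hsub' : C2ᶜ ⊆ C := Set.compl_subset_comm.1 hsub
    refine ⟨⟨C2ᶜ, h.cut.compl _ hC2⟩, ⟨hsub', fun h4 => ?_⟩, ?_⟩
    · refine ht.not _ h2.1 ?_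
      rw [← (show C = C2ᶜ from h4.antisymm hsub')]
      exact hm.1
    · refine (hfin _ ht).subset fun x hx D hD => subset_ball _ _ ?_
      obtain ⟨E, h5, h6⟩ := Node.exists_min h.nf ht hD
      have hE : E = C ∨ E = C2 := by
        by_contra! hcon
        have := htwo _ ht {E, C, C2} (by
          intro B hB
          simp only [Finset.mem_insert, Finset.mem_singleton] at hB
          rcases hB with rfl | rfl | rfl
          · exact h5
          · exact hm
          · exact h2)
        rw [Finset.card_eq_three.2 ⟨E, C, C2, hcon.1, hcon.2, h2'.symm, rfl⟩] at this
        omega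
      apply h6
      rcases hE with rfl | rfl
      · exact hx.1
      · by_contra hn; exact hx.2 hn
  choose f hf1 hf2 using hf
  obtain ⟨C0, hC0⟩ := hne
  let a : ℕ → 𝓔 := fun n => f^[n] ⟨C0, hC0⟩
  have ha : ∀ n, a (n + 1) = f (a n) := fun n => Function.iterate_succ_apply' f n _
  have hlt : ∀ i j, i < j → (a j).1 ⊂ (a i).1 := by
    intro i j hij
    induction hij with
    | refl => show (a (i + 1)).1 ⊂ _; rw [ha]; exact hf1 _
    | step _ ih =>
      refine ssubset_trans ?_ ih
      show (a (_ + 1)).1 ⊂ _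
      rw [ha]; exact hf1 _
  have hfi : ∀ i j, i < j → ((a i).1 \ (a j).1).Finite := by
    intro i j hij
    induction hij with
    | refl => show (_ \ (a (i + 1)).1).Finite; rw [ha]; exact hf2 _
    | @step m _ ih =>
      refine (ih.union (hf2 (a m))).subset ?_
      intro x hx
      by_cases hxm : x ∈ (a m).1
      · refine Or.inr ⟨hxm, ?_⟩
        have := hx.2
        rw [show m.succ = m + 1 from rfl, ha] at this
        exact this
      · exact Or.inl ⟨hx.1, hxm⟩
  obtain ⟨F, hFE, hF, hFo⟩ := h.cut.orbits h.hc h.lf h.acts h.tr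
  choose D hDF g hg using fun n => hFo (a n).1 (a n).2
  have := hF.to_subtype
  obtain ⟨i, j, hij, he⟩ := Finite.exists_ne_map_eq_of_infinite (fun n : ℕ => (⟨D n, hDF n⟩ : F))
  have he' : D i = D j := congrArg Subtype.val he
  have main : ∀ i j, i < j → D i = D j → ∃ (H : Type u) (_ : Group H) (S : Set H),
      S.Finite ∧ Subgroup.closure S = ⊤ ∧ CoarseEq G (cayleyGraph H S) := by
    intro i j hij he
    have hgE : (g j * (g i)⁻¹) • (a i).1 = (a j).1 := by
      rw [mul_smul, ← hg i, inv_smul_smul, he, hg j]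
    refine cayley_trans h (a i).2 (g j * (g i)⁻¹) ?_ ?_ ?_
    · rw [hgE]; exact (hlt i j hij).1
    · rw [hgE]; exact Set.nonempty_of_ssubset (hlt i j hij)
    · rw [hgE]; exact hfi i j hij
  rcases lt_or_gt_of_ne hij with h' | h'
  · exact main i j h' he'
  · exact main j i h' he'.symm

theorem Dat.cayley_all (h : Dat G Γ 𝓔 r) (hne : 𝓔.Nonempty)
    (hco : ∀ s, Node 𝓔 s → (Pt G r s).Infinite → ∃ (H : Type u) (_ : Group H) (S : Set H),
      S.Finite ∧ Subgroup.closure S = ⊤ ∧ CoarseEq (G.induce (Pt G r s)) (cayleyGraph H S)) :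
    ∃ (H : Type u) (_ : Group H) (S : Set H),
      S.Finite ∧ Subgroup.closure S = ⊤ ∧ CoarseEq G (cayleyGraph H S) := by
  by_cases hex : ∃ s, Node 𝓔 s ∧ (Pt G r s).Infinite
  · exact h.cayley_inf hne hex hco
  push Not at hex
  have hfin : ∀ s, Node 𝓔 s → (Pt G r s).Finite := fun s hs => by
    simpa using hex s hs
  by_cases hb : ∃ t, Node 𝓔 t ∧ ∃ A : Finset (Set V), (∀ C ∈ A, MinIn t C) ∧ 2 < A.card
  · obtain ⟨t, ht, A, hA, hA'⟩ := hb
    exact h.cayley_fin hfin ht hA' hA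
  push Not at hb
  exact h.cayley_line hne hfin hb
end

/-! Transitive models. -/
section
variable {W : Type u} {Y : SimpleGraph W}

theorem transitive_model (hc : Y.Connected) (hlf : LocallyFiniteGraph Y) (hqt : QuasiTransitive Y)
    (hcr : Crit Y) (hinf : Infinite W) :
    ∃ (W' : Type u) (X : SimpleGraph W'), X.Connected ∧ LocallyFiniteGraph X ∧
      VertexTransitive X ∧ OneEnded X ∧ CoarseEq X Y := by
  classical
  obtain ⟨v0⟩ := hc.nonempty
  obtain ⟨F, hF, hFo⟩ := hqt
  let O : Set W := {x | ∃ g : Y ≃g Y, g v0 = x}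
  have hdg : ∀ (g : Y ≃g Y) a b (n : ℕ), Y.edist a b ≤ n → Y.edist (g a) (g b) ≤ n := by
    intro g a b n hn
    have := edist_lip (f := g) (c := 1) (H := Y)
      (fun x y hxy => edist_adj (g.map_rel_iff.2 hxy) le_rfl) hn
    rwa [one_mul] at this
  obtain ⟨R, hR⟩ := unif_fin hF (fun x n => Y.edist x v0 ≤ n)
    (fun a m n hmn h => edist_mono h hmn) (fun a _ => edist_ex hc _ _)
  have hnear : ∀ x : W, ∃ y : O, Y.edist x y.1 ≤ R ∧ (x ∈ O → y.1 = x) := by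
    intro x
    by_cases hx : x ∈ O
    · exact ⟨⟨x, hx⟩, edist_self', fun _ => rfl⟩
    · obtain ⟨u, hu, g, rfl⟩ := hFo x
      exact ⟨⟨g v0, g, rfl⟩, hdg g _ _ _ (hR u hu), fun e => absurd e hx⟩
  choose f hf1 hf2 using hnear
  let X : SimpleGraph O := SimpleGraph.fromRel fun a b => Y.edist a.1 b.1 ≤ (2 * R + 1 : ℕ)
  have hX : ∀ a b : O, X.Adj a b ↔ a ≠ b ∧ Y.edist a.1 b.1 ≤ (2 * R + 1 : ℕ) := by
    intro a b
    rw [SimpleGraph.fromRel_adj]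
    refine and_congr_right fun _ => ⟨?_, Or.inl⟩
    rintro (h | h)
    · exact h
    · exact edist_symm h
  have hXe : ∀ a b : O, Y.edist a.1 b.1 ≤ (2 * R + 1 : ℕ) → X.edist a b ≤ (1 : ℕ) := by
    intro a b hab
    by_cases he : a = b
    · rw [he]; exact edist_self'
    · exact edist_adj ((hX a b).2 ⟨he, hab⟩) le_rfl
  have hfl : ∀ x y, Y.Adj x y → Y.edist (f x).1 (f y).1 ≤ (2 * R + 1 : ℕ) := by
    intro x y hxy
    exact edist_tri (edist_symm (hf1 x)) (edist_tri (edist_adj hxy le_rfl) (hf1 y) le_rfl)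
      (by omega)
  have hfO : ∀ x : O, f x.1 = x := fun x => Subtype.ext (hf2 x.1 x.2)
  have hXc : X.Connected := by
    have : Nonempty O := ⟨⟨v0, RelIso.refl _, rfl⟩⟩
    refine ⟨fun x y => ?_⟩
    obtain ⟨n, hn⟩ := edist_ex hc x.1 y.1
    have := edist_lip (H := X) (f := f) (c := 1) (fun x y hxy => hXe _ _ (hfl x y hxy)) hn
    rw [hfO, hfO] at this
    obtain ⟨p, _⟩ := exists_walk_of_edist this
    exact ⟨p⟩
  have hball : ∀ (n : ℕ) v, {w | Y.edist v w ≤ n}.Finite := fun n v =>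
    (dist_finite hc hlf n v).subset fun w hw => dist_of_edist hw
  have hXlf : LocallyFiniteGraph X := by
    intro v
    refine Set.Finite.of_finite_image (f := Subtype.val)
      ((hball (2 * R + 1) v.1).subset ?_) Subtype.val_injective.injOn
    rintro _ ⟨w, hw, rfl⟩
    exact ((hX v w).1 hw).2
  have hXtr : VertexTransitive X := by
    have hO : ∀ (g : Y ≃g Y) (x : W), x ∈ O → g x ∈ O := by
      rintro g _ ⟨k, rfl⟩
      exact ⟨k.trans g, rfl⟩
    have key : ∀ g : Y ≃g Y, ∃ k : X ≃g X, ∀ x, (k x).1 = g x.1 := by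
      intro g
      refine ⟨⟨⟨fun x => ⟨g x.1, hO g _ x.2⟩, fun x => ⟨g.symm x.1, hO g.symm _ x.2⟩, ?_, ?_⟩, ?_⟩,
        fun x => rfl⟩
      · intro x; exact Subtype.ext (g.symm_apply_apply x.1)
      · intro x; exact Subtype.ext (g.apply_symm_apply x.1)
      · intro a b
        show X.Adj ⟨g a.1, hO g _ a.2⟩ ⟨g b.1, hO g _ b.2⟩ ↔ X.Adj a b
        rw [hX, hX]
        refine and_congr ?_ ⟨fun e => ?_, hdg g _ _ _⟩
        · rw [not_iff_not, Subtype.mk.injEq, g.injective.eq_iff, Subtype.ext_iff]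
        · have := hdg g.symm _ _ _ e
          simpa using this
    rintro ⟨_, g, rfl⟩ ⟨_, k, rfl⟩
    obtain ⟨m, hm⟩ := key (g.symm.trans k)
    refine ⟨m, Subtype.ext ?_⟩
    rw [hm]
    show k (g.symm (g v0)) = k v0
    rw [g.symm_apply_apply]
  have hXinf : Infinite O := by
    by_contra hn
    rw [not_infinite_iff_finite] at hn
    have : (Set.univ : Set W).Finite := by
      refine (Set.finite_iUnion fun o : O => hball R o.1).subset fun x _ => ?_
      exact Set.mem_iUnion.2 ⟨f x, edist_symm (hf1 x)⟩
    exact Set.infinite_univ this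
  have hXcr : Crit X := by
    intro K
    have hK1 : {x | f x ∈ K}.Finite := by
      refine (K.finite_toSet.biUnion (t := fun o => {w | Y.edist o.1 w ≤ R})
        fun o _ => hball R o.1).subset fun x hx => ?_
      exact Set.mem_biUnion hx (edist_symm (hf1 x))
    obtain ⟨K', hK'⟩ := hcr hK1.toFinset
    refine ⟨K'.preimage Subtype.val Subtype.val_injective.injOn, fun x y hx hy => ?_⟩
    rw [Finset.mem_preimage] at hx hy
    have hj := hK' x.1 y.1 hx hy
    have hj' : Join X (↑K)ᶜ (f x.1) (f y.1) := by
      generalize y.1 = z at hj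
      induction hj with
      | refl => exact ReflTransGen.refl
      | tail _ hab ih =>
        rename_i a b _
        obtain ⟨hab, ha, hb⟩ := hab
        have ha' : f a ∉ K := by simpa using ha
        have hb' : f b ∉ K := by simpa using hb
        by_cases he : f a = f b
        · rw [← he]; exact ih
        · exact ih.tail ⟨(hX _ _).2 ⟨he, hfl a b hab⟩, ha', hb'⟩
    rwa [hfO, hfO] at hj'
  refine ⟨O, X, hXc, hXlf, hXtr, ⟨nonempty_end hXc hXlf, hXcr.subsingleton⟩, ?_⟩
  refine ⟨Subtype.val, f, 2 * R + 1, ?_, ?_, ?_, ?_⟩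
  · intro x y hxy; exact ((hX x y).1 hxy).2
  · intro x y hxy; exact edist_mono (hXe _ _ (hfl x y hxy)) (by omega)
  · intro x; rw [hfO]; exact edist_self'
  · intro x; exact edist_mono (edist_symm (hf1 x)) (by omega)

theorem iso_coarse {W' : Type*} {Y' : SimpleGraph W'} (e : Y ≃g Y') : CoarseEq Y Y' :=
  ⟨e, e.symm, 1, fun _ _ h => edist_adj (e.map_rel_iff.2 h) le_rfl,
    fun _ _ h => edist_adj (e.symm.map_rel_iff.2 h) le_rfl,
    fun x => by rw [e.symm_apply_apply]; exact edist_self',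
    fun x => by rw [e.apply_symm_apply]; exact edist_self'⟩
end

theorem final {V : Type u} (G : SimpleGraph V)
    (hc : G.Connected) (hlf : LocallyFiniteGraph G) (htr : VertexTransitive G)
    (hacc : Accessible G) (hnc : NotQIToAnyCayley G) :
    ∃ (W : Type u) (X : SimpleGraph W), X.Connected ∧ LocallyFiniteGraph X ∧
      VertexTransitive X ∧ OneEnded X ∧ NotQIToAnyCayley X ∧
      ∃ l : List BGraph.{u}, IsFactorisation ⟨V, G⟩ l ∧ IsTerminal l ∧
        ∃ F ∈ l, QuasiIsometric X F.G := by
  classical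
  have hqt : QuasiTransitive G := by
    obtain ⟨v⟩ := hc.nonempty
    exact ⟨{v}, Set.finite_singleton v, fun w => ⟨v, rfl, htr v w⟩⟩
  rcases finite_or_infinite V with hV | hV
  · exfalso
    have hZ : Subgroup.closure (Set.univ : Set (PUnit.{u + 1})) = ⊤ := Subgroup.closure_univ
    exact hnc PUnit inferInstance Set.univ (Set.toFinite _) hZ
      ((coarseEq_finite hc (cay_connected hZ)).qi hc (cay_connected hZ))
  have hne := nonempty_end hc hlf
  by_cases hsub : Subsingleton G.end
  · refine ⟨V, G, hc, hlf, htr, ⟨hne, hsub⟩, hnc, [⟨V, G⟩], ⟨?_, GoodIterAmalg.single _⟩, ?_, ⟨V, G⟩,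
      List.mem_singleton_self _, (iso_coarse (RelIso.refl _)).qi hc hc⟩
    · intro X hX
      rw [List.mem_singleton] at hX
      subst hX
      exact ⟨hc, hlf, hqt⟩
    · intro X hX
      rw [List.mem_singleton] at hX
      subst hX
      exact hsub
  let _ : MulAction (G ≃g G) V := RelIso.applyMulAction
  have hA : Acts G (G ≃g G) := fun g a b => g.map_rel_iff
  have htr' : ∀ u v : V, ∃ g : G ≃g G, g • u = v := htr
  obtain ⟨𝓔, hcut, hfull⟩ := exists_cutSys_of_accessible hc hlf hacc hA htr'
  have hEne : 𝓔.Nonempty := by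
    rw [not_subsingleton_iff_nontrivial] at hsub
    obtain ⟨e, e', hee⟩ := exists_pair_ne G.end
    obtain ⟨C, hC, _⟩ := hfull e e' hee
    exact ⟨C, hC⟩
  obtain ⟨r, h⟩ := exists_dat hc hlf hA htr' hcut
  obtain ⟨l, hl1, hl2, hl3⟩ := terminal_fact h hfull hqt
  by_contra hcon
  have hall := h.cayley_all hEne (by
    intro s hs hi
    obtain ⟨W, X, x1, x2, x3, x4, x5⟩ := transitive_model (h.connected_Pt hs) (lf_induce hlf _)
      (h.qt_ind hs) (h.crit_ind hfull hs) hi.to_subtype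
    have : ¬ NotQIToAnyCayley X := by
      intro x6
      obtain ⟨F, hF, ⟨e⟩⟩ := hl3 s hs
      exact hcon ⟨W, X, x1, x2, x3, x4, x6, l, hl1, hl2, F, hF,
        (x5.trans (iso_coarse e)).qi x1 (hl1.1 F hF).1⟩
    unfold NotQIToAnyCayley at this
    push Not at this
    obtain ⟨H, iH, S, hS1, hS2, hS3⟩ := this
    exact ⟨H, iH, S, hS1, hS2, x5.symm.trans (coarseEq_of_qi hS3 x1 (cay_connected hS2))⟩)
  obtain ⟨H, iH, S, hS1, hS2, hS3⟩ := hall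
  exact hnc H iH S hS1 hS2 (hS3.qi hc (cay_connected hS2))

end TA
end

/-- **Theorem.** Let `G` be a (connected) locally finite transitive accessible graph that is
not quasi-isometric to any locally finite Cayley graph of a finitely generated group.  Then
there is a one-ended locally finite transitive graph that is quasi-isometric to some factor
in a terminal factorisation of `G` and that is not quasi-isometric to any locally finite
Cayley graph of a finitely generated group. -/
theorem exists_oneEnded_counterexample {V : Type u} (G : SimpleGraph V)
    (hc : G.Connected) (hlf : LocallyFiniteGraph G) (htr : VertexTransitive G)
    (hacc : Accessible G) (hnc : NotQIToAnyCayley G) :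
    ∃ (W : Type u) (X : SimpleGraph W), X.Connected ∧ LocallyFiniteGraph X ∧
      VertexTransitive X ∧ OneEnded X ∧ NotQIToAnyCayley X ∧
      ∃ l : List BGraph.{u}, IsFactorisation ⟨V, G⟩ l ∧ IsTerminal l ∧
        ∃ F ∈ l, QuasiIsometric X F.G := by
  exact TA.final G hc hlf htr hacc hnc
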